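/- There exists an absolute positive constant ε such that the following holds: let (v,p) be a suitable weak solution of the Navier–Stokes equations with force f ∈ L^m(Ω_T) for some m > 5/2, let M ∈ (0,∞), and let z ∈ Ω×(0,T). If limsup_{r→0} E(z,r) ≤ M and liminf_{r→0} E(z,r) < ε/M, then z is a regular point of v. -/

import Mathlib

/- Setting: suitable weak solutions of the 3D incompressible Navier–Stokes equations,
   following Caffarelli–Kohn–Nirenberg.  The velocity field is `v`, its weak spatial
   gradient is `dv`, the pressure is `p` and the force is `f`. -/

open MeasureTheory Filter Metric Set Bornology
open scoped Topology ENNReal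

noncomputable section

/-- Three dimensional Euclidean space. -/
abbrev V3 : Type := EuclideanSpace ℝ (Fin 3)

/-- The standard basis of `V3`. -/
def e3 (i : Fin 3) : V3 := EuclideanSpace.single i 1

/-- Euclidean dot product. -/
def dot3 (a b : V3) : ℝ := ∑ i, a i * b i

/-- Squared Frobenius norm of a (gradient) matrix. -/
def fnormSq (A : V3 →L[ℝ] V3) : ℝ := ∑ i, ‖A (e3 i)‖ ^ 2

/-- Frobenius norm of a (gradient) matrix. -/
def fnorm (A : V3 →L[ℝ] V3) : ℝ := Real.sqrt (fnormSq A)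

/-- Frobenius inner product of two (gradient) matrices. -/
def fdot (A B : V3 →L[ℝ] V3) : ℝ := ∑ i, dot3 (A (e3 i)) (B (e3 i))

/-- Laplacian of a scalar function on `V3`. -/
def lap3 (φ : V3 → ℝ) (x : V3) : ℝ :=
  ∑ i, fderiv ℝ (fun y => fderiv ℝ φ y (e3 i)) x (e3 i)

/-- Smooth compactly supported scalar test function on a spatial domain. -/
def IsSpaceTest (U : Set V3) (φ : V3 → ℝ) : Prop :=
  ContDiff ℝ (⊤ : ℕ∞) φ ∧ HasCompactSupport φ ∧ tsupport φ ⊆ U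

/-- Smooth compactly supported scalar test function on a space-time domain. -/
def IsTimeSpaceTest (U : Set V3) (I : Set ℝ) (φ : V3 → ℝ → ℝ) : Prop :=
  ContDiff ℝ (⊤ : ℕ∞) (fun z : V3 × ℝ => φ z.1 z.2) ∧
  HasCompactSupport (fun z : V3 × ℝ => φ z.1 z.2) ∧
  tsupport (fun z : V3 × ℝ => φ z.1 z.2) ⊆ U ×ˢ I

/-- Smooth compactly supported vector test field on a space-time domain. -/
def IsVectorTest (U : Set V3) (I : Set ℝ) (ψ : V3 → ℝ → V3) : Prop :=
  ContDiff ℝ (⊤ : ℕ∞) (fun z : V3 × ℝ => ψ z.1 z.2) ∧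
  HasCompactSupport (fun z : V3 × ℝ => ψ z.1 z.2) ∧
  tsupport (fun z : V3 × ℝ => ψ z.1 z.2) ⊆ U ×ˢ I

/-- `Ω` has a `C²` boundary: near every boundary point, `Ω` is the sublevel set of a
`C²` function with nonvanishing gradient. -/
def HasC2Boundary (Ω : Set V3) : Prop :=
  ∀ x ∈ frontier Ω, ∃ (U : Set V3) (g : V3 → ℝ), IsOpen U ∧ x ∈ U ∧
    ContDiff ℝ 2 g ∧ (∀ y ∈ U, fderiv ℝ g y ≠ 0) ∧ Ω ∩ U = {y ∈ U | g y < 0}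

/-- `dv` is the weak spatial gradient of `v` on `U × I`. -/
def IsWeakSpatialGradient (U : Set V3) (I : Set ℝ) (v : V3 → ℝ → V3)
    (dv : V3 → ℝ → V3 →L[ℝ] V3) : Prop :=
  ∀ᵐ t ∂(volume.restrict I), ∀ φ : V3 → ℝ, IsSpaceTest U φ → ∀ u : V3,
    (∫ x in U, φ x • dv x t u) = - ∫ x in U, fderiv ℝ φ x u • v x t

/-- `(v, p)` is a suitable weak solution of the Navier–Stokes system with force `f` on
`Ω × (a, b)`, where `Ω ⊆ ℝ³` is a bounded `C²` domain; `dv` denotes the weak spatial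
gradient of `v`. -/
structure IsSuitableWeakSolution (Ω : Set V3) (a b : ℝ) (v : V3 → ℝ → V3)
    (dv : V3 → ℝ → V3 →L[ℝ] V3) (p : V3 → ℝ → ℝ) (f : V3 → ℝ → V3) : Prop where
  open_dom : IsOpen Ω
  bounded_dom : IsBounded Ω
  nonempty_dom : Ω.Nonempty
  c2_boundary : HasC2Boundary Ω
  time_lt : a < b
  meas_v : AEMeasurable (fun z : V3 × ℝ => v z.1 z.2) (volume.restrict (Ω ×ˢ Ioo a b))
  meas_dv : AEMeasurable (fun z : V3 × ℝ => dv z.1 z.2) (volume.restrict (Ω ×ˢ Ioo a b))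
  meas_p : AEMeasurable (fun z : V3 × ℝ => p z.1 z.2) (volume.restrict (Ω ×ˢ Ioo a b))
  meas_f : AEMeasurable (fun z : V3 × ℝ => f z.1 z.2) (volume.restrict (Ω ×ˢ Ioo a b))
  /-- `v ∈ L^∞(a,b; L²(Ω))`. -/
  v_linf_l2 : ∃ K : ℝ, ∀ᵐ t ∂(volume.restrict (Ioo a b)),
    IntegrableOn (fun x => ‖v x t‖ ^ 2) Ω volume ∧ (∫ x in Ω, ‖v x t‖ ^ 2) ≤ K
  /-- `∇v ∈ L²(Ω × (a,b))`. -/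
  dv_l2 : IntegrableOn (fun z : V3 × ℝ => fnormSq (dv z.1 z.2)) (Ω ×ˢ Ioo a b) volume
  /-- `p ∈ L^{3/2}(Ω × (a,b))`. -/
  p_l32 : IntegrableOn (fun z : V3 × ℝ => |p z.1 z.2| ^ ((3:ℝ)/2)) (Ω ×ˢ Ioo a b) volume
  /-- `f ∈ L^m(Ω × (a,b))` for some `m > 5/2`. -/
  f_lm : ∃ m : ℝ, 5/2 < m ∧
    IntegrableOn (fun z : V3 × ℝ => ‖f z.1 z.2‖ ^ m) (Ω ×ˢ Ioo a b) volume
  /-- `dv` is the weak spatial gradient of `v`. -/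
  weak_gradient : IsWeakSpatialGradient Ω (Ioo a b) v dv
  /-- `v` is divergence free in the sense of distributions. -/
  div_free : ∀ᵐ t ∂(volume.restrict (Ioo a b)), ∀ φ : V3 → ℝ, IsSpaceTest Ω φ →
    (∫ x in Ω, fderiv ℝ φ x (v x t)) = 0
  /-- The Navier–Stokes equations hold in the sense of distributions. -/
  nse : ∀ ψ : V3 → ℝ → V3, IsVectorTest Ω (Ioo a b) ψ →
    (∫ t in Ioo a b, ∫ x in Ω,
      (dot3 (v x t) (deriv (fun s => ψ x s) t)
        - fdot (dv x t) (fderiv ℝ (fun y => ψ y t) x)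
        - dot3 (dv x t (v x t)) (ψ x t)
        + p x t * (∑ i, fderiv ℝ (fun y => ψ y t) x (e3 i) i)
        + dot3 (f x t) (ψ x t))) = 0
  /-- The generalized local energy inequality. -/
  energy : ∀ᵐ t ∂(volume.restrict (Ioo a b)), ∀ φ : V3 → ℝ → ℝ,
    IsTimeSpaceTest Ω (Ioo a b) φ → (∀ x s, 0 ≤ φ x s) →
    (∫ x in Ω, ‖v x t‖ ^ 2 * φ x t)
        + 2 * ∫ s in Ioo a t, ∫ x in Ω, fnormSq (dv x s) * φ x s
      ≤ (∫ s in Ioo a t, ∫ x in Ω,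
            ‖v x s‖ ^ 2 * (deriv (fun τ => φ x τ) s + lap3 (fun y => φ y s) x))
        + (∫ s in Ioo a t, ∫ x in Ω, ‖v x s‖ ^ 2 * fderiv ℝ (fun y => φ y s) x (v x s))
        + 2 * (∫ s in Ioo a t, ∫ x in Ω, p x s * fderiv ℝ (fun y => φ y s) x (v x s))
        + 2 * (∫ s in Ioo a t, ∫ x in Ω, dot3 (f x s) (v x s) * φ x s)

/-- `E_q(z,r) = r^{-5+2q} ∬_{Q(z,r)} |∇v|^q`, centered at `z = (x₀,t₀)`. -/
def funEq (dv : V3 → ℝ → V3 →L[ℝ] V3) (q : ℝ) (z : V3 × ℝ) (r : ℝ) : ℝ :=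
  r ^ (2 * q - 5) * ∫ t in Ioo (z.2 - r ^ 2) z.2, ∫ x in ball z.1 r, fnorm (dv x t) ^ q

/-- `E(z,r) = r⁻¹ ∬_{Q(z,r)} |∇v|²`, centered at `z = (x₀,t₀)`. -/
def funE2 (dv : V3 → ℝ → V3 →L[ℝ] V3) (z : V3 × ℝ) (r : ℝ) : ℝ :=
  r⁻¹ * ∫ t in Ioo (z.2 - r ^ 2) z.2, ∫ x in ball z.1 r, fnormSq (dv x t)

/-- `z` is a regular point of `v`: `v` is essentially bounded on some parabolic
cylinder `Q(z,ρ)`. -/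
def RegularPoint (v : V3 → ℝ → V3) (z : V3 × ℝ) : Prop :=
  ∃ ρ : ℝ, 0 < ρ ∧ ∃ K : ℝ,
    ∀ᵐ w : V3 × ℝ ∂(volume.restrict (ball z.1 ρ ×ˢ Ioo (z.2 - ρ ^ 2) z.2)),
      ‖v w.1 w.2‖ ≤ K

/- Scaled functionals centered at the reference point `z = (0,0)`. -/

/-- `A(r) = r⁻¹ sup_{-r²<s<0} ∫_{B(r)} |v|²`. -/
def funA (v : V3 → ℝ → V3) (r : ℝ) : ℝ :=
  r⁻¹ * sSup ((fun s => ∫ x in ball (0 : V3) r, ‖v x s‖ ^ 2) '' Ioo (-r ^ 2) 0)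

/-- `E(r) = r⁻¹ ∬_{Q(r)} |∇v|²`. -/
def funE (dv : V3 → ℝ → V3 →L[ℝ] V3) (r : ℝ) : ℝ :=
  r⁻¹ * ∫ t in Ioo (-r ^ 2) 0, ∫ x in ball (0 : V3) r, fnormSq (dv x t)

/-- `E_q(r) = r^{-5+2q} ∬_{Q(r)} |∇v|^q`. -/
def funEqz (dv : V3 → ℝ → V3 →L[ℝ] V3) (q r : ℝ) : ℝ :=
  r ^ (2 * q - 5) * ∫ t in Ioo (-r ^ 2) 0, ∫ x in ball (0 : V3) r, fnorm (dv x t) ^ q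

/-- `C(r) = r⁻² ∬_{Q(r)} |v|³`. -/
def funC (v : V3 → ℝ → V3) (r : ℝ) : ℝ :=
  r ^ (-2 : ℝ) * ∫ t in Ioo (-r ^ 2) 0, ∫ x in ball (0 : V3) r, ‖v x t‖ ^ 3

/-- `D(r) = r⁻² ∬_{Q(r)} |p - ⟨p⟩_{B(r)}|^{3/2}`. -/
def funD (p : V3 → ℝ → ℝ) (r : ℝ) : ℝ :=
  r ^ (-2 : ℝ) * ∫ t in Ioo (-r ^ 2) 0, ∫ x in ball (0 : V3) r,
    |p x t - ⨍ y in ball (0 : V3) r, p y t| ^ ((3:ℝ)/2)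

/-- `C̃(r) = r⁻² ∬_{Q(r)} |v - ⟨v⟩_{B(r)}|³`. -/
def funCt (v : V3 → ℝ → V3) (r : ℝ) : ℝ :=
  r ^ (-2 : ℝ) * ∫ t in Ioo (-r ^ 2) 0, ∫ x in ball (0 : V3) r,
    ‖v x t - ⨍ y in ball (0 : V3) r, v y t‖ ^ 3

/-- `G(r) = r⁻¹ ∫_{-r²}^0 (∫_{B(r)} |v|⁶)^{1/3}`. -/
def funG (v : V3 → ℝ → V3) (r : ℝ) : ℝ :=
  r⁻¹ * ∫ t in Ioo (-r ^ 2) 0, (∫ x in ball (0 : V3) r, ‖v x t‖ ^ 6) ^ ((1:ℝ)/3)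

/-- `P(r) = r⁻² inf_{c∈ℝ} ( ∫_{-r²}^0 (∫_{B(r)} |p - c|³)^{1/3} )²`. -/
def funP (p : V3 → ℝ → ℝ) (r : ℝ) : ℝ :=
  r ^ (-2 : ℝ) * ⨅ c : ℝ,
    (∫ t in Ioo (-r ^ 2) 0, (∫ x in ball (0 : V3) r, |p x t - c| ^ 3) ^ ((1:ℝ)/3)) ^ 2

/-- `F(r) = ( ∫_{-r²}^0 (∫_{B(r)} |f|²)^{2/3} )^{3/2}`. -/
def funF (f : V3 → ℝ → V3) (r : ℝ) : ℝ :=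
  (∫ t in Ioo (-r ^ 2) 0, (∫ x in ball (0 : V3) r, ‖f x t‖ ^ 2) ^ ((2:ℝ)/3)) ^ ((3:ℝ)/2)

section
open scoped NNReal
local notation "CN(" x ")" => ((x : ℝ≥0) : ℝ≥0∞)
local notation "Smooth" => ContDiff ℝ (⊤ : ℕ∞)
local notation "VV" => V3 → ℝ → V3
local notation "DV" => V3 → ℝ → V3 →L[ℝ] V3
local notation "VR" => V3 → ℝ → ℝ
open ENNReal (add_lt_top coe_lt_top coe_ne_top coe_rpow_of_nonneg coe_toNNReal lintegral_Lp_add_le lintegral_mul_le_Lp_mul_Lq mul_lt_top mul_ne_top mul_rpow_of_nonneg ofReal ofReal_add ofReal_coe_nnreal ofReal_le_ofReal ofReal_lt_top ofReal_mul ofReal_ne_top ofReal_pow ofReal_rpow_of_nonneg ofReal_rpow_of_pos ofReal_toReal one_rpow rpow_le_rpow rpow_lt_top_of_nonneg rpow_mul rpow_natCast rpow_ne_top_of_nonneg rpow_one toReal_le_of_le_ofReal toReal_nonneg zero_rpow_of_neg)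
open Finset (measurable_fun_sum mem_range mul_sum range sum_add_distrib sum_congr sum_le_sum sum_range_one sum_range_succ)
open Real (exp norm_eq_abs norm_of_nonneg rpow_add rpow_neg rpow_neg_one rpow_nonneg rpow_two smoothTransition sq_sqrt sqrt sqrt_eq_rpow sqrt_le_iff)
open MeasureTheory.Measure (ae_ne prod_restrict restrict_apply_univ restrict_mono volume_eq_prod)
open Filter.Eventually (of_forall)
section

/-! Riesz kernels -/

def kr (a : ℝ) (x y : V3) : ℝ≥0∞ := ‖x - y‖ₑ ^ (-a)

lemma kr_comm (a : ℝ) (x y : V3) : kr a x y = kr a y x := by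
  unfold kr; rw [← enorm_neg, neg_sub]

lemma lint_scale (s : ℝ) (hs : 0 < s) (h : V3 → ℝ≥0∞) :
    ∫⁻ z, h z = ofReal (s ^ 3) * ∫⁻ y, h (s • y) := by
  have h1 := Measure.map_addHaar_smul (volume : Measure V3) hs.ne'
  have h2 : ∫⁻ y, h (s • y) = ∫⁻ z, h z ∂(Measure.map (s • · ) (volume : Measure V3)) := by
    rw [MeasurableEmbedding.lintegral_map]
    exact (Homeomorph.smulOfNeZero s hs.ne').measurableEmbedding
  rw [h2, h1, lintegral_smul_measure, smul_eq_mul, ← mul_assoc, ← ofReal_mul (by positivity)]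
  have : (s ^ 3 * |(s ^ Module.finrank ℝ V3)⁻¹|) = 1 := by
    rw [finrank_euclideanSpace_fin, abs_of_pos (by positivity)]; field_simp
  rw [this]; simp

lemma kr_ball_one (a : ℝ) (ha : a < 3) : ∫⁻ z in ball (0:V3) 1, ‖z‖ₑ ^ (-a) < ∞ := by
  have h1 : IntegrableOn (fun x : V3 => (fun u : ℝ => u ^ (-a)) ‖x‖) (ball (0 : V3) 1) := by
    refine (integrableOn_fun_norm_addHaar volume (f := fun u : ℝ => u ^ (-a))).2 ?_
    have := (intervalIntegral.integrableOn_Ioo_rpow_iff (s := 2 - a) one_pos).2 (by linarith)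
    refine this.congr_fun ?_ measurableSet_Ioo
    intro y hy
    simp only [finrank_euclideanSpace_fin, smul_eq_mul]
    rw [← Real.rpow_natCast, ← rpow_add hy.1]; norm_num [sub_eq_add_neg]
  have h2 := h1.2
  rw [hasFiniteIntegral_iff_enorm] at h2
  refine lt_of_le_of_lt (le_of_eq ?_) h2
  refine lintegral_congr_ae (ae_restrict_of_ae ?_)
  filter_upwards [ae_ne volume (0:V3)] with z hz
  have : 0 < ‖z‖ := norm_pos_iff.2 hz
  rw [Real.enorm_eq_ofReal (by positivity), ← ofReal_rpow_of_pos this, ofReal_norm]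

lemma kr_compl_one (a : ℝ) (ha : 3 < a) : ∫⁻ z in (ball (0:V3) 1)ᶜ, ‖z‖ₑ ^ (-a) < ∞ := by
  have h1 : Integrable (fun x : V3 => (indicator (Ici (1:ℝ)) fun u : ℝ => u ^ (-a)) ‖x‖) := by
    rw [integrable_fun_norm_addHaar]
    have := (integrableOn_Ioi_rpow_iff (s := 2 - a) one_pos).2 (by linarith)
    rw [← integrableOn_Ici_iff_integrableOn_Ioi, ← integrable_indicator_iff measurableSet_Ici] at this
    refine this.integrableOn.congr_fun ?_ measurableSet_Ioi
    intro y hy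
    simp only [finrank_euclideanSpace_fin, smul_eq_mul, indicator]
    split_ifs
    · rw [← Real.rpow_natCast, ← rpow_add hy]; norm_num [sub_eq_add_neg]
    · simp
  have h2 := h1.2
  rw [hasFiniteIntegral_iff_enorm] at h2
  refine lt_of_le_of_lt (le_of_eq ?_) h2
  rw [← lintegral_indicator measurableSet_ball.compl]
  refine lintegral_congr_ae ?_
  filter_upwards [ae_ne volume (0:V3)] with z hz
  have h0 : 0 < ‖z‖ := norm_pos_iff.2 hz
  by_cases h : 1 ≤ ‖z‖
  · rw [indicator_of_mem (by simpa using h), indicator_of_mem (by simpa using h)]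
    rw [Real.enorm_eq_ofReal (by positivity), ← ofReal_rpow_of_pos h0, ofReal_norm]
  · rw [indicator_of_notMem (by simpa using h), indicator_of_notMem (by simpa using h)]
    simp

lemma kr_scale_aux (a s : ℝ) (hs : 0 < s) (S S1 : Set V3) (hS : MeasurableSet S)
    (hS1 : MeasurableSet S1) (h : ∀ y, s • y ∈ S ↔ y ∈ S1) :
    ∫⁻ z in S, ‖z‖ₑ ^ (-a) = ofReal (s ^ (3 - a)) * ∫⁻ z in S1, ‖z‖ₑ ^ (-a) := by
  rw [← lintegral_indicator hS, lint_scale s hs, ← lintegral_indicator hS1]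
  have : ∀ y, (S.indicator (fun z => ‖z‖ₑ ^ (-a)) (s • y)) =
      ofReal (s ^ (-a)) * S1.indicator (fun z : V3 => ‖z‖ₑ ^ (-a)) y := by
    intro y
    by_cases hy : y ∈ S1
    · rw [indicator_of_mem ((h y).2 hy), indicator_of_mem hy, enorm_smul,
        ENNReal.mul_rpow_of_ne_top (by simp) (by simp), Real.enorm_eq_ofReal hs.le,
        ofReal_rpow_of_pos hs]
    · rw [indicator_of_notMem (fun hh => hy ((h y).1 hh)), indicator_of_notMem hy]; simp
  simp_rw [this]
  rw [lintegral_const_mul' _ _ ofReal_ne_top, ← mul_assoc, ← ofReal_mul (by positivity),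
    ← Real.rpow_natCast, ← rpow_add hs]
  norm_num [sub_eq_add_neg]

lemma kr_near (a : ℝ) (ha : a < 3) : ∃ C : ℝ≥0, ∀ (x : V3) (s : ℝ), 0 < s →
    ∫⁻ y in ball x s, kr a x y ≤ C * ofReal (s ^ (3 - a)) := by
  refine ⟨(∫⁻ z in ball (0:V3) 1, ‖z‖ₑ ^ (-a)).toNNReal, fun x s hs => ?_⟩
  rw [coe_toNNReal (kr_ball_one a ha).ne, mul_comm]
  rw [← kr_scale_aux a s hs (ball 0 s) (ball 0 1) measurableSet_ball measurableSet_ball ?_]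
  · apply le_of_eq
    rw [← lintegral_indicator measurableSet_ball, ← lintegral_indicator measurableSet_ball,
      ← lintegral_sub_right_eq_self (fun z => (ball (0:V3) s).indicator (fun z => ‖z‖ₑ ^ (-a)) z) x]
    congr 1 with y
    by_cases hy : y ∈ ball x s
    · rw [indicator_of_mem hy, indicator_of_mem (by simpa [dist_eq_norm] using hy), kr_comm, kr]
    · rw [indicator_of_notMem hy, indicator_of_notMem (by simpa [dist_eq_norm] using hy)]
  · intro y
    simp only [mem_ball_zero_iff, norm_smul, norm_eq_abs, abs_of_pos hs]
    constructor <;> intro h <;> nlinarith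

lemma kr_far (a : ℝ) (ha : 3 < a) : ∃ C : ℝ≥0, ∀ (x : V3) (s : ℝ), 0 < s →
    ∫⁻ y in (ball x s)ᶜ, kr a x y ≤ C * ofReal (s ^ (3 - a)) := by
  refine ⟨(∫⁻ z in (ball (0:V3) 1)ᶜ, ‖z‖ₑ ^ (-a)).toNNReal, fun x s hs => ?_⟩
  rw [coe_toNNReal (kr_compl_one a ha).ne, mul_comm]
  rw [← kr_scale_aux a s hs (ball 0 s)ᶜ (ball 0 1)ᶜ measurableSet_ball.compl measurableSet_ball.compl ?_]
  · apply le_of_eq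
    rw [← lintegral_indicator measurableSet_ball.compl, ← lintegral_indicator measurableSet_ball.compl,
      ← lintegral_sub_right_eq_self (fun z => (ball (0:V3) s)ᶜ.indicator (fun z => ‖z‖ₑ ^ (-a)) z) x]
    congr 1 with y
    by_cases hy : y ∈ (ball x s)ᶜ
    · rw [indicator_of_mem hy, indicator_of_mem (by simpa [dist_eq_norm] using hy), kr_comm, kr]
    · rw [indicator_of_notMem hy, indicator_of_notMem (by simpa [dist_eq_norm] using hy)]
  · intro y
    simp only [mem_compl_iff, mem_ball_zero_iff, norm_smul, norm_eq_abs, abs_of_pos hs]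
    rw [not_iff_not]
    constructor <;> intro h <;> nlinarith

lemma kr_mul (a b : ℝ) (ha : 0 < a) (hb : 0 < b) (x y : V3) :
    kr a x y * kr b x y = kr (a + b) x y := by
  unfold kr
  by_cases h : ‖x - y‖ₑ = 0
  · rw [h, zero_rpow_of_neg (by linarith), zero_rpow_of_neg (by linarith),
      zero_rpow_of_neg (by linarith)]; simp
  · rw [← ENNReal.rpow_add _ _ h (by simp)]; congr 1; ring

/-- Cauchy–Schwarz in squared form. -/
lemma cs_sq {α : Type*} [MeasurableSpace α] (μ : Measure α) (f g : α → ℝ≥0∞)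
    (hf : AEMeasurable f μ) (hg : AEMeasurable g μ) :
    (∫⁻ x, f x * g x ∂μ) ^ 2 ≤ (∫⁻ x, f x ^ 2 ∂μ) * ∫⁻ x, g x ^ 2 ∂μ := by
  have h := lintegral_mul_le_Lp_mul_Lq μ
    (Real.HolderConjugate.two_two) hf hg
  calc (∫⁻ x, f x * g x ∂μ) ^ 2 ≤ ((∫⁻ a, f a ^ (2:ℝ) ∂μ) ^ (1 / 2 : ℝ) *
      (∫⁻ a, g a ^ (2:ℝ) ∂μ) ^ (1 / 2 : ℝ)) ^ 2 := by gcongr; exact h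
    _ = _ := by
      rw [mul_pow, ← rpow_natCast, ← rpow_natCast, ← rpow_mul,
        ← rpow_mul]
      norm_num

lemma add_pow4_le (a b : ℝ≥0∞) : (a + b) ^ 4 ≤ 8 * (a ^ 4 + b ^ 4) := by
  have h := ENNReal.rpow_add_le_mul_rpow_add_rpow a b (p := 4) (by norm_num)
  have e : ∀ c : ℝ≥0∞, c ^ (4:ℝ) = c ^ 4 := fun c => by
    rw [← rpow_natCast]; norm_num
  rw [e, e, e] at h
  refine h.trans (le_of_eq ?_)
  congr 1
  rw [show (4 - 1 : ℝ) = ((3:ℕ):ℝ) by norm_num, rpow_natCast]; norm_num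

lemma vol_ball (x : V3) (s : ℝ) (hs : 0 < s) :
    volume (ball x s) = ofReal (s ^ 3) * volume (ball (0:V3) 1) := by
  have := Measure.addHaar_ball_mul_of_pos (volume : Measure V3) x hs 1
  rw [mul_one] at this
  rw [this, finrank_euclideanSpace_fin]

lemma measurable_kr_right (a : ℝ) (x : V3) : Measurable (fun y => kr a x y) := by
  unfold kr; fun_prop

lemma riesz_near (g : V3 → ℝ≥0∞) (hg : Measurable g) (S : Set V3) (x : V3) :
    (∫⁻ y in S, g y * kr 2 x y) ^ 4 ≤
      ((∫⁻ y, g y ^ 2) * ∫⁻ y in S, g y ^ 2 * kr (8/3) x y) * (∫⁻ y in S, kr (8/3) x y) ^ 2 := by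
  have a1 : (∫⁻ y in S, g y * kr 2 x y) ^ 2 ≤
      (∫⁻ y in S, g y ^ 2 * kr (4/3) x y) * ∫⁻ y in S, kr (8/3) x y := by
    have h := cs_sq (volume.restrict S) (fun y => g y * kr (2/3) x y) (fun y => kr (4/3) x y)
      (hg.mul (measurable_kr_right _ _)).aemeasurable (measurable_kr_right _ _).aemeasurable
    have e1 : ∀ y, g y * kr (2/3) x y * kr (4/3) x y = g y * kr 2 x y := fun y => by
      rw [mul_assoc, kr_mul _ _ (by norm_num) (by norm_num)]; norm_num
    have e2 : ∀ y, (g y * kr (2/3) x y) ^ 2 = g y ^ 2 * kr (4/3) x y := fun y => by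
      rw [mul_pow, sq (kr _ _ _), kr_mul _ _ (by norm_num) (by norm_num)]; norm_num
    have e3 : ∀ y, (kr (4/3) x y) ^ 2 = kr (8/3) x y := fun y => by
      rw [sq (kr _ _ _), kr_mul _ _ (by norm_num) (by norm_num)]; norm_num
    simp only [e1, e2, e3] at h
    exact h
  have a2 : (∫⁻ y in S, g y ^ 2 * kr (4/3) x y) ^ 2 ≤
      (∫⁻ y, g y ^ 2) * ∫⁻ y in S, g y ^ 2 * kr (8/3) x y := by
    have h := cs_sq (volume.restrict S) g (fun y => g y * kr (4/3) x y)
      hg.aemeasurable (hg.mul (measurable_kr_right _ _)).aemeasurable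
    have e1 : ∀ y, g y * (g y * kr (4/3) x y) = g y ^ 2 * kr (4/3) x y := fun y => by ring
    have e2 : ∀ y, (g y * kr (4/3) x y) ^ 2 = g y ^ 2 * kr (8/3) x y := fun y => by
      rw [mul_pow, sq (kr _ _ _), kr_mul _ _ (by norm_num) (by norm_num)]; norm_num
    simp only [e1, e2] at h
    exact h.trans (mul_le_mul_left (setLIntegral_le_lintegral _ _) _)
  calc (∫⁻ y in S, g y * kr 2 x y) ^ 4 = ((∫⁻ y in S, g y * kr 2 x y) ^ 2) ^ 2 := by
        rw [← pow_mul]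
    _ ≤ ((∫⁻ y in S, g y ^ 2 * kr (4/3) x y) * ∫⁻ y in S, kr (8/3) x y) ^ 2 :=
        pow_le_pow_left' a1 2
    _ ≤ _ := by
        rw [mul_pow]; exact mul_le_mul_left a2 _

lemma riesz_far (g : V3 → ℝ≥0∞) (hg : Measurable g) (S : Set V3) (x : V3) :
    (∫⁻ y in S, g y * kr 2 x y) ^ 4 ≤
      ((∫⁻ y, g y ^ 2) * ∫⁻ y in S, kr 4 x y) ^ 2 := by
  have a1 : (∫⁻ y in S, g y * kr 2 x y) ^ 2 ≤ (∫⁻ y, g y ^ 2) * ∫⁻ y in S, kr 4 x y := by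
    refine (cs_sq (volume.restrict S) g (fun y => kr 2 x y)
      hg.aemeasurable (measurable_kr_right _ _).aemeasurable).trans ?_
    refine mul_le_mul' (setLIntegral_le_lintegral _ _) (le_of_eq ?_)
    congr 1 with y
    rw [sq, kr_mul _ _ (by norm_num) (by norm_num)]; norm_num
  calc _ = ((∫⁻ y in S, g y * kr 2 x y) ^ 2) ^ 2 := by rw [← pow_mul]
    _ ≤ _ := pow_le_pow_left' a1 2

lemma riesz_joint (a : ℝ) (g : V3 → ℝ≥0∞) (hg : Measurable g) (s : ℝ) :
    Measurable (fun x => ∫⁻ y in ball x s, g y * kr a x y) ∧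
    ∫⁻ x, ∫⁻ y in ball x s, g y * kr a x y = ∫⁻ y, g y * ∫⁻ x in ball y s, kr a y x := by
  have e1 : ∀ x, ∫⁻ y in ball x s, g y * kr a x y =
        ∫⁻ y, g y * (ball y s).indicator (fun x => kr a y x) x := by
      intro x
      rw [← lintegral_indicator measurableSet_ball]
      congr 1 with y
      by_cases h : y ∈ ball x s
      · rw [indicator_of_mem h, indicator_of_mem (mem_ball_comm.1 h), kr_comm]
      · rw [indicator_of_notMem h, indicator_of_notMem (fun h' => h (mem_ball_comm.1 h')), mul_zero]
  have hjm : Measurable (fun q : V3 × V3 => g q.2 * (ball q.2 s).indicator (fun x => kr a q.2 x) q.1) := by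
    have h : Measurable (fun q : V3 × V3 => ({q : V3 × V3 | dist q.1 q.2 < s}).indicator
          (fun q => kr a q.2 q.1) q) :=
        Measurable.indicator (by unfold kr; fun_prop)
          (measurableSet_lt (by fun_prop) (by fun_prop))
    exact (hg.comp measurable_snd).mul h
  constructor
  · simp_rw [e1]
    exact hjm.lintegral_prod_right'
  · simp_rw [e1]
    rw [lintegral_lintegral_swap hjm.aemeasurable]
    congr 1 with y
    have hm : Measurable ((ball y s).indicator (fun x => kr a y x)) :=
        (measurable_kr_right _ _).indicator measurableSet_ball
    rw [lintegral_const_mul _ hm, lintegral_indicator measurableSet_ball]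

/-- Young type bound for the Riesz potential. -/
lemma riesz_L4 : ∃ C : ℝ≥0, ∀ (g : V3 → ℝ≥0∞), Measurable g → ∀ (x0 : V3) (s : ℝ), 0 < s →
    ∫⁻ x in ball x0 s, (∫⁻ y, g y * kr 2 x y) ^ 4 ≤
      C * ofReal s * (∫⁻ y, g y ^ 2) ^ 2 := by
  obtain ⟨C1, hC1⟩ := kr_near (8/3) (by norm_num)
  obtain ⟨C2, hC2⟩ := kr_far 4 (by norm_num)
  obtain ⟨C3, hC3⟩ : ∃ C3 : ℝ≥0, volume (ball (0:V3) 1) = C3 :=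
    ⟨(volume (ball (0:V3) 1)).toNNReal, (coe_toNNReal measure_ball_lt_top.ne).symm⟩
  refine ⟨8 * (C1 ^ 3 + C2 ^ 2 * C3), fun g hg x0 s hs => ?_⟩
  obtain ⟨hm, hsw⟩ := riesz_joint (8/3) (fun y => g y ^ 2) (hg.pow_const 2) s
  set J := ∫⁻ y, g y ^ 2 with hJ
  have hsw2 : ∫⁻ x, ∫⁻ y in ball x s, g y ^ 2 * kr (8/3) x y ≤
      J * (C1 * ofReal (s ^ (3 - 8/3 : ℝ))) := by
    rw [hsw, hJ, ← lintegral_mul_const' _ _ (by finiteness)]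
    exact lintegral_mono fun y => mul_le_mul_right (hC1 y s hs) _
  have hsplit : ∀ x, (∫⁻ y, g y * kr 2 x y) ^ 4 ≤
      8 * ((J * ∫⁻ y in ball x s, g y ^ 2 * kr (8/3) x y) * (C1 * ofReal (s ^ (3 - 8/3 : ℝ))) ^ 2
       + (J * (C2 * ofReal (s ^ (3 - 4 : ℝ)))) ^ 2) := by
    intro x
    rw [← lintegral_add_compl _ (measurableSet_ball (x := x) (ε := s))]
    refine (add_pow4_le _ _).trans (mul_le_mul_right (add_le_add ?_ ?_) _)
    · exact (riesz_near g hg _ x).trans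
        (mul_le_mul_right (pow_le_pow_left' (hC1 x s hs) 2) _)
    · exact (riesz_far g hg _ x).trans (pow_le_pow_left' (mul_le_mul_right (hC2 x s hs) _) 2)
  set P := ofReal (s ^ (3 - 8/3 : ℝ)) with hP
  set Q := ofReal (s ^ (3 - 4 : ℝ)) with hQ
  have s1 : P ^ 3 = ofReal s := by
    rw [hP, ← ofReal_pow (by positivity), ← Real.rpow_natCast, ← Real.rpow_mul hs.le]
    norm_num
  have s2 : Q ^ 2 * ofReal (s ^ 3) = ofReal s := by
    rw [hQ, ← ofReal_pow (by positivity), ← ofReal_mul (by positivity)]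
    congr 1
    norm_num [rpow_neg_one]; field_simp
  clear_value P Q J
  calc ∫⁻ x in ball x0 s, (∫⁻ y, g y * kr 2 x y) ^ 4
      ≤ ∫⁻ x in ball x0 s, 8 * ((J * ∫⁻ y in ball x s, g y ^ 2 * kr (8/3) x y) * (C1 * P) ^ 2
       + (J * (C2 * Q)) ^ 2) := lintegral_mono hsplit
    _ = 8 * ((J * ∫⁻ x in ball x0 s, ∫⁻ y in ball x s, g y ^ 2 * kr (8/3) x y) * (C1 * P) ^ 2
       + (J * (C2 * Q)) ^ 2 * volume (ball x0 s)) := by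
        rw [lintegral_const_mul _ (by fun_prop), lintegral_add_right _ measurable_const,
          lintegral_mul_const _ (by fun_prop), lintegral_const_mul _ (by fun_prop), lintegral_const]
        simp
    _ ≤ 8 * ((J * (J * (C1 * P))) * (C1 * P) ^ 2
       + (J * (C2 * Q)) ^ 2 * (ofReal (s ^ 3) * C3)) := by
        rw [vol_ball x0 s hs, hC3]
        refine mul_le_mul_right (add_le_add (mul_le_mul_left (mul_le_mul_right ?_ _) _) le_rfl) _
        exact (setLIntegral_le_lintegral _ _).trans hsw2
    _ = 8 * (C1 ^ 3 * P ^ 3 + C2 ^ 2 * C3 * (Q ^ 2 * ofReal (s ^ 3))) * J ^ 2 := by ring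
    _ = _ := by rw [s1, s2]; push_cast; ring

end

section

/-! Dilation representation -/

section dil
variable {E : Type*} [NormedAddCommGroup E] [NormedSpace ℝ E] [CompleteSpace E]

def dilPsi (g : V3 → ℝ) (u : V3 → E) (x : V3) (l : ℝ) : E :=
  ∫ y, (l⁻¹ ^ 3 * g (l⁻¹ • (y - x))) • u y

def dilq (g : V3 → ℝ) (z : V3) : ℝ := 3 * g z + fderiv ℝ g z z

lemma dilq_cont {g : V3 → ℝ} (hg : ContDiff ℝ 1 g) : Continuous (dilq g) := by
  have := hg.continuous_fderiv one_ne_zero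
  have := hg.continuous
  unfold dilq; fun_prop

lemma dilq_bdd {g : V3 → ℝ} (hg : ContDiff ℝ 1 g) (hc : HasCompactSupport g) :
    ∃ K, ∀ z, ‖dilq g z‖ ≤ K := by
  have : HasCompactSupport (dilq g) := by
    refine HasCompactSupport.add (f := fun z => 3 * g z) (f' := fun z => fderiv ℝ g z z) hc.mul_left ?_
    exact (hc.fderiv (𝕜 := ℝ)).mono (fun z hz => by
      simp only [Function.mem_support, ne_eq] at hz ⊢
      intro h; exact hz (by rw [h]; simp))
  exact this.exists_bound_of_continuous (dilq_cont hg)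

lemma dil_hasDeriv (g : V3 → ℝ) (hg : ContDiff ℝ 1 g) (hc : HasCompactSupport g)
    (u : V3 → E) (hu : Integrable u) (x : V3) (l : ℝ) (hl : 0 < l) :
    HasDerivAt (dilPsi g u x) (∫ y, (-(l⁻¹ ^ 4 * dilq g (l⁻¹ • (y - x)))) • u y) l := by
  obtain ⟨K, hK⟩ := dilq_bdd hg hc
  obtain ⟨K0, hK0⟩ := hc.exists_bound_of_continuous hg.continuous
  have hK' : 0 ≤ K := (norm_nonneg _).trans (hK 0)
  refine (hasDerivAt_integral_of_dominated_loc_of_deriv_le (𝕜 := ℝ) (μ := (volume : Measure V3)) (s := Ioi (l/2))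
    (F := fun l y => (l⁻¹ ^ 3 * g (l⁻¹ • (y - x))) • u y)
    (F' := fun l y => (-(l⁻¹ ^ 4 * dilq g (l⁻¹ • (y - x)))) • u y) (x₀ := l)
    (bound := fun y => ((2 / l) ^ 4 * K) * ‖u y‖) (Ioi_mem_nhds (half_lt_self hl))
    ?_ ?_ ?_ ?_ (hu.norm.const_mul _) ?_).2
  · refine of_forall fun l' => ?_
    have := hg.continuous
    exact (Continuous.aestronglyMeasurable (by fun_prop)).smul hu.1
  · have := hg.continuous
    refine hu.bdd_smul (l⁻¹ ^ 3 * K0) (Continuous.aestronglyMeasurable (by fun_prop)) ?_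
    refine of_forall fun y => ?_
    rw [norm_mul, norm_pow, norm_inv, norm_of_nonneg hl.le]
    gcongr
    exact hK0 _
  · have := dilq_cont hg
    exact (Continuous.aestronglyMeasurable (by fun_prop)).smul hu.1
  · refine of_forall fun y l' hl' => ?_
    have hl'0 : 0 < l' := lt_trans (by linarith) hl'
    rw [norm_smul, norm_neg, norm_mul, norm_pow, norm_inv, norm_of_nonneg hl'0.le]
    gcongr
    · rw [inv_le_comm₀ hl'0 (by positivity)]
      simpa using (le_of_lt (mem_Ioi.1 hl'))
    · exact hK _
  · refine of_forall fun y l' hl' => ?_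
    have hl'0 : 0 < l' := lt_trans (by linarith) hl'
    apply HasDerivAt.smul_const
    have h1 : HasDerivAt (fun l : ℝ => l⁻¹) (-(l' ^ 2)⁻¹) l' := hasDerivAt_inv hl'0.ne'
    have h2 : HasDerivAt (fun l : ℝ => l⁻¹ • (y - x)) ((-(l' ^ 2)⁻¹) • (y - x)) l' := h1.smul_const _
    have h3 := ((hg.differentiable one_ne_zero) (l'⁻¹ • (y - x))).hasFDerivAt.comp_hasDerivAt l' h2
    have h4 := (h1.pow 3).mul h3
    refine HasDerivAt.congr_deriv (f := fun l : ℝ => l⁻¹ ^ 3 * g (l⁻¹ • (y - x))) h4 ?_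
    unfold dilq
    simp only [map_smul, smul_eq_mul, Function.comp, Pi.pow_apply, Nat.reduceSub]
    field_simp
    norm_num
    try ring

lemma dil_contDiffOn (g : V3 → ℝ) (hg : ContDiff ℝ 1 g) (hc : HasCompactSupport g)
    (u : V3 → E) (hu : Integrable u) (x : V3) :
    ContDiffOn ℝ 1 (dilPsi g u x) (Ioi 0) := by
  obtain ⟨K, hK⟩ := dilq_bdd hg hc
  have hd := fun l hl => dil_hasDeriv g hg hc u hu x l hl
  rw [show (1 : WithTop ℕ∞) = 0 + 1 by simp, contDiffOn_succ_iff_deriv_of_isOpen isOpen_Ioi]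
  refine ⟨fun l hl => (hd l hl).differentiableAt.differentiableWithinAt, by simp, ?_⟩
  rw [contDiffOn_zero]
  have : EqOn (deriv (dilPsi g u x)) (fun l => (-(l⁻¹ ^ 4)) • ∫ y, dilq g (l⁻¹ • (y - x)) • u y) (Ioi 0) := by
    intro l hl
    rw [(hd l hl).deriv]
    simp only
    rw [← integral_smul]
    congr 1 with y
    rw [smul_smul]; congr 1; ring
  refine ContinuousOn.congr ?_ this
  have hinv : ContinuousOn (fun l : ℝ => l⁻¹) (Ioi 0) :=
    continuousOn_inv₀.mono (fun l hl => (ne_of_gt hl))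
  refine ContinuousOn.smul (by fun_prop) ?_
  have hq := dilq_cont hg
  refine continuousOn_of_dominated (bound := fun y => K * ‖u y‖) ?_ ?_ (hu.norm.const_mul _) ?_
  · intro l hl
    exact (Continuous.aestronglyMeasurable (by fun_prop)).smul hu.1
  · intro l hl
    refine of_forall fun y => ?_
    rw [norm_smul]; gcongr; exact hK _
  · refine of_forall fun y => ?_
    refine ContinuousOn.smul ?_ continuousOn_const
    exact hq.comp_continuousOn (hinv.smul continuousOn_const)

/-- one dimensional integral in the dilation parameter -/
lemma dil_lint (rho d : ℝ) (hr : 0 < rho) (hd : 0 < d) :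
    ∫⁻ l in Ioi (d / rho), ofReal (l⁻¹ ^ 4 * d) ≤ ofReal (rho ^ 3 * (d ^ 2)⁻¹) := by
  have hp : 0 < d / rho := by positivity
  have h1 : IntegrableOn (fun l : ℝ => l ^ (-4 : ℝ) * d) (Ioi (d / rho)) :=
    (integrableOn_Ioi_rpow_of_lt (by norm_num) hp).mul_const d
  have e : ∀ l ∈ Ioi (d / rho), ofReal (l⁻¹ ^ 4 * d) = ofReal (l ^ (-4 : ℝ) * d) := by
    intro l hl
    have : 0 < l := hp.trans hl
    rw [rpow_neg this.le, show (4:ℝ) = ((4:ℕ):ℝ) by norm_num, Real.rpow_natCast, inv_pow]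
  rw [setLIntegral_congr_fun measurableSet_Ioi e, ← ofReal_integral_eq_lintegral_ofReal h1]
  · apply ofReal_le_ofReal
    rw [integral_mul_const, integral_Ioi_rpow_of_lt (by norm_num) hp]
    have e2 : (d / rho) ^ ((-4:ℝ) + 1) = ((d / rho) ^ 3)⁻¹ := by
      rw [show (-4:ℝ) + 1 = -((3:ℕ):ℝ) by norm_num, rpow_neg hp.le, Real.rpow_natCast]
    rw [e2]
    have : -((d / rho) ^ 3)⁻¹ / (-4 + 1) * d = (1/3) * (rho ^ 3 * (d ^ 2)⁻¹) := by
      field_simp; norm_num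
    rw [this]
    have : 0 ≤ rho ^ 3 * (d ^ 2)⁻¹ := by positivity
    linarith
  · filter_upwards [ae_restrict_mem measurableSet_Ioi] with l hl
    have : 0 < l := hp.trans hl
    positivity

/-- Main dilation estimate between scales `e` and `1`. -/
lemma dil_est (g : V3 → ℝ) (hg : ContDiff ℝ 1 g) (hc : HasCompactSupport g)
    (K rho : ℝ) (hK : ∀ z, |g z| ≤ K) (hr : 0 < rho) (hrho : ∀ z, g z ≠ 0 → ‖z‖ < rho)
    (u : V3 → E) (hu : Integrable u) (F : V3 → V3 →L[ℝ] E) (hF : Integrable F) (x : V3)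
    (H : ∀ l : ℝ, 0 < l → l ≤ 1 → ∫ y, dilq g (l⁻¹ • (y - x)) • u y =
      - (l • ∫ y, g (l⁻¹ • (y - x)) • F y (l⁻¹ • (y - x))))
    (e : ℝ) (he : 0 < e) (he1 : e ≤ 1) :
    ‖dilPsi g u x 1 - dilPsi g u x e‖ₑ ≤ ofReal (K * rho ^ 3) * ∫⁻ y, ‖F y‖ₑ * kr 2 x y := by
  have hK0 : 0 ≤ K := (abs_nonneg _).trans (hK 0)
  have h1 := enorm_sub_le_lintegral_deriv_of_contDiffOn_Icc
    ((dil_contDiffOn g hg hc u hu x).mono (fun l hl => lt_of_lt_of_le he hl.1) : ContDiffOn ℝ 1 (dilPsi g u x) (Icc e 1)) he1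
  refine h1.trans ?_
  have h2 : ∀ l ∈ Icc e 1, ‖deriv (dilPsi g u x) l‖ₑ ≤
      ∫⁻ y, ‖F y‖ₑ * ({y | ‖y - x‖ < l * rho}.indicator
        (fun y => ofReal (K * (l⁻¹ ^ 4 * ‖y - x‖))) y) := by
    intro l hl
    have hl0 : 0 < l := lt_of_lt_of_le he hl.1
    rw [(dil_hasDeriv g hg hc u hu x l hl0).deriv]
    have e1 : ∫ y, (-(l⁻¹ ^ 4 * dilq g (l⁻¹ • (y - x)))) • u y =
        ∫ y, (l⁻¹ ^ 3 * g (l⁻¹ • (y - x))) • F y (l⁻¹ • (y - x)) := by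
      have : ∀ y, (-(l⁻¹ ^ 4 * dilq g (l⁻¹ • (y - x)))) • u y =
          (-(l⁻¹ ^ 4)) • (dilq g (l⁻¹ • (y - x)) • u y) := fun y => by
        rw [smul_smul]; congr 1; ring
      simp_rw [this]
      rw [integral_smul, H l hl0 hl.2, ← neg_smul, smul_smul, ← integral_smul]
      congr 1 with y
      rw [smul_smul]; congr 1; field_simp
    rw [e1]
    refine (enorm_integral_le_lintegral_enorm _).trans ?_
    refine lintegral_mono fun y => ?_
    by_cases hy : g (l⁻¹ • (y - x)) = 0
    · simp [hy]
    · have hz := hrho _ hy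
      rw [norm_smul, norm_inv, norm_of_nonneg hl0.le, inv_mul_lt_iff₀ hl0] at hz
      rw [indicator_of_mem (by simpa using hz)]
      rw [enorm_smul, mul_comm]
      calc ‖F y (l⁻¹ • (y - x))‖ₑ * ‖l⁻¹ ^ 3 * g (l⁻¹ • (y - x))‖ₑ
          ≤ (‖F y‖ₑ * ‖l⁻¹ • (y - x)‖ₑ) * ‖l⁻¹ ^ 3 * g (l⁻¹ • (y - x))‖ₑ := by
            gcongr; exact ContinuousLinearMap.le_opENorm _ _
        _ = ‖F y‖ₑ * (‖l⁻¹ • (y - x)‖ₑ * ‖l⁻¹ ^ 3 * g (l⁻¹ • (y - x))‖ₑ) := by ring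
        _ ≤ _ := by
            gcongr
            rw [← ofReal_norm, ← ofReal_norm, ← ofReal_mul (by positivity)]
            apply ofReal_le_ofReal
            rw [norm_smul, norm_mul, norm_pow, norm_inv, norm_of_nonneg hl0.le, norm_eq_abs]
            calc l⁻¹ * ‖y - x‖ * (l⁻¹ ^ 3 * |g (l⁻¹ • (y - x))|) ≤ l⁻¹ * ‖y - x‖ * (l⁻¹ ^ 3 * K) := by
                  gcongr; exact hK _
              _ = _ := by ring
  refine (setLIntegral_mono' measurableSet_Icc h2).trans ?_
  rw [lintegral_lintegral_swap]
  · rw [← lintegral_const_mul' _ _ ofReal_ne_top]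
    refine lintegral_mono_ae ?_
    filter_upwards [ae_ne volume x] with y hy
    have hd : 0 < ‖y - x‖ := norm_pos_iff.2 (sub_ne_zero.2 hy)
    rw [lintegral_const_mul' _ _ (by simp)]
    rw [mul_left_comm]
    gcongr
    calc ∫⁻ l in Icc e 1, ({y | ‖y - x‖ < l * rho}.indicator
        (fun y => ofReal (K * (l⁻¹ ^ 4 * ‖y - x‖))) y)
        ≤ ∫⁻ l, (Ioi (‖y - x‖ / rho)).indicator
          (fun l => ofReal K * ofReal (l⁻¹ ^ 4 * ‖y - x‖)) l := by
          refine (setLIntegral_le_lintegral _ _).trans (lintegral_mono fun l => ?_)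
          by_cases h : ‖y - x‖ < l * rho
          · rw [indicator_of_mem (by simpa using h), indicator_of_mem, ofReal_mul hK0]
            rw [mem_Ioi, div_lt_iff₀ hr]; exact h
          · rw [indicator_of_notMem (by simpa using h)]; simp
      _ ≤ ofReal K * ofReal (rho ^ 3 * (‖y - x‖ ^ 2)⁻¹) := by
          rw [lintegral_indicator measurableSet_Ioi, lintegral_const_mul' _ _ ofReal_ne_top]
          gcongr
          exact dil_lint rho _ hr hd
      _ = _ := by
          rw [ofReal_mul (by positivity : 0 ≤ rho ^ 3), ← mul_assoc, ← ofReal_mul hK0]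
          congr 1
          rw [kr_comm, kr, ← ofReal_norm, ofReal_rpow_of_pos hd, rpow_neg hd.le]
          norm_num
  · refine AEMeasurable.mul ?_ ?_
    · exact hF.1.enorm.comp_snd
    · refine (Measurable.indicator (f := fun q : ℝ × V3 => ofReal (K * (q.1⁻¹ ^ 4 * ‖q.2 - x‖)))
        (s := {q : ℝ × V3 | ‖q.2 - x‖ < q.1 * rho}) (by fun_prop)
        (measurableSet_lt (by fun_prop) (by fun_prop))).aemeasurable

/-- Limit of the dilations at Lebesgue points. -/
lemma dil_limit (u : V3 → E) (hu : Integrable u) : ∀ᵐ x, ∀ (g : V3 → ℝ) (rho : ℝ),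
    Continuous g → HasCompactSupport g → 0 < rho → (∀ z, g z ≠ 0 → ‖z‖ < rho) → ∫ z, g z = 1 →
    Tendsto (fun n : ℕ => dilPsi g u x (1 / ((n:ℝ) + 1))) atTop (𝓝 (u x)) := by
  filter_upwards [(Besicovitch.vitaliFamily (volume : Measure V3)).ae_tendsto_average_norm_sub hu.locallyIntegrable]
    with x h0 g rho hg hc hr hrho hint
  obtain ⟨K, hK⟩ := hc.exists_bound_of_continuous hg
  have hlim : Tendsto (fun n : ℕ => (1 / ((n:ℝ) + 1)) * rho) atTop (𝓝[>] 0) := by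
    refine tendsto_nhdsWithin_iff.2 ⟨?_, of_forall fun n => ?_⟩
    · simpa using tendsto_one_div_add_atTop_nhds_zero_nat.mul_const rho
    · show (0:ℝ) < _; positivity
  have h1 := (h0.comp (Besicovitch.tendsto_filterAt volume x)).comp hlim
  refine tendsto_integral_smul_of_tendsto_average_norm_sub
    (K * rho ^ 3 * volume.real (ball (0:V3) 1)) h1 ?_ ?_ ?_ ?_
  · exact of_forall fun n => hu.integrableOn
  · refine tendsto_const_nhds.congr fun n => ?_
    have hl : (0:ℝ) < 1 / ((n:ℝ) + 1) := by positivity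
    rw [integral_const_mul, integral_sub_right_eq_self (fun y => g ((1 / ((n:ℝ) + 1))⁻¹ • y)),
      Measure.integral_comp_smul, hint, finrank_euclideanSpace_fin, smul_eq_mul, mul_one,
      abs_of_pos (by positivity)]
    field_simp
  · refine of_forall fun n y hy => ?_
    have hl : (0:ℝ) < 1 / ((n:ℝ) + 1) := by positivity
    have hz := hrho _ (right_ne_zero_of_mul hy)
    rw [norm_smul, norm_inv, norm_of_nonneg hl.le, inv_mul_lt_iff₀ hl] at hz
    rw [mem_closedBall, dist_eq_norm]; exact hz.le
  · refine of_forall fun n y => ?_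
    have hl : (0:ℝ) < 1 / ((n:ℝ) + 1) := by positivity
    have hv : 0 < volume.real (ball (0:V3) 1) :=
      ENNReal.toReal_pos (measure_ball_pos _ _ one_pos).ne' measure_ball_lt_top.ne
    simp only
    rw [Measure.addHaar_real_closedBall _ _ (by positivity), finrank_euclideanSpace_fin, abs_mul,
      abs_of_pos (by positivity)]
    have : K * rho ^ 3 * volume.real (ball (0:V3) 1) / ((1 / ((n:ℝ) + 1) * rho) ^ 3 * volume.real (ball (0:V3) 1))
      = (1 / ((n:ℝ) + 1))⁻¹ ^ 3 * K := by field_simp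
    rw [this]
    gcongr
    exact hK _

/-- Dilation representation: pointwise estimate. -/
lemma dil_main (u : V3 → E) (hu : Integrable u) (F : V3 → V3 →L[ℝ] E) (hF : Integrable F) :
    ∀ᵐ x, ∀ (g : V3 → ℝ) (K rho : ℝ), ContDiff ℝ 1 g → HasCompactSupport g → (∀ z, |g z| ≤ K) →
    0 < rho → (∀ z, g z ≠ 0 → ‖z‖ < rho) → ∫ z, g z = 1 →
    (∀ l : ℝ, 0 < l → l ≤ 1 → ∫ y, dilq g (l⁻¹ • (y - x)) • u y =
      - (l • ∫ y, g (l⁻¹ • (y - x)) • F y (l⁻¹ • (y - x)))) →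
    ‖u x - ∫ y, g (y - x) • u y‖ₑ ≤ ofReal (K * rho ^ 3) * ∫⁻ y, ‖F y‖ₑ * kr 2 x y := by
  filter_upwards [dil_limit u hu] with x hx g K rho hg hc hK hr hrho hint H
  have h1 := hx g rho hg.continuous hc hr hrho hint
  have e : dilPsi g u x 1 = ∫ y, g (y - x) • u y := by unfold dilPsi; simp
  have h2 : Tendsto (fun n : ℕ => ‖dilPsi g u x 1 - dilPsi g u x (1 / ((n:ℝ) + 1))‖ₑ) atTop
      (𝓝 (‖dilPsi g u x 1 - u x‖ₑ)) := (tendsto_const_nhds.sub h1).enorm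
  rw [← enorm_neg, neg_sub, ← e]
  refine le_of_tendsto h2 (of_forall fun n => ?_)
  refine dil_est g hg hc K rho hK hr hrho u hu F hF x H _ (by positivity) ?_
  rw [div_le_one (by positivity)]; linarith [(Nat.cast_nonneg n : (0:ℝ) ≤ n)]

end dil
end

section

/-! Radial bump -/

def hbump (u : ℝ) : ℝ := smoothTransition (2 - 8 * u)

lemma hbump_smooth : Smooth hbump := by
  unfold hbump
  exact smoothTransition.contDiff.comp (by fun_prop)

lemma hbump_nonneg (u : ℝ) : 0 ≤ hbump u := smoothTransition.nonneg _
lemma hbump_le_one (u : ℝ) : hbump u ≤ 1 := smoothTransition.le_one _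
lemma hbump_one {u : ℝ} (h : u ≤ 1/8) : hbump u = 1 :=
  smoothTransition.one_of_one_le (by linarith)
lemma hbump_zero {u : ℝ} (h : 1/4 ≤ u) : hbump u = 0 :=
  smoothTransition.zero_of_nonpos (by linarith)

def hrad (z : V3) : ℝ := hbump (‖z‖ ^ 2)

lemma hrad_smooth : Smooth hrad := by
  unfold hrad
  exact hbump_smooth.comp (contDiff_norm_sq ℝ)

lemma hrad_ne {z : V3} (h : hrad z ≠ 0) : ‖z‖ < 1/2 := by
  by_contra h'
  push Not at h'
  exact h (hbump_zero (by nlinarith))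

lemma hrad_compact : HasCompactSupport hrad := by
  refine HasCompactSupport.of_support_subset_isCompact (isCompact_closedBall (0:V3) 1) ?_
  intro z hz
  have := hrad_ne hz
  rw [mem_closedBall, dist_zero_right]; linarith

lemma hrad_int_pos : 0 < ∫ z, hrad z := by
  rw [integral_pos_iff_support_of_nonneg (f := hrad) (fun z => hbump_nonneg _)
    (hrad_smooth.continuous.integrable_of_hasCompactSupport hrad_compact)]
  refine lt_of_lt_of_le (measure_ball_pos volume (0:V3) (by norm_num : (0:ℝ) < 1/4)) (measure_mono ?_)
  intro z hz
  rw [mem_ball, dist_zero_right] at hz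
  have : hrad z = 1 := hbump_one (by nlinarith [norm_nonneg z])
  rw [Function.mem_support, this]; norm_num

def crho : ℝ := (∫ z, hrad z)⁻¹

lemma crho_pos : 0 < crho := inv_pos.2 hrad_int_pos

/-- normalised radial bump at scale `R` -/
def rhoR (R : ℝ) (z : V3) : ℝ := (R⁻¹ ^ 3 * crho) * hrad (R⁻¹ • z)

lemma rhoR_smooth (R : ℝ) : Smooth (rhoR R) := by
  unfold rhoR
  exact contDiff_const.mul (hrad_smooth.comp (by fun_prop))

lemma rhoR_ne {R : ℝ} (hR : 0 < R) {z : V3} (h : rhoR R z ≠ 0) : ‖z‖ < R / 2 := by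
  have := hrad_ne (right_ne_zero_of_mul h)
  rw [norm_smul, norm_inv, norm_of_nonneg hR.le, inv_mul_lt_iff₀ hR] at this
  linarith

lemma rhoR_compact {R : ℝ} (hR : 0 < R) : HasCompactSupport (rhoR R) := by
  refine HasCompactSupport.of_support_subset_isCompact (isCompact_closedBall (0:V3) (R/2)) ?_
  intro z hz
  have := rhoR_ne hR hz
  rw [mem_closedBall, dist_zero_right]; linarith

lemma rhoR_nonneg {R : ℝ} (hR : 0 < R) (z : V3) : 0 ≤ rhoR R z := by
  have := crho_pos
  have := hbump_nonneg (‖R⁻¹ • z‖ ^ 2)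
  unfold rhoR hrad; positivity

lemma rhoR_le {R : ℝ} (hR : 0 < R) (z : V3) : |rhoR R z| ≤ R⁻¹ ^ 3 * crho := by
  rw [abs_of_nonneg (rhoR_nonneg hR z)]
  have := crho_pos
  have := hbump_le_one (‖R⁻¹ • z‖ ^ 2)
  unfold rhoR hrad
  calc _ ≤ R⁻¹ ^ 3 * crho * 1 := by gcongr
    _ = _ := by ring

lemma rhoR_int {R : ℝ} (hR : 0 < R) : ∫ z, rhoR R z = 1 := by
  unfold rhoR
  rw [integral_const_mul, Measure.integral_comp_smul, finrank_euclideanSpace_fin, smul_eq_mul,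
    abs_of_pos (by positivity)]
  have := hrad_int_pos.ne'
  unfold crho
  field_simp

lemma sum_e3 (z : V3) : ∑ i, z i • e3 i = z := by
  ext j
  simp [e3, Fin.sum_univ_three]
  fin_cases j <;> simp

/-- Divergence of the dilated field. -/
lemma fderiv_dil (g : V3 → ℝ) (hg : Smooth g) (x : V3) (l : ℝ) (i : Fin 3) (y : V3) :
    fderiv ℝ (fun y => g (l⁻¹ • (y - x)) * (l⁻¹ • (y - x)) i) y (e3 i) =
      l⁻¹ * (fderiv ℝ g (l⁻¹ • (y - x)) ((l⁻¹ • (y - x)) i • e3 i) + g (l⁻¹ • (y - x))) := by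
  have h0 : HasFDerivAt (fun y : V3 => l⁻¹ • (y - x)) (l⁻¹ • ContinuousLinearMap.id ℝ V3) y :=
    ((hasFDerivAt_id y).sub_const x).const_smul l⁻¹
  have h1 : HasFDerivAt (fun y => g (l⁻¹ • (y - x))) _ y :=
    ((hg.differentiable (by simp)) (l⁻¹ • (y - x))).hasFDerivAt.comp y h0
  have h2 : HasFDerivAt (fun y : V3 => (l⁻¹ • (y - x)) i) ((EuclideanSpace.proj i : V3 →L[ℝ] ℝ).comp
      (l⁻¹ • ContinuousLinearMap.id ℝ V3)) y :=
    (EuclideanSpace.proj i : V3 →L[ℝ] ℝ).hasFDerivAt.comp y h0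
  have h3 : HasFDerivAt (fun y => g (l⁻¹ • (y - x)) * (l⁻¹ • (y - x)) i) _ y := h1.mul h2
  rw [h3.fderiv]
  simp [e3]
  ring

lemma dilq_sum (g : V3 → ℝ) (hg : Smooth g) (x : V3) (l : ℝ) (y : V3) :
    ∑ i, fderiv ℝ (fun y => g (l⁻¹ • (y - x)) * (l⁻¹ • (y - x)) i) y (e3 i) =
      l⁻¹ * dilq g (l⁻¹ • (y - x)) := by
  simp_rw [fderiv_dil g hg x l]
  rw [← mul_sum, sum_add_distrib, ← map_sum, sum_e3]
  simp [dilq]; ring_nf; simp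

lemma ind_int {E : Type*} [NormedAddCommGroup E] {f : V3 → E} {s : Set V3} (hs : MeasurableSet s)
    (hf : IntegrableOn f s) : Integrable (s.indicator f) := (integrable_indicator_iff hs).2 hf

/-- Pointwise Sobolev-Poincare inequality. -/
lemma sob_pointwise : ∃ C : ℝ≥0, ∀ (x0 : V3) (R : ℝ), 0 < R → ∀ (u : V3 → V3) (du : V3 → V3 →L[ℝ] V3),
    IntegrableOn u (ball x0 R) → IntegrableOn du (ball x0 R) →
    (∀ φ : V3 → ℝ, IsSpaceTest (ball x0 R) φ → ∀ e : V3,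
      (∫ x in ball x0 R, φ x • du x e) = - ∫ x in ball x0 R, fderiv ℝ φ x e • u x) →
    ∀ᵐ x ∂(volume.restrict (ball x0 R)),
      ‖u x - ∫ y in ball x0 R, rhoR R (y - x0) • u y‖ₑ ≤ C * ∫⁻ y in ball x0 R, ‖du y‖ₑ * kr 2 x y := by
  refine ⟨(8 * crho).toNNReal, fun x0 R hR u du hu hdu hw => ?_⟩
  rw [ae_restrict_iff' measurableSet_ball]
  have hu' := (integrable_indicator_iff measurableSet_ball).2 hu
  have hdu' : Integrable ((ball x0 R).indicator du) :=
    ind_int (E := V3 →L[ℝ] V3) measurableSet_ball hdu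
  filter_upwards [dil_main _ hu' _ hdu'] with x hx hxB
  set g : V3 → ℝ := fun z => rhoR R (z + (x - x0)) with hg
  have hgs : Smooth g := (rhoR_smooth R).comp (by fun_prop)
  have hgne : ∀ z, g z ≠ 0 → ‖z + (x - x0)‖ < R / 2 := fun z hz => rhoR_ne hR hz
  rw [mem_ball, dist_eq_norm] at hxB
  have hgr : ∀ z, g z ≠ 0 → ‖z‖ < 2 * R := fun z hz => by
    have := hgne z hz
    have h2 : ‖z‖ ≤ ‖z + (x - x0)‖ + ‖x - x0‖ := by
      simpa using norm_sub_le (z + (x - x0)) (x - x0)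
    linarith
  have hgc : HasCompactSupport g := by
    refine HasCompactSupport.of_support_subset_isCompact (isCompact_closedBall (0:V3) (2 * R)) ?_
    intro z hz
    rw [mem_closedBall, dist_zero_right]; exact (hgr z hz).le
  have key := hx g (R⁻¹ ^ 3 * crho) (2 * R) (hgs.of_le (by exact_mod_cast le_top)) hgc (fun z => rhoR_le hR _)
    (by positivity) hgr ?_ ?_
  · have e1 : ∀ y, g (y - x) = rhoR R (y - x0) := fun y => by simp [hg]
    have e2 : (R⁻¹ ^ 3 * crho) * (2 * R) ^ 3 = 8 * crho := by field_simp; ring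
    simp_rw [e1] at key
    rw [e2, indicator_of_mem (by rwa [mem_ball, dist_eq_norm])] at key
    have e3 : (fun y => rhoR R (y - x0) • (ball x0 R).indicator u y) =
        (ball x0 R).indicator (fun y => rhoR R (y - x0) • u y) := by
      ext1 y; by_cases hy : y ∈ ball x0 R <;> simp [hy]
    have e4 : (fun y => ‖(ball x0 R).indicator du y‖ₑ * kr 2 x y) =
        (ball x0 R).indicator (fun y => ‖du y‖ₑ * kr 2 x y) := by
      ext1 y
      by_cases hy : y ∈ ball x0 R
      · simp [hy]
      · rw [indicator_of_notMem hy, indicator_of_notMem hy,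
          show ‖(0 : V3 →L[ℝ] V3)‖ₑ = 0 from enorm_zero (E := V3 →L[ℝ] V3), zero_mul]
    rw [e3, e4, integral_indicator measurableSet_ball, lintegral_indicator measurableSet_ball] at key
    exact key
  · rw [hg, integral_add_right_eq_self (rhoR R)]; exact rhoR_int hR
  · intro l hl hl1
    set φ : Fin 3 → V3 → ℝ := fun i y => g (l⁻¹ • (y - x)) * (l⁻¹ • (y - x)) i with hφ
    have hφs : ∀ i, Smooth (φ i) := fun i => by
      refine (hgs.comp (by fun_prop)).mul ?_
      exact (EuclideanSpace.proj i : V3 →L[ℝ] ℝ).contDiff.comp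
        (f := fun y : V3 => l⁻¹ • (y - x)) (by fun_prop)
    have hcl : IsClosed {y : V3 | ‖l⁻¹ • (y - x) + (x - x0)‖ ≤ R / 2} :=
      isClosed_le (by fun_prop) continuous_const
    have hφsupp : ∀ i, tsupport (φ i) ⊆ {y : V3 | ‖l⁻¹ • (y - x) + (x - x0)‖ ≤ R / 2} := fun i => by
      refine closure_minimal (fun y hy => ?_) hcl
      exact (hgne _ (left_ne_zero_of_mul hy)).le
    have hsub : {y : V3 | ‖l⁻¹ • (y - x) + (x - x0)‖ ≤ R / 2} ⊆ ball x0 R := fun y hy => by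
      rw [mem_ofPred_eq] at hy
      rw [mem_ball, dist_eq_norm]
      have : y - x0 = (1 - l) • (x - x0) + l • (l⁻¹ • (y - x) + (x - x0)) := by
        rw [smul_add, smul_smul, mul_inv_cancel₀ hl.ne', sub_smul]; simp
      rw [this]
      refine (norm_add_le _ _).trans_lt ?_
      rw [norm_smul, norm_smul, norm_of_nonneg hl.le, norm_of_nonneg (by linarith)]
      nlinarith
    have hφc : ∀ i, HasCompactSupport (φ i) := fun i =>
      HasCompactSupport.intro' (isCompact_of_isClosed_isBounded hcl (isBounded_ball.subset hsub)) hcl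
        (fun y hy => by
          by_contra h
          exact hy (hφsupp i (subset_tsupport _ h)))
    have hφT : ∀ i, IsSpaceTest (ball x0 R) (φ i) := fun i => ⟨hφs i, hφc i, (hφsupp i).trans hsub⟩
    have e1 : (fun y => dilq g (l⁻¹ • (y - x)) • (ball x0 R).indicator u y) =
        (ball x0 R).indicator (fun y => l • ∑ i, fderiv ℝ (φ i) y (e3 i) • u y) := by
      ext1 y
      by_cases hy : y ∈ ball x0 R
      · simp only [indicator_of_mem hy]
        rw [← Finset.sum_smul, dilq_sum g hgs, smul_smul, ← mul_assoc, mul_inv_cancel₀ hl.ne', one_mul]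
      · simp [hy]
    have e2 : (fun y => g (l⁻¹ • (y - x)) • (ball x0 R).indicator du y (l⁻¹ • (y - x))) =
        (ball x0 R).indicator (fun y => ∑ i, φ i y • du y (e3 i)) := by
      ext1 y
      by_cases hy : y ∈ ball x0 R
      · simp only [indicator_of_mem hy]
        conv_lhs => rw [← sum_e3 (l⁻¹ • (y - x)), map_sum, Finset.smul_sum]
        simp_rw [map_smul, smul_smul]
        rw [sum_e3]
      · simp [hy]
    rw [e1, e2, integral_indicator measurableSet_ball, integral_indicator measurableSet_ball,
      integral_smul, integral_finsetSum, integral_finsetSum, ← smul_neg, ← Finset.sum_neg_distrib]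
    · congr 1
      refine sum_congr rfl fun i _ => ?_
      rw [hw (φ i) (hφT i), neg_neg]
    · intro i _
      obtain ⟨K, hK⟩ := (hφc i).exists_bound_of_continuous (hφs i).continuous
      refine Integrable.bdd_smul (Integrable.apply_continuousLinearMap hdu (e3 i)) K ?_ (of_forall hK)
      exact (hφs i).continuous.aestronglyMeasurable
    · intro i _
      have hcd : Continuous (fun y => fderiv ℝ (φ i) y (e3 i)) :=
        ((hφs i).continuous_fderiv (by simp)).clm_apply continuous_const
      obtain ⟨K, hK⟩ := ((hφc i).fderiv_apply (𝕜 := ℝ) (e3 i)).exists_bound_of_continuous hcd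
      refine Integrable.bdd_smul hu K ?_ (of_forall hK)
      exact hcd.aestronglyMeasurable

end

section

/-! Pressure representation -/

def kbump (u : ℝ) : ℝ := ∫ s in (1:ℝ)..u, hbump s / 2

lemma kbump_deriv (u : ℝ) : HasDerivAt kbump (hbump u / 2) u := by
  have hc : Continuous (fun s => hbump s / 2) := hbump_smooth.continuous.div_const 2
  exact intervalIntegral.integral_hasDerivAt_right (hc.intervalIntegrable _ _)
    (hc.stronglyMeasurableAtFilter _ _) hc.continuousAt

lemma kbump_smooth : Smooth kbump := by
  rw [contDiff_infty_iff_deriv]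
  refine ⟨fun u => (kbump_deriv u).differentiableAt, ?_⟩
  have : deriv kbump = fun u => hbump u / 2 := funext fun u => (kbump_deriv u).deriv
  rw [this]
  exact hbump_smooth.div_const 2

lemma kbump_zero {u : ℝ} (h : 1/4 ≤ u) : kbump u = 0 := by
  unfold kbump
  rw [intervalIntegral.integral_congr (g := fun _ => 0)]
  · simp
  · intro s hs
    have : 1/4 ≤ s := by
      have := hs.1
      refine le_trans ?_ this
      rw [le_min_iff]; constructor <;> linarith
    simp [hbump_zero this]

def krad (z : V3) : ℝ := kbump (‖z‖ ^ 2)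

lemma krad_smooth : Smooth krad := by
  unfold krad
  exact kbump_smooth.comp (contDiff_norm_sq ℝ)

lemma krad_fderiv (z _w : V3) : HasFDerivAt krad (hrad z • innerSL ℝ z) z := by
  have h1 : HasFDerivAt (fun z : V3 => ‖z‖ ^ 2) (2 • innerSL ℝ z) z := (hasStrictFDerivAt_norm_sq z).hasFDerivAt
  have h2 := (kbump_deriv (‖z‖ ^ 2)).comp_hasFDerivAt z h1
  refine h2.congr_fderiv ?_
  unfold hrad
  ext w
  simp
  ring

lemma krad_ne {z : V3} (h : krad z ≠ 0) : ‖z‖ < 1/2 := by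
  by_contra h'
  push Not at h'
  exact h (kbump_zero (by nlinarith))

lemma hrad_lip : ∃ L : ℝ≥0, LipschitzWith L hrad :=
  hrad_smooth.lipschitzWith_of_hasCompactSupport hrad_compact (by simp)

def dualF (w : V3) : V3 →L[ℝ] ℝ := - innerSL ℝ w

lemma dualF_norm (w : V3) : ‖dualF w‖ₑ = ‖w‖ₑ := by
  rw [← ofReal_norm, ← ofReal_norm]
  unfold dualF
  rw [norm_neg, innerSL_apply_norm]

lemma dualF_cont : Continuous dualF := by
  unfold dualF; fun_prop

lemma pres_dil_id {x0 : V3} {R : ℝ} (hR : 0 < R) {q : V3 → ℝ} {Fv : V3 → V3}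
    (hw : ∀ η : V3 → ℝ, IsSpaceTest (ball x0 R) η →
      (∫ x in ball x0 R, q x * lap3 η x) = ∫ x in ball x0 R, fderiv ℝ η x (Fv x))
    {x : V3} (hxB : ‖x - x0‖ < R / 2) (l : ℝ) (hl : 0 < l) (hl1 : l ≤ 1) :
    ∫ y, dilq (rhoR R) (l⁻¹ • (y - x)) • (ball x0 R).indicator q y =
      - (l • ∫ y, rhoR R (l⁻¹ • (y - x)) • (ball x0 R).indicator (fun y => dualF (Fv y)) y (l⁻¹ • (y - x))) := by
  have hgs := rhoR_smooth R
  set η : V3 → ℝ := fun y => (R⁻¹ * crho * l) * krad ((R⁻¹ * l⁻¹) • (y - x)) with hη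
  have hηs : Smooth η := contDiff_const.mul (krad_smooth.comp (by fun_prop))
  have hcl : IsClosed {y : V3 | ‖y - x‖ ≤ R / 2} := isClosed_le (by fun_prop) continuous_const
  have hηsupp : tsupport η ⊆ {y : V3 | ‖y - x‖ ≤ R / 2} := by
    refine closure_minimal (fun y hy => ?_) hcl
    have := krad_ne (right_ne_zero_of_mul hy)
    rw [norm_smul, norm_mul, norm_inv, norm_inv, norm_of_nonneg hR.le,
      norm_of_nonneg hl.le, ← mul_inv, inv_mul_lt_iff₀ (by positivity)] at this
    show ‖y - x‖ ≤ R / 2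
    nlinarith
  have hsub : {y : V3 | ‖y - x‖ ≤ R / 2} ⊆ ball x0 R := fun y hy => by
    rw [mem_ofPred_eq] at hy
    rw [mem_ball, dist_eq_norm]
    have := norm_sub_le_norm_sub_add_norm_sub y x x0
    linarith
  have hηc : HasCompactSupport η :=
    HasCompactSupport.intro' (isCompact_of_isClosed_isBounded hcl (isBounded_ball.subset hsub)) hcl
      (fun y hy => by
        by_contra h
        exact hy (hηsupp (subset_tsupport _ h)))
  have hd : ∀ y w, fderiv ℝ η y w = rhoR R (l⁻¹ • (y - x)) * inner ℝ (l⁻¹ • (y - x)) w := by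
    intro y w
    have h0 : HasFDerivAt (fun y : V3 => (R⁻¹ * l⁻¹) • (y - x)) ((R⁻¹ * l⁻¹) • ContinuousLinearMap.id ℝ V3) y :=
      ((hasFDerivAt_id y).sub_const x).const_smul (R⁻¹ * l⁻¹)
    have h1 : HasFDerivAt η _ y := ((krad_fderiv ((R⁻¹ * l⁻¹) • (y - x)) 0).comp y h0).const_mul (R⁻¹ * crho * l)
    rw [h1.fderiv]
    unfold rhoR
    simp only [smul_apply, ContinuousLinearMap.comp_apply, innerSL_apply_apply,
      ContinuousLinearMap.id_apply, smul_smul, smul_eq_mul, real_inner_smul_left, real_inner_smul_right]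
    field_simp
  have hlap : ∀ y, lap3 η y = l⁻¹ * dilq (rhoR R) (l⁻¹ • (y - x)) := by
    intro y
    unfold lap3
    rw [← dilq_sum (rhoR R) hgs]
    refine sum_congr rfl fun i _ => ?_
    congr 2
    ext1 y'
    rw [hd]
    congr 1
    rw [e3, EuclideanSpace.inner_single_right]
    simp
  have := hw η ⟨hηs, hηc, hηsupp.trans hsub⟩
  simp_rw [hlap, hd] at this
  have e1 : (fun y => dilq (rhoR R) (l⁻¹ • (y - x)) • (ball x0 R).indicator q y) =
      (ball x0 R).indicator (fun y => l * (q y * (l⁻¹ * dilq (rhoR R) (l⁻¹ • (y - x))))) := by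
    ext1 y
    by_cases hy : y ∈ ball x0 R
    · simp only [indicator_of_mem hy, smul_eq_mul]
      field_simp
    · simp [hy]
  have e2 : (fun y => rhoR R (l⁻¹ • (y - x)) • (ball x0 R).indicator (fun y => dualF (Fv y)) y (l⁻¹ • (y - x))) =
      (ball x0 R).indicator (fun y => - (rhoR R (l⁻¹ • (y - x)) * inner ℝ (l⁻¹ • (y - x)) (Fv y))) := by
    ext1 y
    by_cases hy : y ∈ ball x0 R
    · simp only [indicator_of_mem hy, smul_eq_mul]
      unfold dualF
      rw [neg_apply, innerSL_apply_apply, real_inner_comm]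
      ring
    · simp [hy]
  rw [e1, e2, integral_indicator measurableSet_ball, integral_indicator measurableSet_ball,
    integral_const_mul, this, integral_neg]
  simp

lemma pres_pointwise : ∃ C : ℝ≥0, ∀ (x0 : V3) (R : ℝ), 0 < R → ∀ (q : V3 → ℝ) (Fv : V3 → V3),
    IntegrableOn q (ball x0 R) → IntegrableOn Fv (ball x0 R) →
    (∀ η : V3 → ℝ, IsSpaceTest (ball x0 R) η →
      (∫ x in ball x0 R, q x * lap3 η x) = ∫ x in ball x0 R, fderiv ℝ η x (Fv x)) →
    ∀ᵐ x ∂(volume.restrict (ball x0 (R/2))),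
      ‖q x - ∫ y in ball x0 R, rhoR R (y - x) * q y‖ₑ ≤ C * ∫⁻ y in ball x0 R, ‖Fv y‖ₑ * kr 2 x y := by
  refine ⟨crho.toNNReal, fun x0 R hR q Fv hq hF hw => ?_⟩
  rw [ae_restrict_iff' measurableSet_ball]
  have hq' : Integrable ((ball x0 R).indicator q) := ind_int measurableSet_ball hq
  have hF0 : IntegrableOn (fun y => dualF (Fv y)) (ball x0 R) := by
    refine Integrable.mono hF (dualF_cont.comp_aestronglyMeasurable hF.1) (of_forall fun y => ?_)
    rw [← enorm_le_iff_norm_le, dualF_norm]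
  have hF' : Integrable ((ball x0 R).indicator (fun y => dualF (Fv y))) :=
    ind_int (E := V3 →L[ℝ] ℝ) measurableSet_ball hF0
  filter_upwards [dil_main _ hq' _ hF'] with x hx hxB
  rw [mem_ball, dist_eq_norm] at hxB
  have hgs := rhoR_smooth R
  have key := hx (rhoR R) (R⁻¹ ^ 3 * crho) R (hgs.of_le (by exact_mod_cast le_top)) (rhoR_compact hR)
    (fun z => rhoR_le hR _) hR (fun z hz => (rhoR_ne hR hz).trans (by linarith)) (rhoR_int hR) ?_
  · have e2 : (R⁻¹ ^ 3 * crho) * R ^ 3 = crho := by field_simp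
    rw [e2, indicator_of_mem (by rw [mem_ball, dist_eq_norm]; linarith)] at key
    have e3 : (fun y => rhoR R (y - x) • (ball x0 R).indicator q y) =
        (ball x0 R).indicator (fun y => rhoR R (y - x) * q y) := by
      ext1 y; by_cases hy : y ∈ ball x0 R <;> simp [hy]
    have e4 : (fun y => ‖(ball x0 R).indicator (fun y => dualF (Fv y)) y‖ₑ * kr 2 x y) =
        (ball x0 R).indicator (fun y => ‖Fv y‖ₑ * kr 2 x y) := by
      ext1 y
      by_cases hy : y ∈ ball x0 R
      · rw [indicator_of_mem hy, indicator_of_mem hy, dualF_norm]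
      · rw [indicator_of_notMem hy, indicator_of_notMem hy,
          show ‖(0 : V3 →L[ℝ] ℝ)‖ₑ = 0 from enorm_zero (E := V3 →L[ℝ] ℝ), zero_mul]
    rw [e3, e4, integral_indicator measurableSet_ball, lintegral_indicator measurableSet_ball] at key
    exact key
  · intro l hl hl1
    exact pres_dil_id hR hw hxB l hl hl1

lemma rhoR_int_ball {R : ℝ} (hR : 0 < R) (x0 x : V3) (hx : ‖x - x0‖ < R / 2) :
    ∫ y in ball x0 R, rhoR R (y - x) = 1 := by
  rw [setIntegral_eq_integral_of_forall_compl_eq_zero, integral_sub_right_eq_self (rhoR R), rhoR_int hR]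
  intro y hy
  by_contra h
  have := rhoR_ne hR h
  apply hy
  rw [mem_ball, dist_eq_norm]
  have := norm_sub_le_norm_sub_add_norm_sub y x x0
  linarith

lemma rhoR_integrable {R : ℝ} (x : V3) (x0 : V3) : IntegrableOn (fun y => rhoR R (y - x)) (ball x0 R) := by
  have : Continuous (fun y => rhoR R (y - x)) := (rhoR_smooth R).continuous.comp (by fun_prop)
  exact (this.continuousOn.integrableOn_compact (isCompact_closedBall x0 R)).mono_set ball_subset_closedBall

lemma rhoR_mul_integrable {R : ℝ} (hR : 0 < R) (x x0 : V3) (q : V3 → ℝ) (hq : IntegrableOn q (ball x0 R)) :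
    IntegrableOn (fun y => rhoR R (y - x) * q y) (ball x0 R) := by
  have : Continuous (fun y => rhoR R (y - x)) := (rhoR_smooth R).continuous.comp (by fun_prop)
  exact hq.bdd_mul this.aestronglyMeasurable (of_forall fun y => rhoR_le hR (y - x))

/-- oscillation of the smoothed pressure -/
lemma rho_diff : ∃ C : ℝ≥0, ∀ (x0 : V3) (R : ℝ), 0 < R → ∀ (q : V3 → ℝ),
    IntegrableOn q (ball x0 R) → ∀ c : ℝ, ∀ x, ‖x - x0‖ < R / 2 →
      ‖(∫ y in ball x0 R, rhoR R (y - x) * q y) - ∫ y in ball x0 R, rhoR R (y - x0) * q y‖ₑ ≤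
        C * (ofReal (R⁻¹ ^ 4 * ‖x - x0‖) * ∫⁻ y in ball x0 R, ‖q y - c‖ₑ) := by
  obtain ⟨L, hL⟩ := hrad_lip
  refine ⟨crho.toNNReal * L, fun x0 R hR q hq c x hxB => ?_⟩
  have e : (∫ y in ball x0 R, rhoR R (y - x) * q y) - ∫ y in ball x0 R, rhoR R (y - x0) * q y =
      (∫ y in ball x0 R, (rhoR R (y - x) - rhoR R (y - x0)) * (q y - c)) := by
    have : ∀ y, (rhoR R (y - x) - rhoR R (y - x0)) * (q y - c) =
      (rhoR R (y - x) * q y - rhoR R (y - x0) * q y) - (rhoR R (y - x) * c - rhoR R (y - x0) * c) := fun y => by ring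
    simp_rw [this]
    rw [integral_sub, integral_sub, integral_sub, integral_mul_const, integral_mul_const, rhoR_int_ball hR x0 x hxB,
      rhoR_int_ball hR x0 x0 (by simpa using hR)]
    · ring
    · exact (rhoR_integrable _ _).mul_const c
    · exact (rhoR_integrable _ _).mul_const c
    · exact rhoR_mul_integrable hR _ _ _ hq
    · exact rhoR_mul_integrable hR _ _ _ hq
    · exact (rhoR_mul_integrable hR _ _ _ hq).sub (rhoR_mul_integrable hR _ _ _ hq)
    · exact ((rhoR_integrable _ _).mul_const c).sub ((rhoR_integrable _ _).mul_const c)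
  rw [e]
  refine (enorm_integral_le_lintegral_enorm _).trans ?_
  rw [← mul_assoc, ← lintegral_const_mul' _ _ (by finiteness)]
  refine lintegral_mono fun y => ?_
  rw [enorm_mul]
  gcongr
  calc ‖rhoR R (y - x) - rhoR R (y - x0)‖ₑ ≤ ofReal ((crho * L) * (R⁻¹ ^ 4 * ‖x - x0‖)) := by
        rw [← ofReal_norm]
        apply ofReal_le_ofReal
        have h1 := hL.dist_le_mul (R⁻¹ • (y - x)) (R⁻¹ • (y - x0))
        rw [dist_eq_norm, dist_eq_norm, ← smul_sub, sub_sub_sub_cancel_left, norm_smul, norm_inv,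
          norm_of_nonneg hR.le, ← norm_neg (x0 - x), neg_sub] at h1
        unfold rhoR
        rw [← mul_sub, norm_mul, norm_of_nonneg (by have := crho_pos; positivity)]
        have := crho_pos
        calc _ ≤ R⁻¹ ^ 3 * crho * (L * (R⁻¹ * ‖x - x0‖)) := by gcongr
          _ = _ := by ring
    _ = CN(crho.toNNReal * L) * ofReal (R⁻¹ ^ 4 * ‖x - x0‖) := by
        rw [ofReal_mul (by have := crho_pos; positivity), ofReal_mul crho_pos.le]
        simp [ofReal]

end

section

/-! Norm symbols and Hoelder inequalities -/

section norms
variable {α : Type*} [MeasurableSpace α]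

def n2 (μ : Measure α) (f : α → ℝ≥0∞) : ℝ≥0∞ := (∫⁻ x, f x ^ 2 ∂μ) ^ ((1:ℝ)/2)
def n4 (μ : Measure α) (f : α → ℝ≥0∞) : ℝ≥0∞ := (∫⁻ x, f x ^ 4 ∂μ) ^ ((1:ℝ)/4)

lemma rpow_half_sq (x : ℝ≥0∞) : (x ^ ((1:ℝ)/2)) ^ 2 = x := by
  rw [← rpow_natCast, ← rpow_mul]; norm_num
lemma rpow_quarter_4 (x : ℝ≥0∞) : (x ^ ((1:ℝ)/4)) ^ 4 = x := by
  rw [← rpow_natCast, ← rpow_mul]; norm_num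
lemma sq_rpow_half (x : ℝ≥0∞) : (x ^ 2) ^ ((1:ℝ)/2) = x := by
  rw [← rpow_natCast, ← rpow_mul]; norm_num
lemma pow4_rpow_quarter (x : ℝ≥0∞) : (x ^ 4) ^ ((1:ℝ)/4) = x := by
  rw [← rpow_natCast, ← rpow_mul]; norm_num

lemma n2_sq (μ : Measure α) (f : α → ℝ≥0∞) : n2 μ f ^ 2 = ∫⁻ x, f x ^ 2 ∂μ := rpow_half_sq _
lemma n4_pow (μ : Measure α) (f : α → ℝ≥0∞) : n4 μ f ^ 4 = ∫⁻ x, f x ^ 4 ∂μ := rpow_quarter_4 _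

lemma le_of_sq_le {x y : ℝ≥0∞} (h : x ^ 2 ≤ y ^ 2) : x ≤ y := by
  rw [← sq_rpow_half x, ← sq_rpow_half y]; exact rpow_le_rpow h (by norm_num)
lemma le_of_pow4_le {x y : ℝ≥0∞} (h : x ^ 4 ≤ y ^ 4) : x ≤ y := by
  rw [← pow4_rpow_quarter x, ← pow4_rpow_quarter y]; exact rpow_le_rpow h (by norm_num)

lemma n2_mul {μ : Measure α} {f g : α → ℝ≥0∞} (hf : AEMeasurable f μ) (hg : AEMeasurable g μ) :
    ∫⁻ x, f x * g x ∂μ ≤ n2 μ f * n2 μ g := by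
  apply le_of_sq_le
  rw [mul_pow, n2_sq, n2_sq]
  exact cs_sq μ f g hf hg

lemma n4_mul {μ : Measure α} {f g : α → ℝ≥0∞} (hf : AEMeasurable f μ) (hg : AEMeasurable g μ) :
    n2 μ (fun x => f x * g x) ≤ n4 μ f * n4 μ g := by
  apply le_of_pow4_le
  rw [mul_pow, n4_pow, n4_pow, show 4 = 2 * 2 by norm_num, pow_mul, n2_sq]
  simp_rw [mul_pow]
  refine (cs_sq μ (fun x => f x ^ 2) (fun x => g x ^ 2) (by fun_prop) (by fun_prop)).trans_eq ?_
  simp_rw [← pow_mul]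

lemma n424 {μ : Measure α} {f g h : α → ℝ≥0∞} (hf : AEMeasurable f μ) (hg : AEMeasurable g μ)
    (hh : AEMeasurable h μ) :
    ∫⁻ x, f x * g x * h x ∂μ ≤ n4 μ f * n2 μ g * n4 μ h := by
  have : ∀ x, f x * g x * h x = g x * (f x * h x) := fun x => by ring
  simp_rw [this]
  refine (n2_mul hg (by fun_prop)).trans ?_
  calc _ ≤ n2 μ g * (n4 μ f * n4 μ h) := mul_le_mul_right (n4_mul hf hh) _
    _ = _ := by ring

lemma n2_add {μ : Measure α} {f g : α → ℝ≥0∞} (hf : AEMeasurable f μ) (hg : AEMeasurable g μ) :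
    n2 μ (fun x => f x + g x) ≤ n2 μ f + n2 μ g := by
  have := lintegral_Lp_add_le hf hg (p := 2) (by norm_num)
  unfold n2
  simpa using this

lemma n4_add {μ : Measure α} {f g : α → ℝ≥0∞} (hf : AEMeasurable f μ) (hg : AEMeasurable g μ) :
    n4 μ (fun x => f x + g x) ≤ n4 μ f + n4 μ g := by
  have := lintegral_Lp_add_le hf hg (p := 4) (by norm_num)
  unfold n4
  have e : ∀ c : ℝ≥0∞, c ^ (4:ℝ) = c ^ 4 := fun c => by
    rw [← rpow_natCast]; norm_num
  simpa [e] using this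

lemma n2_mono {μ : Measure α} {f g : α → ℝ≥0∞} (h : f ≤ᵐ[μ] g) : n2 μ f ≤ n2 μ g := by
  unfold n2
  refine rpow_le_rpow (lintegral_mono_ae ?_) (by norm_num)
  filter_upwards [h] with x hx using pow_le_pow_left' hx 2

lemma n4_mono {μ : Measure α} {f g : α → ℝ≥0∞} (h : f ≤ᵐ[μ] g) : n4 μ f ≤ n4 μ g := by
  unfold n4
  refine rpow_le_rpow (lintegral_mono_ae ?_) (by norm_num)
  filter_upwards [h] with x hx using pow_le_pow_left' hx 4

lemma n2_mono_measure {μ ν : Measure α} (h : μ ≤ ν) (f : α → ℝ≥0∞) : n2 μ f ≤ n2 ν f := by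
  unfold n2
  exact rpow_le_rpow (lintegral_mono' h le_rfl) (by norm_num)

lemma n4_mono_measure {μ ν : Measure α} (h : μ ≤ ν) (f : α → ℝ≥0∞) : n4 μ f ≤ n4 ν f := by
  unfold n4
  exact rpow_le_rpow (lintegral_mono' h le_rfl) (by norm_num)

lemma n2_const (μ : Measure α) (c : ℝ≥0∞) : n2 μ (fun _ => c) = c * (μ univ) ^ ((1:ℝ)/2) := by
  unfold n2
  rw [lintegral_const, mul_rpow_of_nonneg _ _ (by norm_num), sq_rpow_half]

lemma n4_const (μ : Measure α) (c : ℝ≥0∞) : n4 μ (fun _ => c) = c * (μ univ) ^ ((1:ℝ)/4) := by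
  unfold n4
  rw [lintegral_const, mul_rpow_of_nonneg _ _ (by norm_num), pow4_rpow_quarter]

lemma l1_n2 {μ : Measure α} {f : α → ℝ≥0∞} (hf : AEMeasurable f μ) :
    ∫⁻ x, f x ∂μ ≤ (μ univ) ^ ((1:ℝ)/2) * n2 μ f := by
  have := n2_mul (μ := μ) (f := fun _ => 1) (g := f) (by fun_prop) hf
  simpa [n2_const] using this

lemma n2_n4 {μ : Measure α} {f : α → ℝ≥0∞} (hf : AEMeasurable f μ) :
    n2 μ f ≤ (μ univ) ^ ((1:ℝ)/4) * n4 μ f := by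
  have := n4_mul (μ := μ) (f := fun _ => 1) (g := f) (by fun_prop) hf
  simpa [n4_const] using this

end norms

/-- restriction of Lebesgue measure to a ball -/
abbrev mB (x0 : V3) (R : ℝ) : Measure V3 := volume.restrict (ball x0 R)

def cvol : ℝ≥0 := (volume (ball (0:V3) 1)).toNNReal

lemma mB_univ (x0 : V3) (R : ℝ) (hR : 0 < R) : mB x0 R univ = cvol * ofReal (R ^ 3) := by
  rw [restrict_apply_univ, vol_ball x0 R hR, cvol, coe_toNNReal measure_ball_lt_top.ne, mul_comm]

lemma mB_rpow (x0 : V3) (R e : ℝ) (hR : 0 < R) (he : 0 ≤ e) :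
    (mB x0 R univ) ^ e = CN(cvol ^ e) * ofReal (R ^ (3 * e)) := by
  rw [mB_univ x0 R hR, mul_rpow_of_nonneg _ _ he, coe_rpow_of_nonneg _ he,
    ofReal_rpow_of_nonneg (by positivity) he, Real.rpow_mul hR.le, ← Real.rpow_natCast]
  norm_num

lemma kr_any (a : ℝ) (ha0 : 0 < a) (ha : a < 3) : ∃ C : ℝ≥0, ∀ (x0 y : V3) (s : ℝ), 0 < s →
    ∫⁻ x in ball x0 s, kr a x y ≤ C * ofReal (s ^ (3 - a)) := by
  obtain ⟨C, hC⟩ := kr_near a ha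
  refine ⟨C + cvol, fun x0 y s hs => ?_⟩
  calc ∫⁻ x in ball x0 s, kr a x y ≤ ∫⁻ x in (ball y s) ∪ (ball x0 s \ ball y s), kr a x y := by
        refine lintegral_mono_set ?_
        intro x hx; by_cases h : x ∈ ball y s
        · exact Or.inl h
        · exact Or.inr ⟨hx, h⟩
    _ ≤ (∫⁻ x in ball y s, kr a x y) + ∫⁻ x in ball x0 s \ ball y s, kr a x y := lintegral_union_le _ _ _
    _ ≤ C * ofReal (s ^ (3 - a)) + cvol * ofReal (s ^ (3 - a)) := by
        refine add_le_add ?_ ?_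
        · simp_rw [kr_comm a _ y]; exact hC y s hs
        · calc ∫⁻ x in ball x0 s \ ball y s, kr a x y ≤ ∫⁻ x in ball x0 s \ ball y s, ofReal (s ^ (-a)) := by
                refine setLIntegral_mono' (measurableSet_ball.diff measurableSet_ball) fun x hx => ?_
                have h1 : s ≤ ‖x - y‖ := by
                  have := hx.2; rw [mem_ball, dist_eq_norm] at this; linarith
                unfold kr
                rw [← ofReal_norm, ofReal_rpow_of_pos (by linarith)]
                exact ofReal_le_ofReal (Real.rpow_le_rpow_of_nonpos hs h1 (by linarith))
            _ ≤ ∫⁻ x in ball x0 s, ofReal (s ^ (-a)) := lintegral_mono_set sdiff_subset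
            _ = cvol * ofReal (s ^ (3 - a)) := by
                rw [lintegral_const, mB_univ x0 s hs, mul_left_comm, ← ofReal_mul (by positivity),
                  ← Real.rpow_natCast, ← rpow_add hs]
                norm_num
                ring_nf
    _ = _ := by rw [← add_mul]; push_cast; rfl

/-- `ofReal` of a real power, multiplicatively -/
def pw (R e : ℝ) : ℝ≥0∞ := ofReal (R ^ e)

lemma pw_mul {R : ℝ} (hR : 0 < R) (a b : ℝ) : pw R a * pw R b = pw R (a + b) := by
  unfold pw; rw [← ofReal_mul (by positivity), ← rpow_add hR]

lemma pw_ne_top (R e : ℝ) : pw R e ≠ ∞ := ofReal_ne_top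
lemma pw_zero (R : ℝ) : pw R 0 = 1 := by simp [pw]
lemma pw_rpow {R : ℝ} (hR : 0 < R) (a b : ℝ) (hb : 0 ≤ b) : pw R a ^ b = pw R (a * b) := by
  unfold pw; rw [ofReal_rpow_of_nonneg (by positivity) hb, ← Real.rpow_mul hR.le]
end

section

/-- Good time slice. -/
structure GS (U : Set V3) (u : V3 → V3) (du : V3 → V3 →L[ℝ] V3) (q : V3 → ℝ) (g : V3 → V3) : Prop where
  mu : Measurable u
  mdu : Measurable du
  mq : Measurable q
  mg : Measurable g
  u2 : ∫⁻ x in U, ‖u x‖ₑ ^ 2 < ∞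
  du2 : ∫⁻ x in U, ‖du x‖ₑ ^ 2 < ∞
  q1 : ∫⁻ x in U, ‖q x‖ₑ < ∞
  g2 : ∫⁻ x in U, ‖g x‖ₑ ^ 2 < ∞
  wg : ∀ φ : V3 → ℝ, IsSpaceTest U φ → ∀ e : V3,
    (∫ x in U, φ x • du x e) = - ∫ x in U, fderiv ℝ φ x e • u x
  df : ∀ φ : V3 → ℝ, IsSpaceTest U φ → (∫ x in U, fderiv ℝ φ x (u x)) = 0
  pe : ∀ η : V3 → ℝ, IsSpaceTest U η →
    (∫ x in U, q x * lap3 η x) = ∫ x in U, fderiv ℝ η x (du x (u x) - g x)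

lemma IsSpaceTest.mono {U V : Set V3} (h : U ⊆ V) {φ : V3 → ℝ} (hφ : IsSpaceTest U φ) : IsSpaceTest V φ :=
  ⟨hφ.1, hφ.2.1, hφ.2.2.trans h⟩

lemma IsSpaceTest.zero_off {U : Set V3} {φ : V3 → ℝ} (hφ : IsSpaceTest U φ) {x : V3} (hx : x ∉ U) :
    φ x = 0 ∧ fderiv ℝ φ x = 0 ∧ lap3 φ x = 0 := by
  have h0 : x ∉ tsupport φ := fun h => hx (hφ.2.2 h)
  have h1 : ∀ᶠ y in 𝓝 x, φ y = 0 := by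
    have := (isClosed_tsupport φ).isOpen_compl.mem_nhds h0
    filter_upwards [this] with y hy
    exact image_eq_zero_of_notMem_tsupport hy
  have h2 : ∀ᶠ y in 𝓝 x, fderiv ℝ φ y = 0 := by
    filter_upwards [h1.eventually_nhds] with y hy
    have : φ =ᶠ[𝓝 y] fun _ => 0 := hy
    rw [this.fderiv_eq]; simp
  refine ⟨h1.self_of_nhds, h2.self_of_nhds, ?_⟩
  unfold lap3
  refine Finset.sum_eq_zero fun i _ => ?_
  have : (fun y => fderiv ℝ φ y (e3 i)) =ᶠ[𝓝 x] fun _ => 0 := by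
    filter_upwards [h2] with y hy; rw [hy]; simp
  rw [this.fderiv_eq]; simp

lemma GS.mono {U V : Set V3} {u du q g} (h : GS V u du q g) (hUV : U ⊆ V) (hV : MeasurableSet V) : GS U u du q g where
  mu := h.mu
  mdu := h.mdu
  mq := h.mq
  mg := h.mg
  u2 := (lintegral_mono_set hUV).trans_lt h.u2
  du2 := (lintegral_mono_set hUV).trans_lt h.du2
  q1 := (lintegral_mono_set hUV).trans_lt h.q1
  g2 := (lintegral_mono_set hUV).trans_lt h.g2
  wg := fun φ hφ e => by
    have := h.wg φ (hφ.mono hUV) e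
    rwa [setIntegral_eq_of_subset_of_forall_sdiff_eq_zero hV hUV (fun x hx => by rw [(hφ.zero_off hx.2).1]; simp),
      setIntegral_eq_of_subset_of_forall_sdiff_eq_zero hV hUV (fun x hx => by rw [(hφ.zero_off hx.2).2.1]; simp)] at this
  df := fun φ hφ => by
    have := h.df φ (hφ.mono hUV)
    rwa [setIntegral_eq_of_subset_of_forall_sdiff_eq_zero hV hUV (fun x hx => by rw [(hφ.zero_off hx.2).2.1]; simp)] at this
  pe := fun φ hφ => by
    have := h.pe φ (hφ.mono hUV)
    rwa [setIntegral_eq_of_subset_of_forall_sdiff_eq_zero hV hUV (fun x hx => by rw [(hφ.zero_off hx.2).2.2]; simp),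
      setIntegral_eq_of_subset_of_forall_sdiff_eq_zero hV hUV (fun x hx => by rw [(hφ.zero_off hx.2).2.1]; simp)] at this

section
variable {E : Type*} [NormedAddCommGroup E]

lemma n2_lt_top_of {μ : Measure V3} {f : V3 → ℝ≥0∞} (h : ∫⁻ x, f x ^ 2 ∂μ < ∞) : n2 μ f < ∞ :=
  rpow_lt_top_of_nonneg (by norm_num) h.ne

end

section slices
variable {x0 : V3} {R : ℝ} {u : V3 → V3} {du : V3 → V3 →L[ℝ] V3} {q : V3 → ℝ} {g : V3 → V3}

lemma mB_lt_top (x0 : V3) (R : ℝ) : mB x0 R univ < ∞ := by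
  rw [restrict_apply_univ]; exact measure_ball_lt_top

lemma GS.int_u (h : GS (ball x0 R) u du q g) : IntegrableOn u (ball x0 R) :=
  ⟨h.mu.aestronglyMeasurable, (l1_n2 h.mu.enorm.aemeasurable).trans_lt
    (mul_lt_top (rpow_lt_top_of_nonneg (by norm_num) (mB_lt_top _ _).ne) (n2_lt_top_of h.u2))⟩

lemma GS.int_g (h : GS (ball x0 R) u du q g) : IntegrableOn g (ball x0 R) :=
  ⟨h.mg.aestronglyMeasurable, (l1_n2 h.mg.enorm.aemeasurable).trans_lt
    (mul_lt_top (rpow_lt_top_of_nonneg (by norm_num) (mB_lt_top _ _).ne) (n2_lt_top_of h.g2))⟩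

lemma GS.int_du (h : GS (ball x0 R) u du q g) : IntegrableOn du (ball x0 R) :=
  ⟨h.mdu.aestronglyMeasurable, (l1_n2 h.mdu.enorm.aemeasurable).trans_lt
    (mul_lt_top (rpow_lt_top_of_nonneg (by norm_num) (mB_lt_top _ _).ne) (n2_lt_top_of h.du2))⟩

lemma GS.int_q (h : GS (ball x0 R) u du q g) : IntegrableOn q (ball x0 R) :=
  ⟨h.mq.aestronglyMeasurable, h.q1⟩

/-- weighted mean of the velocity -/
def vmean (x0 : V3) (R : ℝ) (u : V3 → V3) : V3 := ∫ y in ball x0 R, rhoR R (y - x0) • u y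
def pmean (x0 : V3) (R : ℝ) (q : V3 → ℝ) : ℝ := ∫ y in ball x0 R, rhoR R (y - x0) * q y

lemma enorm_rhoR_le (hR : 0 < R) (z : V3) : ‖rhoR R z‖ₑ ≤ crho.toNNReal * pw R (-3) := by
  rw [← ofReal_norm, norm_eq_abs]
  refine (ofReal_le_ofReal (rhoR_le hR z)).trans_eq ?_
  rw [mul_comm, ofReal_mul crho_pos.le]
  unfold pw
  congr 2
  rw [rpow_neg hR.le, inv_pow]; norm_num

lemma mB_half (x0 : V3) {R : ℝ} (hR : 0 < R) :
    (mB x0 R univ) ^ ((1:ℝ)/2) = CN(cvol ^ ((1:ℝ)/2)) * pw R (3/2) := by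
  rw [mB_rpow x0 R _ hR (by norm_num), pw]; norm_num

lemma mB_quarter (x0 : V3) {R : ℝ} (hR : 0 < R) :
    (mB x0 R univ) ^ ((1:ℝ)/4) = CN(cvol ^ ((1:ℝ)/4)) * pw R (3/4) := by
  rw [mB_rpow x0 R _ hR (by norm_num), pw]; norm_num

/-- S1 -/
lemma S1 : ∃ C : ℝ≥0, ∀ (x0 : V3) (R : ℝ), 0 < R → ∀ u : V3 → V3, Measurable u →
    ‖vmean x0 R u‖ₑ ≤ C * pw R (-(3/2)) * n2 (mB x0 R) (fun x => ‖u x‖ₑ) := by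
  refine ⟨crho.toNNReal * cvol ^ ((1:ℝ)/2), fun x0 R hR u hu => ?_⟩
  unfold vmean
  refine (enorm_integral_le_lintegral_enorm _).trans ?_
  calc ∫⁻ y in ball x0 R, ‖rhoR R (y - x0) • u y‖ₑ
      ≤ ∫⁻ y in ball x0 R, (crho.toNNReal * pw R (-3)) * ‖u y‖ₑ := by
        refine lintegral_mono fun y => ?_
        rw [enorm_smul]; exact mul_le_mul_left (enorm_rhoR_le hR _) _
    _ = (crho.toNNReal * pw R (-3)) * ∫⁻ y in ball x0 R, ‖u y‖ₑ := by
        rw [lintegral_const_mul _ hu.enorm]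
    _ ≤ (crho.toNNReal * pw R (-3)) * ((mB x0 R univ) ^ ((1:ℝ)/2) * n2 (mB x0 R) (fun x => ‖u x‖ₑ)) :=
        mul_le_mul_right (l1_n2 hu.enorm.aemeasurable) _
    _ = _ := by
        rw [mB_half x0 hR]
        rw [show (-(3/2) : ℝ) = -3 + 3/2 by norm_num, ← pw_mul hR]
        push_cast
        ring

/-- S2 -/
lemma S2 : ∃ C : ℝ≥0, ∀ (x0 : V3) (R : ℝ), 0 < R → ∀ u du q g, GS (ball x0 R) u du q g →
    ∀ (x1 : V3) (s : ℝ), 0 < s → ball x1 s ⊆ ball x0 R →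
    n4 (mB x1 s) (fun x => ‖u x - vmean x0 R u‖ₑ) ≤ C * pw s (1/4) * n2 (mB x0 R) (fun x => ‖du x‖ₑ) := by
  obtain ⟨C, hC⟩ := sob_pointwise
  obtain ⟨C2, hC2⟩ := riesz_L4
  refine ⟨C * C2 ^ ((1:ℝ)/4), fun x0 R hR u du q g h x1 s hs hsub => ?_⟩
  have h1 := hC x0 R hR u du h.int_u h.int_du h.wg
  have h2 := ae_restrict_of_ae_restrict_of_subset hsub h1
  set G : V3 → ℝ≥0∞ := (ball x0 R).indicator (fun y => ‖du y‖ₑ) with hG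
  have hGm : Measurable G := h.mdu.enorm.indicator measurableSet_ball
  have e : ∀ x, ∫⁻ y in ball x0 R, ‖du y‖ₑ * kr 2 x y = ∫⁻ y, G y * kr 2 x y := fun x => by
    rw [← lintegral_indicator measurableSet_ball]
    refine lintegral_congr fun y => ?_
    by_cases hy : y ∈ ball x0 R <;> simp [hG, hy]
  have e2 : ∫⁻ y, G y ^ 2 = n2 (mB x0 R) (fun x => ‖du x‖ₑ) ^ 2 := by
    rw [n2_sq, ← lintegral_indicator measurableSet_ball]
    refine lintegral_congr fun y => ?_
    by_cases hy : y ∈ ball x0 R <;> simp [hG, hy]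
  simp_rw [e] at h2
  apply le_of_pow4_le
  rw [n4_pow]
  calc ∫⁻ x in ball x1 s, ‖u x - vmean x0 R u‖ₑ ^ 4
      ≤ ∫⁻ x in ball x1 s, (C:ℝ≥0∞) ^ 4 * (∫⁻ y, G y * kr 2 x y) ^ 4 := by
        refine lintegral_mono_ae ?_
        filter_upwards [h2] with x hx
        rw [← mul_pow]
        exact pow_le_pow_left' hx 4
    _ = (C:ℝ≥0∞) ^ 4 * ∫⁻ x in ball x1 s, (∫⁻ y, G y * kr 2 x y) ^ 4 := by
        rw [lintegral_const_mul' _ _ (by finiteness)]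
    _ ≤ (C:ℝ≥0∞) ^ 4 * (C2 * ofReal s * (n2 (mB x0 R) (fun x => ‖du x‖ₑ) ^ 2) ^ 2) := by
        rw [← e2]; exact mul_le_mul_right (hC2 G hGm x1 s hs) _
    _ = _ := by
        rw [mul_pow, mul_pow]
        push_cast
        rw [coe_rpow_of_nonneg _ (by norm_num), mul_pow, rpow_quarter_4]
        have : pw s (1/4) ^ 4 = ofReal s := by
          unfold pw; rw [← ofReal_pow (by positivity), ← Real.rpow_natCast, ← Real.rpow_mul hs.le]; norm_num
        rw [this]; ring

/-- S3 -/
lemma S3 : ∃ C : ℝ≥0, ∀ (x0 : V3) (R : ℝ), 0 < R → ∀ u du q g, GS (ball x0 R) u du q g →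
    n2 (mB x0 R) (fun x => ‖u x - vmean x0 R u‖ₑ) ≤ C * pw R 1 * n2 (mB x0 R) (fun x => ‖du x‖ₑ) ∧
    n2 (mB x0 R) (fun x => ‖u x - vmean x0 R u‖ₑ) ≤ C * n2 (mB x0 R) (fun x => ‖u x‖ₑ) ∧
    n2 (mB x0 R) (fun x => ‖u x‖ₑ + ‖vmean x0 R u‖ₑ) ≤ C * n2 (mB x0 R) (fun x => ‖u x‖ₑ) := by
  obtain ⟨C1, h1⟩ := S1
  obtain ⟨C2, h2⟩ := S2
  refine ⟨max (cvol ^ ((1:ℝ)/4) * C2) (1 + C1 * cvol ^ ((1:ℝ)/2)), fun x0 R hR u du q g h => ?_⟩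
  have hm : Measurable (fun x => ‖u x - vmean x0 R u‖ₑ) := (h.mu.sub_const _).enorm
  have key : n2 (mB x0 R) (fun x => ‖u x‖ₑ + ‖vmean x0 R u‖ₑ) ≤
      CN(1 + C1 * cvol ^ ((1:ℝ)/2)) * n2 (mB x0 R) (fun x => ‖u x‖ₑ) := by
    refine (n2_add h.mu.enorm.aemeasurable aemeasurable_const).trans ?_
    rw [n2_const, mB_half x0 hR]
    calc _ ≤ n2 (mB x0 R) (fun x => ‖u x‖ₑ) + (C1 * pw R (-(3/2)) * n2 (mB x0 R) (fun x => ‖u x‖ₑ)) *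
          (CN(cvol ^ ((1:ℝ)/2)) * pw R (3/2)) :=
          add_le_add le_rfl (mul_le_mul_left (h1 x0 R hR u h.mu) _)
      _ = n2 (mB x0 R) (fun x => ‖u x‖ₑ) + C1 * CN(cvol ^ ((1:ℝ)/2)) * (pw R (-(3/2)) * pw R (3/2))
          * n2 (mB x0 R) (fun x => ‖u x‖ₑ) := by ring
      _ = _ := by
        rw [pw_mul hR, neg_add_cancel, pw_zero]
        push_cast
        ring
  refine ⟨?_, ?_, ?_⟩
  · refine (n2_n4 hm.aemeasurable).trans ?_
    rw [mB_quarter x0 hR]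
    calc _ ≤ (CN(cvol ^ ((1:ℝ)/4)) * pw R (3/4)) * (C2 * pw R (1/4) * n2 (mB x0 R) (fun x => ‖du x‖ₑ)) :=
          mul_le_mul_right (h2 x0 R hR u du q g h x0 R hR le_rfl) _
      _ = CN(cvol ^ ((1:ℝ)/4) * C2) * (pw R (3/4) * pw R (1/4)) * n2 (mB x0 R) (fun x => ‖du x‖ₑ) := by
        push_cast; ring
      _ ≤ _ := by
        rw [pw_mul hR]; norm_num
        refine mul_le_mul_left (mul_le_mul_left ?_ _) _
        exact le_max_left _ _
  · refine (n2_mono (of_forall fun x => enorm_sub_le)).trans (key.trans ?_)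
    exact mul_le_mul_left (by exact_mod_cast le_max_right _ _) _
  · refine key.trans ?_
    exact mul_le_mul_left (by exact_mod_cast le_max_right _ _) _

/-- S4 -/
lemma S4 : ∃ C : ℝ≥0, ∀ (x0 : V3) (R : ℝ), 0 < R → ∀ u du q g, GS (ball x0 R) u du q g →
    ∀ s, 0 < s → s ≤ R →
    n4 (mB x0 s) (fun x => ‖u x‖ₑ) ≤ C * (pw s (1/4) * n2 (mB x0 R) (fun x => ‖du x‖ₑ)
      + pw s (3/4) * pw R (-(3/2)) * n2 (mB x0 R) (fun x => ‖u x‖ₑ)) := by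
  obtain ⟨C1, h1⟩ := S1
  obtain ⟨C2, h2⟩ := S2
  refine ⟨C2 + C1 * cvol ^ ((1:ℝ)/4), fun x0 R hR u du q g h s hs hsR => ?_⟩
  have hm : Measurable (fun x => ‖u x - vmean x0 R u‖ₑ) := (h.mu.sub_const _).enorm
  calc n4 (mB x0 s) (fun x => ‖u x‖ₑ) ≤ n4 (mB x0 s) (fun x => ‖u x - vmean x0 R u‖ₑ + ‖vmean x0 R u‖ₑ) := by
        refine n4_mono (of_forall fun x => ?_)
        simpa using enorm_add_le (u x - vmean x0 R u) (vmean x0 R u)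
    _ ≤ n4 (mB x0 s) (fun x => ‖u x - vmean x0 R u‖ₑ) + n4 (mB x0 s) (fun _ => ‖vmean x0 R u‖ₑ) :=
        n4_add hm.aemeasurable aemeasurable_const
    _ ≤ C2 * pw s (1/4) * n2 (mB x0 R) (fun x => ‖du x‖ₑ) +
        (C1 * pw R (-(3/2)) * n2 (mB x0 R) (fun x => ‖u x‖ₑ)) * (CN(cvol ^ ((1:ℝ)/4)) * pw s (3/4)) := by
        rw [n4_const, mB_quarter x0 hs]
        exact add_le_add (h2 x0 R hR u du q g h x0 s hs (ball_subset_ball hsR)) (mul_le_mul_left (h1 x0 R hR u h.mu) _)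
    _ = C2 * (pw s (1/4) * n2 (mB x0 R) (fun x => ‖du x‖ₑ)) +
        (C1 * CN(cvol ^ ((1:ℝ)/4))) * (pw s (3/4) * pw R (-(3/2)) * n2 (mB x0 R) (fun x => ‖u x‖ₑ)) := by ring
    _ ≤ CN(C2 + C1 * cvol ^ ((1:ℝ)/4)) * (pw s (1/4) * n2 (mB x0 R) (fun x => ‖du x‖ₑ)) +
        CN(C2 + C1 * cvol ^ ((1:ℝ)/4)) * (pw s (3/4) * pw R (-(3/2)) * n2 (mB x0 R) (fun x => ‖u x‖ₑ)) := by
        push_cast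
        exact add_le_add (mul_le_mul_left le_self_add _) (mul_le_mul_left le_add_self _)
    _ = _ := by rw [mul_add]

/-- S8: velocity flux -/
lemma S8 : ∃ C : ℝ≥0, ∀ (x0 : V3) (R : ℝ), 0 < R → ∀ u du q g, GS (ball x0 R) u du q g →
    ∫⁻ x in ball x0 R, ‖‖u x‖ ^ 2 - ‖vmean x0 R u‖ ^ 2‖ₑ * ‖u x‖ₑ ≤
      C * pw R (1/4) * n2 (mB x0 R) (fun x => ‖u x‖ₑ) * n2 (mB x0 R) (fun x => ‖du x‖ₑ) *
        n4 (mB x0 R) (fun x => ‖u x‖ₑ) := by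
  obtain ⟨C2, h2⟩ := S2
  obtain ⟨C3, h3⟩ := S3
  refine ⟨C2 * C3, fun x0 R hR u du q g h => ?_⟩
  have hm : Measurable (fun x => ‖u x - vmean x0 R u‖ₑ) := (h.mu.sub_const _).enorm
  calc ∫⁻ x in ball x0 R, ‖‖u x‖ ^ 2 - ‖vmean x0 R u‖ ^ 2‖ₑ * ‖u x‖ₑ
      ≤ ∫⁻ x in ball x0 R, ‖u x - vmean x0 R u‖ₑ * (‖u x‖ₑ + ‖vmean x0 R u‖ₑ) * ‖u x‖ₑ := by
        refine lintegral_mono fun x => mul_le_mul_left ?_ _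
        rw [← ofReal_norm, ← ofReal_norm, ← ofReal_norm, ← ofReal_norm, ← ofReal_add (by positivity) (by positivity),
          ← ofReal_mul (by positivity)]
        apply ofReal_le_ofReal
        rw [sq_sub_sq, norm_mul, mul_comm, norm_of_nonneg (by positivity : 0 ≤ ‖u x‖ + ‖vmean x0 R u‖)]
        gcongr
        rw [norm_eq_abs]
        exact abs_norm_sub_norm_le _ _
    _ ≤ n4 (mB x0 R) (fun x => ‖u x - vmean x0 R u‖ₑ) * n2 (mB x0 R) (fun x => ‖u x‖ₑ + ‖vmean x0 R u‖ₑ) *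
        n4 (mB x0 R) (fun x => ‖u x‖ₑ) :=
        n424 hm.aemeasurable (h.mu.enorm.add_const _).aemeasurable h.mu.enorm.aemeasurable
    _ ≤ (C2 * pw R (1/4) * n2 (mB x0 R) (fun x => ‖du x‖ₑ)) * (C3 * n2 (mB x0 R) (fun x => ‖u x‖ₑ)) *
        n4 (mB x0 R) (fun x => ‖u x‖ₑ) :=
        mul_le_mul_left (mul_le_mul' (h2 x0 R hR u du q g h x0 R hR le_rfl) (h3 x0 R hR u du q g h).2.2) _
    _ = _ := by push_cast; ring

end slices
end

section

lemma IsSpaceTest.deriv_dir {U : Set V3} {η : V3 → ℝ} (h : IsSpaceTest U η) (a : V3) :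
    IsSpaceTest U (fun x => fderiv ℝ η x a) := by
  have hs : Smooth (fun x => fderiv ℝ η x a) :=
    (h.1.fderiv_right (m := (⊤ : ℕ∞)) (by simp)).clm_apply contDiff_const
  refine ⟨hs, h.2.1.fderiv_apply (𝕜 := ℝ) a, ?_⟩
  exact (tsupport_fderiv_apply_subset ℝ a).trans h.2.2

lemma IsSpaceTest.bdd {U : Set V3} {η : V3 → ℝ} (h : IsSpaceTest U η) : ∃ K, ∀ x, ‖η x‖ ≤ K :=
  h.2.1.exists_bound_of_continuous h.1.continuous

lemma fderiv_sum_coord (η : V3 → ℝ) (x y : V3) : fderiv ℝ η x y = ∑ j, fderiv ℝ η x (e3 j) * y j := by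
  conv_lhs => rw [← sum_e3 y]
  rw [map_sum]
  refine sum_congr rfl fun j _ => ?_
  rw [map_smul, smul_eq_mul, mul_comm]

lemma integral_coord {μ : Measure V3} {f : V3 → V3} (hf : Integrable f μ) (j : Fin 3) :
    (∫ x, f x ∂μ) j = ∫ x, f x j ∂μ :=
  ((EuclideanSpace.proj j : V3 →L[ℝ] ℝ).integral_comp_comm hf).symm

lemma integrable_coord {μ : Measure V3} {f : V3 → V3} (hf : Integrable f μ) (j : Fin 3) :
    Integrable (fun x => f x j) μ :=
  (EuclideanSpace.proj j : V3 →L[ℝ] ℝ).integrable_comp hf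

section
variable {x0 : V3} {R : ℝ} {u : V3 → V3} {du : V3 → V3 →L[ℝ] V3} {q : V3 → ℝ} {g : V3 → V3}

lemma fderiv_swap {η : V3 → ℝ} (h : Smooth η) (x a b : V3) :
    fderiv ℝ (fun y => fderiv ℝ η y b) x a = fderiv ℝ (fun y => fderiv ℝ η y a) x b := by
  have h1 : Smooth (fderiv ℝ η) := h.fderiv_right (m := (⊤ : ℕ∞)) (by simp)
  have h2 : DifferentiableAt ℝ (fderiv ℝ η) x := (h1.differentiable (by simp)) x
  rw [fderiv_clm_apply h2 (differentiableAt_const b), fderiv_clm_apply h2 (differentiableAt_const a)]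
  simp
  have := (h.contDiffAt (x := x)).isSymmSndFDerivAt (by simp; exact WithTop.coe_le_coe.2 (le_top : (2:ℕ∞) ≤ ⊤))
  exact this a b

lemma du_const_set {U : Set V3} (hu : IntegrableOn u U) (hdu : IntegrableOn du U)
    (wg : ∀ φ : V3 → ℝ, IsSpaceTest U φ → ∀ e : V3, (∫ x in U, φ x • du x e) = - ∫ x in U, fderiv ℝ φ x e • u x)
    (df : ∀ φ : V3 → ℝ, IsSpaceTest U φ → (∫ x in U, fderiv ℝ φ x (u x)) = 0)
    (a : V3) (η : V3 → ℝ) (hη : IsSpaceTest U η) :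
    ∫ x in U, fderiv ℝ η x (du x a) = 0 := by
  have hda : IntegrableOn (fun x => du x a) U := by
    have := (ContinuousLinearMap.apply ℝ V3 a).integrable_comp hdu
    simp only [ContinuousLinearMap.apply_apply] at this
    exact this
  have hi : ∀ j, IntegrableOn (fun x => fderiv ℝ η x (e3 j) • du x a) U := fun j => by
    obtain ⟨K, hK⟩ := (hη.deriv_dir (e3 j)).bdd
    exact Integrable.bdd_smul hda K (hη.deriv_dir (e3 j)).1.continuous.aestronglyMeasurable (of_forall hK)
  have hi2 : ∀ j, IntegrableOn (fun x => fderiv ℝ (fun y => fderiv ℝ η y (e3 j)) x a • u x) U := fun j => by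
    obtain ⟨K, hK⟩ := ((hη.deriv_dir (e3 j)).deriv_dir a).bdd
    exact Integrable.bdd_smul hu K ((hη.deriv_dir (e3 j)).deriv_dir a).1.continuous.aestronglyMeasurable (of_forall hK)
  simp_rw [fderiv_sum_coord η _ (du _ a)]
  rw [integral_finsetSum _ (fun j _ => by simpa using integrable_coord (hi j) j)]
  have h1 : ∀ j, ∫ x in U, fderiv ℝ η x (e3 j) * du x a j =
      - ∫ x in U, fderiv ℝ (fun y => fderiv ℝ η y a) x (e3 j) * u x j := fun j => by
    have := congrArg (fun z : V3 => z j) (wg _ (hη.deriv_dir (e3 j)) a)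
    simp only [PiLp.neg_apply] at this
    rw [integral_coord (hi j), integral_coord (hi2 j)] at this
    simp only [PiLp.smul_apply, smul_eq_mul] at this
    rw [this]
    simp_rw [fderiv_swap hη.1 _ a]
  simp_rw [h1]
  rw [Finset.sum_neg_distrib, ← integral_finsetSum]
  · have := df _ (hη.deriv_dir a)
    simp_rw [fderiv_sum_coord _ _ (u _)] at this
    rw [this, neg_zero]
  · intro j _
    have := integrable_coord (hi2 j) j
    simp_rw [fderiv_swap hη.1 _ a] at this
    simpa using this

lemma GS.du_const (h : GS (ball x0 R) u du q g) (a : V3) (η : V3 → ℝ) (hη : IsSpaceTest (ball x0 R) η) :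
    ∫ x in ball x0 R, fderiv ℝ η x (du x a) = 0 :=
  du_const_set h.int_u h.int_du h.wg h.df a η hη

/-- centred flux -/
def Fc (x0 : V3) (R : ℝ) (u : V3 → V3) (du : V3 → V3 →L[ℝ] V3) (g : V3 → V3) (x : V3) : V3 :=
  du x (u x - vmean x0 R u) - g x

def F1 (x0 : V3) (R : ℝ) (u : V3 → V3) (du : V3 → V3 →L[ℝ] V3) (g : V3 → V3) : ℝ≥0∞ :=
  ∫⁻ x in ball x0 R, ‖Fc x0 R u du g x‖ₑ

lemma Fc_meas (h : GS (ball x0 R) u du q g) : Measurable (Fc x0 R u du g) := by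
  unfold Fc
  have h1 := h.mdu
  have h2 := h.mu
  have h3 := h.mg
  have : Measurable (fun x => du x (u x - vmean x0 R u)) := by
    have hc : Continuous (fun p : (V3 →L[ℝ] V3) × V3 => p.1 p.2) := by fun_prop
    exact hc.measurable.comp (h1.prodMk (h2.sub_const _))
  exact this.sub h3

lemma F1_le : ∃ C : ℝ≥0, ∀ (x0 : V3) (R : ℝ), 0 < R → ∀ u du q g, GS (ball x0 R) u du q g →
    F1 x0 R u du g ≤ n2 (mB x0 R) (fun x => ‖u x - vmean x0 R u‖ₑ) * n2 (mB x0 R) (fun x => ‖du x‖ₑ)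
      + C * pw R (3/2) * n2 (mB x0 R) (fun x => ‖g x‖ₑ) := by
  refine ⟨cvol ^ ((1:ℝ)/2), fun x0 R hR u du q g h => ?_⟩
  have hm : Measurable (fun x => ‖u x - vmean x0 R u‖ₑ) := (h.mu.sub_const _).enorm
  calc F1 x0 R u du g ≤ ∫⁻ x in ball x0 R, (‖u x - vmean x0 R u‖ₑ * ‖du x‖ₑ + ‖g x‖ₑ) := by
        refine lintegral_mono fun x => ?_
        unfold Fc
        refine enorm_sub_le.trans (add_le_add ?_ le_rfl)
        rw [mul_comm]
        exact ContinuousLinearMap.le_opENorm _ _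
    _ = (∫⁻ x in ball x0 R, ‖u x - vmean x0 R u‖ₑ * ‖du x‖ₑ) + ∫⁻ x in ball x0 R, ‖g x‖ₑ :=
        lintegral_add_right _ h.mg.enorm
    _ ≤ _ := by
        refine add_le_add (n2_mul hm.aemeasurable h.mdu.enorm.aemeasurable) ?_
        rw [← mB_half x0 hR]
        exact l1_n2 h.mg.enorm.aemeasurable

lemma F1_lt_top (hR : 0 < R) (h : GS (ball x0 R) u du q g) : F1 x0 R u du g < ∞ := by
  obtain ⟨C, hC⟩ := F1_le
  obtain ⟨C3, hC3⟩ := S3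
  refine (hC x0 R hR u du q g h).trans_lt ?_
  have h1 := n2_lt_top_of h.u2
  have h2 := n2_lt_top_of h.du2
  have h3 := n2_lt_top_of h.g2
  have h4 : n2 (mB x0 R) (fun x => ‖u x - vmean x0 R u‖ₑ) < ∞ :=
    ((hC3 x0 R hR u du q g h).2.1).trans_lt (mul_lt_top (by finiteness) h1)
  exact add_lt_top.2 ⟨mul_lt_top h4 h2, mul_lt_top (mul_lt_top (by finiteness) (pw_ne_top _ _).lt_top) h3⟩

lemma Fc_int (hR : 0 < R) (h : GS (ball x0 R) u du q g) : IntegrableOn (Fc x0 R u du g) (ball x0 R) :=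
  ⟨(Fc_meas h).aestronglyMeasurable, F1_lt_top hR h⟩

lemma du_u_int (h : GS (ball x0 R) u du q g) : IntegrableOn (fun x => du x (u x)) (ball x0 R) := by
  have hc : Continuous (fun p : (V3 →L[ℝ] V3) × V3 => p.1 p.2) := by fun_prop
  refine ⟨(hc.measurable.comp (h.mdu.prodMk h.mu)).aestronglyMeasurable, ?_⟩
  refine lt_of_le_of_lt (lintegral_mono fun x => ContinuousLinearMap.le_opENorm _ _) ?_
  refine (n2_mul (μ := mB x0 R) h.mdu.enorm.aemeasurable h.mu.enorm.aemeasurable).trans_lt ?_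
  exact mul_lt_top (n2_lt_top_of h.du2) (n2_lt_top_of h.u2)

lemma test_int {U : Set V3} {η : V3 → ℝ} (hη : IsSpaceTest U η) {f : V3 → V3} {μ : Measure V3} (hf : Integrable f μ) :
    Integrable (fun x => fderiv ℝ η x (f x)) μ := by
  rw [show (fun x => fderiv ℝ η x (f x)) = fun x => ∑ j, fderiv ℝ η x (e3 j) * f x j from
    funext fun x => fderiv_sum_coord η x (f x)]
  refine integrable_finsetSum _ fun j _ => ?_
  obtain ⟨K, hK⟩ := (hη.deriv_dir (e3 j)).bdd
  exact (integrable_coord hf j).bdd_mul (hη.deriv_dir (e3 j)).1.continuous.aestronglyMeasurable (of_forall hK)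

lemma GS.pe' (h : GS (ball x0 R) u du q g) (η : V3 → ℝ) (hη : IsSpaceTest (ball x0 R) η) :
    (∫ x in ball x0 R, q x * lap3 η x) = ∫ x in ball x0 R, fderiv ℝ η x (Fc x0 R u du g x) := by
  rw [h.pe η hη]
  have e : ∀ x, fderiv ℝ η x (Fc x0 R u du g x) =
      fderiv ℝ η x (du x (u x) - g x) - fderiv ℝ η x (du x (vmean x0 R u)) := fun x => by
    unfold Fc; rw [map_sub (du x)]; simp only [map_sub]; ring
  simp_rw [e]
  rw [integral_sub, h.du_const _ _ hη, sub_zero]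
  · exact test_int hη ((du_u_int h).sub h.int_g)
  · refine test_int hη ?_
    have := (ContinuousLinearMap.apply ℝ V3 (vmean x0 R u)).integrable_comp h.int_du
    simpa using this

end
end

section

def kapR (R : ℝ) (z : V3) : V3 := rhoR R z • z

lemma kap_lip : ∃ L : ℝ≥0, ∀ R : ℝ, 0 < R → ∀ z z', ‖kapR R z - kapR R z'‖ ≤ L * R⁻¹ ^ 3 * ‖z - z'‖ := by
  have hs : Smooth (fun z : V3 => hrad z • z) := hrad_smooth.smul contDiff_id
  obtain ⟨L, hL⟩ := hs.lipschitzWith_of_hasCompactSupport (hrad_compact.smul_right (f' := fun z : V3 => z)) (by simp)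
  refine ⟨crho.toNNReal * L, fun R hR z z' => ?_⟩
  have h1 := hL.dist_le_mul (R⁻¹ • z) (R⁻¹ • z')
  simp only [Pi.smul_apply'] at h1
  rw [dist_eq_norm, dist_eq_norm, ← smul_sub, norm_smul (R⁻¹), norm_inv, norm_of_nonneg hR.le] at h1
  have e : ∀ z, kapR R z = (R⁻¹ ^ 2 * crho) • (hrad (R⁻¹ • z) • (R⁻¹ • z)) := fun z => by
    unfold kapR rhoR
    rw [smul_smul, smul_smul]
    congr 1
    field_simp
  rw [e, e, ← smul_sub, norm_smul, norm_of_nonneg (by have := crho_pos; positivity)]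
  have := crho_pos
  calc _ ≤ (R⁻¹ ^ 2 * crho) * (L * (R⁻¹ * ‖z - z'‖)) := by gcongr
    _ = _ := by
      push_cast
      rw [Real.coe_toNNReal _ crho_pos.le]
      ring

lemma rhoR_half {R : ℝ} (hR : 0 < R) (z : V3) : rhoR (R/2) z = (2:ℝ) ^ 3 * rhoR R ((2:ℝ) • z) := by
  unfold rhoR
  rw [smul_smul, show (R/2)⁻¹ = R⁻¹ * 2 by field_simp]
  ring

lemma pres_step : ∃ C : ℝ≥0, ∀ (x0 : V3) (R : ℝ), 0 < R → ∀ (q : V3 → ℝ) (Fv : V3 → V3),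
    IntegrableOn q (ball x0 R) → IntegrableOn Fv (ball x0 R) →
    (∀ η : V3 → ℝ, IsSpaceTest (ball x0 R) η →
      (∫ x in ball x0 R, q x * lap3 η x) = ∫ x in ball x0 R, fderiv ℝ η x (Fv x)) → ∀ x, ‖x - x0‖ < R / 2 →
    ‖((∫ y in ball x0 R, rhoR (R/2) (y - x) * q y) - ∫ y in ball x0 R, rhoR (R/2) (y - x0) * q y) -
      ((∫ y in ball x0 R, rhoR R (y - x) * q y) - ∫ y in ball x0 R, rhoR R (y - x0) * q y)‖ₑ ≤
      C * (ofReal (R⁻¹ ^ 3 * ‖x - x0‖) * ∫⁻ y in ball x0 R, ‖Fv y‖ₑ) := by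
  obtain ⟨L, hL⟩ := kap_lip
  refine ⟨8 * L, fun x0 R hR q Fv hq hF hw x hx => ?_⟩
  have hx0 : ‖x0 - x0‖ < R / 2 := by simpa using hR
  have hq' : Integrable ((ball x0 R).indicator q) := ind_int measurableSet_ball hq
  set Q := (ball x0 R).indicator q with hQ
  have hgs : ContDiff ℝ 1 (rhoR R) := (rhoR_smooth R).of_le (by exact_mod_cast le_top)
  have hd : ∀ l > 0, ∀ a : V3, HasDerivAt (dilPsi (rhoR R) Q a) _ l := fun l hl a =>
    dil_hasDeriv (rhoR R) hgs (rhoR_compact hR) Q hq' a l hl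
  set N : ℝ := ∫ y in ball x0 R, ‖Fv y‖ with hN
  have hder : ∀ a : V3, ‖a - x0‖ < R / 2 → ∀ l : ℝ, 0 < l → l ≤ 1 →
      (∫ y, (-(l⁻¹ ^ 4 * dilq (rhoR R) (l⁻¹ • (y - a)))) • Q y) =
      - (l⁻¹ ^ 3 * ∫ y in ball x0 R, inner ℝ (kapR R (l⁻¹ • (y - a))) (Fv y)) := by
    intro a ha l hl hl1
    have h1 := pres_dil_id hR hw ha l hl hl1
    have e1 : ∀ y, (-(l⁻¹ ^ 4 * dilq (rhoR R) (l⁻¹ • (y - a)))) • Q y =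
        (-(l⁻¹ ^ 4)) * (dilq (rhoR R) (l⁻¹ • (y - a)) • Q y) := fun y => by
      simp only [smul_eq_mul]; ring
    simp_rw [e1]
    rw [integral_const_mul, h1]
    have e2 : (fun y => rhoR R (l⁻¹ • (y - a)) • (ball x0 R).indicator (fun y => dualF (Fv y)) y (l⁻¹ • (y - a))) =
        (ball x0 R).indicator (fun y => - inner ℝ (kapR R (l⁻¹ • (y - a))) (Fv y)) := by
      ext1 y
      by_cases hy : y ∈ ball x0 R
      · simp only [indicator_of_mem hy, smul_eq_mul]
        unfold dualF kapR
        rw [neg_apply, innerSL_apply_apply, real_inner_comm, real_inner_smul_left, real_inner_smul_left, real_inner_smul_left]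
        ring
      · simp [hy]
    rw [e2, integral_indicator measurableSet_ball, integral_neg]
    simp only [smul_eq_mul]
    field_simp
  have hki : ∀ a : V3, ∀ l : ℝ, IntegrableOn (fun y => inner ℝ (kapR R (l⁻¹ • (y - a))) (Fv y)) (ball x0 R) := by
    intro a l
    have hk : Continuous (fun y => kapR R (l⁻¹ • (y - a))) := by
      have := (rhoR_smooth R).continuous
      unfold kapR
      fun_prop
    have hkc : HasCompactSupport (kapR R) := (rhoR_compact hR).smul_right (f' := fun z : V3 => z)
    obtain ⟨K, hK⟩ := hkc.exists_bound_of_continuous (by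
      have := (rhoR_smooth R).continuous
      unfold kapR
      fun_prop)
    refine Integrable.mono' (hF.norm.const_mul K) (hk.aestronglyMeasurable.inner hF.1) (of_forall fun y => ?_)
    refine (norm_inner_le_norm _ _).trans ?_
    gcongr
    exact hK _
  set D : ℝ → ℝ := fun l => dilPsi (rhoR R) Q x l - dilPsi (rhoR R) Q x0 l with hD
  have hDd : ∀ l ∈ Icc (1/2:ℝ) 1, HasDerivWithinAt D
      (- (l⁻¹ ^ 3 * ∫ y in ball x0 R, inner ℝ (kapR R (l⁻¹ • (y - x))) (Fv y))
        - - (l⁻¹ ^ 3 * ∫ y in ball x0 R, inner ℝ (kapR R (l⁻¹ • (y - x0))) (Fv y))) (Icc (1/2:ℝ) 1) l := by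
    intro l hl
    have hl0 : 0 < l := by linarith [hl.1]
    rw [← hder x hx l hl0 hl.2, ← hder x0 hx0 l hl0 hl.2]
    exact ((hd l hl0 x).sub (hd l hl0 x0)).hasDerivWithinAt
  have hb : ∀ l ∈ Icc (1/2:ℝ) 1, ‖(- (l⁻¹ ^ 3 * ∫ y in ball x0 R, inner ℝ (kapR R (l⁻¹ • (y - x))) (Fv y))
        - - (l⁻¹ ^ 3 * ∫ y in ball x0 R, inner ℝ (kapR R (l⁻¹ • (y - x0))) (Fv y)))‖ ≤
      16 * L * (R⁻¹ ^ 3 * ‖x - x0‖) * N := by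
    intro l hl
    have hl0 : 0 < l := by linarith [hl.1]
    have hl2 : l⁻¹ ≤ 2 := by rw [inv_le_comm₀ hl0 (by norm_num)]; linarith [hl.1]
    rw [show (- (l⁻¹ ^ 3 * ∫ y in ball x0 R, inner ℝ (kapR R (l⁻¹ • (y - x))) (Fv y))
        - - (l⁻¹ ^ 3 * ∫ y in ball x0 R, inner ℝ (kapR R (l⁻¹ • (y - x0))) (Fv y))) =
        l⁻¹ ^ 3 * ((∫ y in ball x0 R, inner ℝ (kapR R (l⁻¹ • (y - x0))) (Fv y)) -
          ∫ y in ball x0 R, inner ℝ (kapR R (l⁻¹ • (y - x))) (Fv y)) by ring,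
      ← integral_sub (hki _ _) (hki _ _), norm_mul, norm_of_nonneg (by positivity)]
    have h1 : ‖∫ y in ball x0 R, (inner ℝ (kapR R (l⁻¹ • (y - x0))) (Fv y) - inner ℝ (kapR R (l⁻¹ • (y - x))) (Fv y))‖ ≤
        ∫ y in ball x0 R, (L * R⁻¹ ^ 3 * (2 * ‖x - x0‖)) * ‖Fv y‖ := by
      refine norm_integral_le_of_norm_le (hF.norm.const_mul _) (of_forall fun y => ?_)
      rw [← inner_sub_left]
      refine (norm_inner_le_norm _ _).trans ?_
      gcongr
      refine (hL R hR _ _).trans ?_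
      rw [← smul_sub, sub_sub_sub_cancel_left, norm_smul, norm_inv, norm_of_nonneg hl0.le]
      gcongr
    rw [integral_const_mul] at h1
    have hN0 : 0 ≤ N := integral_nonneg fun y => norm_nonneg _
    calc _ ≤ (2:ℝ) ^ 3 * ((L * R⁻¹ ^ 3 * (2 * ‖x - x0‖)) * N) := by gcongr
      _ = _ := by ring
  have key := (convex_Icc (1/2:ℝ) 1).norm_image_sub_le_of_norm_hasDerivWithin_le hDd hb
    (show (1:ℝ) ∈ Icc (1/2:ℝ) 1 by constructor <;> norm_num) (show (1/2:ℝ) ∈ Icc (1/2:ℝ) 1 by constructor <;> norm_num)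
  have eD1 : ∀ a, dilPsi (rhoR R) Q a 1 = ∫ y in ball x0 R, rhoR R (y - a) * q y := fun a => by
    unfold dilPsi
    rw [← integral_indicator measurableSet_ball]
    refine integral_congr_ae (of_forall fun y => ?_)
    by_cases hy : y ∈ ball x0 R <;> simp [hQ, hy]
  have eD2 : ∀ a, dilPsi (rhoR R) Q a (1/2) = ∫ y in ball x0 R, rhoR (R/2) (y - a) * q y := fun a => by
    unfold dilPsi
    rw [← integral_indicator measurableSet_ball]
    refine integral_congr_ae (of_forall fun y => ?_)
    by_cases hy : y ∈ ball x0 R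
    · simp [hQ, hy, rhoR_half hR]
    · simp [hQ, hy]
  simp only [hD, eD1, eD2] at key
  rw [← ofReal_norm]
  refine (ofReal_le_ofReal key).trans ?_
  have hN0 : 0 ≤ N := integral_nonneg fun y => norm_nonneg _
  have e5 : ofReal N = ∫⁻ y in ball x0 R, ‖Fv y‖ₑ := by
    rw [hN, ofReal_integral_norm_eq_lintegral_enorm hF]
  have e6 : ‖(1/2:ℝ) - 1‖ = 1/2 := by norm_num
  rw [e6, show 16 * (L:ℝ) * (R⁻¹ ^ 3 * ‖x - x0‖) * N * (1/2) = (8 * L) * ((R⁻¹ ^ 3 * ‖x - x0‖) * N) by ring,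
    ofReal_mul (by positivity), ofReal_mul (p := R⁻¹ ^ 3 * ‖x - x0‖) (by positivity), e5]
  refine le_of_eq ?_
  congr 1
  rw [ofReal_mul (by norm_num)]
  simp
end

section

/-- dyadic radii -/
def rr (R : ℝ) (k : ℕ) : ℝ := R * (1/2) ^ k

lemma rr_pos {R : ℝ} (hR : 0 < R) (k : ℕ) : 0 < rr R k := by unfold rr; positivity
lemma rr_succ (R : ℝ) (k : ℕ) : rr R (k+1) = rr R k / 2 := by unfold rr; rw [pow_succ]; ring
lemma rr_zero (R : ℝ) : rr R 0 = R := by unfold rr; simp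
lemma rr_anti {R : ℝ} (hR : 0 < R) {j k : ℕ} (h : j ≤ k) : rr R k ≤ rr R j := by
  unfold rr
  gcongr 1
  exact pow_le_pow_of_le_one (by norm_num) (by norm_num) h
lemma rr_le {R : ℝ} (hR : 0 < R) (k : ℕ) : rr R k ≤ R := by
  have := rr_anti hR (Nat.zero_le k); rwa [rr_zero] at this
lemma rr_add (R : ℝ) (j k : ℕ) : rr (rr R j) k = rr R (j + k) := by unfold rr; rw [pow_add]; ring

def O1 (x0 : V3) (R : ℝ) (q : V3 → ℝ) : ℝ≥0∞ := ∫⁻ x in ball x0 R, ‖q x - pmean x0 R q‖ₑ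

lemma O1_le : ∃ C : ℝ≥0, ∀ (x0 : V3) (R : ℝ), 0 < R → ∀ q : V3 → ℝ, Measurable q → IntegrableOn q (ball x0 R) → ∀ c : ℝ,
    O1 x0 R q ≤ C * ∫⁻ x in ball x0 R, ‖q x - c‖ₑ := by
  refine ⟨1 + crho.toNNReal * cvol, fun x0 R hR q hq hqi c => ?_⟩
  have hm : Measurable (fun x => ‖q x - c‖ₑ) := (hq.sub_const c).enorm
  have e : pmean x0 R q - c = ∫ y in ball x0 R, rhoR R (y - x0) * (q y - c) := by
    simp_rw [mul_sub]
    rw [integral_sub (rhoR_mul_integrable hR _ _ _ hqi) ((rhoR_integrable _ _).mul_const c), integral_mul_const,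
      rhoR_int_ball hR x0 x0 (by simpa using hR), one_mul]
    rfl
  have h1 : ‖pmean x0 R q - c‖ₑ ≤ (crho.toNNReal * pw R (-3)) * ∫⁻ x in ball x0 R, ‖q x - c‖ₑ := by
    rw [e]
    refine (enorm_integral_le_lintegral_enorm _).trans ?_
    rw [← lintegral_const_mul _ hm]
    refine lintegral_mono fun y => ?_
    rw [enorm_mul]; exact mul_le_mul_left (enorm_rhoR_le hR _) _
  calc O1 x0 R q ≤ ∫⁻ x in ball x0 R, (‖q x - c‖ₑ + ‖pmean x0 R q - c‖ₑ) := by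
        refine lintegral_mono fun x => ?_
        rw [show q x - pmean x0 R q = (q x - c) - (pmean x0 R q - c) by ring]
        exact enorm_sub_le
    _ = (∫⁻ x in ball x0 R, ‖q x - c‖ₑ) + ‖pmean x0 R q - c‖ₑ * (cvol * pw R 3) := by
        rw [lintegral_add_left hm, lintegral_const, mB_univ x0 R hR]
        congr 3
        unfold pw; norm_num
    _ ≤ (∫⁻ x in ball x0 R, ‖q x - c‖ₑ) + (crho.toNNReal * pw R (-3)) * (∫⁻ x in ball x0 R, ‖q x - c‖ₑ) * (cvol * pw R 3) :=
        add_le_add le_rfl (mul_le_mul_left h1 _)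
    _ = (∫⁻ x in ball x0 R, ‖q x - c‖ₑ) + (crho.toNNReal * cvol * (pw R (-3) * pw R 3)) * (∫⁻ x in ball x0 R, ‖q x - c‖ₑ) := by ring
    _ = _ := by
        rw [pw_mul hR, neg_add_cancel, pw_zero]
        push_cast
        ring

/-- integral against a bump does not see the larger ball -/
lemma rho_ball_eq {x0 x : V3} {s R : ℝ} (hs : 0 < s) (hsR : s ≤ R) (hx : ‖x - x0‖ < s / 2) (q : V3 → ℝ) :
    ∫ y in ball x0 R, rhoR s (y - x) * q y = ∫ y in ball x0 s, rhoR s (y - x) * q y := by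
  refine setIntegral_eq_of_subset_of_forall_sdiff_eq_zero measurableSet_ball (ball_subset_ball hsR) fun y hy => ?_
  have : rhoR s (y - x) = 0 := by
    by_contra h
    have h1 := rhoR_ne hs h
    apply hy.2
    rw [mem_ball, dist_eq_norm]
    have := norm_sub_le_norm_sub_add_norm_sub y x x0
    linarith
  rw [this, zero_mul]

lemma GS.ball_mono {x0 : V3} {R s : ℝ} {u du q g} (h : GS (ball x0 R) u du q g) (hs : s ≤ R) : GS (ball x0 s) u du q g :=
  h.mono (ball_subset_ball hs) measurableSet_ball

lemma pres_multi : ∃ C : ℝ≥0, ∀ (x0 : V3) (R : ℝ), 0 < R → ∀ u du q g, GS (ball x0 R) u du q g → ∀ c : ℝ, ∀ n : ℕ,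
    ∀ᵐ x ∂(volume.restrict (ball x0 (rr R n / 2))),
      ‖q x - pmean x0 (rr R n) q‖ₑ ≤
        C * (ofReal (R⁻¹ ^ 4 * ‖x - x0‖) * (∫⁻ y in ball x0 R, ‖q y - c‖ₑ)
          + (∑ k ∈ range n, ofReal ((rr R k)⁻¹ ^ 3 * ‖x - x0‖) * F1 x0 (rr R k) u du g)
          + ∫⁻ y in ball x0 (rr R n), ‖Fc x0 (rr R n) u du g y‖ₑ * kr 2 x y) := by
  obtain ⟨C1, h1⟩ := pres_pointwise
  obtain ⟨C2, h2⟩ := rho_diff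
  obtain ⟨C3, h3⟩ := pres_step
  refine ⟨max C1 (max C2 C3), fun x0 R hR u du q g h c n => ?_⟩
  set C := max C1 (max C2 C3) with hC
  set M : ℕ → V3 → ℝ := fun k x => ∫ y in ball x0 (rr R k), rhoR (rr R k) (y - x) * q y with hM
  have hg : ∀ k, GS (ball x0 (rr R k)) u du q g := fun k => h.ball_mono (rr_le hR k)
  have hD : ∀ k x, ‖x - x0‖ < rr R k / 2 → ‖M k x - M k x0‖ₑ ≤
      C * (ofReal (R⁻¹ ^ 4 * ‖x - x0‖) * (∫⁻ y in ball x0 R, ‖q y - c‖ₑ)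
          + (∑ k ∈ range k, ofReal ((rr R k)⁻¹ ^ 3 * ‖x - x0‖) * F1 x0 (rr R k) u du g)) := by
    intro k
    induction k with
    | zero =>
      intro x hx
      simp only [hM, rr_zero] at hx ⊢
      rw [Finset.sum_range_zero, add_zero]
      refine (h2 x0 R hR q h.int_q c x hx).trans (mul_le_mul_left ?_ _)
      exact_mod_cast (le_max_left _ _).trans (le_max_right _ _)
    | succ k ih =>
      intro x hx
      have hp := rr_pos hR k
      have hx' : ‖x - x0‖ < rr R k / 2 := by rw [rr_succ] at hx; linarith
      have hs := h3 x0 (rr R k) hp q _ (hg k).int_q (Fc_int hp (hg k)) (hg k).pe' x hx'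
      rw [← rr_succ, rho_ball_eq (rr_pos hR (k+1)) (rr_anti hR (Nat.le_succ k)) hx,
        rho_ball_eq (x := x0) (rr_pos hR (k+1)) (rr_anti hR (Nat.le_succ k)) (by simpa using rr_pos hR (k+1))] at hs
      rw [sum_range_succ, ← add_assoc, mul_add]
      calc ‖M (k+1) x - M (k+1) x0‖ₑ = ‖(M k x - M k x0) + ((M (k+1) x - M (k+1) x0) - (M k x - M k x0))‖ₑ := by
            congr 1; ring
        _ ≤ _ := enorm_add_le _ _
        _ ≤ _ := add_le_add (ih x hx') (hs.trans (mul_le_mul_left (by exact_mod_cast (le_max_right _ _).trans (le_max_right _ _)) _))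
  have hp := rr_pos hR n
  filter_upwards [h1 x0 (rr R n) hp q _ (hg n).int_q (Fc_int hp (hg n)) (hg n).pe', ae_restrict_mem measurableSet_ball] with x hx hxB
  rw [mem_ball, dist_eq_norm] at hxB
  rw [mul_add]
  calc ‖q x - pmean x0 (rr R n) q‖ₑ = ‖(M n x - M n x0) + (q x - M n x)‖ₑ := by
        congr 1
        show q x - M n x0 = _
        ring
    _ ≤ _ := enorm_add_le _ _
    _ ≤ _ := add_le_add (hD n x hxB) (hx.trans (mul_le_mul_left (by exact_mod_cast le_max_left _ _) _))

lemma lint_norm_ball : ∀ (x0 : V3) (s a : ℝ), 0 < s → 0 ≤ a →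
    ∫⁻ x in ball x0 s, ofReal (a * ‖x - x0‖) ≤ cvol * ofReal (a * s ^ 4) := by
  intro x0 s a hs ha
  calc ∫⁻ x in ball x0 s, ofReal (a * ‖x - x0‖) ≤ ∫⁻ x in ball x0 s, ofReal (a * s) := by
        refine setLIntegral_mono measurable_const fun x hx => ?_
        rw [mem_ball, dist_eq_norm] at hx
        gcongr
    _ = _ := by
        rw [lintegral_const, mB_univ x0 s hs, mul_comm, mul_assoc, ← ofReal_mul (by positivity)]
        congr 2; ring

/-- Tonelli bound for the near part -/
lemma near_lint : ∃ C : ℝ≥0, ∀ (x0 x1 : V3) (s R : ℝ), 0 < s → ∀ F : V3 → V3, Measurable F →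
    ∫⁻ x in ball x1 s, ∫⁻ y in ball x0 R, ‖F y‖ₑ * kr 2 x y ≤ C * ofReal s * ∫⁻ y in ball x0 R, ‖F y‖ₑ := by
  obtain ⟨C, hC⟩ := kr_any 2 (by norm_num) (by norm_num)
  refine ⟨C, fun x0 x1 s R hs F hF => ?_⟩
  have hm : Measurable (fun p : V3 × V3 => ‖F p.2‖ₑ * kr 2 p.1 p.2) := by unfold kr; fun_prop
  rw [lintegral_lintegral_swap hm.aemeasurable, ← lintegral_const_mul _ hF.enorm]
  refine lintegral_mono fun y => ?_
  have hk : Measurable (fun x => kr 2 x y) := by unfold kr; fun_prop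
  rw [lintegral_const_mul _ hk, mul_comm]
  refine mul_le_mul_left ((hC x1 y s hs).trans_eq ?_) _
  norm_num

lemma pres_O1 : ∃ C : ℝ≥0, ∀ (x0 : V3) (R : ℝ), 0 < R → ∀ u du q g, GS (ball x0 R) u du q g → ∀ n : ℕ, 1 ≤ n →
    O1 x0 (rr R n) q ≤ C * (ofReal (R⁻¹ ^ 4 * rr R n ^ 4) * O1 x0 R q
      + ∑ k ∈ range n, ofReal ((rr R k)⁻¹ ^ 3 * rr R n ^ 4) * F1 x0 (rr R k) u du g) := by
  obtain ⟨C0, h0⟩ := O1_le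
  obtain ⟨C1, h1⟩ := pres_multi
  obtain ⟨C2, h2⟩ := near_lint
  refine ⟨C0 * (C1 * (cvol + 8 * C2)), fun x0 R hR u du q g h n hn => ?_⟩
  obtain ⟨m, rfl⟩ : ∃ m, n = m + 1 := ⟨n - 1, by omega⟩
  have hp := rr_pos hR m
  have hp1 := rr_pos hR (m+1)
  refine (h0 x0 _ hp1 q h.mq (h.ball_mono (rr_le hR _)).int_q (pmean x0 (rr R m) q)).trans ?_
  have hb := h1 x0 R hR u du q g h (pmean x0 R q) m
  rw [← rr_succ] at hb
  set s := rr R (m+1) with hs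
  have hsm : rr R m = 2 * s := by rw [hs, rr_succ]; ring
  set S : ℝ≥0∞ := ∑ k ∈ range m, ofReal ((rr R k)⁻¹ ^ 3 * s ^ 4) * F1 x0 (rr R k) u du g with hS
  have key : ∫⁻ x in ball x0 s, ‖q x - pmean x0 (rr R m) q‖ₑ ≤
      C1 * (cvol * (ofReal (R⁻¹ ^ 4 * s ^ 4) * O1 x0 R q) + cvol * S + C2 * ofReal s * F1 x0 (rr R m) u du g) := by
    refine (lintegral_mono_ae hb).trans ?_
    rw [lintegral_const_mul' _ _ (by finiteness)]
    have hm1 : Measurable (fun x => ofReal (R⁻¹ ^ 4 * ‖x - x0‖) * (∫⁻ y in ball x0 R, ‖q y - pmean x0 R q‖ₑ)) := by fun_prop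
    have hm2 : ∀ k, Measurable (fun x => ofReal ((rr R k)⁻¹ ^ 3 * ‖x - x0‖) * F1 x0 (rr R k) u du g) := fun k => by fun_prop
    have hm3 : Measurable (fun x => ∑ k ∈ range m, ofReal ((rr R k)⁻¹ ^ 3 * ‖x - x0‖) * F1 x0 (rr R k) u du g) :=
      measurable_fun_sum _ fun k _ => hm2 k
    have hm13 : Measurable (fun x => ofReal (R⁻¹ ^ 4 * ‖x - x0‖) * (∫⁻ y in ball x0 R, ‖q y - pmean x0 R q‖ₑ) + ∑ k ∈ range m, ofReal ((rr R k)⁻¹ ^ 3 * ‖x - x0‖) * F1 x0 (rr R k) u du g) := hm1.add hm3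
    rw [lintegral_add_left hm13, lintegral_add_left hm1, lintegral_finsetSum _ (fun k _ => hm2 k)]
    refine mul_le_mul_right (add_le_add (add_le_add ?_ ?_) ?_) _
    · rw [lintegral_mul_const _ (by fun_prop), ← mul_assoc]
      exact mul_le_mul_left (lint_norm_ball x0 s _ hp1 (by positivity)) _
    · rw [hS, mul_sum]
      refine sum_le_sum fun k _ => ?_
      have := rr_pos hR k
      rw [lintegral_mul_const _ (by fun_prop), ← mul_assoc]
      exact mul_le_mul_left (lint_norm_ball x0 s _ hp1 (by positivity)) _
    · exact h2 x0 x0 s _ hp1 _ (Fc_meas (h.ball_mono (rr_le hR m)))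
  have e8 : ofReal s = 8 * ofReal ((rr R m)⁻¹ ^ 3 * s ^ 4) := by
    rw [show (8:ℝ≥0∞) = ofReal 8 by norm_num, ← ofReal_mul (by norm_num), hsm]
    congr 1
    field_simp
    norm_num
  rw [sum_range_succ, ← hS]
  rw [e8] at key
  refine (mul_le_mul_right key _).trans ?_
  set X := ofReal (R⁻¹ ^ 4 * s ^ 4) * O1 x0 R q
  set Z := F1 x0 (rr R m) u du g
  set W := ofReal ((rr R m)⁻¹ ^ 3 * s ^ 4)
  have e : (C0:ℝ≥0∞) * (C1 * (cvol * X + cvol * S + C2 * (8 * W) * Z)) ≤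
      C0 * (C1 * ((cvol + 8 * C2) * X + (cvol + 8 * C2) * S + (cvol + 8 * C2) * (W * Z))) := by
    refine mul_le_mul_right (mul_le_mul_right (add_le_add (add_le_add (mul_le_mul_left le_self_add _) (mul_le_mul_left le_self_add _)) ?_) _) _
    rw [show (C2:ℝ≥0∞) * (8 * W) * Z = (8 * C2) * (W * Z) by ring]
    exact mul_le_mul_left le_add_self _
  refine e.trans_eq ?_
  push_cast
  ring

/-- S7: pressure flux -/
lemma S7 : ∃ C : ℝ≥0, ∀ (x0 : V3) (R : ℝ), 0 < R → ∀ u du q g, GS (ball x0 R) u du q g →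
    ∫⁻ x in ball x0 (R/2), ‖q x - pmean x0 R q‖ₑ * ‖u x‖ₑ ≤
      C * (pw R (-(3/2)) * O1 x0 R q * n2 (mB x0 R) (fun x => ‖u x‖ₑ) +
        pw R (1/4) * n4 (mB x0 R) (fun x => ‖u x‖ₑ) * F1 x0 R u du g) := by
  obtain ⟨C1, h1⟩ := pres_multi
  obtain ⟨K, hK⟩ := kr_any (8/3) (by norm_num) (by norm_num)
  refine ⟨C1 * (cvol ^ ((1:ℝ)/2) + K ^ ((3:ℝ)/4)), fun x0 R hR u du q g h => ?_⟩
  have hb := h1 x0 R hR u du q g h (pmean x0 R q) 0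
  simp only [rr_zero, Finset.sum_range_zero, add_zero] at hb
  have hmF := Fc_meas h
  have hmu := h.mu
  set P := O1 x0 R q with hP
  have hsub : ball x0 (R/2) ⊆ ball x0 R := ball_subset_ball (by linarith)
  have hn4 : n4 (mB x0 (R/2)) (fun x => ‖u x‖ₑ) ≤ n4 (mB x0 R) (fun x => ‖u x‖ₑ) :=
    n4_mono_measure (restrict_mono hsub le_rfl) _
  have hkey : ∀ y, ∫⁻ x in ball x0 (R/2), kr 2 x y * ‖u x‖ₑ ≤
      CN(K ^ ((3:ℝ)/4)) * (pw R (1/4) * n4 (mB x0 R) (fun x => ‖u x‖ₑ)) := by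
    intro y
    have hk : Measurable (fun x => kr 2 x y) := by unfold kr; fun_prop
    have hh := lintegral_mul_le_Lp_mul_Lq (volume.restrict (ball x0 (R/2)))
      (p := 4/3) (q := 4) ⟨by norm_num, by norm_num, by norm_num⟩ hk.aemeasurable hmu.enorm.aemeasurable
    refine hh.trans ?_
    rw [← mul_assoc]
    refine mul_le_mul' ?_ ?_
    · have e1 : ∀ x, kr 2 x y ^ ((4:ℝ)/3) = kr (8/3) x y := fun x => by
        unfold kr; rw [← rpow_mul]; norm_num
      simp_rw [e1]
      have := hK x0 y R hR
      have h2 := (lintegral_mono_set (μ := volume) (f := fun x => kr (8/3) x y) hsub).trans this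
      refine (rpow_le_rpow h2 (by norm_num : (0:ℝ) ≤ 1/(4/3))).trans_eq ?_
      rw [mul_rpow_of_nonneg _ _ (by norm_num), ← coe_rpow_of_nonneg _ (by norm_num)]
      congr 1
      · norm_num
      · unfold pw
        rw [ofReal_rpow_of_nonneg (by positivity) (by norm_num), ← Real.rpow_mul hR.le]; norm_num
    · refine le_trans (le_of_eq ?_) hn4
      unfold n4
      norm_num
  calc ∫⁻ x in ball x0 (R/2), ‖q x - pmean x0 R q‖ₑ * ‖u x‖ₑ
      ≤ ∫⁻ x in ball x0 (R/2), C1 * ((pw R (-3) * P) * ‖u x‖ₑ + ∫⁻ y in ball x0 R, ‖Fc x0 R u du g y‖ₑ * (kr 2 x y * ‖u x‖ₑ)) := by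
        refine lintegral_mono_ae ?_
        filter_upwards [hb, ae_restrict_mem measurableSet_ball] with x hx hxB
        rw [mem_ball, dist_eq_norm] at hxB
        refine (mul_le_mul_left hx _).trans ?_
        rw [mul_assoc, add_mul]
        refine mul_le_mul_right (add_le_add (mul_le_mul_left (mul_le_mul_left ?_ _) _) (le_of_eq ?_)) _
        · unfold pw
          apply ofReal_le_ofReal
          rw [rpow_neg hR.le]
          calc R⁻¹ ^ 4 * ‖x - x0‖ ≤ R⁻¹ ^ 4 * R := by gcongr; linarith
            _ = (R ^ (3:ℝ))⁻¹ := by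
              rw [show (3:ℝ) = ((3:ℕ):ℝ) by norm_num, Real.rpow_natCast]; field_simp
        · have hk : Measurable (fun y => kr 2 x y) := by unfold kr; fun_prop
          rw [← lintegral_mul_const _ (by fun_prop)]
          refine lintegral_congr fun y => ?_
          ring
    _ = C1 * ((pw R (-3) * P) * (∫⁻ x in ball x0 (R/2), ‖u x‖ₑ) +
          ∫⁻ x in ball x0 (R/2), ∫⁻ y in ball x0 R, ‖Fc x0 R u du g y‖ₑ * (kr 2 x y * ‖u x‖ₑ)) := by
        rw [lintegral_const_mul' _ _ (by finiteness), lintegral_add_left (by fun_prop), lintegral_const_mul _ hmu.enorm]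
    _ ≤ C1 * ((pw R (-3) * P) * ((CN(cvol ^ ((1:ℝ)/2)) * pw R (3/2)) * n2 (mB x0 R) (fun x => ‖u x‖ₑ)) +
          (CN(K ^ ((3:ℝ)/4)) * (pw R (1/4) * n4 (mB x0 R) (fun x => ‖u x‖ₑ))) * F1 x0 R u du g) := by
        refine mul_le_mul_right (add_le_add (mul_le_mul_right ?_ _) ?_) _
        · rw [← mB_half x0 hR]
          exact (lintegral_mono_set hsub).trans (l1_n2 hmu.enorm.aemeasurable)
        · have hm : Measurable (fun p : V3 × V3 => ‖Fc x0 R u du g p.2‖ₑ * (kr 2 p.1 p.2 * ‖u p.1‖ₑ)) := by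
            unfold kr; fun_prop
          rw [lintegral_lintegral_swap hm.aemeasurable, F1, ← lintegral_const_mul _ hmF.enorm]
          refine lintegral_mono fun y => ?_
          have hk : Measurable (fun x => kr 2 x y) := by unfold kr; fun_prop
          rw [lintegral_const_mul _ (by fun_prop), mul_comm]
          exact mul_le_mul_left (hkey y) _
    _ = C1 * (CN(cvol ^ ((1:ℝ)/2)) * ((pw R (-3) * pw R (3/2)) * P * n2 (mB x0 R) (fun x => ‖u x‖ₑ)) +
          CN(K ^ ((3:ℝ)/4)) * (pw R (1/4) * n4 (mB x0 R) (fun x => ‖u x‖ₑ) * F1 x0 R u du g)) := by ring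
    _ ≤ C1 * ((CN(cvol ^ ((1:ℝ)/2)) + CN(K ^ ((3:ℝ)/4))) * ((pw R (-3) * pw R (3/2)) * P * n2 (mB x0 R) (fun x => ‖u x‖ₑ)) +
          (CN(cvol ^ ((1:ℝ)/2)) + CN(K ^ ((3:ℝ)/4))) * (pw R (1/4) * n4 (mB x0 R) (fun x => ‖u x‖ₑ) * F1 x0 R u du g)) :=
        mul_le_mul_right (add_le_add (mul_le_mul_left le_self_add _) (mul_le_mul_left le_add_self _)) _
    _ = _ := by
        rw [pw_mul hR, show (-3 + 3/2 : ℝ) = -(3/2) by norm_num]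
        push_cast
        ring
end

section

/-- restriction to a product, swapped -/
lemma ae_slice {Ω : Set V3} {I : Set ℝ} {P : V3 × ℝ → Prop}
    (h : ∀ᵐ z ∂((volume : Measure (V3 × ℝ)).restrict (Ω ×ˢ I)), P z) :
    ∀ᵐ t ∂(volume.restrict I), ∀ᵐ x ∂((volume : Measure V3).restrict Ω), P (x, t) := by
  rw [volume_eq_prod, ← prod_restrict] at h
  have := (Measure.measurePreserving_swap (μ := (volume : Measure ℝ).restrict I) (ν := (volume : Measure V3).restrict Ω)).quasiMeasurePreserving.ae h
  exact Measure.ae_ae_of_ae_prod this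

lemma lint_slice {Ω : Set V3} {I : Set ℝ} {F : V3 × ℝ → ℝ≥0∞} (hF : Measurable F) :
    ∫⁻ z in Ω ×ˢ I, F z = ∫⁻ t in I, ∫⁻ x in Ω, F (x, t) := by
  rw [volume_eq_prod, ← prod_restrict, lintegral_prod_symm _ hF.aemeasurable]

lemma int_slice {Ω : Set V3} {I : Set ℝ} {F : V3 × ℝ → ℝ} (hF : IntegrableOn F (Ω ×ˢ I) volume) :
    IntegrableOn (fun t => ∫ x in Ω, F (x, t)) I := by
  rw [IntegrableOn, volume_eq_prod, ← prod_restrict] at hF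
  exact hF.integral_prod_right

lemma int_slice_ae {Ω : Set V3} {I : Set ℝ} {F : V3 × ℝ → ℝ} (hF : IntegrableOn F (Ω ×ˢ I) volume) :
    ∀ᵐ t ∂(volume.restrict I), IntegrableOn (fun x => F (x, t)) Ω := by
  rw [IntegrableOn, volume_eq_prod, ← prod_restrict] at hF
  exact hF.prod_left_ae

lemma enorm_le_fnormSq (A : V3 →L[ℝ] V3) : ‖A‖ₑ ^ 2 ≤ ofReal (fnormSq A) := by
  have h : ‖A‖ ≤ sqrt (fnormSq A) := by
    refine A.opNorm_le_bound (Real.sqrt_nonneg _) fun y => ?_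
    conv_lhs => rw [← sum_e3 y]
    rw [map_sum]
    calc ‖∑ i, A (y i • e3 i)‖ ≤ ∑ i, ‖A (y i • e3 i)‖ := norm_sum_le _ _
      _ = ∑ i, ‖A (e3 i)‖ * |y i| := by
        refine sum_congr rfl fun i _ => ?_
        rw [map_smul, norm_smul, norm_eq_abs, mul_comm]
      _ ≤ sqrt (∑ i, ‖A (e3 i)‖ ^ 2) * sqrt (∑ i, |y i| ^ 2) := Real.sum_mul_le_sqrt_mul_sqrt _ _ _
      _ = _ := by
        rw [EuclideanSpace.norm_eq]; simp [fnormSq]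
  have h2 : ‖A‖ ^ 2 ≤ fnormSq A := by
    calc ‖A‖ ^ 2 ≤ sqrt (fnormSq A) ^ 2 := by gcongr
      _ = _ := sq_sqrt (by unfold fnormSq; positivity)
  rw [← ofReal_norm, ← ofReal_pow (norm_nonneg _)]
  exact ofReal_le_ofReal h2

lemma fnormSq_nonneg (A : V3 →L[ℝ] V3) : 0 ≤ fnormSq A := by unfold fnormSq; positivity

lemma meas_fnormSq : Measurable fnormSq := by
  have : Continuous fnormSq := by unfold fnormSq; fun_prop
  exact this.measurable

/-- Transfer of a suitable weak solution along slice-wise a.e. equality. -/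
lemma suitable_congr {Ω : Set V3} {a b : ℝ} {v v' : VV} {dv dv' : DV} {p p' : VR}
    {f f' : VV} (h : IsSuitableWeakSolution Ω a b v dv p f)
    (hv : (fun z : V3 × ℝ => v z.1 z.2) =ᵐ[volume.restrict (Ω ×ˢ Ioo a b)] fun z => v' z.1 z.2)
    (hdv : (fun z : V3 × ℝ => dv z.1 z.2) =ᵐ[volume.restrict (Ω ×ˢ Ioo a b)] fun z => dv' z.1 z.2)
    (hp : (fun z : V3 × ℝ => p z.1 z.2) =ᵐ[volume.restrict (Ω ×ˢ Ioo a b)] fun z => p' z.1 z.2)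
    (hf : (fun z : V3 × ℝ => f z.1 z.2) =ᵐ[volume.restrict (Ω ×ˢ Ioo a b)] fun z => f' z.1 z.2) :
    IsSuitableWeakSolution Ω a b v' dv' p' f' := by
  have sv := ae_slice hv
  have sdv := ae_slice hdv
  have sp := ae_slice hp
  have sf := ae_slice hf
  refine ⟨h.open_dom, h.bounded_dom, h.nonempty_dom, h.c2_boundary, h.time_lt, h.meas_v.congr hv, h.meas_dv.congr hdv,
    h.meas_p.congr hp, h.meas_f.congr hf, ?_, ?_, ?_, ?_, ?_, ?_, ?_, ?_⟩
  · obtain ⟨K, hK⟩ := h.v_linf_l2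
    refine ⟨K, ?_⟩
    filter_upwards [hK, sv] with t ht hs
    have e : (fun x => ‖v x t‖ ^ 2) =ᵐ[volume.restrict Ω] fun x => ‖v' x t‖ ^ 2 := by
      filter_upwards [hs] with x hx; rw [hx]
    exact ⟨ht.1.congr e, (integral_congr_ae e).symm.trans_le ht.2⟩
  · refine h.dv_l2.congr ?_
    filter_upwards [hdv] with z hz; rw [hz]
  · refine h.p_l32.congr ?_
    filter_upwards [hp] with z hz; rw [hz]
  · obtain ⟨m, hm, hi⟩ := h.f_lm
    refine ⟨m, hm, hi.congr ?_⟩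
    filter_upwards [hf] with z hz; rw [hz]
  · filter_upwards [h.weak_gradient, sv, sdv] with t ht h1 h2 φ hφ u
    have := ht φ hφ u
    have e1 : (∫ x in Ω, φ x • dv x t u) = ∫ x in Ω, φ x • dv' x t u :=
      integral_congr_ae (by filter_upwards [h2] with x hx; rw [hx])
    have e2 : (∫ x in Ω, fderiv ℝ φ x u • v x t) = ∫ x in Ω, fderiv ℝ φ x u • v' x t :=
      integral_congr_ae (by filter_upwards [h1] with x hx; rw [hx])
    rw [e1, e2] at this
    exact this
  · filter_upwards [h.div_free, sv] with t ht h1 φ hφ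
    have := ht φ hφ
    rw [integral_congr_ae (g := fun x => fderiv ℝ φ x (v' x t)) (by filter_upwards [h1] with x hx; rw [hx])] at this
    exact this
  · intro ψ hψ
    rw [← h.nse ψ hψ]
    refine integral_congr_ae ?_
    filter_upwards [sv, sdv, sp, sf] with t h1 h2 h3 h4
    refine integral_congr_ae ?_
    filter_upwards [h1, h2, h3, h4] with x h1 h2 h3 h4
    rw [h1, h2, h3, h4]
  · filter_upwards [h.energy, sv, ae_restrict_mem measurableSet_Ioo] with t ht h1 htI φ hφ hφ0
    have := ht φ hφ hφ0
    have hsub : Ioo a t ⊆ Ioo a b := Ioo_subset_Ioo_right htI.2.le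
    have sv' := ae_mono (restrict_mono hsub le_rfl) sv
    have sdv' := ae_mono (restrict_mono hsub le_rfl) sdv
    have sp' := ae_mono (restrict_mono hsub le_rfl) sp
    have sf' := ae_mono (restrict_mono hsub le_rfl) sf
    have e0 : (∫ x in Ω, ‖v x t‖ ^ 2 * φ x t) = ∫ x in Ω, ‖v' x t‖ ^ 2 * φ x t :=
      integral_congr_ae (by filter_upwards [h1] with x hx; rw [hx])
    have e1 : (∫ s in Ioo a t, ∫ x in Ω, fnormSq (dv x s) * φ x s) = ∫ s in Ioo a t, ∫ x in Ω, fnormSq (dv' x s) * φ x s := by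
      refine integral_congr_ae ?_
      filter_upwards [sdv'] with s h2
      exact integral_congr_ae (by filter_upwards [h2] with x hx; rw [hx])
    have e2 : (∫ s in Ioo a t, ∫ x in Ω, ‖v x s‖ ^ 2 * (deriv (fun τ => φ x τ) s + lap3 (fun y => φ y s) x))
        = ∫ s in Ioo a t, ∫ x in Ω, ‖v' x s‖ ^ 2 * (deriv (fun τ => φ x τ) s + lap3 (fun y => φ y s) x) := by
      refine integral_congr_ae ?_
      filter_upwards [sv'] with s h2
      exact integral_congr_ae (by filter_upwards [h2] with x hx; rw [hx])
    have e3 : (∫ s in Ioo a t, ∫ x in Ω, ‖v x s‖ ^ 2 * fderiv ℝ (fun y => φ y s) x (v x s))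
        = ∫ s in Ioo a t, ∫ x in Ω, ‖v' x s‖ ^ 2 * fderiv ℝ (fun y => φ y s) x (v' x s) := by
      refine integral_congr_ae ?_
      filter_upwards [sv'] with s h2
      exact integral_congr_ae (by filter_upwards [h2] with x hx; rw [hx])
    have e4 : (∫ s in Ioo a t, ∫ x in Ω, p x s * fderiv ℝ (fun y => φ y s) x (v x s))
        = ∫ s in Ioo a t, ∫ x in Ω, p' x s * fderiv ℝ (fun y => φ y s) x (v' x s) := by
      refine integral_congr_ae ?_
      filter_upwards [sv', sp'] with s h2 h3
      exact integral_congr_ae (by filter_upwards [h2, h3] with x hx hx3; rw [hx, hx3])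
    have e5 : (∫ s in Ioo a t, ∫ x in Ω, dot3 (f x s) (v x s) * φ x s)
        = ∫ s in Ioo a t, ∫ x in Ω, dot3 (f' x s) (v' x s) * φ x s := by
      refine integral_congr_ae ?_
      filter_upwards [sv', sf'] with s h2 h3
      exact integral_congr_ae (by filter_upwards [h2, h3] with x hx hx3; rw [hx, hx3])
    rw [e0, e1, e2, e3, e4, e5] at this
    exact this

end

section

/-- measurable data of a solution -/
structure MS (Ω : Set V3) (T : ℝ) (v : VV) (dv : DV) (p : VR) (f : VV) : Prop where
  sol : IsSuitableWeakSolution Ω 0 T v dv p f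
  mv : Measurable fun z : V3 × ℝ => v z.1 z.2
  mdv : Measurable fun z : V3 × ℝ => dv z.1 z.2
  mp : Measurable fun z : V3 × ℝ => p z.1 z.2
  mf : Measurable fun z : V3 × ℝ => f z.1 z.2

lemma exists_MS {Ω : Set V3} {T : ℝ} {v : VV} {dv : DV} {p : VR} {f : VV}
    (h : IsSuitableWeakSolution Ω 0 T v dv p f) : ∃ v' dv' p' f', MS Ω T v' dv' p' f' ∧
      ((fun z : V3 × ℝ => v z.1 z.2) =ᵐ[volume.restrict (Ω ×ˢ Ioo 0 T)] fun z => v' z.1 z.2) ∧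
      ((fun z : V3 × ℝ => dv z.1 z.2) =ᵐ[volume.restrict (Ω ×ˢ Ioo 0 T)] fun z => dv' z.1 z.2) := by
  refine ⟨fun x t => h.meas_v.mk _ (x, t), fun x t => h.meas_dv.mk _ (x, t), fun x t => h.meas_p.mk _ (x, t),
    fun x t => h.meas_f.mk _ (x, t), ⟨?_, h.meas_v.measurable_mk, h.meas_dv.measurable_mk, h.meas_p.measurable_mk,
    h.meas_f.measurable_mk⟩, h.meas_v.ae_eq_mk, h.meas_dv.ae_eq_mk⟩
  exact suitable_congr h h.meas_v.ae_eq_mk h.meas_dv.ae_eq_mk h.meas_p.ae_eq_mk h.meas_f.ae_eq_mk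

section
variable {Ω : Set V3} {T : ℝ} {v : VV} {dv : DV} {p : VR} {f : VV}

lemma MS.vol (h : MS Ω T v dv p f) : volume Ω < ∞ := h.sol.bounded_dom.measure_lt_top

lemma MS.volT (h : MS Ω T v dv p f) : volume (Ω ×ˢ Ioo (0:ℝ) T) < ∞ := by
  rw [volume_eq_prod, Measure.prod_prod]
  exact mul_lt_top h.vol (by simp)

lemma MS.vK (h : MS Ω T v dv p f) : ∃ K : ℝ≥0, ∀ᵐ t ∂(volume.restrict (Ioo 0 T)), ∫⁻ x in Ω, ‖v x t‖ₑ ^ 2 ≤ K := by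
  obtain ⟨K, hK⟩ := h.sol.v_linf_l2
  refine ⟨K.toNNReal, ?_⟩
  filter_upwards [hK] with t ht
  have := ofReal_integral_eq_lintegral_ofReal ht.1 (ae_of_all _ fun x => by positivity)
  calc ∫⁻ x in Ω, ‖v x t‖ₑ ^ 2 = ∫⁻ x in Ω, ofReal (‖v x t‖ ^ 2) := by
        refine lintegral_congr fun x => ?_
        rw [ofReal_pow (norm_nonneg _), ofReal_norm]
    _ = ofReal (∫ x in Ω, ‖v x t‖ ^ 2) := this.symm
    _ ≤ _ := ofReal_le_ofReal ht.2

lemma MS.dE (h : MS Ω T v dv p f) : ∫⁻ t in Ioo 0 T, ∫⁻ x in Ω, ofReal (fnormSq (dv x t)) < ∞ := by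
  have hm : Measurable (fun z : V3 × ℝ => ofReal (fnormSq (dv z.1 z.2))) := (meas_fnormSq.comp h.mdv).ennreal_ofReal
  have := lint_slice (Ω := Ω) (I := Ioo 0 T) hm
  simp only at this
  rw [← this]
  exact h.sol.dv_l2.lintegral_lt_top

lemma MS.dE2 (h : MS Ω T v dv p f) : ∫⁻ t in Ioo 0 T, ∫⁻ x in Ω, ‖dv x t‖ₑ ^ 2 < ∞ :=
  lt_of_le_of_lt (lintegral_mono fun _ => lintegral_mono fun _ => enorm_le_fnormSq _) h.dE

lemma MS.pP (h : MS Ω T v dv p f) : ∫⁻ t in Ioo 0 T, ∫⁻ x in Ω, ‖p x t‖ₑ ^ ((3:ℝ)/2) < ∞ := by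
  have hm : Measurable (fun z : V3 × ℝ => ‖p z.1 z.2‖ₑ ^ ((3:ℝ)/2)) := h.mp.enorm.pow_const _
  have := lint_slice (Ω := Ω) (I := Ioo 0 T) hm
  simp only at this
  rw [← this]
  refine lt_of_eq_of_lt ?_ h.sol.p_l32.lintegral_lt_top
  refine lintegral_congr fun z => ?_
  rw [← ofReal_norm, ofReal_rpow_of_nonneg (norm_nonneg _) (by norm_num), norm_eq_abs]

lemma MS.fF (h : MS Ω T v dv p f) : ∃ m : ℝ, 5/2 < m ∧ ∫⁻ t in Ioo 0 T, ∫⁻ x in Ω, ‖f x t‖ₑ ^ m < ∞ := by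
  obtain ⟨m, hm1, hi⟩ := h.sol.f_lm
  refine ⟨m, hm1, ?_⟩
  have hm : Measurable (fun z : V3 × ℝ => ‖f z.1 z.2‖ₑ ^ m) := h.mf.enorm.pow_const _
  have := lint_slice (Ω := Ω) (I := Ioo 0 T) hm
  simp only at this
  rw [← this]
  refine lt_of_eq_of_lt ?_ hi.lintegral_lt_top
  refine lintegral_congr fun z => ?_
  rw [← ofReal_norm, ofReal_rpow_of_nonneg (norm_nonneg _) (by linarith)]

lemma pow_le_one_add {x : ℝ≥0∞} {a m : ℝ} (h0 : 0 ≤ a) (h : a ≤ m) : x ^ a ≤ 1 + x ^ m := by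
  rcases le_total x 1 with hx | hx
  · exact (ENNReal.rpow_le_one hx h0).trans le_self_add
  · exact (ENNReal.rpow_le_rpow_of_exponent_le hx h).trans le_add_self

lemma lint_low {α : Type*} [MeasurableSpace α] {μ : Measure α} (hμ : μ univ < ∞) {F : α → ℝ≥0∞} {a m : ℝ} (h0 : 0 ≤ a) (h : a ≤ m)
    (hi : ∫⁻ x, F x ^ m ∂μ < ∞) : ∫⁻ x, F x ^ a ∂μ < ∞ := by
  refine lt_of_le_of_lt (lintegral_mono fun x => pow_le_one_add h0 h) ?_
  rw [lintegral_add_left measurable_const, lintegral_one]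
  exact add_lt_top.2 ⟨hμ, hi⟩

lemma MS.slices (h : MS Ω T v dv p f) : ∀ᵐ t ∂(volume.restrict (Ioo 0 T)),
    (∫⁻ x in Ω, ‖v x t‖ₑ ^ 2 < ∞) ∧ (∫⁻ x in Ω, ‖dv x t‖ₑ ^ 2 < ∞) ∧ (∫⁻ x in Ω, ‖p x t‖ₑ < ∞) ∧
    (∫⁻ x in Ω, ‖f x t‖ₑ ^ 2 < ∞) := by
  obtain ⟨K, hK⟩ := h.vK
  obtain ⟨m, hm, hf⟩ := h.fF
  have hmv : Measurable (fun z : V3 × ℝ => ‖dv z.1 z.2‖ₑ ^ 2) := h.mdv.enorm.pow_const _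
  have hmp : Measurable (fun z : V3 × ℝ => ‖p z.1 z.2‖ₑ ^ ((3:ℝ)/2)) := h.mp.enorm.pow_const _
  have hmf : Measurable (fun z : V3 × ℝ => ‖f z.1 z.2‖ₑ ^ m) := h.mf.enorm.pow_const _
  have hΩ : (volume.restrict Ω) univ < ∞ := by rw [restrict_apply_univ]; exact h.vol
  have a1 : Measurable fun t => ∫⁻ x in Ω, ‖dv x t‖ₑ ^ 2 := hmv.lintegral_prod_left'
  have a2 : Measurable fun t => ∫⁻ x in Ω, ‖p x t‖ₑ ^ ((3:ℝ)/2) := hmp.lintegral_prod_left'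
  have a3 : Measurable fun t => ∫⁻ x in Ω, ‖f x t‖ₑ ^ m := hmf.lintegral_prod_left'
  filter_upwards [hK, ae_lt_top a1 h.dE2.ne, ae_lt_top a2 h.pP.ne, ae_lt_top a3 hf.ne] with t h1 h2 h3 h4
  refine ⟨h1.trans_lt coe_lt_top, h2, ?_, ?_⟩
  · have := lint_low hΩ (a := 1) (by norm_num) (by norm_num) h3
    simpa using this
  · have := lint_low hΩ (a := 2) (by norm_num) (by linarith) h4
    simpa using this

lemma integrableOn_of_lint {F : V3 × ℝ → ℝ} (hF : Measurable F) {I : Set ℝ} (hi : ∫⁻ t in I, ∫⁻ x in Ω, ‖F (x, t)‖ₑ < ∞) :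
    IntegrableOn F (Ω ×ˢ I) volume := by
  refine ⟨hF.aestronglyMeasurable, ?_⟩
  rw [HasFiniteIntegral, lint_slice hF.enorm]
  exact hi

lemma MS.v2 (h : MS Ω T v dv p f) : ∫⁻ t in Ioo 0 T, ∫⁻ x in Ω, ‖v x t‖ₑ ^ 2 < ∞ := by
  obtain ⟨K, hK⟩ := h.vK
  refine lt_of_le_of_lt (lintegral_mono_ae hK) ?_
  rw [lintegral_const]
  exact mul_lt_top coe_lt_top (by simp)

lemma MS.ip (h : MS Ω T v dv p f) : ∫⁻ t in Ioo 0 T, ∫⁻ x in Ω, ‖p x t‖ₑ < ∞ := by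
  have hm : Measurable (fun z : V3 × ℝ => ‖p z.1 z.2‖ₑ ^ ((3:ℝ)/2)) := h.mp.enorm.pow_const _
  have h1 := lint_slice (Ω := Ω) (I := Ioo 0 T) hm
  have h2 := lint_slice (Ω := Ω) (I := Ioo 0 T) (F := fun z => ‖p z.1 z.2‖ₑ) h.mp.enorm
  simp only at h1 h2
  rw [← h2]
  have := lint_low (μ := (volume : Measure (V3 × ℝ)).restrict (Ω ×ˢ Ioo 0 T)) (F := fun z => ‖p z.1 z.2‖ₑ) (a := 1) (m := 3/2)
    (by rw [restrict_apply_univ]; exact h.volT) (by norm_num) (by norm_num) (by rw [h1]; exact h.pP)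
  simpa using this

lemma MS.f2 (h : MS Ω T v dv p f) : ∫⁻ t in Ioo 0 T, ∫⁻ x in Ω, ‖f x t‖ₑ ^ 2 < ∞ := by
  obtain ⟨m, hm1, hf⟩ := h.fF
  have hm : Measurable (fun z : V3 × ℝ => ‖f z.1 z.2‖ₑ ^ m) := h.mf.enorm.pow_const _
  have h1 := lint_slice (Ω := Ω) (I := Ioo 0 T) hm
  have h2 := lint_slice (Ω := Ω) (I := Ioo 0 T) (F := fun z => ‖f z.1 z.2‖ₑ ^ 2) (h.mf.enorm.pow_const _)
  simp only at h1 h2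
  rw [← h2]
  have := lint_low (μ := (volume : Measure (V3 × ℝ)).restrict (Ω ×ˢ Ioo 0 T)) (F := fun z => ‖f z.1 z.2‖ₑ) (a := 2) (m := m)
    (by rw [restrict_apply_univ]; exact h.volT) (by norm_num) (by linarith) (by rw [h1]; exact hf)
  simpa using this

lemma MS.iF (h : MS Ω T v dv p f) : ∫⁻ t in Ioo 0 T, ∫⁻ x in Ω, ‖dv x t (v x t) - f x t‖ₑ < ∞ := by
  have ha := h.mv; have hb := h.mdv; have hc := h.mf
  calc ∫⁻ t in Ioo 0 T, ∫⁻ x in Ω, ‖dv x t (v x t) - f x t‖ₑ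
      ≤ ∫⁻ t in Ioo 0 T, ∫⁻ x in Ω, (‖dv x t‖ₑ ^ 2 + (‖v x t‖ₑ ^ 2 + (1 + ‖f x t‖ₑ ^ 2))) := by
        refine lintegral_mono fun t => lintegral_mono fun x => ?_
        refine enorm_sub_le.trans ?_
        rw [← add_assoc]
        refine add_le_add ((ContinuousLinearMap.le_opENorm _ _).trans ?_) ?_
        · rcases le_total ‖dv x t‖ₑ ‖v x t‖ₑ with hh | hh
          · exact (mul_le_mul_left hh _).trans (by rw [sq, sq]; exact le_add_self)
          · exact (mul_le_mul_right hh _).trans (by rw [sq, sq]; exact le_self_add)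
        · have := pow_le_one_add (x := ‖f x t‖ₑ) (a := 1) (m := 2) (by norm_num) (by norm_num)
          simpa using this
    _ = (∫⁻ t in Ioo 0 T, ∫⁻ x in Ω, ‖dv x t‖ₑ ^ 2) + ((∫⁻ t in Ioo 0 T, ∫⁻ x in Ω, ‖v x t‖ₑ ^ 2) +
          ((∫⁻ t in Ioo 0 T, ∫⁻ x in Ω, 1) + (∫⁻ t in Ioo 0 T, ∫⁻ x in Ω, ‖f x t‖ₑ ^ 2))) := by
        have m1 : Measurable (fun z : V3 × ℝ => ‖dv z.1 z.2‖ₑ ^ 2) := hb.enorm.pow_const _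
        have m2 : Measurable (fun z : V3 × ℝ => ‖v z.1 z.2‖ₑ ^ 2) := ha.enorm.pow_const _
        have m3 : Measurable (fun z : V3 × ℝ => ‖f z.1 z.2‖ₑ ^ 2) := hc.enorm.pow_const _
        have m13 : Measurable (fun z : V3 × ℝ => 1 + ‖f z.1 z.2‖ₑ ^ 2) := measurable_const.add m3
        have m23 : Measurable (fun z : V3 × ℝ => ‖v z.1 z.2‖ₑ ^ 2 + (1 + ‖f z.1 z.2‖ₑ ^ 2)) := m2.add m13
        have m4 : Measurable (fun z : V3 × ℝ => ‖dv z.1 z.2‖ₑ ^ 2 + (‖v z.1 z.2‖ₑ ^ 2 + (1 + ‖f z.1 z.2‖ₑ ^ 2))) := m1.add m23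
        have e1 := lint_slice (Ω := Ω) (I := Ioo 0 T) m1
        have e2 := lint_slice (Ω := Ω) (I := Ioo 0 T) m2
        have e3 := lint_slice (Ω := Ω) (I := Ioo 0 T) m3
        have e4 := lint_slice (Ω := Ω) (I := Ioo 0 T) m4
        have e5 := lint_slice (Ω := Ω) (I := Ioo 0 T) (F := fun _ => 1) measurable_const
        simp only at e1 e2 e3 e4 e5
        rw [← e1, ← e2, ← e3, ← e4, ← e5, lintegral_add_left m1, lintegral_add_left m2, lintegral_add_left measurable_const]
    _ < ∞ := by
        have h1 := h.dE2; have h2 := h.v2; have h3 := h.f2; have h4 := h.vol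
        have h5 : ∫⁻ t in Ioo 0 T, ∫⁻ x in Ω, (1:ℝ≥0∞) < ∞ := by
          simp only [lintegral_const, restrict_apply_univ, one_mul]
          exact mul_lt_top h4 (by simp)
        exact add_lt_top.2 ⟨h1, add_lt_top.2 ⟨h2, add_lt_top.2 ⟨h5, h3⟩⟩⟩

end
end

section

def gradv (η : V3 → ℝ) (x : V3) : V3 := ∑ j, fderiv ℝ η x (e3 j) • e3 j

lemma e3_apply (i j : Fin 3) : e3 i j = if j = i then 1 else 0 := by
  unfold e3; simp

lemma gradv_apply (η : V3 → ℝ) (x : V3) (j : Fin 3) : gradv η x j = fderiv ℝ η x (e3 j) := by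
  unfold gradv
  simp [e3_apply]

lemma dot3_gradv (η : V3 → ℝ) (x a : V3) : dot3 a (gradv η x) = fderiv ℝ η x a := by
  rw [fderiv_sum_coord]
  unfold dot3
  refine sum_congr rfl fun j _ => ?_
  rw [gradv_apply, mul_comm]

lemma dot3_smul (c : ℝ) (a b : V3) : dot3 a (c • b) = c * dot3 a b := by
  unfold dot3
  rw [mul_sum]
  refine sum_congr rfl fun j _ => ?_
  simp; ring

lemma gradv_smooth {η : V3 → ℝ} (h : Smooth η) : Smooth (gradv η) := by
  unfold gradv
  refine ContDiff.sum fun j _ => ?_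
  have h1 : Smooth (fun x => fderiv ℝ η x (e3 j)) := (h.fderiv_right (m := (⊤ : ℕ∞)) (by simp)).clm_apply contDiff_const
  exact h1.smul contDiff_const

lemma fderiv_gradv_apply {η : V3 → ℝ} (h : Smooth η) (x y : V3) (j : Fin 3) :
    (fderiv ℝ (gradv η) x y) j = fderiv ℝ (fun y => fderiv ℝ η y (e3 j)) x y := by
  have h1 : HasFDerivAt (gradv η) (fderiv ℝ (gradv η) x) x := ((gradv_smooth h).differentiable (by simp) x).hasFDerivAt
  have h2 := ((EuclideanSpace.proj j : V3 →L[ℝ] ℝ).hasFDerivAt (x := gradv η x)).comp x h1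
  have e : ((EuclideanSpace.proj j : V3 →L[ℝ] ℝ) ∘ gradv η) = fun y => fderiv ℝ η y (e3 j) := by
    funext y; simp [gradv_apply]
  rw [e] at h2
  rw [h2.fderiv]
  simp

lemma tsupport_gradv (η : V3 → ℝ) : tsupport (gradv η) ⊆ tsupport η := by
  refine closure_minimal ?_ (isClosed_tsupport η)
  intro x hx
  by_contra h
  apply hx
  have h1 : η =ᶠ[𝓝 x] fun _ => 0 := by
    filter_upwards [(isClosed_tsupport η).isOpen_compl.mem_nhds h] with y hy
    exact image_eq_zero_of_notMem_tsupport hy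
  unfold gradv
  rw [h1.fderiv_eq]; simp

lemma lap3_cont {η : V3 → ℝ} (h : Smooth η) : Continuous (lap3 η) := by
  unfold lap3
  refine continuous_finsetSum _ fun i _ => ?_
  have h1 : Smooth (fun y => fderiv ℝ η y (e3 i)) := (h.fderiv_right (m := (⊤ : ℕ∞)) (by simp)).clm_apply contDiff_const
  have h2 : Smooth (fun x => fderiv ℝ (fun y => fderiv ℝ η y (e3 i)) x (e3 i)) :=
    (h1.fderiv_right (m := (⊤ : ℕ∞)) (by simp)).clm_apply contDiff_const
  exact h2.continuous

lemma lap3_bdd {U : Set V3} {η : V3 → ℝ} (h : IsSpaceTest U η) : ∃ K, ∀ x, ‖lap3 η x‖ ≤ K := by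
  choose K hK using fun i : Fin 3 => ((h.deriv_dir (e3 i)).deriv_dir (e3 i)).bdd
  refine ⟨∑ i, K i, fun x => ?_⟩
  unfold lap3
  exact (norm_sum_le _ _).trans (sum_le_sum fun i _ => hK i x)

lemma test_vec {Ω : Set V3} {I : Set ℝ} {η : V3 → ℝ} (hη : IsSpaceTest Ω η) {θ : ℝ → ℝ} (hθ : Smooth θ)
    (hc : HasCompactSupport θ) (hs : tsupport θ ⊆ I) : IsVectorTest Ω I (fun x t => θ t • gradv η x) := by
  have hsub : tsupport (fun z : V3 × ℝ => θ z.2 • gradv η z.1) ⊆ tsupport η ×ˢ tsupport θ := by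
    refine closure_minimal ?_ ((isClosed_tsupport η).prod (isClosed_tsupport θ))
    rintro ⟨x, t⟩ hz
    rw [Function.mem_support] at hz
    simp only at hz
    refine ⟨?_, ?_⟩
    · exact tsupport_gradv η (subset_tsupport _ fun h0 => hz (by rw [h0, smul_zero]))
    · exact subset_tsupport _ fun h0 => hz (by rw [h0, zero_smul])
  refine ⟨?_, ?_, hsub.trans (prod_mono hη.2.2 hs)⟩
  · exact (hθ.comp contDiff_snd).smul ((gradv_smooth hη.1).comp contDiff_fst)
  · exact HasCompactSupport.of_support_subset_isCompact (hη.2.1.isCompact.prod hc.isCompact) ((subset_tsupport _).trans hsub)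

lemma slice_id {U : Set V3} {u : V3 → V3} {du : V3 → V3 →L[ℝ] V3} {q : V3 → ℝ} {g : V3 → V3}
    (hu : IntegrableOn u U) (hdu : IntegrableOn du U) (hq : IntegrableOn q U) (hF : IntegrableOn (fun x => du x (u x) - g x) U)
    (wg : ∀ φ : V3 → ℝ, IsSpaceTest U φ → ∀ e : V3, (∫ x in U, φ x • du x e) = - ∫ x in U, fderiv ℝ φ x e • u x)
    (df : ∀ φ : V3 → ℝ, IsSpaceTest U φ → (∫ x in U, fderiv ℝ φ x (u x)) = 0)
    {η : V3 → ℝ} (hη : IsSpaceTest U η) (a b : ℝ) :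
    (∫ x in U, (dot3 (u x) (a • gradv η x) - fdot (du x) (b • fderiv ℝ (gradv η) x) - dot3 (du x (u x)) (b • gradv η x)
      + q x * (∑ i, (b • fderiv ℝ (gradv η) x) (e3 i) i) + dot3 (g x) (b • gradv η x))) =
    b * ((∫ x in U, q x * lap3 η x) - ∫ x in U, fderiv ℝ η x (du x (u x) - g x)) := by
  have e : ∀ x, (dot3 (u x) (a • gradv η x) - fdot (du x) (b • fderiv ℝ (gradv η) x) - dot3 (du x (u x)) (b • gradv η x)
      + q x * (∑ i, (b • fderiv ℝ (gradv η) x) (e3 i) i) + dot3 (g x) (b • gradv η x)) =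
      a * fderiv ℝ η x (u x) - b * (∑ i, fderiv ℝ (fun y => fderiv ℝ η y (e3 i)) x (du x (e3 i)))
        + b * (q x * lap3 η x) - b * fderiv ℝ η x (du x (u x) - g x) := by
    intro x
    have e1 : fdot (du x) (b • fderiv ℝ (gradv η) x) = b * (∑ i, fderiv ℝ (fun y => fderiv ℝ η y (e3 i)) x (du x (e3 i))) := by
      unfold fdot
      rw [mul_sum]
      refine sum_congr rfl fun i _ => ?_
      rw [smul_apply, dot3_smul, fderiv_sum_coord]
      congr 1
      unfold dot3
      refine sum_congr rfl fun j _ => ?_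
      rw [fderiv_gradv_apply hη.1, fderiv_swap hη.1, mul_comm]
    have e2 : (∑ i, (b • fderiv ℝ (gradv η) x) (e3 i) i) = b * lap3 η x := by
      unfold lap3
      rw [mul_sum]
      refine sum_congr rfl fun i _ => ?_
      rw [smul_apply, PiLp.smul_apply, fderiv_gradv_apply hη.1, smul_eq_mul]
    rw [e1, e2, dot3_smul, dot3_smul, dot3_smul, dot3_gradv, dot3_gradv, dot3_gradv, map_sub]
    ring
  simp_rw [e]
  have i1 : IntegrableOn (fun x => a * fderiv ℝ η x (u x)) U := (test_int hη hu).const_mul a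
  have hda : ∀ c, IntegrableOn (fun x => du x c) U := fun c => by
    have := (ContinuousLinearMap.apply ℝ V3 c).integrable_comp hdu
    simp only [ContinuousLinearMap.apply_apply] at this
    exact this
  have i2' : ∀ i : Fin 3, IntegrableOn (fun x => fderiv ℝ (fun y => fderiv ℝ η y (e3 i)) x (du x (e3 i))) U := fun i =>
    test_int (hη.deriv_dir (e3 i)) (hda _)
  have i2 : IntegrableOn (fun x => b * (∑ i, fderiv ℝ (fun y => fderiv ℝ η y (e3 i)) x (du x (e3 i)))) U :=
    (integrable_finsetSum _ fun i _ => i2' i).const_mul b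
  have i3 : IntegrableOn (fun x => b * (q x * lap3 η x)) U := by
    obtain ⟨K, hK⟩ := lap3_bdd hη
    have := hq.bdd_mul (lap3_cont hη.1).aestronglyMeasurable (of_forall hK)
    refine Integrable.const_mul (this.congr (of_forall fun x => mul_comm _ _)) b
  have i4 : IntegrableOn (fun x => b * fderiv ℝ η x (du x (u x) - g x)) U := (test_int hη hF).const_mul b
  have i12 : IntegrableOn (fun x => a * fderiv ℝ η x (u x) - b * (∑ i, fderiv ℝ (fun y => fderiv ℝ η y (e3 i)) x (du x (e3 i)))) U := i1.sub i2
  have i123 : IntegrableOn (fun x => a * fderiv ℝ η x (u x) - b * (∑ i, fderiv ℝ (fun y => fderiv ℝ η y (e3 i)) x (du x (e3 i))) + b * (q x * lap3 η x)) U := i12.add i3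
  rw [integral_sub i123 i4, integral_add i12 i3, integral_sub i1 i2, integral_const_mul, integral_const_mul, integral_const_mul,
    integral_const_mul, df η hη, integral_finsetSum _ (fun i _ => i2' i)]
  rw [Finset.sum_eq_zero fun i _ => du_const_set hu hdu wg df (e3 i) _ (hη.deriv_dir (e3 i))]
  ring

end

section

lemma meas_slice {F : Type*} [MeasurableSpace F] {w : V3 → ℝ → F} (h : Measurable fun z : V3 × ℝ => w z.1 z.2) (t : ℝ) :
    Measurable fun x => w x t := h.comp (measurable_id.prodMk measurable_const)

lemma int_of_sq {E : Type*} [NormedAddCommGroup E] {U : Set V3} (hU : volume U < ∞) {u : V3 → E}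
    (hm : AEStronglyMeasurable u (volume.restrict U))
    (h : ∫⁻ x in U, ‖u x‖ₑ ^ 2 < ∞) : IntegrableOn u U := by
  refine ⟨hm, ?_⟩
  have := lint_low (μ := volume.restrict U) (F := fun x => ‖u x‖ₑ) (a := 1) (m := 2)
    (by rw [restrict_apply_univ]; exact hU) (by norm_num) (by norm_num) (by simpa using h)
  rw [HasFiniteIntegral]
  simpa using this

section
variable {Ω : Set V3} {T : ℝ} {v : VV} {dv : DV} {p : VR} {f : VV}

lemma MS.mF (h : MS Ω T v dv p f) : Measurable fun z : V3 × ℝ => dv z.1 z.2 (v z.1 z.2) - f z.1 z.2 := by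
  have hc : Continuous (fun p : (V3 →L[ℝ] V3) × V3 => p.1 p.2) := by fun_prop
  exact (hc.measurable.comp (h.mdv.prodMk h.mv)).sub h.mf

lemma MS.slices2 (h : MS Ω T v dv p f) : ∀ᵐ t ∂(volume.restrict (Ioo 0 T)),
    IntegrableOn (fun x => v x t) Ω ∧ IntegrableOn (fun x => dv x t) Ω ∧ IntegrableOn (fun x => p x t) Ω ∧
    IntegrableOn (fun x => dv x t (v x t) - f x t) Ω := by
  have hm : Measurable (fun z : V3 × ℝ => ‖dv z.1 z.2 (v z.1 z.2) - f z.1 z.2‖ₑ) := h.mF.enorm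
  have a1 : Measurable fun t => ∫⁻ x in Ω, ‖dv x t (v x t) - f x t‖ₑ := hm.lintegral_prod_left'
  filter_upwards [h.slices, ae_lt_top a1 h.iF.ne] with t ht h2
  exact ⟨int_of_sq h.vol (meas_slice h.mv t).aestronglyMeasurable ht.1,
    int_of_sq h.vol (meas_slice h.mdv t).aestronglyMeasurable ht.2.1,
    ⟨(meas_slice h.mp t).aestronglyMeasurable, ht.2.2.1⟩, ⟨(meas_slice (w := fun x t => dv x t (v x t) - f x t) h.mF t).aestronglyMeasurable, h2⟩⟩

lemma MS.pe_single (h : MS Ω T v dv p f) {η : V3 → ℝ} (hη : IsSpaceTest Ω η) : ∀ᵐ t ∂(volume.restrict (Ioo 0 T)),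
    (∫ x in Ω, p x t * lap3 η x) = ∫ x in Ω, fderiv ℝ η x (dv x t (v x t) - f x t) := by
  set H : ℝ → ℝ := fun t => (∫ x in Ω, p x t * lap3 η x) - ∫ x in Ω, fderiv ℝ η x (dv x t (v x t) - f x t) with hH
  have hc : Continuous (fun p : (V3 →L[ℝ] ℝ) × V3 => p.1 p.2) := by fun_prop
  have hdη : Measurable (fun x => fderiv ℝ η x) := (hη.1.continuous_fderiv (by simp)).measurable
  have h1 : IntegrableOn (fun t => ∫ x in Ω, p x t * lap3 η x) (Ioo 0 T) := by
    refine int_slice (F := fun z => p z.1 z.2 * lap3 η z.1) (integrableOn_of_lint (h.mp.mul ((lap3_cont hη.1).measurable.comp measurable_fst)) ?_)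
    obtain ⟨K, hK⟩ := lap3_bdd hη
    calc ∫⁻ t in Ioo 0 T, ∫⁻ x in Ω, ‖p x t * lap3 η x‖ₑ ≤ ∫⁻ t in Ioo 0 T, ∫⁻ x in Ω, ‖p x t‖ₑ * ofReal K := by
          refine lintegral_mono fun t => lintegral_mono fun x => ?_
          simp only [enorm_mul]
          refine mul_le_mul_right ?_ _
          rw [← ofReal_norm]; exact ofReal_le_ofReal (hK x)
      _ = (∫⁻ t in Ioo 0 T, ∫⁻ x in Ω, ‖p x t‖ₑ) * ofReal K := by
          rw [← lintegral_mul_const' _ _ ofReal_ne_top]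
          refine lintegral_congr fun t => ?_
          rw [lintegral_mul_const' _ _ ofReal_ne_top]
      _ < ∞ := mul_lt_top h.ip ofReal_lt_top
  have h2 : IntegrableOn (fun t => ∫ x in Ω, fderiv ℝ η x (dv x t (v x t) - f x t)) (Ioo 0 T) := by
    refine int_slice (F := fun z => fderiv ℝ η z.1 (dv z.1 z.2 (v z.1 z.2) - f z.1 z.2))
      (integrableOn_of_lint (hc.measurable.comp ((hdη.comp measurable_fst).prodMk h.mF)) ?_)
    obtain ⟨K, hK⟩ : ∃ K, ∀ x, ‖fderiv ℝ η x‖ ≤ K := (hη.2.1.fderiv (𝕜 := ℝ)).exists_bound_of_continuous (hη.1.continuous_fderiv (by simp))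
    calc ∫⁻ t in Ioo 0 T, ∫⁻ x in Ω, ‖fderiv ℝ η x (dv x t (v x t) - f x t)‖ₑ
        ≤ ∫⁻ t in Ioo 0 T, ∫⁻ x in Ω, ofReal K * ‖dv x t (v x t) - f x t‖ₑ := by
          refine lintegral_mono fun t => lintegral_mono fun x => ?_
          refine (ContinuousLinearMap.le_opENorm _ _).trans (mul_le_mul_left ?_ _)
          rw [← ofReal_norm]; exact ofReal_le_ofReal (hK x)
      _ = ofReal K * (∫⁻ t in Ioo 0 T, ∫⁻ x in Ω, ‖dv x t (v x t) - f x t‖ₑ) := by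
          rw [← lintegral_const_mul' _ _ ofReal_ne_top]
          refine lintegral_congr fun t => ?_
          rw [lintegral_const_mul' _ _ ofReal_ne_top]
      _ < ∞ := mul_lt_top ofReal_lt_top h.iF
  have hint : IntegrableOn H (Ioo 0 T) := h1.sub h2
  have key := IsOpen.ae_eq_zero_of_integral_contDiff_smul_eq_zero (isOpen_Ioo (a := (0:ℝ)) (b := T)) (f := H) (μ := volume)
    hint.locallyIntegrableOn ?_
  · rw [ae_restrict_iff' measurableSet_Ioo]
    filter_upwards [key] with t ht htI
    exact sub_eq_zero.1 (ht htI)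
  intro θ hθ hθc hθs
  have hn := h.sol.nse _ (test_vec hη hθ hθc hθs)
  have e : ∫ t, θ t • H t = ∫ t in Ioo 0 T, θ t • H t := by
    symm
    refine setIntegral_eq_integral_of_forall_compl_eq_zero fun t ht => ?_
    rw [image_eq_zero_of_notMem_tsupport (fun hh => ht (hθs hh)), zero_smul]
  rw [e]
  refine Eq.trans ?_ hn
  refine integral_congr_ae ?_
  filter_upwards [h.slices2, h.sol.weak_gradient, h.sol.div_free] with t ht hw hd
  have := slice_id ht.1 ht.2.1 ht.2.2.1 ht.2.2.2 hw hd hη (deriv θ t) (θ t)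
  rw [smul_eq_mul, ← this]
  refine integral_congr_ae (ae_of_all _ fun x => ?_)
  have d1 : deriv (fun s => θ s • gradv η x) t = deriv θ t • gradv η x :=
    deriv_smul_const (hθ.differentiable (by simp) t) _
  have d2 : fderiv ℝ (fun y => θ t • gradv η y) x = θ t • fderiv ℝ (gradv η) x :=
    fderiv_fun_const_smul ((gradv_smooth hη.1).differentiable (by simp) x) _
  simp only [d1, d2]

lemma MS.pe_all (h : MS Ω T v dv p f) : ∀ᵐ t ∂(volume.restrict (Ioo 0 T)), ∀ η, IsSpaceTest Ω η →
    (∫ x in Ω, p x t * lap3 η x) = ∫ x in Ω, fderiv ℝ η x (dv x t (v x t) - f x t) := by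
  have hK : IsCompact (closure Ω) := h.sol.bounded_dom.isCompact_closure
  have : CompactSpace (closure Ω) := isCompact_iff_compactSpace.1 hK
  let X := {η : V3 → ℝ // IsSpaceTest Ω η}
  let J : X → C(closure Ω, ℝ × (V3 →L[ℝ] ℝ)) := fun η => ⟨fun x => (lap3 η.1 x.1, fderiv ℝ η.1 x.1),
    ((lap3_cont η.2.1).prodMk (η.2.1.continuous_fderiv (by simp))).comp continuous_subtype_val⟩
  let S := range J
  obtain ⟨D, hDc, hDd⟩ := TopologicalSpace.exists_countable_dense S
  choose e he using fun s : S => s.2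
  have := hDc.to_subtype
  have hall : ∀ᵐ t ∂(volume.restrict (Ioo 0 T)), ∀ d : D,
      (∫ x in Ω, p x t * lap3 (e d.1).1 x) = ∫ x in Ω, fderiv ℝ (e d.1).1 x (dv x t (v x t) - f x t) :=
    ae_all_iff.2 fun d => h.pe_single (e d.1).2
  filter_upwards [hall, h.slices2] with t ht h2 η hη
  obtain ⟨-, -, hp, hF⟩ := h2
  set F : V3 → V3 := fun x => dv x t (v x t) - f x t with hFd
  set L : (V3 → ℝ) → ℝ := fun η => (∫ x in Ω, p x t * lap3 η x) - ∫ x in Ω, fderiv ℝ η x (F x) with hL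
  suffices hh : L η = 0 from sub_eq_zero.1 hh
  have ip : ∀ η, IsSpaceTest Ω η → IntegrableOn (fun x => p x t * lap3 η x) Ω := fun η hη => by
    obtain ⟨K, hK⟩ := lap3_bdd hη
    have := hp.bdd_mul (lap3_cont hη.1).aestronglyMeasurable (of_forall hK)
    exact this.congr (of_forall fun x => mul_comm _ _)
  have iF : ∀ η, IsSpaceTest Ω η → IntegrableOn (fun x => fderiv ℝ η x (F x)) Ω := fun η hη => test_int hη hF
  set Q : ℝ := (∫ x in Ω, ‖p x t‖) + ∫ x in Ω, ‖F x‖ with hQ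
  have hQ0 : 0 ≤ Q := by positivity
  have hdist : ∀ d : X, ‖L η - L d.1‖ ≤ dist (J ⟨η, hη⟩) (J d) * Q := by
    intro d
    have e1 : L η - L d.1 = (∫ x in Ω, (p x t * lap3 η x - p x t * lap3 d.1 x)) -
        ∫ x in Ω, (fderiv ℝ η x (F x) - fderiv ℝ d.1 x (F x)) := by
      rw [integral_sub (ip _ hη) (ip _ d.2), integral_sub (iF _ hη) (iF _ d.2)]
      simp only [hL]; ring
    have hpt : ∀ x ∈ Ω, |lap3 η x - lap3 d.1 x| ≤ dist (J ⟨η, hη⟩) (J d) ∧ ‖fderiv ℝ η x - fderiv ℝ d.1 x‖ ≤ dist (J ⟨η, hη⟩) (J d) := by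
      intro x hx
      have := ContinuousMap.dist_apply_le_dist (f := J ⟨η, hη⟩) (g := J d) ⟨x, subset_closure hx⟩
      have h3 : dist ((J ⟨η, hη⟩) ⟨x, subset_closure hx⟩) ((J d) ⟨x, subset_closure hx⟩) =
        max (dist (lap3 η x) (lap3 d.1 x)) (dist (fderiv ℝ η x) (fderiv ℝ d.1 x)) := Prod.dist_eq
      rw [h3] at this
      exact ⟨(le_max_left _ _).trans this, by rw [← dist_eq_norm]; exact (le_max_right _ _).trans this⟩
    rw [e1, hQ, mul_add, ← integral_const_mul, ← integral_const_mul]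
    refine (norm_sub_le _ _).trans (add_le_add ?_ ?_)
    · refine norm_integral_le_of_norm_le (hp.norm.const_mul _) ?_
      filter_upwards [ae_restrict_mem h.sol.open_dom.measurableSet] with x hx
      rw [← mul_sub, norm_mul, mul_comm]
      exact mul_le_mul_of_nonneg_right (hpt x hx).1 (norm_nonneg _)
    · refine norm_integral_le_of_norm_le (hF.norm.const_mul _) ?_
      filter_upwards [ae_restrict_mem h.sol.open_dom.measurableSet] with x hx
      rw [← sub_apply]
      exact (ContinuousLinearMap.le_opNorm _ _).trans (mul_le_mul_of_nonneg_right (hpt x hx).2 (norm_nonneg _))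
  by_contra hne
  have hpos : 0 < ‖L η‖ := norm_pos_iff.2 hne
  have hcl : J ⟨η, hη⟩ ∈ closure ((fun s : S => s.1) '' D) :=
    continuous_subtype_val.range_subset_closure_image_dense hDd ⟨⟨J ⟨η, hη⟩, ⟨η, hη⟩, rfl⟩, rfl⟩
  obtain ⟨_, ⟨d, hd, rfl⟩, hdD⟩ := (Metric.mem_closure_iff (α := C(closure Ω, ℝ × (V3 →L[ℝ] ℝ)))).1 hcl (‖L η‖ / (Q + 1)) (by positivity)
  have h0 : L (e d).1 = 0 := sub_eq_zero.2 (ht ⟨d, hd⟩)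
  have h1 := hdist (e d)
  rw [h0, sub_zero, he d] at h1
  have h4 : dist (J ⟨η, hη⟩) d.1 < ‖L η‖ / (Q + 1) := hdD
  rw [lt_div_iff₀ (by positivity)] at h4
  nlinarith [dist_nonneg (x := J ⟨η, hη⟩) (y := d.1)]

lemma MS.gs (h : MS Ω T v dv p f) : ∀ᵐ t ∂(volume.restrict (Ioo 0 T)),
    GS Ω (fun x => v x t) (fun x => dv x t) (fun x => p x t) (fun x => f x t) := by
  filter_upwards [h.slices, h.pe_all, h.sol.weak_gradient, h.sol.div_free] with t h1 h2 h3 h4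
  exact ⟨meas_slice h.mv t, meas_slice h.mdv t, meas_slice h.mp t, meas_slice h.mf t, h1.1, h1.2.1, h1.2.2.1, h1.2.2.2, h3, h4, h2⟩

end
end

section

def mI (t0 r : ℝ) : Measure ℝ := volume.restrict (Ioo (t0 - r ^ 2) t0)
def aN {F : Type*} [NormedAddCommGroup F] (v : V3 → ℝ → F) (x0 : V3) (r t : ℝ) : ℝ≥0∞ := n2 (mB x0 r) (fun x => ‖v x t‖ₑ)
def gN (v : VV) (x0 : V3) (r t : ℝ) : ℝ≥0∞ := n4 (mB x0 r) (fun x => ‖v x t‖ₑ)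
def oN (p : VR) (x0 : V3) (r t : ℝ) : ℝ≥0∞ := O1 x0 r (fun x => p x t)

/-- scaled functionals -/
def fA (v : VV) (x0 : V3) (t0 r : ℝ) : ℝ≥0∞ := pw r (-1) * essSup (fun t => aN v x0 r t ^ 2) (mI t0 r)
def fE (dv : DV) (x0 : V3) (t0 r : ℝ) : ℝ≥0∞ := pw r (-1) * ∫⁻ t, aN dv x0 r t ^ 2 ∂(mI t0 r)
def fG (v : VV) (x0 : V3) (t0 r : ℝ) : ℝ≥0∞ := pw r (-(3/2)) * ∫⁻ t, gN v x0 r t ^ 2 ∂(mI t0 r)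
def fP (p : VR) (x0 : V3) (t0 r : ℝ) : ℝ≥0∞ := pw r (-3) * ∫⁻ t, oN p x0 r t ∂(mI t0 r)
def nq {α : Type*} [MeasurableSpace α] (μ : Measure α) (g : α → ℝ≥0∞) : ℝ≥0∞ := (∫⁻ t, g t ^ ((4:ℝ)/3) ∂μ) ^ ((3:ℝ)/4)
def fQ (p : VR) (x0 : V3) (t0 r : ℝ) : ℝ≥0∞ := pw r (-(5/2)) * nq (mI t0 r) (fun t => oN p x0 r t)
def fF (f : VV) (x0 : V3) (t0 r : ℝ) : ℝ≥0∞ := pw r (1/2) * n2 (mI t0 r) (fun t => aN f x0 r t)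

structure GI (x0 : V3) (t0 R : ℝ) (v : VV) (dv : DV) (p : VR) (f : VV) : Prop where
  mv : Measurable fun z : V3 × ℝ => v z.1 z.2
  mdv : Measurable fun z : V3 × ℝ => dv z.1 z.2
  mp : Measurable fun z : V3 × ℝ => p z.1 z.2
  mf : Measurable fun z : V3 × ℝ => f z.1 z.2
  gs : ∀ᵐ t ∂(mI t0 R), GS (ball x0 R) (fun x => v x t) (fun x => dv x t) (fun x => p x t) (fun x => f x t)

lemma mI_mono {t0 r R : ℝ} (h0 : 0 ≤ r) (h : r ≤ R) : mI t0 r ≤ mI t0 R := by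
  refine restrict_mono (Ioo_subset_Ioo_left ?_) le_rfl
  have := pow_le_pow_left₀ h0 h 2
  linarith

lemma mI_univ {t0 r : ℝ} (hr : 0 < r) : mI t0 r univ = pw r 2 := by
  unfold mI pw
  rw [restrict_apply_univ, Real.volume_Ioo]
  congr 1
  rw [rpow_two]; ring

lemma meas_aN {F : Type*} [NormedAddCommGroup F] [MeasurableSpace F] [OpensMeasurableSpace F] {v : V3 → ℝ → F} (h : Measurable fun z : V3 × ℝ => v z.1 z.2) (x0 : V3) (r : ℝ) :
    Measurable fun t => aN v x0 r t := by
  unfold aN n2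
  have h1 : Measurable (fun z : V3 × ℝ => ‖v z.1 z.2‖ₑ ^ 2) := h.enorm.pow_const 2
  exact (h1.lintegral_prod_left' (μ := mB x0 r)).pow_const _

lemma meas_gN {v : VV} (h : Measurable fun z : V3 × ℝ => v z.1 z.2) (x0 : V3) (r : ℝ) :
    Measurable fun t => gN v x0 r t := by
  unfold gN n4
  have h1 : Measurable (fun z : V3 × ℝ => ‖v z.1 z.2‖ₑ ^ 4) := h.enorm.pow_const 4
  exact (h1.lintegral_prod_left' (μ := mB x0 r)).pow_const _

lemma meas_pmean {p : VR} (h : Measurable fun z : V3 × ℝ => p z.1 z.2) (x0 : V3) (r : ℝ) :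
    Measurable fun t => pmean x0 r (fun x => p x t) := by
  unfold pmean
  have hρ : Measurable (fun y => rhoR r (y - x0)) := by
    have := (rhoR_smooth r).continuous
    exact (this.comp (continuous_id.sub continuous_const)).measurable
  have h1 : Measurable (fun z : V3 × ℝ => rhoR r (z.1 - x0) * p z.1 z.2) := (hρ.comp measurable_fst).mul h
  exact (h1.stronglyMeasurable.integral_prod_left' (μ := volume.restrict (ball x0 r))).measurable

lemma meas_oN {p : VR} (h : Measurable fun z : V3 × ℝ => p z.1 z.2) (x0 : V3) (r : ℝ) :
    Measurable fun t => oN p x0 r t := by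
  unfold oN O1
  have h1 : Measurable (fun z : V3 × ℝ => ‖p z.1 z.2 - pmean x0 r (fun x => p x z.2)‖ₑ) :=
    (h.sub ((meas_pmean h x0 r).comp measurable_snd)).enorm
  exact h1.lintegral_prod_left' (μ := volume.restrict (ball x0 r))

section
variable {x0 : V3} {t0 R r : ℝ} {v : VV} {dv : DV} {p : VR} {f : VV}

lemma GI.mono (h : GI x0 t0 R v dv p f) (h0 : 0 ≤ r) (hr : r ≤ R) : GI x0 t0 r v dv p f :=
  ⟨h.mv, h.mdv, h.mp, h.mf, by
    filter_upwards [ae_mono (mI_mono h0 hr) h.gs] with t ht using ht.ball_mono hr⟩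

lemma pw_cancel (hr : 0 < r) (e : ℝ) (x : ℝ≥0∞) : pw r e * (pw r (-e) * x) = x := by
  rw [← mul_assoc, pw_mul hr]; simp [pw_zero]

lemma ae_aN_le (v : VV) (x0 : V3) (t0 : ℝ) (hr : 0 < r) : ∀ᵐ t ∂(mI t0 r), aN v x0 r t ≤ pw r (1/2) * fA v x0 t0 r ^ ((1:ℝ)/2) := by
  have := ENNReal.ae_le_essSup (μ := mI t0 r) (fun t => aN v x0 r t ^ 2)
  filter_upwards [this] with t ht
  apply le_of_sq_le
  rw [mul_pow, rpow_half_sq, fA, ← rpow_natCast (pw r (1/2)), pw_rpow hr _ _ (by norm_num)]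
  norm_num
  rw [pw_cancel hr]
  exact ht

lemma n2_aN_dv (dv : DV) (x0 : V3) (t0 : ℝ) (hr : 0 < r) : n2 (mI t0 r) (fun t => aN dv x0 r t) = pw r (1/2) * fE dv x0 t0 r ^ ((1:ℝ)/2) := by
  rw [fE, mul_rpow_of_nonneg _ _ (by norm_num), pw_rpow hr _ _ (by norm_num)]
  rw [show (-1:ℝ) * (1/2) = -(1/2) by norm_num, pw_cancel hr]
  rfl

lemma n2_gN (v : VV) (x0 : V3) (t0 : ℝ) (hr : 0 < r) : n2 (mI t0 r) (fun t => gN v x0 r t) = pw r (3/4) * fG v x0 t0 r ^ ((1:ℝ)/2) := by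
  rw [fG, mul_rpow_of_nonneg _ _ (by norm_num), pw_rpow hr _ _ (by norm_num)]
  rw [show -(3/2:ℝ) * (1/2) = -(3/4) by norm_num, pw_cancel hr]
  rfl

lemma n2_aN_f (f : VV) (x0 : V3) (t0 : ℝ) (hr : 0 < r) : n2 (mI t0 r) (fun t => aN f x0 r t) = pw r (-(1/2)) * fF f x0 t0 r := by
  rw [fF, ← mul_assoc, pw_mul hr]; norm_num [pw_zero]

lemma int_oN (p : VR) (x0 : V3) (t0 : ℝ) (hr : 0 < r) : ∫⁻ t, oN p x0 r t ∂(mI t0 r) = pw r 3 * fP p x0 t0 r := by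
  rw [fP, pw_cancel hr]

lemma nq_oN (p : VR) (x0 : V3) (t0 : ℝ) (hr : 0 < r) : nq (mI t0 r) (fun t => oN p x0 r t) = pw r (5/2) * fQ p x0 t0 r := by
  rw [fQ, pw_cancel hr]

end
end

section

lemma sq_add_le4 (x y : ℝ≥0∞) : (x + y) ^ 2 ≤ 4 * (x ^ 2 + y ^ 2) := by
  rcases le_total x y with h | h
  · calc (x + y) ^ 2 ≤ (y + y) ^ 2 := pow_le_pow_left' (add_le_add h le_rfl) 2
      _ = 4 * y ^ 2 := by ring
      _ ≤ _ := by gcongr; exact le_add_self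
  · calc (x + y) ^ 2 ≤ (x + x) ^ 2 := pow_le_pow_left' (add_le_add le_rfl h) 2
      _ = 4 * x ^ 2 := by ring
      _ ≤ _ := by gcongr; exact le_self_add

lemma n2_cmul {α : Type*} [MeasurableSpace α] {μ : Measure α} (c : ℝ≥0∞) {g : α → ℝ≥0∞} (hg : Measurable g) :
    n2 μ (fun t => c * g t) = c * n2 μ g := by
  unfold n2
  simp_rw [mul_pow]
  rw [lintegral_const_mul _ (hg.pow_const 2), mul_rpow_of_nonneg _ _ (by norm_num), sq_rpow_half]

lemma n2_le_const {α : Type*} [MeasurableSpace α] {μ : Measure α} {c : ℝ≥0∞} {g : α → ℝ≥0∞} (h : ∀ᵐ t ∂μ, g t ≤ c) :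
    n2 μ g ≤ c * (μ univ) ^ ((1:ℝ)/2) := (n2_mono h).trans_eq (n2_const μ c)

lemma mI_half {t0 r : ℝ} (hr : 0 < r) : (mI t0 r univ) ^ ((1:ℝ)/2) = pw r 1 := by
  rw [mI_univ hr, pw_rpow hr _ _ (by norm_num)]; norm_num

section
variable {x0 : V3} {t0 R r : ℝ} {v : VV} {dv : DV} {p : VR} {f : VV}

lemma pw_sq (hr : 0 < r) (e : ℝ) : pw r e ^ 2 = pw r (2 * e) := by
  rw [← rpow_natCast, pw_rpow hr _ _ (by norm_num)]; congr 1; push_cast; ring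

lemma pw_ratio {s : ℝ} (hs : 0 < s) (hR : 0 < R) (e : ℝ) : pw s e * pw R (-e) = ofReal ((s / R) ^ e) := by
  unfold pw
  rw [← ofReal_mul (by positivity), Real.div_rpow hs.le hR.le, rpow_neg hR.le, div_eq_mul_inv]

lemma R1 : ∃ C : ℝ≥0, ∀ (x0 : V3) (t0 R : ℝ) v dv p f, 0 < R → GI x0 t0 R v dv p f → ∀ s, 0 < s → s ≤ R →
    fG v x0 t0 s ≤ C * (ofReal (R / s) * fE dv x0 t0 R + ofReal ((s / R) ^ 2) * fA v x0 t0 R) := by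
  obtain ⟨C, hC⟩ := S4
  refine ⟨4 * C ^ 2, fun x0 t0 R v dv p f hR h s hs hsR => ?_⟩
  have h1 : ∀ᵐ t ∂(mI t0 s), gN v x0 s t ≤ (C * pw s (1/4)) * aN dv x0 R t + (C * pw s (3/4) * pw R (-(3/2))) * aN v x0 R t := by
    filter_upwards [ae_mono (mI_mono hs.le hsR) h.gs] with t ht
    refine (hC x0 R hR _ _ _ _ ht s hs hsR).trans_eq ?_
    unfold aN; ring
  have hd := meas_aN h.mdv x0 R
  have ha := meas_aN h.mv x0 R
  have h2 : n2 (mI t0 s) (fun t => gN v x0 s t) ≤ C * (pw s (1/4) * (pw R (1/2) * fE dv x0 t0 R ^ ((1:ℝ)/2)) +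
      pw s (7/4) * pw R (-1) * fA v x0 t0 R ^ ((1:ℝ)/2)) := by
    refine (n2_mono h1).trans ((n2_add (hd.const_mul _).aemeasurable (ha.const_mul _).aemeasurable).trans ?_)
    rw [n2_cmul _ hd, n2_cmul _ ha, mul_add]
    refine add_le_add ?_ ?_
    · rw [mul_assoc]
      refine mul_le_mul_right (mul_le_mul_right ?_ _) _
      rw [← n2_aN_dv dv x0 t0 hR]
      exact n2_mono_measure (mI_mono hs.le hsR) _
    · have := n2_le_const (ae_mono (mI_mono hs.le hsR) (ae_aN_le v x0 t0 hR))
      refine (mul_le_mul_right this _).trans_eq ?_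
      rw [mI_half hs]
      calc _ = C * ((pw s (3/4) * pw s 1) * (pw R (-(3/2)) * pw R (1/2)) * fA v x0 t0 R ^ ((1:ℝ)/2)) := by ring
        _ = _ := by rw [pw_mul hs, pw_mul hR]; norm_num
  rw [fG]
  change _ * ∫⁻ t, gN v x0 s t ^ 2 ∂(mI t0 s) ≤ _
  rw [← n2_sq]
  refine (mul_le_mul_right (pow_le_pow_left' h2 2) _).trans ?_
  rw [mul_pow]
  refine (mul_le_mul_right (mul_le_mul_right (sq_add_le4 _ _) _) _).trans_eq ?_
  simp only [mul_pow, rpow_half_sq, pw_sq hs, pw_sq hR]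
  calc _ = 4 * (C:ℝ≥0∞) ^ 2 * ((pw s (-(3/2)) * pw s (2 * (1/4))) * pw R (2*(1/2)) * fE dv x0 t0 R +
        (pw s (-(3/2)) * pw s (2 * (7/4))) * pw R (2 * -1) * fA v x0 t0 R) := by ring
    _ = 4 * (C:ℝ≥0∞) ^ 2 * ((pw R 1 * pw s (-1)) * fE dv x0 t0 R + (pw s 2 * pw R (-2)) * fA v x0 t0 R) := by
        rw [pw_mul hs, pw_mul hs]; norm_num; ring
    _ = _ := by
        rw [pw_ratio hR hs, pw_ratio hs hR]; norm_num

lemma V2G : ∃ C : ℝ≥0, ∀ (x0 : V3) (t0 R : ℝ) v, 0 < R → (Measurable fun z : V3 × ℝ => v z.1 z.2) →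
    pw R (-3) * ∫⁻ t, aN v x0 R t ^ 2 ∂(mI t0 R) ≤ C * fG v x0 t0 R := by
  refine ⟨cvol ^ ((1:ℝ)/2), fun x0 t0 R v hR h => ?_⟩
  have h1 : ∀ t, aN v x0 R t ^ 2 ≤ CN(cvol ^ ((1:ℝ)/2)) * pw R (3/2) * gN v x0 R t ^ 2 := by
    intro t
    refine (pow_le_pow_left' (n2_n4 (meas_slice h t).enorm.aemeasurable) 2).trans_eq ?_
    rw [mul_pow, ← rpow_natCast (_ ^ _), ← rpow_mul, show (1/4:ℝ) * ((2:ℕ):ℝ) = 1/2 by norm_num,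
      mB_rpow _ _ _ hR (by norm_num), show (3:ℝ) * (1/2) = 3/2 by norm_num]
    rfl
  refine (mul_le_mul_right (lintegral_mono h1) _).trans_eq ?_
  rw [lintegral_const_mul _ ((meas_gN h x0 R).pow_const 2), fG]
  calc _ = CN(cvol ^ ((1:ℝ)/2)) * ((pw R (-3) * pw R (3/2)) * ∫⁻ t, gN v x0 R t ^ 2 ∂(mI t0 R)) := by ring
    _ = _ := by rw [pw_mul hR]; norm_num

/-- slice bounds of F1 -/
lemma F1b : ∃ C : ℝ≥0, ∀ (x0 : V3) (t0 R : ℝ) v dv p f, 0 < R → GI x0 t0 R v dv p f → ∀ᵐ t ∂(mI t0 R),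
    F1 x0 R (fun x => v x t) (fun x => dv x t) (fun x => f x t) ≤ C * (aN v x0 R t * aN dv x0 R t + pw R (3/2) * aN f x0 R t) ∧
    F1 x0 R (fun x => v x t) (fun x => dv x t) (fun x => f x t) ≤ C * (pw R 1 * aN dv x0 R t ^ 2 + pw R (3/2) * aN f x0 R t) ∧
    F1 x0 R (fun x => v x t) (fun x => dv x t) (fun x => f x t) ≤ C * (pw R (1/2) * aN v x0 R t ^ ((1:ℝ)/2) * aN dv x0 R t ^ ((3:ℝ)/2) + pw R (3/2) * aN f x0 R t) := by
  obtain ⟨C, hC⟩ := F1_le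
  obtain ⟨C3, h3⟩ := S3
  refine ⟨C + C3, fun x0 t0 R v dv p f hR h => ?_⟩
  filter_upwards [h.gs] with t ht
  have k1 := hC x0 R hR _ _ _ _ ht
  obtain ⟨k2, k3, -⟩ := h3 x0 R hR _ _ _ _ ht
  set w := n2 (mB x0 R) (fun x => ‖v x t - vmean x0 R (fun x => v x t)‖ₑ)
  have hc1 : (C:ℝ≥0∞) ≤ CN(C + C3) := by exact_mod_cast le_self_add
  have hc3 : (C3:ℝ≥0∞) ≤ CN(C + C3) := by exact_mod_cast le_add_self
  have gen : ∀ B, w * aN dv x0 R t ≤ C3 * B → F1 x0 R (fun x => v x t) (fun x => dv x t) (fun x => f x t) ≤ (C + C3 : ℝ≥0) * (B + pw R (3/2) * aN f x0 R t) := by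
    intro B hB
    refine k1.trans ?_
    rw [mul_add]
    refine add_le_add (hB.trans (mul_le_mul_left hc3 _)) ?_
    rw [← mul_assoc]
    exact mul_le_mul_left (mul_le_mul_left hc1 _) _
  refine ⟨gen _ ?_, gen _ ?_, gen _ ?_⟩
  · rw [← mul_assoc]; exact mul_le_mul_left k3 _
  · refine (mul_le_mul_left k2 _).trans_eq ?_
    unfold aN; ring
  · have : w ≤ C3 * (pw R (1/2) * aN v x0 R t ^ ((1:ℝ)/2) * aN dv x0 R t ^ ((1:ℝ)/2)) := by
      apply le_of_sq_le
      rw [sq]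
      refine (mul_le_mul' k2 k3).trans_eq ?_
      simp only [mul_pow, rpow_half_sq, pw_sq hR]
      unfold aN
      norm_num; ring
    refine (mul_le_mul_left this _).trans_eq ?_
    rw [show ((3:ℝ)/2) = 1/2 + 1 by norm_num, ENNReal.rpow_add_of_nonneg _ _ (by norm_num) (by norm_num), rpow_one]
    ring

end
end

section

section nq
variable {α : Type*} [MeasurableSpace α] {μ ν : Measure α} {g h : α → ℝ≥0∞}

lemma nq_mono (hh : ∀ᵐ t ∂μ, g t ≤ h t) : nq μ g ≤ nq μ h := by
  unfold nq
  refine rpow_le_rpow (lintegral_mono_ae ?_) (by norm_num)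
  filter_upwards [hh] with t ht using rpow_le_rpow ht (by norm_num)

lemma nq_mono_measure (hh : μ ≤ ν) (g : α → ℝ≥0∞) : nq μ g ≤ nq ν g := by
  unfold nq
  exact rpow_le_rpow (lintegral_mono' hh le_rfl) (by norm_num)

lemma nq_cmul (c : ℝ≥0∞) (hg : Measurable g) : nq μ (fun t => c * g t) = c * nq μ g := by
  unfold nq
  simp_rw [mul_rpow_of_nonneg _ _ (show (0:ℝ) ≤ 4/3 by norm_num)]
  rw [lintegral_const_mul _ (hg.pow_const _), mul_rpow_of_nonneg _ _ (by norm_num), ← rpow_mul]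
  norm_num

lemma nq_cmul' (c : ℝ≥0∞) (hc : c ≠ ∞) (g : α → ℝ≥0∞) : nq μ (fun t => c * g t) = c * nq μ g := by
  unfold nq
  simp_rw [mul_rpow_of_nonneg _ _ (show (0:ℝ) ≤ 4/3 by norm_num)]
  rw [lintegral_const_mul' _ _ (rpow_ne_top_of_nonneg (by norm_num) hc), mul_rpow_of_nonneg _ _ (by norm_num), ← rpow_mul]
  norm_num

lemma nq_add (hg : Measurable g) (hh : Measurable h) : nq μ (fun t => g t + h t) ≤ nq μ g + nq μ h := by
  have := lintegral_Lp_add_le (μ := μ) hg.aemeasurable hh.aemeasurable (p := 4/3) (by norm_num)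
  unfold nq
  norm_num at this
  exact this

lemma nq_sum (s : Finset ℕ) {g : ℕ → α → ℝ≥0∞} (hg : ∀ k, Measurable (g k)) :
    nq μ (fun t => ∑ k ∈ s, g k t) ≤ ∑ k ∈ s, nq μ (g k) := by
  induction s using Finset.induction_on with
  | empty => simp [nq]
  | insert a s ha ih =>
    simp_rw [Finset.sum_insert ha]
    exact (nq_add (hg a) (measurable_fun_sum s fun k _ => hg k)).trans (add_le_add le_rfl ih)

lemma nq_le_n2 (hg : Measurable g) : nq μ g ≤ (μ univ) ^ ((1:ℝ)/4) * n2 μ g := by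
  have hpq : (3/2:ℝ).HolderConjugate 3 := by
    refine ⟨?_, ?_, ?_⟩ <;> norm_num
  have := lintegral_mul_le_Lp_mul_Lq μ hpq (f := fun t => g t ^ ((4:ℝ)/3)) (g := fun _ => 1) (hg.pow_const _).aemeasurable (by fun_prop)
  simp only [Pi.mul_apply, mul_one, one_rpow, lintegral_one, ← rpow_mul] at this
  norm_num at this
  unfold nq n2
  refine (rpow_le_rpow this (by norm_num)).trans_eq ?_
  rw [mul_rpow_of_nonneg _ _ (by norm_num), ← rpow_mul, ← rpow_mul, mul_comm]
  norm_num

lemma l1_nq (hg : Measurable g) : ∫⁻ t, g t ∂μ ≤ (μ univ) ^ ((1:ℝ)/4) * nq μ g := by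
  have hpq : (4/3:ℝ).HolderConjugate 4 := by
    refine ⟨?_, ?_, ?_⟩ <;> norm_num
  have := lintegral_mul_le_Lp_mul_Lq μ hpq (f := g) (g := fun _ => 1) hg.aemeasurable (by fun_prop)
  simp only [Pi.mul_apply, mul_one, one_rpow, lintegral_one] at this
  norm_num at this
  unfold nq
  rw [mul_comm]
  convert this using 3
end nq

lemma mI_quarter {t0 r : ℝ} (hr : 0 < r) : (mI t0 r univ) ^ ((1:ℝ)/4) = pw r (1/2) := by
  rw [mI_univ hr, pw_rpow hr _ _ (by norm_num)]; norm_num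

lemma P_le_Q {p : VR} (h : Measurable fun z : V3 × ℝ => p z.1 z.2) (x0 : V3) (t0 : ℝ) {r : ℝ} (hr : 0 < r) :
    fP p x0 t0 r ≤ fQ p x0 t0 r := by
  rw [fP]
  refine (mul_le_mul_right (l1_nq (meas_oN h x0 r)) _).trans_eq ?_
  rw [mI_quarter hr, nq_oN p x0 t0 hr, ← mul_assoc, ← mul_assoc, pw_mul hr, pw_mul hr]
  norm_num [pw_zero]

lemma e_bound (dv : DV) (x0 : V3) (t0 : ℝ) {r : ℝ} (hr : 0 < r) :
    ∫⁻ t, aN dv x0 r t ^ 2 ∂(mI t0 r) = pw r 1 * fE dv x0 t0 r := by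
  rw [fE, pw_cancel hr]

lemma f_bound {f : VV} (h : Measurable fun z : V3 × ℝ => f z.1 z.2) (x0 : V3) (t0 : ℝ) {r : ℝ} (hr : 0 < r) :
    ∫⁻ t, aN f x0 r t ∂(mI t0 r) ≤ pw r (1/2) * fF f x0 t0 r := by
  refine (l1_n2 (meas_aN h x0 r).aemeasurable).trans_eq ?_
  rw [mI_half hr, n2_aN_f f x0 t0 hr, ← mul_assoc, pw_mul hr]; norm_num

lemma f_bound' {f : VV} (h : Measurable fun z : V3 × ℝ => f z.1 z.2) (x0 : V3) (t0 : ℝ) {r : ℝ} (hr : 0 < r) :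
    nq (mI t0 r) (fun t => aN f x0 r t) ≤ fF f x0 t0 r := by
  refine (nq_le_n2 (meas_aN h x0 r)).trans_eq ?_
  rw [mI_quarter hr, n2_aN_f f x0 t0 hr, ← mul_assoc, pw_mul hr]; norm_num [pw_zero]

lemma ae_bound {v : VV} {dv : DV} (hd : Measurable fun z : V3 × ℝ => dv z.1 z.2) (x0 : V3) (t0 : ℝ) {r : ℝ} (hr : 0 < r) :
    nq (mI t0 r) (fun t => aN v x0 r t ^ ((1:ℝ)/2) * aN dv x0 r t ^ ((3:ℝ)/2)) ≤
      pw r 1 * (fA v x0 t0 r ^ ((1:ℝ)/4) * fE dv x0 t0 r ^ ((3:ℝ)/4)) := by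
  have h1 : ∀ᵐ t ∂(mI t0 r), aN v x0 r t ^ ((1:ℝ)/2) * aN dv x0 r t ^ ((3:ℝ)/2) ≤
      (pw r (1/4) * fA v x0 t0 r ^ ((1:ℝ)/4)) * aN dv x0 r t ^ ((3:ℝ)/2) := by
    filter_upwards [ae_aN_le v x0 t0 hr] with t ht
    refine mul_le_mul_left ((rpow_le_rpow ht (by norm_num)).trans_eq ?_) _
    rw [mul_rpow_of_nonneg _ _ (by norm_num), pw_rpow hr _ _ (by norm_num), ← rpow_mul]
    norm_num
  refine (nq_mono h1).trans_eq ?_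
  rw [nq_cmul _ ((meas_aN hd x0 r).pow_const _)]
  have h2 : nq (mI t0 r) (fun t => aN dv x0 r t ^ ((3:ℝ)/2)) = pw r (3/4) * fE dv x0 t0 r ^ ((3:ℝ)/4) := by
    unfold nq
    simp_rw [← rpow_mul]
    norm_num
    rw [e_bound dv x0 t0 hr, mul_rpow_of_nonneg _ _ (by norm_num), pw_rpow hr _ _ (by norm_num)]
    norm_num
  rw [h2]
  calc _ = (pw r (1/4) * pw r (3/4)) * (fA v x0 t0 r ^ ((1:ℝ)/4) * fE dv x0 t0 r ^ ((3:ℝ)/4)) := by ring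
    _ = _ := by rw [pw_mul hr]; norm_num

/-- slice pressure decay with explicit measurable majorants -/
lemma pres_slice : ∃ C : ℝ≥0, ∀ (x0 : V3) (t0 R : ℝ) v dv p f, 0 < R → GI x0 t0 R v dv p f → ∀ n : ℕ, 1 ≤ n →
    ∀ᵐ t ∂(mI t0 (rr R n)),
      oN p x0 (rr R n) t ≤ C * (pw (rr R n) 4 * pw R (-4) * oN p x0 R t + ∑ k ∈ range n, pw (rr R n) 4 * pw (rr R k) (-3) *
        (pw (rr R k) 1 * aN dv x0 (rr R k) t ^ 2 + pw (rr R k) (3/2) * aN f x0 (rr R k) t)) ∧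
      oN p x0 (rr R n) t ≤ C * (pw (rr R n) 4 * pw R (-4) * oN p x0 R t + ∑ k ∈ range n, pw (rr R n) 4 * pw (rr R k) (-3) *
        (pw (rr R k) (1/2) * (aN v x0 (rr R k) t ^ ((1:ℝ)/2) * aN dv x0 (rr R k) t ^ ((3:ℝ)/2)) + pw (rr R k) (3/2) * aN f x0 (rr R k) t)) := by
  obtain ⟨C1, h1⟩ := pres_O1
  obtain ⟨C2, h2⟩ := F1b
  refine ⟨C1 * (1 + C2), fun x0 t0 R v dv p f hR h n hn => ?_⟩
  have hall0 := fun k (hk : k ∈ range n) => (h2 x0 t0 (rr R k) v dv p f (rr_pos hR k) (h.mono (rr_pos hR k).le (rr_le hR k))).filter_mono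
      (ae_mono (mI_mono (t0 := t0) (rr_pos hR n).le (rr_anti hR (mem_range.1 hk).le)))
  have hall := (Filter.eventually_all_finset (range n)).2 hall0
  have e4 : ofReal (R⁻¹ ^ 4 * rr R n ^ 4) = pw (rr R n) 4 * pw R (-4) := by
    unfold pw
    rw [← ofReal_mul (by have := rr_pos hR n; positivity), rpow_neg hR.le]
    norm_cast
    rw [inv_pow, mul_comm]
  have e3 : ∀ k, ofReal ((rr R k)⁻¹ ^ 3 * rr R n ^ 4) = pw (rr R n) 4 * pw (rr R k) (-3) := by
    intro k
    unfold pw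
    rw [← ofReal_mul (by have := rr_pos hR n; positivity), rpow_neg (rr_pos hR k).le]
    norm_cast
    rw [inv_pow, mul_comm]
  filter_upwards [hall, ae_mono (mI_mono (rr_pos hR n).le (rr_le hR n)) h.gs] with t ht hg
  have k1 := h1 x0 R hR _ _ _ _ hg n hn
  rw [e4] at k1
  have gen : ∀ B : ℕ → ℝ≥0∞, (∀ k ∈ range n, F1 x0 (rr R k) (fun x => v x t) (fun x => dv x t) (fun x => f x t) ≤ C2 * B k) →
      oN p x0 (rr R n) t ≤ CN(C1 * (1 + C2)) * (pw (rr R n) 4 * pw R (-4) * oN p x0 R t + ∑ k ∈ range n, pw (rr R n) 4 * pw (rr R k) (-3) * B k) := by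
    intro B hB
    refine k1.trans ?_
    rw [ENNReal.coe_mul, mul_assoc (C1:ℝ≥0∞)]
    refine mul_le_mul' le_rfl ?_
    rw [mul_add]
    refine add_le_add ?_ ?_
    · have h1c : (1:ℝ≥0∞) ≤ CN(1 + C2) := by exact_mod_cast le_self_add
      exact (one_mul _).symm.le.trans (mul_le_mul_left h1c _)
    · rw [mul_sum]
      refine sum_le_sum fun k hk => ?_
      rw [e3]
      refine (mul_le_mul_right (hB k hk) _).trans ?_
      rw [mul_left_comm]
      have hc2 : (C2:ℝ≥0∞) ≤ ((1 + C2 : ℝ≥0):ℝ≥0∞) := by exact_mod_cast le_add_self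
      exact mul_le_mul_left hc2 _
  refine ⟨gen _ fun k hk => (ht k hk).2.1, gen _ fun k hk => ?_⟩
  rw [← mul_assoc]
  exact (ht k hk).2.2

lemma R3 : ∃ C : ℝ≥0, ∀ (x0 : V3) (t0 R : ℝ) v dv p f, 0 < R → GI x0 t0 R v dv p f → ∀ n : ℕ, 1 ≤ n →
    fP p x0 t0 (rr R n) ≤ C * (ofReal (rr R n / R) * fP p x0 t0 R +
      ∑ k ∈ range n, ofReal (rr R n / rr R k) * (fE dv x0 t0 (rr R k) + fF f x0 t0 (rr R k))) := by
  obtain ⟨C, hC⟩ := pres_slice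
  refine ⟨C, fun x0 t0 R v dv p f hR h n hn => ?_⟩
  have hn0 := rr_pos hR n
  have hd : ∀ k, Measurable (fun t => pw (rr R k) 1 * aN dv x0 (rr R k) t ^ 2) := fun k => ((meas_aN h.mdv x0 (rr R k)).pow_const 2).const_mul _
  have hf : ∀ k, Measurable (fun t => pw (rr R k) (3/2) * aN f x0 (rr R k) t) := fun k => (meas_aN h.mf x0 (rr R k)).const_mul _
  have ho := meas_oN h.mp x0 R
  have hs : ∀ k, Measurable (fun t => pw (rr R n) 4 * pw (rr R k) (-3) *
        (pw (rr R k) 1 * aN dv x0 (rr R k) t ^ 2 + pw (rr R k) (3/2) * aN f x0 (rr R k) t)) :=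
    fun k => ((hd k).add (hf k)).const_mul _
  rw [fP]
  refine (mul_le_mul_right (lintegral_mono_ae ((hC x0 t0 R v dv p f hR h n hn).mono fun t ht => ht.1)) _).trans ?_
  rw [lintegral_const_mul' _ _ coe_ne_top, lintegral_add_left (ho.const_mul _), lintegral_const_mul _ ho,
    lintegral_finsetSum _ (fun k _ => hs k), mul_left_comm]
  refine mul_le_mul_right ?_ _
  rw [mul_add]
  refine add_le_add ?_ ?_
  · refine (mul_le_mul_right (mul_le_mul_right (lintegral_mono' (mI_mono hn0.le (rr_le hR n)) le_rfl) _) _).trans_eq ?_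
    rw [int_oN p x0 t0 hR]
    calc _ = (pw (rr R n) (-3) * pw (rr R n) 4) * (pw R (-4) * pw R 3) * fP p x0 t0 R := by ring
      _ = _ := by
        rw [pw_mul hn0, pw_mul hR]; norm_num
        rw [pw_ratio hn0 hR]; norm_num
  · rw [mul_sum]
    refine sum_le_sum fun k hk => ?_
    have hk0 := rr_pos hR k
    rw [lintegral_const_mul' _ _ (mul_ne_top (pw_ne_top _ _) (pw_ne_top _ _)), lintegral_add_left (hd k), lintegral_const_mul _ ((meas_aN h.mdv x0 _).pow_const 2),
      lintegral_const_mul _ (meas_aN h.mf x0 _)]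
    have hm := mI_mono (t0 := t0) hn0.le (rr_anti hR (mem_range.1 hk).le)
    have b1 : ∫⁻ t, aN dv x0 (rr R k) t ^ 2 ∂(mI t0 (rr R n)) ≤ pw (rr R k) 1 * fE dv x0 t0 (rr R k) :=
      (lintegral_mono' hm le_rfl).trans_eq (e_bound dv x0 t0 hk0)
    have b2 : ∫⁻ t, aN f x0 (rr R k) t ∂(mI t0 (rr R n)) ≤ pw (rr R k) (1/2) * fF f x0 t0 (rr R k) :=
      (lintegral_mono' hm le_rfl).trans (f_bound h.mf x0 t0 hk0)
    refine (mul_le_mul_right (mul_le_mul_right (add_le_add (mul_le_mul_right b1 _) (mul_le_mul_right b2 _)) _) _).trans_eq ?_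
    calc _ = (pw (rr R n) (-3) * pw (rr R n) 4) * pw (rr R k) (-3) * ((pw (rr R k) 1 * pw (rr R k) 1) * fE dv x0 t0 (rr R k) +
            (pw (rr R k) (3/2) * pw (rr R k) (1/2)) * fF f x0 t0 (rr R k)) := by ring
      _ = (pw (rr R n) (-3) * pw (rr R n) 4) * (pw (rr R k) (-3) * pw (rr R k) 2) * (fE dv x0 t0 (rr R k) + fF f x0 t0 (rr R k)) := by
          rw [pw_mul hk0, pw_mul hk0]; norm_num; ring
      _ = _ := by
        rw [pw_mul hn0, pw_mul hk0]; norm_num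
        rw [pw_ratio hn0 hk0]; norm_num

lemma R3q : ∃ C : ℝ≥0, ∀ (x0 : V3) (t0 R : ℝ) v dv p f, 0 < R → GI x0 t0 R v dv p f → ∀ n : ℕ, 1 ≤ n →
    fQ p x0 t0 (rr R n) ≤ C * (ofReal ((rr R n / R) ^ ((3:ℝ)/2)) * fQ p x0 t0 R +
      ∑ k ∈ range n, ofReal ((rr R n / rr R k) ^ ((3:ℝ)/2)) *
        (fA v x0 t0 (rr R k) ^ ((1:ℝ)/4) * fE dv x0 t0 (rr R k) ^ ((3:ℝ)/4) + fF f x0 t0 (rr R k))) := by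
  obtain ⟨C, hC⟩ := pres_slice
  refine ⟨C, fun x0 t0 R v dv p f hR h n hn => ?_⟩
  have hn0 := rr_pos hR n
  have hd' : ∀ k, Measurable (fun t => aN v x0 (rr R k) t ^ ((1:ℝ)/2) * aN dv x0 (rr R k) t ^ ((3:ℝ)/2)) := fun k =>
    ((meas_aN h.mv x0 (rr R k)).pow_const _).mul ((meas_aN h.mdv x0 (rr R k)).pow_const _)
  have hd : ∀ k, Measurable (fun t => pw (rr R k) (1/2) * (aN v x0 (rr R k) t ^ ((1:ℝ)/2) * aN dv x0 (rr R k) t ^ ((3:ℝ)/2))) := fun k =>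
    (hd' k).const_mul _
  have hf : ∀ k, Measurable (fun t => pw (rr R k) (3/2) * aN f x0 (rr R k) t) := fun k => (meas_aN h.mf x0 (rr R k)).const_mul _
  have ho := meas_oN h.mp x0 R
  have hs : ∀ k, Measurable (fun t => pw (rr R n) 4 * pw (rr R k) (-3) *
        (pw (rr R k) (1/2) * (aN v x0 (rr R k) t ^ ((1:ℝ)/2) * aN dv x0 (rr R k) t ^ ((3:ℝ)/2)) + pw (rr R k) (3/2) * aN f x0 (rr R k) t)) :=
    fun k => ((hd k).add (hf k)).const_mul _
  rw [fQ]
  refine (mul_le_mul_right (nq_mono ((hC x0 t0 R v dv p f hR h n hn).mono fun t ht => ht.2)) _).trans ?_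
  rw [nq_cmul' _ coe_ne_top, mul_left_comm]
  refine mul_le_mul_right ?_ _
  refine (mul_le_mul_right ((nq_add (ho.const_mul _) (measurable_fun_sum _ fun k _ => hs k)).trans (add_le_add le_rfl (nq_sum _ hs))) _).trans ?_
  rw [mul_add]
  refine add_le_add ?_ ?_
  · rw [nq_cmul _ ho]
    refine (mul_le_mul_right (mul_le_mul_right (nq_mono_measure (mI_mono hn0.le (rr_le hR n)) _) _) _).trans_eq ?_
    rw [nq_oN p x0 t0 hR]
    calc _ = (pw (rr R n) (-(5/2)) * pw (rr R n) 4) * (pw R (-4) * pw R (5/2)) * fQ p x0 t0 R := by ring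
      _ = _ := by
        rw [pw_mul hn0, pw_mul hR]; norm_num
        rw [pw_ratio hn0 hR]
  · rw [mul_sum]
    refine sum_le_sum fun k hk => ?_
    have hk0 := rr_pos hR k
    have hm := mI_mono (t0 := t0) hn0.le (rr_anti hR (mem_range.1 hk).le)
    rw [nq_cmul' _ (mul_ne_top (pw_ne_top _ _) (pw_ne_top _ _))]
    have b1 := (nq_mono_measure hm _).trans (ae_bound (v := v) h.mdv x0 t0 hk0)
    have b2 := (nq_mono_measure hm _).trans (f_bound' h.mf x0 t0 hk0)
    have b3 := nq_add (μ := mI t0 (rr R n)) (hd k) (hf k)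
    rw [nq_cmul _ (hd' k), nq_cmul _ (meas_aN h.mf x0 _)] at b3
    have b4 := b3.trans (add_le_add (mul_le_mul_right b1 _) (mul_le_mul_right b2 _))
    refine (mul_le_mul_right (mul_le_mul_right b4 _) _).trans_eq ?_
    generalize fA v x0 t0 (rr R k) ^ ((1:ℝ)/4) * fE dv x0 t0 (rr R k) ^ ((3:ℝ)/4) = X
    calc _ = (pw (rr R n) (-(5/2)) * pw (rr R n) 4) * pw (rr R k) (-3) * ((pw (rr R k) (1/2) * pw (rr R k) 1) * X +
            pw (rr R k) (3/2) * fF f x0 t0 (rr R k)) := by ring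
      _ = (pw (rr R n) (-(5/2)) * pw (rr R n) 4) * (pw (rr R k) (-3) * pw (rr R k) (3/2)) * (X + fF f x0 t0 (rr R k)) := by
          rw [pw_mul hk0]; norm_num; ring
      _ = _ := by
        rw [pw_mul hn0, pw_mul hk0]; norm_num
        rw [pw_ratio hn0 hk0]

end

section
section
variable {x0 : V3} {t0 R r : ℝ} {v : VV} {dv : DV} {p : VR} {f : VV}

/-- time integral of a product with the kinetic norm -/
lemma int_a_mul (hr : 0 < r) {g : ℝ → ℝ≥0∞} (hg : Measurable g) :
    ∫⁻ t, aN v x0 r t * g t ∂(mI t0 r) ≤ pw r (1/2) * fA v x0 t0 r ^ ((1:ℝ)/2) * ∫⁻ t, g t ∂(mI t0 r) := by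
  rw [← lintegral_const_mul _ hg]
  refine lintegral_mono_ae ?_
  filter_upwards [ae_aN_le v x0 t0 hr] with t ht
  exact mul_le_mul_left ht _

lemma int_aeg (hr : 0 < r) (h : GI x0 t0 r v dv p f) :
    ∫⁻ t, aN v x0 r t * (aN dv x0 r t * gN v x0 r t) ∂(mI t0 r) ≤
      pw r (7/4) * (fA v x0 t0 r ^ ((1:ℝ)/2) * fE dv x0 t0 r ^ ((1:ℝ)/2) * fG v x0 t0 r ^ ((1:ℝ)/2)) := by
  have m1 := meas_aN h.mdv x0 r
  have m2 := meas_gN h.mv x0 r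
  refine (int_a_mul hr (m1.mul m2)).trans ?_
  refine (mul_le_mul_right (n2_mul m1.aemeasurable m2.aemeasurable) _).trans_eq ?_
  rw [n2_aN_dv dv x0 t0 hr, n2_gN v x0 t0 hr]
  calc _ = (pw r (1/2) * pw r (1/2) * pw r (3/4)) * (fA v x0 t0 r ^ ((1:ℝ)/2) * fE dv x0 t0 r ^ ((1:ℝ)/2) * fG v x0 t0 r ^ ((1:ℝ)/2)) := by ring
    _ = _ := by rw [pw_mul hr, pw_mul hr]; norm_num

lemma FL1 : ∃ C : ℝ≥0, ∀ (x0 : V3) (t0 R : ℝ) v dv p f, 0 < R → GI x0 t0 R v dv p f →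
    pw R (-2) * ∫⁻ t, (∫⁻ x in ball x0 R, ‖‖v x t‖ ^ 2 - ‖vmean x0 R (fun y => v y t)‖ ^ 2‖ₑ * ‖v x t‖ₑ) ∂(mI t0 R) ≤
      C * (fA v x0 t0 R ^ ((1:ℝ)/2) * fE dv x0 t0 R ^ ((1:ℝ)/2) * fG v x0 t0 R ^ ((1:ℝ)/2)) := by
  obtain ⟨C, hC⟩ := S8
  refine ⟨C, fun x0 t0 R v dv p f hR h => ?_⟩
  have hb : ∫⁻ t, (∫⁻ x in ball x0 R, ‖‖v x t‖ ^ 2 - ‖vmean x0 R (fun y => v y t)‖ ^ 2‖ₑ * ‖v x t‖ₑ) ∂(mI t0 R) ≤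
      ∫⁻ t, (C * pw R (1/4)) * (aN v x0 R t * (aN dv x0 R t * gN v x0 R t)) ∂(mI t0 R) := by
    refine lintegral_mono_ae ?_
    filter_upwards [h.gs] with t ht
    refine (hC x0 R hR _ _ _ _ ht).trans_eq ?_
    unfold aN gN
    ring
  rw [lintegral_const_mul' _ _ (mul_ne_top (by finiteness) (pw_ne_top _ _))] at hb
  refine (mul_le_mul_right (hb.trans (mul_le_mul_right (int_aeg hR h) _)) _).trans_eq ?_
  calc _ = C * ((pw R (-2) * pw R (1/4) * pw R (7/4)) * (fA v x0 t0 R ^ ((1:ℝ)/2) * fE dv x0 t0 R ^ ((1:ℝ)/2) * fG v x0 t0 R ^ ((1:ℝ)/2))) := by ring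
    _ = _ := by rw [pw_mul hR, pw_mul hR]; norm_num [pw_zero]

lemma FL3 (hR : 0 < R) (h : GI x0 t0 R v dv p f) :
    pw R (-1) * ∫⁻ t, (∫⁻ x in ball x0 R, ‖f x t‖ₑ * ‖v x t‖ₑ) ∂(mI t0 R) ≤ fA v x0 t0 R ^ ((1:ℝ)/2) * fF f x0 t0 R := by
  have hb : ∫⁻ t, (∫⁻ x in ball x0 R, ‖f x t‖ₑ * ‖v x t‖ₑ) ∂(mI t0 R) ≤ ∫⁻ t, aN v x0 R t * aN f x0 R t ∂(mI t0 R) := by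
    refine lintegral_mono fun t => ?_
    refine (n2_mul (meas_slice h.mf t).enorm.aemeasurable (meas_slice h.mv t).enorm.aemeasurable).trans_eq ?_
    unfold aN mB
    ring
  refine (mul_le_mul_right (hb.trans ((int_a_mul hR (meas_aN h.mf x0 R)).trans (mul_le_mul_right (f_bound h.mf x0 t0 hR) _))) _).trans_eq ?_
  calc _ = (pw R (-1) * pw R (1/2) * pw R (1/2)) * (fA v x0 t0 R ^ ((1:ℝ)/2) * fF f x0 t0 R) := by ring
    _ = _ := by rw [pw_mul hR, pw_mul hR]; norm_num [pw_zero]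

lemma FL2 : ∃ C : ℝ≥0, ∀ (x0 : V3) (t0 R : ℝ) v dv p f, 0 < R → GI x0 t0 R v dv p f →
    pw R (-2) * ∫⁻ t, (∫⁻ x in ball x0 (R/2), ‖p x t - pmean x0 R (fun y => p y t)‖ₑ * ‖v x t‖ₑ) ∂(mI t0 R) ≤
      C * (fA v x0 t0 R ^ ((1:ℝ)/2) * fP p x0 t0 R + (fA v x0 t0 R ^ ((1:ℝ)/2) * fE dv x0 t0 R ^ ((1:ℝ)/2) * fG v x0 t0 R ^ ((1:ℝ)/2)
        + fG v x0 t0 R ^ ((1:ℝ)/2) * fF f x0 t0 R)) := by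
  obtain ⟨C1, h1⟩ := S7
  obtain ⟨C2, h2⟩ := F1b
  refine ⟨C1 * (1 + C2), fun x0 t0 R v dv p f hR h => ?_⟩
  have hc1 : (1:ℝ≥0∞) ≤ CN(1 + C2) := by exact_mod_cast le_self_add
  have hc2 : (C2:ℝ≥0∞) ≤ CN(1 + C2) := by exact_mod_cast le_add_self
  have mo := meas_oN h.mp x0 R
  have ma := meas_aN h.mv x0 R
  have md := meas_aN h.mdv x0 R
  have mg := meas_gN h.mv x0 R
  have mf := meas_aN h.mf x0 R
  have hb : ∫⁻ t, (∫⁻ x in ball x0 (R/2), ‖p x t - pmean x0 R (fun y => p y t)‖ₑ * ‖v x t‖ₑ) ∂(mI t0 R) ≤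
      ∫⁻ t, ((C1 * (1 + C2) : ℝ≥0):ℝ≥0∞) * (pw R (-(3/2)) * (aN v x0 R t * oN p x0 R t) + (pw R (1/4) * (aN v x0 R t * (aN dv x0 R t * gN v x0 R t))
        + pw R (7/4) * (gN v x0 R t * aN f x0 R t))) ∂(mI t0 R) := by
    refine lintegral_mono_ae ?_
    filter_upwards [h.gs, h2 x0 t0 R v dv p f hR h] with t ht hf
    refine (h1 x0 R hR _ _ _ _ ht).trans ?_
    rw [ENNReal.coe_mul, mul_assoc (C1:ℝ≥0∞)]
    refine mul_le_mul_right ?_ _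
    rw [mul_add CN(1 + C2)]
    refine add_le_add ?_ ?_
    · refine (one_mul _).symm.le.trans (mul_le_mul' hc1 (le_of_eq ?_))
      unfold aN oN
      ring
    · refine (mul_le_mul_right hf.1 _).trans ?_
      rw [mul_left_comm]
      refine mul_le_mul' hc2 (le_of_eq ?_)
      calc _ = pw R (1/4) * (aN v x0 R t * (aN dv x0 R t * gN v x0 R t)) + (pw R (1/4) * pw R (3/2)) * (gN v x0 R t * aN f x0 R t) := by
            unfold aN gN; ring
        _ = _ := by rw [pw_mul hR]; norm_num
  have m1 : Measurable fun t => pw R (-(3/2)) * (aN v x0 R t * oN p x0 R t) := (ma.mul mo).const_mul _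
  have m2 : Measurable fun t => pw R (1/4) * (aN v x0 R t * (aN dv x0 R t * gN v x0 R t)) := (ma.mul (md.mul mg)).const_mul _
  rw [lintegral_const_mul' _ _ coe_ne_top, lintegral_add_left m1, lintegral_add_left m2, lintegral_const_mul' _ _ (pw_ne_top _ _),
    lintegral_const_mul' _ _ (pw_ne_top _ _), lintegral_const_mul' _ _ (pw_ne_top _ _)] at hb
  have i1 := int_a_mul (v := v) (x0 := x0) (t0 := t0) hR mo
  rw [int_oN p x0 t0 hR] at i1
  have i2 := int_aeg hR h
  have i3 := n2_mul (μ := mI t0 R) mg.aemeasurable mf.aemeasurable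
  rw [n2_gN v x0 t0 hR, n2_aN_f f x0 t0 hR] at i3
  refine (mul_le_mul_right (hb.trans (mul_le_mul_right (add_le_add (mul_le_mul_right i1 _) (add_le_add (mul_le_mul_right i2 _) (mul_le_mul_right i3 _))) _)) _).trans_eq ?_
  calc _ = ((C1 * (1 + C2) : ℝ≥0):ℝ≥0∞) * ((pw R (-2) * pw R (-(3/2)) * pw R (1/2) * pw R 3) * (fA v x0 t0 R ^ ((1:ℝ)/2) * fP p x0 t0 R) +
        ((pw R (-2) * pw R (1/4) * pw R (7/4)) * (fA v x0 t0 R ^ ((1:ℝ)/2) * fE dv x0 t0 R ^ ((1:ℝ)/2) * fG v x0 t0 R ^ ((1:ℝ)/2))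
        + (pw R (-2) * pw R (7/4) * pw R (3/4) * pw R (-(1/2))) * (fG v x0 t0 R ^ ((1:ℝ)/2) * fF f x0 t0 R))) := by ring
    _ = _ := by simp only [pw_mul hR]; norm_num [pw_zero]

/-! monotonicity -/
/-- change of centre: smaller cylinder inside the bigger one -/
lemma A_sub {x1 : V3} {t1 s : ℝ} (hs : 0 < s) (hR : 0 < R) (hB : ball x1 s ⊆ ball x0 R) (hI : Ioo (t1 - s^2) t1 ⊆ Ioo (t0 - R^2) t0) :
    fA v x1 t1 s ≤ ofReal (R/s) * fA v x0 t0 R := by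
  have h1 : essSup (fun t => aN v x1 s t ^ 2) (mI t1 s) ≤ essSup (fun t => aN v x0 R t ^ 2) (mI t0 R) := by
    refine (essSup_mono_ae (of_forall fun t => pow_le_pow_left' (n2_mono_measure (restrict_mono hB le_rfl) _) 2)).trans ?_
    exact essSup_mono_measure' (restrict_mono hI le_rfl)
  unfold fA
  refine (mul_le_mul_right h1 _).trans_eq ?_
  rw [← mul_assoc]
  congr 1
  unfold pw
  rw [← ofReal_mul (by positivity), rpow_neg_one, rpow_neg_one]
  congr 1
  field_simp

lemma E_sub {x1 : V3} {t1 s : ℝ} (hs : 0 < s) (hR : 0 < R) (hB : ball x1 s ⊆ ball x0 R) (hI : Ioo (t1 - s^2) t1 ⊆ Ioo (t0 - R^2) t0) :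
    fE dv x1 t1 s ≤ ofReal (R/s) * fE dv x0 t0 R := by
  have h1 : ∫⁻ t, aN dv x1 s t ^ 2 ∂(mI t1 s) ≤ ∫⁻ t, aN dv x0 R t ^ 2 ∂(mI t0 R) := by
    refine (lintegral_mono fun t => pow_le_pow_left' (n2_mono_measure (restrict_mono hB le_rfl) _) 2).trans ?_
    exact lintegral_mono' (restrict_mono hI le_rfl) le_rfl
  unfold fE
  refine (mul_le_mul_right h1 _).trans_eq ?_
  rw [← mul_assoc]
  congr 1
  unfold pw
  rw [← ofReal_mul (by positivity), rpow_neg_one, rpow_neg_one]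
  congr 1
  field_simp

lemma Q_sub : ∃ C : ℝ≥0, ∀ (x0 x1 : V3) (t0 t1 s R : ℝ) v dv p f, 0 < s → 0 < R → ball x1 s ⊆ ball x0 R → Ioo (t1 - s^2) t1 ⊆ Ioo (t0 - R^2) t0 →
    GI x0 t0 R v dv p f →
    fQ p x1 t1 s ≤ C * (ofReal ((R/s)^((5:ℝ)/2)) * fQ p x0 t0 R) := by
  obtain ⟨C, hC⟩ := O1_le
  refine ⟨C, fun x0 x1 t0 t1 s R v dv p f hs hR hB hI h => ?_⟩
  have hI' : mI t1 s ≤ mI t0 R := restrict_mono hI le_rfl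
  have h1 : nq (mI t1 s) (fun t => oN p x1 s t) ≤ C * nq (mI t0 R) (fun t => oN p x0 R t) := by
    rw [← nq_cmul _ (meas_oN h.mp x0 R)]
    refine le_trans (nq_mono ?_) (nq_mono_measure hI' _)
    filter_upwards [ae_mono hI' h.gs] with t ht
    refine (hC x1 s hs _ ht.mq (ht.int_q.mono_set hB) (pmean x0 R (fun x => p x t))).trans ?_
    exact mul_le_mul_right (lintegral_mono_set hB) _
  unfold fQ
  refine (mul_le_mul_right h1 _).trans_eq ?_
  rw [mul_left_comm]
  congr 1
  rw [← mul_assoc]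
  congr 1
  unfold pw
  rw [← ofReal_mul (by positivity), rpow_neg hs.le, rpow_neg hR.le, Real.div_rpow hR.le hs.le]
  congr 1
  have := Real.rpow_pos_of_pos hR (5/2)
  field_simp
end
end

section

lemma holder1 {α : Type*} [MeasurableSpace α] {μ : Measure α} {g : α → ℝ≥0∞} (hg : Measurable g) {θ : ℝ} (h0 : 0 < θ) (h1 : θ < 1) :
    ∫⁻ x, g x ^ θ ∂μ ≤ (∫⁻ x, g x ∂μ) ^ θ * μ univ ^ (1 - θ) := by
  have hpq : (1/θ).HolderConjugate (1/(1-θ)) := by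
    rw [Real.holderConjugate_iff]
    constructor
    · rw [lt_div_iff₀ h0]; linarith
    · simp
  have := lintegral_mul_le_Lp_mul_Lq μ hpq (f := fun x => g x ^ θ) (g := fun _ => 1) (hg.pow_const _).aemeasurable aemeasurable_const
  simp only [Pi.mul_apply, mul_one, one_rpow, lintegral_one, ← rpow_mul, rpow_one, one_div, inv_inv, mul_inv_cancel₀ h0.ne'] at this
  exact this

section
variable {Ω : Set V3} {T : ℝ} {x0 : V3} {t0 R r : ℝ} {v : VV} {dv : DV} {p : VR} {f : VV}

lemma MS.gi (h : MS Ω T v dv p f) (hB : ball x0 R ⊆ Ω) (hI : Ioo (t0 - R^2) t0 ⊆ Ioo 0 T) : GI x0 t0 R v dv p f :=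
  ⟨h.mv, h.mdv, h.mp, h.mf, by
    filter_upwards [ae_mono (restrict_mono hI le_rfl) h.gs] with t ht
    exact ht.mono hB h.sol.open_dom.measurableSet⟩

lemma MS.fin (h : MS Ω T v dv p f) (hR : 0 < R) (hB : ball x0 R ⊆ Ω) (hI : Ioo (t0 - R^2) t0 ⊆ Ioo 0 T) :
    fA v x0 t0 R < ∞ ∧ fE dv x0 t0 R < ∞ ∧ fQ p x0 t0 R < ∞ := by
  have hI' : mI t0 R ≤ volume.restrict (Ioo 0 T) := restrict_mono hI le_rfl
  refine ⟨?_, ?_, ?_⟩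
  · obtain ⟨K, hK⟩ := h.vK
    refine mul_lt_top (pw_ne_top _ _).lt_top (lt_of_le_of_lt (essSup_le_of_ae_le (K:ℝ≥0∞) ?_) coe_lt_top)
    filter_upwards [ae_mono hI' hK] with t ht
    unfold aN
    rw [n2_sq]
    exact (lintegral_mono_set hB).trans ht
  · refine mul_lt_top (pw_ne_top _ _).lt_top (lt_of_le_of_lt ?_ h.dE2)
    refine (lintegral_mono fun t => ?_).trans (lintegral_mono' hI' le_rfl)
    unfold aN
    rw [n2_sq]
    exact lintegral_mono_set hB
  · refine mul_lt_top (pw_ne_top _ _).lt_top (rpow_lt_top_of_nonneg (by norm_num) (ne_of_lt ?_))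
    obtain ⟨C, hC⟩ := O1_le
    set V := mB x0 R univ with hV
    have hVt : V ≠ ∞ := (mB_lt_top x0 R).ne
    have hb : ∫⁻ t, oN p x0 R t ^ ((4:ℝ)/3) ∂(mI t0 R) ≤ ∫⁻ t, (1 + C ^ ((3:ℝ)/2) * V ^ ((1:ℝ)/2) * ∫⁻ x in Ω, ‖p x t‖ₑ ^ ((3:ℝ)/2)) ∂(mI t0 R) := by
      refine lintegral_mono_ae ?_
      filter_upwards [(h.gi hB hI).gs] with t ht
      refine (pow_le_one_add (by norm_num) (show (4:ℝ)/3 ≤ 3/2 by norm_num)).trans (add_le_add le_rfl ?_)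
      have k1 := hC x0 R hR _ ht.mq ht.int_q 0
      simp only [sub_zero] at k1
      have k2 := holder1 (μ := mB x0 R) (ht.mq.enorm.pow_const ((3:ℝ)/2)) (show (0:ℝ) < 2/3 by norm_num) (by norm_num)
      simp_rw [← rpow_mul] at k2
      rw [show (3/2:ℝ) * (2/3) = 1 by norm_num, show 1 - (2/3:ℝ) = 1/3 by norm_num] at k2
      simp_rw [rpow_one] at k2
      have k3 := rpow_le_rpow (k1.trans (mul_le_mul_right k2 _)) (show (0:ℝ) ≤ 3/2 by norm_num)
      refine k3.trans ?_
      rw [mul_rpow_of_nonneg _ _ (by norm_num), mul_rpow_of_nonneg _ _ (by norm_num), ← rpow_mul, ← rpow_mul,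
        show (2/3:ℝ) * (3/2) = 1 by norm_num, rpow_one, show (1/3:ℝ) * (3/2) = 1/2 by norm_num, ← hV, mul_assoc]
      refine mul_le_mul_right ?_ _
      rw [mul_comm]
      exact mul_le_mul_right (lintegral_mono_set hB) _
    refine lt_of_le_of_lt hb ?_
    rw [lintegral_add_left measurable_const, lintegral_const_mul' _ _ (by finiteness), lintegral_one, mI_univ hR]
    refine add_lt_top.2 ⟨(pw_ne_top _ _).lt_top, mul_lt_top (by finiteness) ?_⟩
    exact lt_of_le_of_lt (lintegral_mono' hI' le_rfl) h.pP

lemma MS.F_decay (h : MS Ω T v dv p f) : ∃ γ : ℝ, 0 < γ ∧ γ ≤ 1/4 ∧ ∃ φ : ℝ≥0, ∀ x0 t0 R, 0 < R → R ≤ 1 → ball x0 R ⊆ Ω → Ioo (t0 - R^2) t0 ⊆ Ioo 0 T →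
    _root_.fF f x0 t0 R ≤ φ * pw R (1 + γ) := by
  obtain ⟨m, hm, hK⟩ := h.fF
  set K := ∫⁻ t in Ioo 0 T, ∫⁻ x in Ω, ‖f x t‖ₑ ^ m with hKd
  have hm0 : 0 < m := by linarith
  have hθ0 : 0 < 2/m := by positivity
  have hθ1 : 2/m < 1 := by rw [div_lt_one hm0]; linarith
  have hγ : 0 < 2 - 5/m := by
    have : 5/m < 2 := by rw [div_lt_iff₀ hm0]; linarith
    linarith
  set κ : ℝ≥0∞ := K ^ (1/m) * (cvol:ℝ≥0∞) ^ ((1-2/m)/2) with hκ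
  have hκt : κ ≠ ∞ := by
    refine mul_ne_top (rpow_ne_top_of_nonneg (by positivity) hK.ne) (rpow_ne_top_of_nonneg (by linarith) (by simp))
  refine ⟨min (2-5/m) (1/4), lt_min hγ (by norm_num), min_le_right _ _, κ.toNNReal, fun x0 t0 R hR hR1 hB hI => ?_⟩
  rw [coe_toNNReal hκt]
  have hI' : mI t0 R ≤ volume.restrict (Ioo 0 T) := restrict_mono hI le_rfl
  have hf := h.mf
  have hmm : Measurable (fun t => ∫⁻ x in ball x0 R, ‖f x t‖ₑ ^ m) := by
    have h1 : Measurable (fun z : V3 × ℝ => ‖f z.1 z.2‖ₑ ^ m) := hf.enorm.pow_const m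
    exact h1.lintegral_prod_left' (μ := volume.restrict (ball x0 R))
  have hVt : mB x0 R univ ^ (1 - 2/m) ≠ ∞ := rpow_ne_top_of_nonneg (by linarith) (mB_lt_top x0 R).ne
  have k1 : ∫⁻ t, aN f x0 R t ^ 2 ∂(mI t0 R) ≤ (K ^ (2/m) * pw R (2 * (1-2/m))) * mB x0 R univ ^ (1 - 2/m) := by
    calc ∫⁻ t, aN f x0 R t ^ 2 ∂(mI t0 R) ≤ ∫⁻ t, (∫⁻ x in ball x0 R, ‖f x t‖ₑ ^ m) ^ (2/m) * mB x0 R univ ^ (1 - 2/m) ∂(mI t0 R) := by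
          refine lintegral_mono fun t => ?_
          unfold aN
          rw [n2_sq]
          have := holder1 (μ := mB x0 R) ((meas_slice hf t).enorm.pow_const m) hθ0 hθ1
          simp_rw [← rpow_mul] at this
          rw [mul_div_cancel₀ _ hm0.ne'] at this
          simpa using this
      _ = (∫⁻ t, (∫⁻ x in ball x0 R, ‖f x t‖ₑ ^ m) ^ (2/m) ∂(mI t0 R)) * mB x0 R univ ^ (1 - 2/m) := lintegral_mul_const' _ _ hVt
      _ ≤ _ := by
          refine mul_le_mul_left ((holder1 hmm hθ0 hθ1).trans ?_) _
          rw [mI_univ hR, pw_rpow hR _ _ (by linarith)]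
          refine mul_le_mul_left (rpow_le_rpow ?_ hθ0.le) _
          exact (lintegral_mono fun t => lintegral_mono_set hB).trans (lintegral_mono' hI' le_rfl)
  have k2 : n2 (mI t0 R) (fun t => aN f x0 R t) ≤ κ * pw R (5/2 - 5/m) := by
    unfold n2
    refine (rpow_le_rpow k1 (by norm_num)).trans_eq ?_
    have e1 : (mB x0 R univ : ℝ≥0∞) = cvol * pw R 3 := by
      rw [mB_univ x0 R hR]; unfold pw; norm_cast
    rw [e1, mul_rpow_of_nonneg _ _ (by norm_num), mul_rpow_of_nonneg _ _ (by norm_num), mul_rpow_of_nonneg _ _ (by linarith),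
      mul_rpow_of_nonneg _ _ (by norm_num), pw_rpow hR _ _ (by norm_num), pw_rpow hR _ _ (by linarith), pw_rpow hR _ _ (by norm_num),
      ← rpow_mul, ← rpow_mul, hκ]
    rw [show 2/m * (1/2) = 1/m by ring, show (1-2/m) * (1/2) = (1-2/m)/2 by ring]
    calc _ = K ^ (1/m) * (cvol:ℝ≥0∞) ^ ((1-2/m)/2) * (pw R (2 * (1 - 2/m) * (1/2)) * pw R (3 * (1-2/m) * (1/2))) := by ring
      _ = _ := by rw [pw_mul hR]; congr 2; ring
  unfold _root_.fF
  calc _ ≤ pw R (1/2) * (κ * pw R (5/2 - 5/m)) := mul_le_mul_right k2 _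
    _ = κ * (pw R (1/2) * pw R (5/2 - 5/m)) := by ring
    _ = κ * pw R (1 + (2 - 5/m)) := by rw [pw_mul hR]; congr 2; ring
    _ ≤ _ := by
      refine mul_le_mul_right ?_ _
      unfold pw
      refine ofReal_le_ofReal (Real.rpow_le_rpow_of_exponent_ge hR hR1 ?_)
      have := min_le_left (2-5/m) (1/4)
      linarith
end
end

section

/-- one dimensional cutoff -/
def hb (u : ℝ) : ℝ := smoothTransition (2 - 4 * u)

lemma hb_smooth : Smooth hb := by
  unfold hb
  exact smoothTransition.contDiff.comp (by fun_prop)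
lemma hb_one {u : ℝ} (h : u ≤ 1/4) : hb u = 1 := smoothTransition.one_of_one_le (by linarith)
lemma hb_zero {u : ℝ} (h : 1/2 ≤ u) : hb u = 0 := smoothTransition.zero_of_nonpos (by linarith)
lemma hb_nonneg (u : ℝ) : 0 ≤ hb u := smoothTransition.nonneg _
lemma hb_le (u : ℝ) : hb u ≤ 1 := smoothTransition.le_one _

def hb1 : ℝ → ℝ := deriv hb
def hb2 : ℝ → ℝ := deriv hb1
lemma hb1_smooth : Smooth hb1 := by
  have := (contDiff_infty_iff_deriv.1 hb_smooth).2
  exact this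
lemma hb2_smooth : Smooth hb2 := (contDiff_infty_iff_deriv.1 hb1_smooth).2
lemma hb_deriv (u : ℝ) : HasDerivAt hb (hb1 u) u := (hb_smooth.differentiable (by simp)).differentiableAt.hasDerivAt
lemma hb1_deriv (u : ℝ) : HasDerivAt hb1 (hb2 u) u := (hb1_smooth.differentiable (by simp)).differentiableAt.hasDerivAt

lemma hb1_zero {u : ℝ} (h : u < 1/4 ∨ 1/2 < u) : hb1 u = 0 := by
  rcases h with h | h
  · have : hb =ᶠ[𝓝 u] fun _ => (1:ℝ) := by
      filter_upwards [Iio_mem_nhds h] with y hy using hb_one (le_of_lt hy)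
    unfold hb1; rw [this.deriv_eq]; simp
  · have : hb =ᶠ[𝓝 u] fun _ => (0:ℝ) := by
      filter_upwards [Ioi_mem_nhds h] with y hy using hb_zero (le_of_lt hy)
    unfold hb1; rw [this.deriv_eq]; simp
lemma hb2_zero {u : ℝ} (h : u < 1/4 ∨ 1/2 < u) : hb2 u = 0 := by
  have : hb1 =ᶠ[𝓝 u] fun _ => (0:ℝ) := by
    rcases h with h | h
    · filter_upwards [Iio_mem_nhds h] with y hy using hb1_zero (Or.inl hy)
    · filter_upwards [Ioi_mem_nhds h] with y hy using hb1_zero (Or.inr hy)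
  unfold hb2; rw [this.deriv_eq]; simp

lemma hb_bdd : ∃ K : ℝ, 1 ≤ K ∧ ∀ u, |hb1 u| ≤ K ∧ |hb2 u| ≤ K := by
  obtain ⟨K1, h1⟩ := (isCompact_Icc (a := (1/4:ℝ)) (b := 1/2)).exists_bound_of_continuousOn hb1_smooth.continuous.continuousOn
  obtain ⟨K2, h2⟩ := (isCompact_Icc (a := (1/4:ℝ)) (b := 1/2)).exists_bound_of_continuousOn hb2_smooth.continuous.continuousOn
  refine ⟨max 1 (max K1 K2), le_max_left _ _, fun u => ?_⟩
  by_cases hu : u ∈ Icc (1/4:ℝ) (1/2)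
  · exact ⟨(h1 u hu).trans (by simp), (h2 u hu).trans (by simp)⟩
  · have : u < 1/4 ∨ 1/2 < u := by
      by_contra hc
      push Not at hc
      exact hu ⟨hc.1, hc.2⟩
    rw [hb1_zero this, hb2_zero this]
    simp

/-- radial gaussian profile -/
def gam (σ ρ : ℝ) : ℝ := σ ^ (-(3/2) : ℝ) * exp (-ρ / (4 * σ))

lemma gam_pos {σ : ℝ} (hσ : 0 < σ) (ρ : ℝ) : 0 < gam σ ρ := by unfold gam; positivity

lemma gam_deriv (σ ρ : ℝ) : HasDerivAt (gam σ) (-(gam σ ρ / (4 * σ))) ρ := by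
  unfold gam
  have h1 : HasDerivAt (fun ρ : ℝ => -ρ / (4 * σ)) (-1 / (4 * σ)) ρ := ((hasDerivAt_id ρ).neg).div_const _
  exact (h1.exp.const_mul (σ ^ (-(3/2) : ℝ))).congr_deriv (by ring)

lemma gam_deriv_s {σ0 t s ρ : ℝ} (hσ : 0 < σ0 + (t - s)) : HasDerivAt (fun s => gam (σ0 + (t - s)) ρ)
    (gam (σ0 + (t - s)) ρ * (3/2 / (σ0 + (t - s)) - ρ / (4 * (σ0 + (t - s)) ^ 2))) s := by
  unfold gam
  set σ := σ0 + (t - s) with hσd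
  have h0 : HasDerivAt (fun s => σ0 + (t - s)) (-1) s := by
    have := ((hasDerivAt_id s).const_sub t).const_add σ0
    simpa using this
  have h1 : HasDerivAt (fun s => (σ0 + (t - s)) ^ (-(3/2):ℝ)) ((-1) * (-(3/2)) * σ ^ (-(3/2) - 1 : ℝ)) s :=
    h0.rpow_const (Or.inl hσ.ne')
  have h2 : HasDerivAt (fun s => -ρ / (4 * (σ0 + (t - s)))) (-(ρ / (4 * σ ^ 2))) s := by
    have := (h0.const_mul 4).fun_inv (by positivity)
    have := this.const_mul (-ρ)
    simp only [← div_eq_mul_inv] at this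
    refine this.congr_deriv ?_
    rw [← hσd]
    field_simp
  refine (h1.fun_mul h2.exp).congr_deriv ?_
  rw [Real.rpow_sub_one hσ.ne', ← hσd]
  ring

/-- key gaussian bounds -/
lemma gam_bound {σ ρ d : ℝ} (hσ : 0 < σ) (hρ : 0 ≤ ρ) (hd : 0 < d) (h : d ^ 2 ≤ σ + ρ) :
    gam σ ρ ≤ 1728 * d⁻¹ ^ 3 ∧ gam σ ρ / σ ≤ 1728 * d⁻¹ ^ 5 := by
  set y := ρ / σ with hy
  have hy0 : 0 ≤ y := by positivity
  have e1 : -ρ / (4 * σ) = -(y / 4) := by rw [hy]; field_simp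
  have k1 : (1 + y) ^ 3 * exp (-(y/4)) ≤ 1728 := by
    have a1 : 1 + y ≤ 12 * exp (y/12) := by
      have := Real.add_one_le_exp (y/12)
      nlinarith
    have a2 : (1 + y) ^ 3 ≤ (12 * exp (y/12)) ^ 3 := pow_le_pow_left₀ (by positivity) a1 3
    have a3 : (12 * exp (y/12)) ^ 3 * exp (-(y/4)) = 1728 := by
      rw [mul_pow, ← Real.exp_nat_mul, mul_assoc, ← Real.exp_add]
      norm_num
      ring
    rw [← a3]
    exact mul_le_mul_of_nonneg_right a2 (Real.exp_pos _).le
  have hs : σ * (1 + y) = σ + ρ := by rw [hy]; field_simp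
  have hg : d ≤ sqrt σ * sqrt (1 + y) := by
    rw [← Real.sqrt_mul hσ.le, hs]
    exact Real.le_sqrt_of_sq_le h
  have er : σ ^ (-(3/2):ℝ) = (sqrt σ)⁻¹ ^ 3 := by
    rw [sqrt_eq_rpow, ← rpow_neg hσ.le, ← Real.rpow_natCast, ← Real.rpow_mul hσ.le]
    norm_num
  set w := sqrt σ with hw
  set z := sqrt (1 + y) with hz
  have hw0 : 0 < w := Real.sqrt_pos.2 hσ
  have hz1 : 1 ≤ z := by rw [hz, Real.one_le_sqrt]; linarith
  have hz0 : 0 < z := by linarith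
  have hz2 : z ^ 2 = 1 + y := sq_sqrt (by linarith)
  have hw2 : w ^ 2 = σ := sq_sqrt hσ.le
  have hwi : w⁻¹ ≤ d⁻¹ * z := by
    rw [inv_eq_one_div, div_le_iff₀ hw0]
    calc (1:ℝ) = d⁻¹ * d := by field_simp
      _ ≤ d⁻¹ * (w * z) := mul_le_mul_of_nonneg_left hg (by positivity)
      _ = _ := by ring
  have hE := Real.exp_pos (-(y/4))
  have k6 : z ^ 6 * exp (-(y/4)) ≤ 1728 := by
    calc _ = (z ^ 2) ^ 3 * exp (-(y/4)) := by ring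
      _ ≤ _ := by rw [hz2]; exact k1
  constructor
  · unfold gam
    rw [er, e1]
    calc w⁻¹ ^ 3 * exp (-(y/4)) ≤ (d⁻¹ * z) ^ 3 * exp (-(y/4)) := by gcongr
      _ = d⁻¹ ^ 3 * (z ^ 3 * exp (-(y/4))) := by ring
      _ ≤ d⁻¹ ^ 3 * (z ^ 6 * exp (-(y/4))) := by gcongr <;> norm_num
      _ ≤ d⁻¹ ^ 3 * 1728 := by gcongr
      _ = _ := by ring
  · unfold gam
    rw [er, e1]
    calc w⁻¹ ^ 3 * exp (-(y/4)) / σ = w⁻¹ ^ 5 * exp (-(y/4)) := by rw [← hw2]; field_simp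
      _ ≤ (d⁻¹ * z) ^ 5 * exp (-(y/4)) := by gcongr
      _ = d⁻¹ ^ 5 * (z ^ 5 * exp (-(y/4))) := by ring
      _ ≤ d⁻¹ ^ 5 * (z ^ 6 * exp (-(y/4))) := by gcongr <;> norm_num
      _ ≤ d⁻¹ ^ 5 * 1728 := by gcongr
      _ = _ := by ring

lemma gam_lower {σ ρ r : ℝ} (hr : 0 < r) (h1 : r ^ 2 ≤ σ) (h2 : σ ≤ 2 * r ^ 2) (h3 : ρ ≤ r ^ 2) :
    1/8 * r⁻¹ ^ 3 ≤ gam σ ρ := by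
  have hσ : 0 < σ := lt_of_lt_of_le (by positivity) h1
  have er : (4 * r ^ 2) ^ (-(3/2):ℝ) = (2 * r)⁻¹ ^ 3 := by
    rw [show 4 * r ^ 2 = (2 * r) ^ 2 by ring, ← Real.rpow_natCast (2 * r) 2, ← Real.rpow_mul (by positivity), inv_pow, ← Real.rpow_natCast (2*r) 3, ← rpow_neg (by positivity)]
    norm_num
  have er2 : (2 * r ^ 2) ^ (-(3/2):ℝ) = (2:ℝ) ^ ((3/2):ℝ) * (4 * r ^ 2) ^ (-(3/2):ℝ) := by
    rw [show 2 * r ^ 2 = 2⁻¹ * (4 * r ^ 2) by ring, Real.mul_rpow (by norm_num) (by positivity), Real.inv_rpow (by norm_num), rpow_neg (by norm_num), inv_inv]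
  have k1 : (2 * r ^ 2) ^ (-(3/2):ℝ) ≤ σ ^ (-(3/2):ℝ) := Real.rpow_le_rpow_of_nonpos hσ h2 (by norm_num)
  have k2 : (3/4:ℝ) ≤ exp (-ρ / (4 * σ)) := by
    have := Real.add_one_le_exp (-ρ / (4 * σ))
    have h4 : ρ / (4 * σ) ≤ 1/4 := by rw [div_le_iff₀ (by positivity)]; linarith
    have h5 : -ρ / (4 * σ) = -(ρ / (4 * σ)) := by ring
    linarith
  have k3 : (2:ℝ) ≤ 2 ^ ((3/2):ℝ) := by
    calc (2:ℝ) = 2 ^ (1:ℝ) := by simp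
      _ ≤ _ := Real.rpow_le_rpow_of_exponent_le (by norm_num) (by norm_num)
  unfold gam
  rw [er2, er] at k1
  have hp : 0 < (2 * r)⁻¹ ^ 3 := by positivity
  calc 1/8 * r⁻¹ ^ 3 = 1 * (2 * r)⁻¹ ^ 3 := by rw [mul_inv]; ring
    _ ≤ (2 * (2 * r)⁻¹ ^ 3) * (3/4) := by nlinarith
    _ ≤ σ ^ (-(3/2):ℝ) * exp (-ρ / (4 * σ)) := by
      refine mul_le_mul (le_trans ?_ k1) k2 (by norm_num) (by positivity)
      exact mul_le_mul_of_nonneg_right k3 hp.le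

/-! radial functions -/
lemma nsq_fderiv (x0 y : V3) : HasFDerivAt (fun y : V3 => ‖y - x0‖ ^ 2) (2 • innerSL ℝ (y - x0)) y := by
  have := (hasStrictFDerivAt_norm_sq (y - x0)).hasFDerivAt.comp y ((hasFDerivAt_id y).sub_const x0)
  exact this.congr_fderiv (by ext; simp)

lemma rad_fderiv {g : ℝ → ℝ} {g' : ℝ} {x0 y : V3} (h : HasDerivAt g g' (‖y - x0‖ ^ 2)) :
    HasFDerivAt (fun y : V3 => g (‖y - x0‖ ^ 2)) (g' • (2 • innerSL ℝ (y - x0))) y :=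
  h.comp_hasFDerivAt y (nsq_fderiv x0 y)

lemma lap3_rad {g g1 g2 : ℝ → ℝ} (h1 : ∀ ρ, HasDerivAt g (g1 ρ) ρ) (h2 : ∀ ρ, HasDerivAt g1 (g2 ρ) ρ) (x0 x : V3) :
    lap3 (fun y => g (‖y - x0‖ ^ 2)) x = 4 * ‖x - x0‖ ^ 2 * g2 (‖x - x0‖ ^ 2) + 6 * g1 (‖x - x0‖ ^ 2) := by
  unfold lap3
  have e : ∀ i : Fin 3, fderiv ℝ (fun y => fderiv ℝ (fun y => g (‖y - x0‖ ^ 2)) y (e3 i)) x (e3 i) =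
      4 * g2 (‖x - x0‖ ^ 2) * ((x - x0) i) ^ 2 + 2 * g1 (‖x - x0‖ ^ 2) := by
    intro i
    have e1 : (fun y => fderiv ℝ (fun y => g (‖y - x0‖ ^ 2)) y (e3 i)) = fun y => g1 (‖y - x0‖ ^ 2) * (2 * (y i - x0 i)) := by
      funext y
      rw [(rad_fderiv (h1 _)).fderiv]
      simp [e3, EuclideanSpace.inner_single_right]
    rw [e1]
    have d2 : HasFDerivAt (fun y : V3 => 2 * (y i - x0 i)) ((2:ℝ) • (EuclideanSpace.proj i : V3 →L[ℝ] ℝ)) x := by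
      have := ((EuclideanSpace.proj i : V3 →L[ℝ] ℝ).hasFDerivAt (x := x)).sub_const (x0 i)
      exact this.const_mul 2
    rw [((rad_fderiv (h2 _)).fun_mul d2).fderiv]
    simp [e3, EuclideanSpace.inner_single_right]
    ring
  simp_rw [e]
  rw [sum_add_distrib, ← mul_sum, EuclideanSpace.norm_sq_eq]
  simp
  ring
end

section

lemma gam_smooth_rad {σ : ℝ} (x0 : V3) : Smooth (fun y : V3 => gam σ (‖y - x0‖ ^ 2)) := by
  unfold gam
  have : Smooth (fun y : V3 => ‖y - x0‖ ^ 2) := (contDiff_id.sub contDiff_const).norm_sq ℝ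
  exact contDiff_const.mul ((this.neg.div_const _).exp)

/-- shells -/
def shell (x0 : V3) (r σ a b : ℝ) (y : V3) : ℝ :=
  (a * hb (4 * ‖y - x0‖ ^ 2 / r ^ 2) - b * hb (16 * ‖y - x0‖ ^ 2 / r ^ 2)) * gam σ (‖y - x0‖ ^ 2)

lemma shell_zero {x0 : V3} {r σ a b : ℝ} (hr : 0 < r) {y : V3} (hy : r ^ 2 / 8 ≤ ‖y - x0‖ ^ 2) : shell x0 r σ a b y = 0 := by
  unfold shell
  rw [hb_zero, hb_zero]
  · ring
  · rw [le_div_iff₀ (by positivity)]; nlinarith [sq_nonneg r]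
  · rw [le_div_iff₀ (by positivity)]; linarith

lemma shell_smooth (x0 : V3) (r σ a b : ℝ) : Smooth (shell x0 r σ a b) := by
  unfold shell
  have h0 : Smooth (fun y : V3 => ‖y - x0‖ ^ 2) := (contDiff_id.sub contDiff_const).norm_sq ℝ
  have h1 : Smooth (fun y : V3 => hb (4 * ‖y - x0‖ ^ 2 / r ^ 2)) := hb_smooth.comp ((contDiff_const.mul h0).div_const _)
  have h2 : Smooth (fun y : V3 => hb (16 * ‖y - x0‖ ^ 2 / r ^ 2)) := hb_smooth.comp ((contDiff_const.mul h0).div_const _)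
  exact ((contDiff_const.mul h1).sub (contDiff_const.mul h2)).mul (gam_smooth_rad x0)

lemma shell_off {x0 : V3} {r σ a b : ℝ} (hr : 0 < r) {y : V3} (hy : y ∉ ball x0 (r/2)) :
    shell x0 r σ a b y = 0 ∧ fderiv ℝ (shell x0 r σ a b) y = 0 := by
  have h1 : r / 2 ≤ ‖y - x0‖ := by simpa [dist_eq_norm] using hy
  have h2 : r ^ 2 / 8 < ‖y - x0‖ ^ 2 := by
    have : (r/2)^2 ≤ ‖y - x0‖ ^ 2 := pow_le_pow_left₀ (by positivity) h1 2
    nlinarith [sq_pos_of_pos hr]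
  refine ⟨shell_zero hr h2.le, ?_⟩
  have : shell x0 r σ a b =ᶠ[𝓝 y] fun _ => (0:ℝ) := by
    have hc : Continuous (fun y : V3 => ‖y - x0‖ ^ 2) := by fun_prop
    filter_upwards [hc.continuousAt.preimage_mem_nhds (Ioi_mem_nhds h2)] with w hw
    exact shell_zero hr (le_of_lt hw)
  rw [this.fderiv_eq]; simp

lemma shell_test {x0 : V3} {r σ a b : ℝ} (hr : 0 < r) {U : Set V3} (hU : ball x0 r ⊆ U) : IsSpaceTest U (shell x0 r σ a b) := by
  have hs : tsupport (shell x0 r σ a b) ⊆ closedBall x0 (r/2) := by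
    refine closure_minimal ?_ isClosed_closedBall
    intro y hy
    by_contra hc
    exact hy (shell_off hr (fun h => hc (ball_subset_closedBall h))).1
  refine ⟨shell_smooth _ _ _ _ _, ?_, hs.trans ((closedBall_subset_ball (by linarith)).trans hU)⟩
  exact (isCompact_closedBall x0 (r/2)).of_isClosed_subset (isClosed_tsupport _) hs

lemma shell_bound : ∃ C : ℝ, 0 < C ∧ ∀ (x0 : V3) (r σ a b : ℝ), 0 < r → 0 < σ → 0 ≤ a → a ≤ 1 → 0 ≤ b → b ≤ 1 →
    (σ < r ^ 2 / 64 → a = b) → ∀ y, |shell x0 r σ a b y| ≤ C * r⁻¹ ^ 3 ∧ ‖fderiv ℝ (shell x0 r σ a b) y‖ ≤ C * r⁻¹ ^ 4 := by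
  obtain ⟨K, hK, hKb⟩ := hb_bdd
  set L : ℝ := 1728 * 8 ^ 5 with hL
  refine ⟨21 * K * L, by positivity, fun x0 r σ a b hr hσ ha ha1 hb0 hb1' hab y => ?_⟩
  by_cases hy : y ∈ ball x0 (r/2)
  swap
  · rw [(shell_off hr hy).1, (shell_off hr hy).2]
    simp; constructor <;> positivity
  have hyn : ‖y - x0‖ ≤ r / 2 := by
    have := mem_ball.1 hy
    rw [dist_eq_norm] at this; exact this.le
  by_cases hc : σ + ‖y - x0‖ ^ 2 < r ^ 2 / 64
  · have hab' := hab (by nlinarith [sq_nonneg ‖y - x0‖])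
    have hz : shell x0 r σ a b =ᶠ[𝓝 y] fun _ => (0:ℝ) := by
      have hcn : Continuous (fun y : V3 => ‖y - x0‖ ^ 2) := by fun_prop
      filter_upwards [hcn.continuousAt.preimage_mem_nhds (Iio_mem_nhds (by linarith : ‖y - x0‖ ^ 2 < r ^ 2 / 64))] with w hw
      have hw' : ‖w - x0‖ ^ 2 < r ^ 2 / 64 := hw
      unfold shell
      rw [hb_one, hb_one, hab']
      · ring
      · rw [div_le_iff₀ (by positivity)]; linarith
      · rw [div_le_iff₀ (by positivity)]; nlinarith [sq_nonneg ‖w - x0‖]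
    rw [hz.eq_of_nhds, hz.fderiv_eq]
    simp; constructor <;> positivity
  · push Not at hc
    obtain ⟨g1, g2⟩ := gam_bound (d := r / 8) hσ (sq_nonneg ‖y - x0‖) (by positivity) (by nlinarith)
    have hgp := gam_pos hσ (‖y - x0‖ ^ 2)
    set G := gam σ (‖y - x0‖ ^ 2) with hG
    set q := r⁻¹ with hq
    have hq0 : 0 < q := by positivity
    have hrq : r * q = 1 := by rw [hq]; field_simp
    have eq8 : (r / 8)⁻¹ = 8 * q := by rw [hq]; field_simp
    rw [eq8] at g1 g2
    have g1' : G ≤ L * q ^ 3 := g1.trans (by rw [hL]; nlinarith [pow_pos hq0 3])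
    have g2' : G / σ ≤ L * q ^ 5 := g2.trans (by rw [hL]; nlinarith [pow_pos hq0 5])
    have hr2 : ∀ c ρ : ℝ, c * ρ / r ^ 2 = c * q ^ 2 * ρ := by intro c ρ; rw [hq]; field_simp
    have bd : |a * hb (4 * ‖y - x0‖ ^ 2 / r ^ 2) - b * hb (16 * ‖y - x0‖ ^ 2 / r ^ 2)| ≤ 1 := by
      have h1 := hb_nonneg (4 * ‖y - x0‖ ^ 2 / r ^ 2)
      have h2 := hb_le (4 * ‖y - x0‖ ^ 2 / r ^ 2)
      have h3 := hb_nonneg (16 * ‖y - x0‖ ^ 2 / r ^ 2)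
      have h4 := hb_le (16 * ‖y - x0‖ ^ 2 / r ^ 2)
      rw [abs_le]
      constructor <;> nlinarith [mul_nonneg ha h1, mul_nonneg hb0 h3, mul_le_one₀ ha1 h1 h2, mul_le_one₀ hb1' h3 h4]
    have hL0 : 0 < L := by positivity
    constructor
    · unfold shell
      rw [abs_mul, abs_of_pos hgp]
      calc _ ≤ 1 * (L * q ^ 3) := mul_le_mul bd g1' hgp.le (by norm_num)
        _ ≤ 21 * K * L * q ^ 3 := by nlinarith [mul_pos hL0 (pow_pos hq0 3)]
    · have dh : ∀ c ρ : ℝ, HasDerivAt (fun ρ => hb (c * ρ / r ^ 2)) (hb1 (c * ρ / r ^ 2) * (c * q ^ 2)) ρ := by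
        intro c ρ
        have i1 : HasDerivAt (fun ρ => c * ρ / r ^ 2) (c * q ^ 2) ρ := by
          refine (((hasDerivAt_id ρ).const_mul c).div_const (r ^ 2)).congr_deriv ?_
          rw [hq]; field_simp
        exact (hb_deriv _).comp ρ i1
      set ρ := ‖y - x0‖ ^ 2 with hρ
      have dd : HasDerivAt (fun ρ => (a * hb (4 * ρ / r ^ 2) - b * hb (16 * ρ / r ^ 2)) * gam σ ρ)
          ((a * (hb1 (4 * ρ / r ^ 2) * (4 * q ^ 2)) - b * (hb1 (16 * ρ / r ^ 2) * (16 * q ^ 2))) * G +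
            (a * hb (4 * ρ / r ^ 2) - b * hb (16 * ρ / r ^ 2)) * (-(G / (4 * σ)))) ρ :=
        HasDerivAt.fun_mul (((dh 4 ρ).const_mul a).fun_sub ((dh 16 ρ).const_mul b)) (gam_deriv σ ρ)
      have df := rad_fderiv (x0 := x0) (y := y) dd
      have e : fderiv ℝ (shell x0 r σ a b) y = _ := df.fderiv
      rw [e, norm_smul]
      have n1 : ‖(2 • innerSL ℝ (y - x0) : V3 →L[ℝ] ℝ)‖ ≤ r := by
        calc _ ≤ 2 * ‖innerSL ℝ (y - x0)‖ := by simpa using norm_nsmul_le (n := 2) (a := innerSL ℝ (y - x0))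
          _ = 2 * ‖y - x0‖ := by rw [innerSL_apply_norm]
          _ ≤ r := by linarith
      have n2' : ‖(a * (hb1 (4 * ρ / r ^ 2) * (4 * q ^ 2)) - b * (hb1 (16 * ρ / r ^ 2) * (16 * q ^ 2))) * G +
            (a * hb (4 * ρ / r ^ 2) - b * hb (16 * ρ / r ^ 2)) * (-(G / (4 * σ)))‖ ≤ 21 * K * L * q ^ 5 := by
        have t1 : |a * (hb1 (4 * ρ / r ^ 2) * (4 * q ^ 2))| ≤ 1 * (K * (4 * q ^ 2)) := by
          rw [abs_mul, abs_mul, abs_of_nonneg ha, abs_of_pos (by positivity : (0:ℝ) < 4 * q ^ 2)]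
          exact mul_le_mul ha1 (mul_le_mul_of_nonneg_right (hKb _).1 (by positivity)) (by positivity) (by norm_num)
        have t2 : |b * (hb1 (16 * ρ / r ^ 2) * (16 * q ^ 2))| ≤ 1 * (K * (16 * q ^ 2)) := by
          rw [abs_mul, abs_mul, abs_of_nonneg hb0, abs_of_pos (by positivity : (0:ℝ) < 16 * q ^ 2)]
          exact mul_le_mul hb1' (mul_le_mul_of_nonneg_right (hKb _).1 (by positivity)) (by positivity) (by norm_num)
        have t3 : |a * (hb1 (4 * ρ / r ^ 2) * (4 * q ^ 2)) - b * (hb1 (16 * ρ / r ^ 2) * (16 * q ^ 2))| ≤ 20 * K * q ^ 2 := by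
          refine (abs_sub _ _).trans ?_
          linarith
        rw [norm_eq_abs]
        refine (abs_add_le _ _).trans ?_
        rw [abs_mul, abs_mul, abs_of_pos hgp, abs_neg, abs_of_pos (by positivity : 0 < G / (4 * σ))]
        have u1 : |a * (hb1 (4 * ρ / r ^ 2) * (4 * q ^ 2)) - b * (hb1 (16 * ρ / r ^ 2) * (16 * q ^ 2))| * G ≤ 20 * K * q ^ 2 * (L * q ^ 3) :=
          mul_le_mul t3 g1' hgp.le (by positivity)
        have u2 : |a * hb (4 * ρ / r ^ 2) - b * hb (16 * ρ / r ^ 2)| * (G / (4 * σ)) ≤ 1 * (L * q ^ 5) := by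
          refine mul_le_mul bd (le_trans ?_ g2') (by positivity) (by norm_num)
          rw [div_le_div_iff₀ (by positivity) hσ]
          nlinarith [mul_pos hgp hσ]
        nlinarith [mul_pos hL0 (pow_pos hq0 5)]
      calc _ ≤ (21 * K * L * q ^ 5) * r := mul_le_mul n2' n1 (norm_nonneg _) (by positivity)
        _ = 21 * K * L * q ^ 4 * (r * q) := by ring
        _ = _ := by rw [hrq, mul_one]

/-- slice estimate -/
lemma slice_est {U : Set V3} {u : V3 → V3} {w : V3 → ℝ} (mu : Measurable u) (mw : Measurable w)
    (hu : IntegrableOn u U)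
    (hdiv : ∀ φ : V3 → ℝ, IsSpaceTest U φ → ∫ x in U, fderiv ℝ φ x (u x) = 0) {ψ : ℕ → V3 → ℝ} {N : ℕ} {x0 : V3} {ρ : ℕ → ℝ} {D : ℕ → ℝ≥0∞}
    (hψ : ∀ k < N, IsSpaceTest U (ψ k)) (hb : ∀ k < N, ∀ y, ‖fderiv ℝ (ψ k) y‖ₑ ≤ D k)
    (hoff : ∀ k < N, ∀ y, y ∉ ball x0 (ρ k) → fderiv ℝ (ψ k) y = 0) (c : ℕ → ℝ) {φ : V3 → ℝ} (hφ : ∀ y, φ y = ∑ k ∈ range N, ψ k y) :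
    ‖∫ x in U, w x * fderiv ℝ φ x (u x)‖ₑ ≤ ∑ k ∈ range N, D k * ∫⁻ x in ball x0 (ρ k), ‖w x - c k‖ₑ * ‖u x‖ₑ := by
  by_cases htop : ∑ k ∈ range N, D k * ∫⁻ x in ball x0 (ρ k), ‖w x - c k‖ₑ * ‖u x‖ₑ = ⊤
  · rw [htop]; exact le_top
  have hfd : ∀ x, fderiv ℝ φ x (u x) = ∑ k ∈ range N, fderiv ℝ (ψ k) x (u x) := by
    intro x
    have : φ = fun y => ∑ k ∈ range N, ψ k y := funext hφ
    rw [this, fderiv_fun_sum]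
    · rw [sum_apply]
    · intro k hk
      exact ((hψ k (mem_range.1 hk)).1.differentiable (by simp)).differentiableAt
  have hm : ∀ k < N, Measurable fun x => fderiv ℝ (ψ k) x (u x) := by
    intro k hk
    have : Continuous (fderiv ℝ (ψ k)) := (hψ k hk).1.continuous_fderiv (by simp)
    exact (isBoundedBilinearMap_apply.continuous.measurable.comp (this.measurable.prodMk mu))
  have hpt : ∀ k < N, ∀ x, ‖(w x - c k) * fderiv ℝ (ψ k) x (u x)‖ₑ ≤ (ball x0 (ρ k)).indicator (fun x => D k * (‖w x - c k‖ₑ * ‖u x‖ₑ)) x := by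
    intro k hk x
    by_cases hx : x ∈ ball x0 (ρ k)
    · rw [indicator_of_mem hx, enorm_mul]
      calc _ ≤ ‖w x - c k‖ₑ * (‖fderiv ℝ (ψ k) x‖ₑ * ‖u x‖ₑ) := mul_le_mul_right (ContinuousLinearMap.le_opENorm _ _) _
        _ ≤ ‖w x - c k‖ₑ * (D k * ‖u x‖ₑ) := mul_le_mul_right (mul_le_mul_left (hb k hk x) _) _
        _ = _ := by ring
    · rw [hoff k hk x hx]; simp
  have hle : ∀ k < N, ∫⁻ x in U, ‖(w x - c k) * fderiv ℝ (ψ k) x (u x)‖ₑ ≤ D k * ∫⁻ x in ball x0 (ρ k), ‖w x - c k‖ₑ * ‖u x‖ₑ := by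
    intro k hk
    calc _ ≤ ∫⁻ x in U, (ball x0 (ρ k)).indicator (fun x => D k * (‖w x - c k‖ₑ * ‖u x‖ₑ)) x := lintegral_mono (hpt k hk)
      _ ≤ ∫⁻ x, (ball x0 (ρ k)).indicator (fun x => D k * (‖w x - c k‖ₑ * ‖u x‖ₑ)) x := setLIntegral_le_lintegral _ _
      _ = ∫⁻ x in ball x0 (ρ k), D k * (‖w x - c k‖ₑ * ‖u x‖ₑ) := lintegral_indicator measurableSet_ball _
      _ = _ := lintegral_const_mul _ (by fun_prop)
  have i1 : ∀ k < N, IntegrableOn (fun x => (w x - c k) * fderiv ℝ (ψ k) x (u x)) U := by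
    intro k hk
    refine ⟨((mw.sub_const _).mul (hm k hk)).aestronglyMeasurable, lt_of_le_of_lt (hle k hk) ?_⟩
    exact lt_of_le_of_lt (Finset.single_le_sum (f := fun k => D k * ∫⁻ x in ball x0 (ρ k), ‖w x - c k‖ₑ * ‖u x‖ₑ) (fun _ _ => zero_le) (mem_range.2 hk)) (lt_top_iff_ne_top.2 htop)
  have i2 : ∀ k < N, IntegrableOn (fun x => c k * fderiv ℝ (ψ k) x (u x)) U := by
    intro k hk
    refine Integrable.const_mul ?_ _
    obtain ⟨B, hB⟩ := ((hψ k hk).1.continuous_fderiv (by simp)).bounded_above_of_compact_support ((hψ k hk).2.1.fderiv (𝕜 := ℝ))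
    refine (hu.norm.const_mul B).mono' (hm k hk).aestronglyMeasurable (of_forall fun x => ?_)
    exact (ContinuousLinearMap.le_opNorm _ _).trans (mul_le_mul_of_nonneg_right (hB x) (norm_nonneg _))
  have e1 : ∫ x in U, w x * fderiv ℝ φ x (u x) = ∑ k ∈ range N, ∫ x in U, (w x - c k) * fderiv ℝ (ψ k) x (u x) := by
    have : ∀ x, w x * fderiv ℝ φ x (u x) = ∑ k ∈ range N, ((w x - c k) * fderiv ℝ (ψ k) x (u x) + c k * fderiv ℝ (ψ k) x (u x)) := by
      intro x
      rw [hfd, mul_sum]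
      exact sum_congr rfl fun k _ => by ring
    rw [integral_congr_ae (of_forall this), integral_finsetSum]
    · refine sum_congr rfl fun k hk => ?_
      have hk' := mem_range.1 hk
      rw [integral_add (i1 k hk') (i2 k hk'), integral_const_mul, hdiv _ (hψ k hk'), mul_zero, add_zero]
    · intro k hk
      exact (i1 k (mem_range.1 hk)).add (i2 k (mem_range.1 hk))
  rw [e1]
  refine (enorm_sum_le _ _).trans (sum_le_sum fun k hk => ?_)
  exact (enorm_integral_le_lintegral_enorm _).trans (hle k (mem_range.1 hk))
end

section

def om (t0 e s : ℝ) : ℝ := smoothTransition ((t0 + e - s) / e)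

lemma om_one {t0 e s : ℝ} (he : 0 < e) (hs : s ≤ t0) : om t0 e s = 1 := by
  refine smoothTransition.one_of_one_le ?_
  rw [le_div_iff₀ he]; linarith
lemma om_zero {t0 e s : ℝ} (he : 0 < e) (hs : t0 + e ≤ s) : om t0 e s = 0 := by
  refine smoothTransition.zero_of_nonpos ?_
  exact div_nonpos_of_nonpos_of_nonneg (by linarith) he.le

def sg (t0 e σ0 s : ℝ) : ℝ := σ0 + (t0 - s) * om t0 e s

lemma sg_pos {t0 e σ0 s : ℝ} (he : 0 < e) (h2 : e < σ0) : 0 < sg t0 e σ0 s := by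
  unfold sg
  rcases le_or_gt s t0 with h | h
  · rw [om_one he h]; linarith
  rcases le_or_gt (t0 + e) s with h' | h'
  · rw [om_zero he h']; linarith
  · have a0 : 0 ≤ om t0 e s := smoothTransition.nonneg _
    have a1 : om t0 e s ≤ 1 := smoothTransition.le_one _
    nlinarith

/-- the test function -/
def tf (x0 : V3) (t0 R σ0 e : ℝ) (x : V3) (s : ℝ) : ℝ :=
  om t0 e s * hb (4 * (t0 - s) / R ^ 2) * (hb (4 * ‖x - x0‖ ^ 2 / R ^ 2) * gam (sg t0 e σ0 s) (‖x - x0‖ ^ 2))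

lemma om_smooth (t0 e : ℝ) : Smooth (om t0 e) := by
  unfold om
  exact smoothTransition.contDiff.comp (by fun_prop)

lemma tf_smooth {x0 : V3} {t0 R σ0 e : ℝ} (he : 0 < e) (h2 : e < σ0) :
    Smooth (fun z : V3 × ℝ => tf x0 t0 R σ0 e z.1 z.2) := by
  have h0 : Smooth (fun z : V3 × ℝ => ‖z.1 - x0‖ ^ 2) := (contDiff_fst.sub contDiff_const).norm_sq ℝ
  have ho : Smooth (fun z : V3 × ℝ => om t0 e z.2) := (om_smooth t0 e).comp contDiff_snd
  have hs : Smooth (fun z : V3 × ℝ => sg t0 e σ0 z.2) := by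
    unfold sg
    exact contDiff_const.add ((contDiff_const.sub contDiff_snd).mul ho)
  have h1 : Smooth (fun z : V3 × ℝ => hb (4 * (t0 - z.2) / R ^ 2)) :=
    hb_smooth.comp ((contDiff_const.mul (contDiff_const.sub contDiff_snd)).div_const _)
  have h3 : Smooth (fun z : V3 × ℝ => hb (4 * ‖z.1 - x0‖ ^ 2 / R ^ 2)) :=
    hb_smooth.comp ((contDiff_const.mul h0).div_const _)
  have h4 : Smooth (fun z : V3 × ℝ => gam (sg t0 e σ0 z.2) (‖z.1 - x0‖ ^ 2)) := by
    unfold gam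
    refine (hs.rpow_const_of_ne fun z => (sg_pos he h2).ne').mul ?_
    refine (h0.neg.div (contDiff_const.mul hs) fun z => ?_).exp
    have := sg_pos (s := z.2) (t0 := t0) he h2
    positivity
  exact (ho.mul h1).mul (h3.mul h4)

lemma tf_off {x0 : V3} {t0 R σ0 e : ℝ} (hR : 0 < R) (he : 0 < e) {x : V3} {s : ℝ}
    (h : ¬ (x ∈ closedBall x0 (R/2) ∧ s ∈ Icc (t0 - R ^ 2 / 8) (t0 + e))) : tf x0 t0 R σ0 e x s = 0 := by
  unfold tf
  by_cases h1 : x ∈ closedBall x0 (R/2)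
  · have h2 : s < t0 - R ^ 2 / 8 ∨ t0 + e < s := by
      by_contra hc
      push Not at hc
      exact h ⟨h1, hc.1, hc.2⟩
    rcases h2 with h2 | h2
    · rw [hb_zero (u := 4 * (t0 - s) / R ^ 2)]
      · ring
      · rw [le_div_iff₀ (by positivity)]; linarith
    · rw [om_zero he h2.le]; ring
  · have h2 : R / 2 < ‖x - x0‖ := by simpa [dist_eq_norm] using h1
    have h3 : (R/2)^2 ≤ ‖x - x0‖ ^ 2 := pow_le_pow_left₀ (by positivity) h2.le 2
    rw [hb_zero (u := 4 * ‖x - x0‖ ^ 2 / R ^ 2)]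
    · ring
    · rw [le_div_iff₀ (by positivity)]; nlinarith [sq_nonneg R]

lemma tf_test {x0 : V3} {t0 R σ0 e T : ℝ} {U : Set V3} (hR : 0 < R) (he : 0 < e) (h2 : e < σ0) (hU : ball x0 R ⊆ U)
    (ht : 0 ≤ t0 - R ^ 2) (hT : t0 + e < T) : IsTimeSpaceTest U (Ioo 0 T) (tf x0 t0 R σ0 e) := by
  have hs : tsupport (fun z : V3 × ℝ => tf x0 t0 R σ0 e z.1 z.2) ⊆ closedBall x0 (R/2) ×ˢ Icc (t0 - R ^ 2 / 8) (t0 + e) := by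
    refine closure_minimal ?_ (isClosed_closedBall.prod isClosed_Icc)
    intro z hz
    by_contra hc
    exact hz (tf_off hR he hc)
  refine ⟨tf_smooth he h2, ?_, hs.trans (prod_mono ((closedBall_subset_ball (by linarith)).trans hU) ?_)⟩
  · exact ((isCompact_closedBall x0 (R/2)).prod isCompact_Icc).of_isClosed_subset (isClosed_tsupport _) hs
  · intro s hs
    have := sq_pos_of_pos hR
    exact ⟨by linarith [hs.1], by linarith [hs.2]⟩

lemma tf_nonneg {x0 : V3} {t0 R σ0 e : ℝ} (he : 0 < e) (h2 : e < σ0) (x : V3) (s : ℝ) : 0 ≤ tf x0 t0 R σ0 e x s := by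
  unfold tf
  have a0 : 0 ≤ om t0 e s := smoothTransition.nonneg _
  have := hb_nonneg (4 * (t0 - s) / R ^ 2)
  have := hb_nonneg (4 * ‖x - x0‖ ^ 2 / R ^ 2)
  have := gam_pos (sg_pos (s := s) (t0 := t0) he h2) (‖x - x0‖ ^ 2)
  positivity

lemma tf_eq {x0 : V3} {t0 R σ0 e : ℝ} (he : 0 < e) (x : V3) {s : ℝ} (hs : s ≤ t0) :
    tf x0 t0 R σ0 e x s = hb (4 * (t0 - s) / R ^ 2) * (hb (4 * ‖x - x0‖ ^ 2 / R ^ 2) * gam (σ0 + (t0 - s)) (‖x - x0‖ ^ 2)) := by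
  unfold tf sg
  rw [om_one he hs, one_mul, mul_one]

set_option maxHeartbeats 1000000 in
lemma tf_heat : ∃ C : ℝ, 0 < C ∧ ∀ (x0 : V3) (t0 R σ0 e : ℝ), 0 < R → 0 < e → e < σ0 → ∀ x s, s < t0 →
    |deriv (fun τ => tf x0 t0 R σ0 e x τ) s + lap3 (fun y => tf x0 t0 R σ0 e y s) x| ≤ C * R⁻¹ ^ 5 ∧
    (x ∉ ball x0 R → deriv (fun τ => tf x0 t0 R σ0 e x τ) s + lap3 (fun y => tf x0 t0 R σ0 e y s) x = 0) ∧
    (s ≤ t0 - R ^ 2 → deriv (fun τ => tf x0 t0 R σ0 e x τ) s + lap3 (fun y => tf x0 t0 R σ0 e y s) x = 0) := by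
  obtain ⟨K, hK, hKb⟩ := hb_bdd
  set L : ℝ := 1728 * 4 ^ 5 with hL
  refine ⟨40 * K * L, by positivity, fun x0 t0 R σ0 e hR he h2 x s hs => ?_⟩
  set q := R⁻¹ with hq
  have hq0 : 0 < q := by positivity
  set σ := σ0 + (t0 - s) with hσd
  have hσ : 0 < σ := by linarith
  have e1 : deriv (fun τ => tf x0 t0 R σ0 e x τ) s =
      (-(4 * q ^ 2) * hb1 (4 * (t0 - s) / R ^ 2)) * (hb (4 * ‖x - x0‖ ^ 2 / R ^ 2) * gam σ (‖x - x0‖ ^ 2)) +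
      hb (4 * (t0 - s) / R ^ 2) * (hb (4 * ‖x - x0‖ ^ 2 / R ^ 2) * (gam σ (‖x - x0‖ ^ 2) * (3/2 / σ - ‖x - x0‖ ^ 2 / (4 * σ ^ 2)))) := by
    have ev : (fun τ => tf x0 t0 R σ0 e x τ) =ᶠ[𝓝 s] fun s => hb (4 * (t0 - s) / R ^ 2) * (hb (4 * ‖x - x0‖ ^ 2 / R ^ 2) * gam (σ0 + (t0 - s)) (‖x - x0‖ ^ 2)) := by
      filter_upwards [Iio_mem_nhds hs] with τ hτ using tf_eq he x (le_of_lt hτ)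
    rw [ev.deriv_eq]
    have i1 : HasDerivAt (fun s => 4 * (t0 - s) / R ^ 2) (-(4 * q ^ 2)) s := by
      refine ((((hasDerivAt_id s).const_sub t0).const_mul 4).div_const (R ^ 2)).congr_deriv ?_
      rw [hq]; field_simp
    have i2 : HasDerivAt (fun s => hb (4 * (t0 - s) / R ^ 2)) (-(4 * q ^ 2) * hb1 (4 * (t0 - s) / R ^ 2)) s := by
      refine ((hb_deriv _).comp s i1).congr_deriv ?_
      ring
    exact (i2.fun_mul ((gam_deriv_s (σ0 := σ0) (t := t0) (s := s) (ρ := ‖x - x0‖ ^ 2) hσ).const_mul _)).deriv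
  have dh : ∀ ρ : ℝ, HasDerivAt (fun ρ => hb (4 * ρ / R ^ 2)) (4 * q ^ 2 * hb1 (4 * ρ / R ^ 2)) ρ := by
    intro ρ
    have i1 : HasDerivAt (fun ρ => 4 * ρ / R ^ 2) (4 * q ^ 2) ρ := by
      refine (((hasDerivAt_id ρ).const_mul 4).div_const (R ^ 2)).congr_deriv ?_
      rw [hq]; field_simp
    exact ((hb_deriv _).comp ρ i1).congr_deriv (by ring)
  have dh1 : ∀ ρ : ℝ, HasDerivAt (fun ρ => hb1 (4 * ρ / R ^ 2)) (4 * q ^ 2 * hb2 (4 * ρ / R ^ 2)) ρ := by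
    intro ρ
    have i1 : HasDerivAt (fun ρ => 4 * ρ / R ^ 2) (4 * q ^ 2) ρ := by
      refine (((hasDerivAt_id ρ).const_mul 4).div_const (R ^ 2)).congr_deriv ?_
      rw [hq]; field_simp
    exact ((hb1_deriv _).comp ρ i1).congr_deriv (by ring)
  set χ := hb (4 * (t0 - s) / R ^ 2) with hχ
  have D1 : ∀ ρ, HasDerivAt (fun ρ => χ * (hb (4 * ρ / R ^ 2) * gam σ ρ))
      (χ * (4 * q ^ 2 * hb1 (4 * ρ / R ^ 2) * gam σ ρ + hb (4 * ρ / R ^ 2) * (-(gam σ ρ / (4 * σ))))) ρ := by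
    intro ρ
    exact ((dh ρ).fun_mul (gam_deriv σ ρ)).const_mul χ
  have D2 : ∀ ρ, HasDerivAt (fun ρ => χ * (4 * q ^ 2 * hb1 (4 * ρ / R ^ 2) * gam σ ρ + hb (4 * ρ / R ^ 2) * (-(gam σ ρ / (4 * σ)))))
      (χ * ((4 * q ^ 2 * (4 * q ^ 2 * hb2 (4 * ρ / R ^ 2))) * gam σ ρ + (4 * q ^ 2 * hb1 (4 * ρ / R ^ 2)) * (-(gam σ ρ / (4 * σ)))
        + ((4 * q ^ 2 * hb1 (4 * ρ / R ^ 2)) * (-(gam σ ρ / (4 * σ))) + hb (4 * ρ / R ^ 2) * (-(-(gam σ ρ / (4 * σ)) / (4 * σ)))))) ρ := by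
    intro ρ
    exact ((((dh1 ρ).const_mul (4 * q ^ 2)).fun_mul (gam_deriv σ ρ)).fun_add
      ((dh ρ).fun_mul (((gam_deriv σ ρ).div_const (4 * σ)).fun_neg))).const_mul χ
  have e2 := lap3_rad D1 D2 x0 x
  rw [show (fun y => χ * (hb (4 * ‖y - x0‖ ^ 2 / R ^ 2) * gam σ (‖y - x0‖ ^ 2))) = (fun y => tf x0 t0 R σ0 e y s) from funext fun y => (tf_eq he y hs.le).symm] at e2
  set ρ := ‖x - x0‖ ^ 2 with hρ
  have hρ0 : 0 ≤ ρ := sq_nonneg _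
  set G := gam σ ρ with hG
  have hGp : 0 < G := gam_pos hσ _
  have e3' : deriv (fun τ => tf x0 t0 R σ0 e x τ) s + lap3 (fun y => tf x0 t0 R σ0 e y s) x =
      -(4 * q ^ 2) * hb1 (4 * (t0 - s) / R ^ 2) * hb (4 * ρ / R ^ 2) * G +
      χ * (64 * ρ * q ^ 4 * hb2 (4 * ρ / R ^ 2) * G - 8 * ρ * q ^ 2 * hb1 (4 * ρ / R ^ 2) * (G / σ) + 24 * q ^ 2 * hb1 (4 * ρ / R ^ 2) * G) := by
    rw [e1, e2]
    field_simp
    ring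
  have hρz : R ^ 2 / 8 < ρ → hb (4 * ρ / R ^ 2) = 0 ∧ hb1 (4 * ρ / R ^ 2) = 0 ∧ hb2 (4 * ρ / R ^ 2) = 0 := by
    intro h
    have : 1/2 < 4 * ρ / R ^ 2 := by rw [lt_div_iff₀ (by positivity)]; linarith
    exact ⟨hb_zero this.le, hb1_zero (Or.inr this), hb2_zero (Or.inr this)⟩
  refine ⟨?_, ?_, ?_⟩
  · rw [e3']
    have hχ0 : 0 ≤ χ := hb_nonneg _
    have hχ1 : χ ≤ 1 := hb_le _
    have key : R ^ 2 / 16 ≤ σ + ρ → G ≤ L * q ^ 3 ∧ G / σ ≤ L * q ^ 5 := by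
      intro h
      obtain ⟨g1, g2⟩ := gam_bound (d := R / 4) hσ hρ0 (by positivity) (by nlinarith)
      have eq8 : (R / 4)⁻¹ = 4 * q := by rw [hq]; field_simp
      rw [eq8] at g1 g2
      exact ⟨g1.trans (by rw [hL]; nlinarith [pow_pos hq0 3]), g2.trans (by rw [hL]; nlinarith [pow_pos hq0 5])⟩
    have hL0 : 0 < L := by positivity
    have b1 : |-(4 * q ^ 2) * hb1 (4 * (t0 - s) / R ^ 2) * hb (4 * ρ / R ^ 2) * G| ≤ 4 * K * L * q ^ 5 := by
      by_cases hc : 4 * (t0 - s) / R ^ 2 < 1/4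
      · rw [hb1_zero (Or.inl hc)]; simp; positivity
      · push Not at hc
        rw [le_div_iff₀ (by positivity)] at hc
        obtain ⟨g1, -⟩ := key (by linarith)
        rw [abs_mul, abs_mul, abs_mul, abs_neg, abs_of_pos hGp, abs_of_pos (by positivity : 0 < 4 * q ^ 2), abs_of_nonneg (hb_nonneg (4 * ρ / R ^ 2))]
        calc _ ≤ 4 * q ^ 2 * K * 1 * (L * q ^ 3) := by
              have := (hKb (4 * (t0 - s) / R ^ 2)).1
              have := hb_le (4 * ρ / R ^ 2)
              have := hb_nonneg (4 * ρ / R ^ 2)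
              gcongr
          _ = _ := by ring
    have b2 : |64 * ρ * q ^ 4 * hb2 (4 * ρ / R ^ 2) * G - 8 * ρ * q ^ 2 * hb1 (4 * ρ / R ^ 2) * (G / σ) + 24 * q ^ 2 * hb1 (4 * ρ / R ^ 2) * G| ≤ 36 * K * L * q ^ 5 := by
      by_cases hc : 4 * ρ / R ^ 2 < 1/4
      · rw [hb1_zero (Or.inl hc), hb2_zero (Or.inl hc)]; simp; positivity
      by_cases hc2 : R ^ 2 / 8 < ρ
      · obtain ⟨-, z1, z2⟩ := hρz hc2
        rw [z1, z2]; simp; positivity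
      push Not at hc hc2
      rw [le_div_iff₀ (by positivity)] at hc
      obtain ⟨g1, g2⟩ := key (by linarith)
      have hρq : ρ * q ^ 2 ≤ 1/8 := by
        have : R ^ 2 * q ^ 2 = 1 := by rw [hq]; field_simp
        calc ρ * q ^ 2 ≤ R ^ 2 / 8 * q ^ 2 := mul_le_mul_of_nonneg_right hc2 (by positivity)
          _ = (R ^ 2 * q ^ 2) / 8 := by ring
          _ = _ := by rw [this]
      obtain ⟨k1, k2⟩ := hKb (4 * ρ / R ^ 2)
      have c1 : |64 * ρ * q ^ 4 * hb2 (4 * ρ / R ^ 2) * G| ≤ 8 * K * L * q ^ 5 := by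
        rw [show 64 * ρ * q ^ 4 * hb2 (4 * ρ / R ^ 2) * G = (64 * (ρ * q ^ 2) * q ^ 2) * hb2 (4 * ρ / R ^ 2) * G by ring, abs_mul, abs_mul, abs_of_pos hGp, abs_of_nonneg (by positivity : 0 ≤ 64 * (ρ * q ^ 2) * q ^ 2)]
        calc _ ≤ (64 * (1/8) * q ^ 2) * K * (L * q ^ 3) := by gcongr
          _ = _ := by ring
      have c2 : |8 * ρ * q ^ 2 * hb1 (4 * ρ / R ^ 2) * (G / σ)| ≤ K * L * q ^ 5 := by
        rw [show 8 * ρ * q ^ 2 * hb1 (4 * ρ / R ^ 2) * (G / σ) = (8 * (ρ * q ^ 2)) * hb1 (4 * ρ / R ^ 2) * (G / σ) by ring, abs_mul, abs_mul, abs_of_pos (by positivity : 0 < G / σ), abs_of_nonneg (by positivity : 0 ≤ 8 * (ρ * q ^ 2))]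
        calc _ ≤ (8 * (1/8)) * K * (L * q ^ 5) := by gcongr
          _ = _ := by ring
      have c3 : |24 * q ^ 2 * hb1 (4 * ρ / R ^ 2) * G| ≤ 24 * K * L * q ^ 5 := by
        rw [abs_mul, abs_mul, abs_of_pos hGp, abs_of_pos (by positivity : 0 < 24 * q ^ 2)]
        calc _ ≤ 24 * q ^ 2 * K * (L * q ^ 3) := by gcongr
          _ = _ := by ring
      refine (abs_add_le _ _).trans ?_
      have := abs_sub (64 * ρ * q ^ 4 * hb2 (4 * ρ / R ^ 2) * G) (8 * ρ * q ^ 2 * hb1 (4 * ρ / R ^ 2) * (G / σ))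
      have : 0 < K * L * q ^ 5 := by positivity
      linarith
    refine (abs_add_le _ _).trans ?_
    rw [abs_mul χ, abs_of_nonneg hχ0]
    have := mul_le_mul hχ1 b2 (abs_nonneg _) (by norm_num)
    linarith
  · intro hx
    rw [e3']
    have : R ≤ ‖x - x0‖ := by simpa [dist_eq_norm] using hx
    have h3 : R ^ 2 ≤ ρ := pow_le_pow_left₀ hR.le this 2
    obtain ⟨z0, z1, z2⟩ := hρz (by nlinarith [sq_pos_of_pos hR])
    rw [z0, z1, z2]; ring
  · intro hs'
    rw [e3']
    have : 1/2 < 4 * (t0 - s) / R ^ 2 := by rw [lt_div_iff₀ (by positivity)]; nlinarith [sq_pos_of_pos hR]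
    rw [hb1_zero (Or.inr this), hχ, hb_zero this.le]; ring

/-- decomposition of the test function into shells -/
def sb (t0 r s : ℝ) : ℝ := hb (4 * (t0 - s) / r ^ 2)

lemma tf_shell {x0 : V3} {t0 R e s : ℝ} (n : ℕ) (he : 0 < e) (hs : s ≤ t0) (y : V3) :
    tf x0 t0 R (rr R n ^ 2) e y s = ∑ k ∈ range (n + 1),
      shell x0 (rr R k) (rr R n ^ 2 + (t0 - s)) (sb t0 (rr R k) s) (if k < n then sb t0 (rr R (k+1)) s else 0) y := by
  rw [tf_eq he y hs]
  set F : ℕ → ℝ := fun k => sb t0 (rr R k) s * hb (4 * ‖y - x0‖ ^ 2 / rr R k ^ 2) * gam (rr R n ^ 2 + (t0 - s)) (‖y - x0‖ ^ 2) with hF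
  have e16 : ∀ k, 16 * ‖y - x0‖ ^ 2 / rr R k ^ 2 = 4 * ‖y - x0‖ ^ 2 / rr R (k+1) ^ 2 := by
    intro k
    rw [rr_succ]
    rw [show (rr R k / 2) ^ 2 = rr R k ^ 2 / 4 by ring]
    rw [div_div_eq_mul_div]; ring
  rw [sum_range_succ]
  have : ∀ k ∈ range n, shell x0 (rr R k) (rr R n ^ 2 + (t0 - s)) (sb t0 (rr R k) s) (if k < n then sb t0 (rr R (k+1)) s else 0) y = F k - F (k+1) := by
    intro k hk
    rw [if_pos (mem_range.1 hk)]
    unfold shell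
    rw [e16, hF]
    ring
  rw [sum_congr rfl this, Finset.sum_range_sub']
  rw [if_neg (lt_irrefl n)]
  unfold shell
  simp only [hF, rr_zero, sb]
  ring
end

section

def psh (x0 : V3) (t0 R : ℝ) (n : ℕ) (s : ℝ) (k : ℕ) : V3 → ℝ :=
  shell x0 (rr R k) (rr R n ^ 2 + (t0 - s)) (sb t0 (rr R k) s) (if k < n then sb t0 (rr R (k+1)) s else 0)

lemma pw_inv_pow {r : ℝ} (hr : 0 < r) (j : ℕ) : ofReal (r⁻¹ ^ j) = pw r (-j) := by
  unfold pw
  rw [rpow_neg hr.le, Real.rpow_natCast, inv_pow]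

lemma psh_bound : ∃ C : ℝ≥0, ∀ (x0 : V3) (t0 R : ℝ) (n : ℕ) (s : ℝ) (k : ℕ), 0 < R → s < t0 → k ≤ n → ∀ y,
    ‖psh x0 t0 R n s k y‖ₑ ≤ (Ioo (t0 - rr R k ^ 2) t0).indicator (fun _ => C * pw (rr R k) (-3)) s ∧
    ‖fderiv ℝ (psh x0 t0 R n s k) y‖ₑ ≤ (Ioo (t0 - rr R k ^ 2) t0).indicator (fun _ => C * pw (rr R k) (-4)) s := by
  obtain ⟨C, hC0, hC⟩ := shell_bound
  refine ⟨C.toNNReal, fun x0 t0 R n s k hR hs hk y => ?_⟩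
  have hr := rr_pos hR k
  by_cases hI : s ∈ Ioo (t0 - rr R k ^ 2) t0
  · rw [indicator_of_mem hI, indicator_of_mem hI]
    have hb0 : 0 ≤ (if k < n then sb t0 (rr R (k+1)) s else 0) := by
      split_ifs
      · exact hb_nonneg _
      · exact le_rfl
    have hb1' : (if k < n then sb t0 (rr R (k+1)) s else 0) ≤ 1 := by
      split_ifs
      · exact hb_le _
      · norm_num
    have hn := rr_pos hR n
    obtain ⟨h1, h2⟩ := hC x0 (rr R k) (rr R n ^ 2 + (t0 - s)) (sb t0 (rr R k) s) (if k < n then sb t0 (rr R (k+1)) s else 0)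
      hr (by nlinarith [sq_pos_of_pos hn]) (hb_nonneg _) (hb_le _) hb0 hb1' (by
        intro hlt
        rcases lt_or_eq_of_le hk with h | h
        · rw [if_pos h]
          have hp := sq_pos_of_pos hn
          unfold sb
          rw [hb_one, hb_one]
          · rw [rr_succ, div_le_iff₀ (by positivity)]
            have : (rr R k / 2) ^ 2 = rr R k ^ 2 / 4 := by ring
            rw [this]; linarith
          · rw [div_le_iff₀ (by positivity)]; nlinarith
        · exfalso
          subst h
          nlinarith [sq_pos_of_pos hn]) y
    have eC : CN(C.toNNReal) = ofReal C := rfl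
    constructor
    · rw [← ofReal_norm, norm_eq_abs, eC, show (-3:ℝ) = -((3:ℕ):ℝ) by norm_num, ← pw_inv_pow hr 3, ← ofReal_mul hC0.le]
      exact ofReal_le_ofReal h1
    · rw [← ofReal_norm, eC, show (-4:ℝ) = -((4:ℕ):ℝ) by norm_num, ← pw_inv_pow hr 4, ← ofReal_mul hC0.le]
      exact ofReal_le_ofReal h2
  · have hle : rr R k ^ 2 ≤ t0 - s := by
      by_contra hc
      push Not at hc
      exact hI ⟨by linarith, hs⟩
    have z1 : sb t0 (rr R k) s = 0 := by
      refine hb_zero ?_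
      rw [le_div_iff₀ (by positivity)]
      nlinarith [sq_pos_of_pos hr]
    have z2 : (if k < n then sb t0 (rr R (k+1)) s else 0) = 0 := by
      split_ifs
      · refine hb_zero ?_
        have := rr_pos hR (k+1)
        rw [le_div_iff₀ (by positivity), rr_succ]
        nlinarith [sq_pos_of_pos hr]
      · rfl
    have : psh x0 t0 R n s k = fun _ => 0 := by
      funext w
      unfold psh shell
      rw [z1, z2]; ring
    rw [this]
    refine ⟨by simp, ?_⟩
    have hz : ‖fderiv ℝ (fun _ : V3 => (0:ℝ)) y‖ = 0 := by simp
    rw [← ofReal_norm, hz, ENNReal.ofReal_zero]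
    exact zero_le

lemma abs_dot3_le (a b : V3) : |dot3 a b| ≤ ‖a‖ * ‖b‖ := by
  have : dot3 a b = inner ℝ b a := by
    unfold dot3
    simp [PiLp.inner_apply]
  rw [this, mul_comm]
  exact abs_real_inner_le_norm _ _

lemma meas_vmean {v : VV} (h : Measurable fun z : V3 × ℝ => v z.1 z.2) (x0 : V3) (r : ℝ) :
    Measurable fun t => vmean x0 r (fun x => v x t) := by
  unfold vmean
  have hρ : Measurable (fun y => rhoR r (y - x0)) := by
    have := (rhoR_smooth r).continuous
    exact (this.comp (continuous_id.sub continuous_const)).measurable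
  have h1 : Measurable (fun z : V3 × ℝ => rhoR r (z.1 - x0) • v z.1 z.2) := (hρ.comp measurable_fst).smul h
  exact (h1.stronglyMeasurable.integral_prod_left' (μ := volume.restrict (ball x0 r))).measurable

/-- the three slice fluxes -/
def kX (v : VV) (x0 : V3) (r t : ℝ) : ℝ≥0∞ := ∫⁻ x in ball x0 r, ‖‖v x t‖ ^ 2 - ‖vmean x0 r (fun y => v y t)‖ ^ 2‖ₑ * ‖v x t‖ₑ
def kY (v : VV) (p : VR) (x0 : V3) (r t : ℝ) : ℝ≥0∞ := ∫⁻ x in ball x0 (r/2), ‖p x t - pmean x0 r (fun y => p y t)‖ₑ * ‖v x t‖ₑ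
def kZ (v f : VV) (x0 : V3) (r t : ℝ) : ℝ≥0∞ := ∫⁻ x in ball x0 r, ‖f x t‖ₑ * ‖v x t‖ₑ

lemma meas_kX {v : VV} (h : Measurable fun z : V3 × ℝ => v z.1 z.2) (x0 : V3) (r : ℝ) : Measurable fun t => kX v x0 r t := by
  unfold kX
  have h1 : Measurable (fun z : V3 × ℝ => ‖‖v z.1 z.2‖ ^ 2 - ‖vmean x0 r (fun y => v y z.2)‖ ^ 2‖ₑ * ‖v z.1 z.2‖ₑ) :=
    (((h.norm.pow_const 2).sub (((meas_vmean h x0 r).comp measurable_snd).norm.pow_const 2)).enorm).mul h.enorm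
  exact h1.lintegral_prod_left' (μ := volume.restrict (ball x0 r))
lemma meas_kY {v : VV} {p : VR} (h : Measurable fun z : V3 × ℝ => v z.1 z.2) (hp : Measurable fun z : V3 × ℝ => p z.1 z.2) (x0 : V3) (r : ℝ) : Measurable fun t => kY v p x0 r t := by
  unfold kY
  have h1 : Measurable (fun z : V3 × ℝ => ‖p z.1 z.2 - pmean x0 r (fun y => p y z.2)‖ₑ * ‖v z.1 z.2‖ₑ) :=
    (hp.sub ((meas_pmean hp x0 r).comp measurable_snd)).enorm.mul h.enorm
  exact h1.lintegral_prod_left' (μ := volume.restrict (ball x0 (r/2)))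
lemma meas_kZ {v f : VV} (h : Measurable fun z : V3 × ℝ => v z.1 z.2) (hf : Measurable fun z : V3 × ℝ => f z.1 z.2) (x0 : V3) (r : ℝ) : Measurable fun t => kZ v f x0 r t := by
  unfold kZ
  have h1 : Measurable (fun z : V3 × ℝ => ‖f z.1 z.2‖ₑ * ‖v z.1 z.2‖ₑ) := hf.enorm.mul h.enorm
  exact h1.lintegral_prod_left' (μ := volume.restrict (ball x0 r))

/-- localisation in time -/
lemma time_loc {t0 t : ℝ} {N : ℕ} {r : ℕ → ℝ} {g : ℕ → ℝ → ℝ≥0∞} (hg : ∀ k, Measurable (g k)) {F : ℝ → ℝ}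
    (h : ∀ᵐ s ∂(volume.restrict (Ioo 0 t)), ‖F s‖ₑ ≤ ∑ k ∈ range N, (Ioo (t0 - r k ^ 2) t0).indicator (g k) s) :
    ‖∫ s in Ioo 0 t, F s‖ₑ ≤ ∑ k ∈ range N, ∫⁻ s, g k s ∂(mI t0 (r k)) := by
  calc _ ≤ ∫⁻ s in Ioo 0 t, ‖F s‖ₑ := enorm_integral_le_lintegral_enorm _
    _ ≤ ∫⁻ s in Ioo 0 t, ∑ k ∈ range N, (Ioo (t0 - r k ^ 2) t0).indicator (g k) s := lintegral_mono_ae h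
    _ ≤ ∫⁻ s, ∑ k ∈ range N, (Ioo (t0 - r k ^ 2) t0).indicator (g k) s := setLIntegral_le_lintegral _ _
    _ = ∑ k ∈ range N, ∫⁻ s, (Ioo (t0 - r k ^ 2) t0).indicator (g k) s :=
      lintegral_finsetSum _ fun k _ => (hg k).indicator measurableSet_Ioo
    _ = _ := sum_congr rfl fun k _ => lintegral_indicator measurableSet_Ioo _

section
variable {Ω : Set V3} {T : ℝ} {v : VV} {dv : DV} {p : VR} {f : VV} {x0 : V3} {t0 R : ℝ}

lemma rhs_bound : ∃ C : ℝ≥0, ∀ Ω T v dv p f, MS Ω T v dv p f → ∀ (x0 : V3) (t0 R e : ℝ) (n : ℕ), 0 < R → ball x0 R ⊆ Ω → 0 < e → e < rr R n ^ 2 →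
    ∀ t, t < t0 → t < T → ∀ φ, φ = tf x0 t0 R (rr R n ^ 2) e →
    ofReal ((∫ s in Ioo 0 t, ∫ x in Ω, ‖v x s‖ ^ 2 * (deriv (fun τ => φ x τ) s + lap3 (fun y => φ y s) x)) +
      (∫ s in Ioo 0 t, ∫ x in Ω, ‖v x s‖ ^ 2 * fderiv ℝ (fun y => φ y s) x (v x s)) +
      2 * (∫ s in Ioo 0 t, ∫ x in Ω, p x s * fderiv ℝ (fun y => φ y s) x (v x s)) +
      2 * (∫ s in Ioo 0 t, ∫ x in Ω, dot3 (f x s) (v x s) * φ x s)) ≤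
    C * (pw R (-5) * (∫⁻ s, aN v x0 R s ^ 2 ∂(mI t0 R)) + ∑ k ∈ range (n+1),
      (pw (rr R k) (-4) * ((∫⁻ s, kX v x0 (rr R k) s ∂(mI t0 (rr R k))) + ∫⁻ s, kY v p x0 (rr R k) s ∂(mI t0 (rr R k))) +
        pw (rr R k) (-3) * ∫⁻ s, kZ v f x0 (rr R k) s ∂(mI t0 (rr R k)))) := by
  obtain ⟨Ch, hCh0, hCh⟩ := tf_heat
  obtain ⟨Cs, hCs⟩ := psh_bound
  refine ⟨Ch.toNNReal + 2 * Cs, fun Ω T v dv p f h x0 t0 R e n hR hB he heσ t htt htT φ hφ => ?_⟩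
  have hI' : volume.restrict (Ioo 0 t) ≤ volume.restrict (Ioo 0 T) := restrict_mono (Ioo_subset_Ioo_right htT.le) le_rfl
  have hmem : ∀ᵐ s ∂(volume.restrict (Ioo 0 t)), s < t0 := by
    filter_upwards [ae_restrict_mem measurableSet_Ioo] with s hs using hs.2.trans htt
  have hdec : ∀ s < t0, ∀ y, φ y s = ∑ k ∈ range (n+1), psh x0 t0 R n s k y := by
    intro s hs y
    rw [hφ]; exact tf_shell n he hs.le y
  have htest : ∀ s k, IsSpaceTest Ω (psh x0 t0 R n s k) := fun s k =>
    shell_test (rr_pos hR k) ((ball_subset_ball (rr_le hR k)).trans hB)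
  -- flux slice
  have hslice : ∀ (w : VR) (c : ℕ → ℝ → ℝ), (Measurable fun z : V3 × ℝ => w z.1 z.2) → ∀ᵐ s ∂(volume.restrict (Ioo 0 t)),
      ‖∫ x in Ω, w x s * fderiv ℝ (fun y => φ y s) x (v x s)‖ₑ ≤ ∑ k ∈ range (n+1), (Ioo (t0 - rr R k ^ 2) t0).indicator
        (fun s => (Cs * pw (rr R k) (-4)) * ∫⁻ x in ball x0 (rr R k / 2), ‖w x s - c k s‖ₑ * ‖v x s‖ₑ) s := by
    intro w c mw
    filter_upwards [hmem, ae_mono hI' h.slices2, ae_mono hI' h.sol.div_free] with s hs h2 h3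
    have := slice_est (u := fun x => v x s) (w := fun x => w x s) (N := n+1) (ψ := psh x0 t0 R n s) (ρ := fun k => rr R k / 2) (x0 := x0)
      (D := fun k => (Ioo (t0 - rr R k ^ 2) t0).indicator (fun _ => Cs * pw (rr R k) (-4)) s) (φ := fun y => φ y s)
      (meas_slice h.mv s) (meas_slice mw s) h2.1 h3 (fun k _ => htest s k)
      (fun k hk y => (hCs x0 t0 R n s k hR hs (Nat.lt_succ_iff.1 hk) y).2) (fun k _ y hy => (shell_off (rr_pos hR k) hy).2)
      (fun k => c k s) (hdec s hs)
    refine this.trans (sum_le_sum fun k _ => ?_)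
    by_cases hsI : s ∈ Ioo (t0 - rr R k ^ 2) t0
    · rw [indicator_of_mem hsI, indicator_of_mem hsI]
    · rw [indicator_of_notMem hsI, indicator_of_notMem hsI, zero_mul]
  have mv2 : Measurable fun z : V3 × ℝ => ‖v z.1 z.2‖ ^ 2 := h.mv.norm.pow_const 2
  have T2 : ‖∫ s in Ioo 0 t, ∫ x in Ω, ‖v x s‖ ^ 2 * fderiv ℝ (fun y => φ y s) x (v x s)‖ₑ ≤
      ∑ k ∈ range (n+1), ∫⁻ s, (Cs * pw (rr R k) (-4)) * kX v x0 (rr R k) s ∂(mI t0 (rr R k)) := by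
    refine time_loc (r := fun k => rr R k) (fun k => (meas_kX h.mv x0 _).const_mul _) ?_
    filter_upwards [hslice (fun x s => ‖v x s‖ ^ 2) (fun k s => ‖vmean x0 (rr R k) (fun y => v y s)‖ ^ 2) mv2] with s hs
    refine hs.trans (sum_le_sum fun k _ => ?_)
    refine indicator_le_indicator (mul_le_mul_right ?_ _)
    exact lintegral_mono_set (ball_subset_ball (by have := rr_pos hR k; linarith))
  have T3 : ‖∫ s in Ioo 0 t, ∫ x in Ω, p x s * fderiv ℝ (fun y => φ y s) x (v x s)‖ₑ ≤
      ∑ k ∈ range (n+1), ∫⁻ s, (Cs * pw (rr R k) (-4)) * kY v p x0 (rr R k) s ∂(mI t0 (rr R k)) := by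
    refine time_loc (r := fun k => rr R k) (fun k => (meas_kY h.mv h.mp x0 _).const_mul _) ?_
    exact hslice p (fun k s => pmean x0 (rr R k) (fun y => p y s)) h.mp
  have T4 : ‖∫ s in Ioo 0 t, ∫ x in Ω, dot3 (f x s) (v x s) * φ x s‖ₑ ≤
      ∑ k ∈ range (n+1), ∫⁻ s, (Cs * pw (rr R k) (-3)) * kZ v f x0 (rr R k) s ∂(mI t0 (rr R k)) := by
    refine time_loc (r := fun k => rr R k) (fun k => (meas_kZ h.mv h.mf x0 _).const_mul _) ?_
    filter_upwards [hmem] with s hs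
    have mfs := (meas_slice h.mf s).enorm
    have mvs := (meas_slice h.mv s).enorm
    have mfv : Measurable fun x => ‖f x s‖ₑ * ‖v x s‖ₑ := mfs.mul mvs
    set D : ℕ → ℝ≥0∞ := fun k => (Ioo (t0 - rr R k ^ 2) t0).indicator (fun _ => Cs * pw (rr R k) (-3)) s with hD
    calc _ ≤ ∫⁻ x in Ω, ‖dot3 (f x s) (v x s) * φ x s‖ₑ := enorm_integral_le_lintegral_enorm _
      _ ≤ ∫⁻ x in Ω, ∑ k ∈ range (n+1), (ball x0 (rr R k)).indicator (fun x => D k * (‖f x s‖ₑ * ‖v x s‖ₑ)) x := by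
        refine lintegral_mono fun x => ?_
        rw [enorm_mul, hdec s hs x]
        have d1 : ‖dot3 (f x s) (v x s)‖ₑ ≤ ‖f x s‖ₑ * ‖v x s‖ₑ := by
          rw [← enorm_norm (f x s), ← enorm_norm (v x s), ← enorm_mul, ← ofReal_norm, ← ofReal_norm]
          refine ofReal_le_ofReal ?_
          rw [norm_eq_abs, norm_eq_abs, abs_of_nonneg (by positivity : 0 ≤ ‖f x s‖ * ‖v x s‖)]
          exact abs_dot3_le _ _
        refine (mul_le_mul' d1 (enorm_sum_le _ _)).trans ?_
        rw [mul_sum]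
        refine sum_le_sum fun k hk => ?_
        by_cases hx : x ∈ ball x0 (rr R k)
        · rw [indicator_of_mem hx, mul_comm]
          exact mul_le_mul_left (hCs x0 t0 R n s k hR hs (Nat.lt_succ_iff.1 (mem_range.1 hk)) x).1 _
        · have : psh x0 t0 R n s k x = 0 := (shell_off (rr_pos hR k) fun hc => hx (ball_subset_ball (by have := rr_pos hR k; linarith) hc)).1
          rw [this]; simp
      _ ≤ ∫⁻ x, ∑ k ∈ range (n+1), (ball x0 (rr R k)).indicator (fun x => D k * (‖f x s‖ₑ * ‖v x s‖ₑ)) x := setLIntegral_le_lintegral _ _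
      _ = ∑ k ∈ range (n+1), ∫⁻ x, (ball x0 (rr R k)).indicator (fun x => D k * (‖f x s‖ₑ * ‖v x s‖ₑ)) x :=
        lintegral_finsetSum _ fun k _ => (mfv.const_mul _).indicator measurableSet_ball
      _ = ∑ k ∈ range (n+1), D k * kZ v f x0 (rr R k) s := by
        refine sum_congr rfl fun k _ => ?_
        rw [lintegral_indicator measurableSet_ball, lintegral_const_mul _ mfv]; rfl
      _ ≤ _ := by
        refine sum_le_sum fun k _ => ?_
        rw [hD]
        by_cases hsI : s ∈ Ioo (t0 - rr R k ^ 2) t0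
        · simp only [indicator_of_mem hsI]; exact le_rfl
        · simp only [indicator_of_notMem hsI, zero_mul]; exact le_rfl
  have T1 : ‖∫ s in Ioo 0 t, ∫ x in Ω, ‖v x s‖ ^ 2 * (deriv (fun τ => φ x τ) s + lap3 (fun y => φ y s) x)‖ₑ ≤
      ∑ k ∈ range 1, ∫⁻ s, (Ch.toNNReal * pw R (-5)) * aN v x0 R s ^ 2 ∂(mI t0 R) := by
    refine time_loc (r := fun _ => R) (fun k => ((meas_aN h.mv x0 R).pow_const 2).const_mul _) ?_
    filter_upwards [hmem] with s hs
    rw [sum_range_one]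
    have hc := fun x => hCh x0 t0 R (rr R n ^ 2) e hR he heσ x s hs
    rw [← hφ] at hc
    by_cases hsI : s ∈ Ioo (t0 - R ^ 2) t0
    · rw [indicator_of_mem hsI]
      refine (enorm_integral_le_lintegral_enorm _).trans ?_
      have eC : CN(Ch.toNNReal) = ofReal Ch := rfl
      calc _ ≤ ∫⁻ x in Ω, (ball x0 R).indicator (fun x => (Ch.toNNReal * pw R (-5)) * ‖v x s‖ₑ ^ 2) x := by
            refine lintegral_mono fun x => ?_
            by_cases hx : x ∈ ball x0 R
            · rw [indicator_of_mem hx, enorm_mul, mul_comm, enorm_pow, enorm_norm]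
              refine mul_le_mul_left ?_ _
              rw [← ofReal_norm, norm_eq_abs, eC, show (-5:ℝ) = -((5:ℕ):ℝ) by norm_num, ← pw_inv_pow hR 5, ← ofReal_mul hCh0.le]
              exact ofReal_le_ofReal (hc x).1
            · rw [(hc x).2.1 hx]; simp
        _ ≤ ∫⁻ x, (ball x0 R).indicator (fun x => (Ch.toNNReal * pw R (-5)) * ‖v x s‖ₑ ^ 2) x := setLIntegral_le_lintegral _ _
        _ = _ := by
          rw [lintegral_indicator measurableSet_ball, lintegral_const_mul _ ((meas_slice h.mv s).enorm.pow_const 2)]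
          unfold aN
          rw [n2_sq]
    · have hle : s ≤ t0 - R ^ 2 := by
        by_contra hcc
        push Not at hcc
        exact hsI ⟨hcc, hs⟩
      have : ∀ x, ‖v x s‖ ^ 2 * (deriv (fun τ => φ x τ) s + lap3 (fun y => φ y s) x) = 0 := by
        intro x; rw [(hc x).2.2 hle, mul_zero]
      simp [this]
  rw [sum_range_one, lintegral_const_mul _ ((meas_aN h.mv x0 R).pow_const 2)] at T1
  have e2 : ∀ k, ∫⁻ s, (Cs * pw (rr R k) (-4)) * kX v x0 (rr R k) s ∂(mI t0 (rr R k)) = (Cs * pw (rr R k) (-4)) * ∫⁻ s, kX v x0 (rr R k) s ∂(mI t0 (rr R k)) :=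
    fun k => lintegral_const_mul _ (meas_kX h.mv x0 _)
  have e3' : ∀ k, ∫⁻ s, (Cs * pw (rr R k) (-4)) * kY v p x0 (rr R k) s ∂(mI t0 (rr R k)) = (Cs * pw (rr R k) (-4)) * ∫⁻ s, kY v p x0 (rr R k) s ∂(mI t0 (rr R k)) :=
    fun k => lintegral_const_mul _ (meas_kY h.mv h.mp x0 _)
  have e4 : ∀ k, ∫⁻ s, (Cs * pw (rr R k) (-3)) * kZ v f x0 (rr R k) s ∂(mI t0 (rr R k)) = (Cs * pw (rr R k) (-3)) * ∫⁻ s, kZ v f x0 (rr R k) s ∂(mI t0 (rr R k)) :=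
    fun k => lintegral_const_mul _ (meas_kZ h.mv h.mf x0 _)
  simp only [e2] at T2
  simp only [e3'] at T3
  simp only [e4] at T4
  generalize (∫ s in Ioo 0 t, ∫ x in Ω, ‖v x s‖ ^ 2 * (deriv (fun τ => φ x τ) s + lap3 (fun y => φ y s) x)) = I1 at T1 ⊢
  generalize (∫ s in Ioo 0 t, ∫ x in Ω, ‖v x s‖ ^ 2 * fderiv ℝ (fun y => φ y s) x (v x s)) = I2 at T2 ⊢
  generalize (∫ s in Ioo 0 t, ∫ x in Ω, p x s * fderiv ℝ (fun y => φ y s) x (v x s)) = I3 at T3 ⊢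
  generalize (∫ s in Ioo 0 t, ∫ x in Ω, dot3 (f x s) (v x s) * φ x s) = I4 at T4 ⊢
  have hr : ofReal (I1 + I2 + 2 * I3 + 2 * I4) ≤ ‖I1‖ₑ + ‖I2‖ₑ + 2 * ‖I3‖ₑ + 2 * ‖I4‖ₑ := by
    calc _ ≤ ofReal (‖I1‖ + ‖I2‖ + 2 * ‖I3‖ + 2 * ‖I4‖) := by
          refine ofReal_le_ofReal ?_
          simp only [norm_eq_abs]
          have := le_abs_self I1; have := le_abs_self I2; have := le_abs_self I3; have := le_abs_self I4
          linarith
      _ = _ := by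
        rw [ofReal_add (by positivity) (by positivity), ofReal_add (by positivity) (by positivity), ofReal_add (by positivity) (by positivity),
          ofReal_mul (by norm_num), ofReal_mul (by norm_num)]
        simp only [ofReal_norm]
        norm_num
  refine hr.trans ?_
  refine (add_le_add (add_le_add (add_le_add T1 T2) (mul_le_mul_right T3 2)) (mul_le_mul_right T4 2)).trans ?_
  rw [mul_add CN(Ch.toNNReal + 2 * Cs), mul_sum, mul_sum, mul_sum, add_assoc, add_assoc, ← sum_add_distrib, ← sum_add_distrib]
  have k1 : CN(Ch.toNNReal) ≤ CN(Ch.toNNReal + 2 * Cs) := by exact_mod_cast le_self_add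
  have k2 : 2 * (Cs : ℝ≥0∞) ≤ CN(Ch.toNNReal + 2 * Cs) := by exact_mod_cast le_add_self
  refine add_le_add ?_ (sum_le_sum fun k _ => ?_)
  · rw [mul_assoc (Ch.toNNReal : ℝ≥0∞)]
    exact mul_le_mul_left k1 _
  · generalize (∫⁻ s, kX v x0 (rr R k) s ∂(mI t0 (rr R k))) = a
    generalize (∫⁻ s, kY v p x0 (rr R k) s ∂(mI t0 (rr R k))) = b
    generalize (∫⁻ s, kZ v f x0 (rr R k) s ∂(mI t0 (rr R k))) = c
    refine le_trans ?_ (mul_le_mul_left k2 _)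
    calc _ ≤ 2 * (Cs * pw (rr R k) (-4) * a) + (2 * (Cs * pw (rr R k) (-4) * b) + 2 * (Cs * pw (rr R k) (-3) * c)) := by
          refine add_le_add ?_ le_rfl
          rw [two_mul]; exact le_self_add
      _ = _ := by ring
end
end

section

section
variable {Ω : Set V3} {T : ℝ} {v : VV} {dv : DV} {p : VR} {f : VV} {x0 : V3} {t0 R : ℝ}

lemma lhs1 (h : MS Ω T v dv p f) {φ : VR} (hφ : IsTimeSpaceTest Ω (Ioo 0 T) φ) (h0 : ∀ x s, 0 ≤ φ x s) {t r c : ℝ}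
    (hi : IntegrableOn (fun x => ‖v x t‖ ^ 2) Ω volume) (hB : ball x0 r ⊆ Ω) (_hc0 : 0 ≤ c) (hc : ∀ x ∈ ball x0 r, c ≤ φ x t) :
    ofReal c * aN v x0 r t ^ 2 ≤ ofReal (∫ x in Ω, ‖v x t‖ ^ 2 * φ x t) := by
  obtain ⟨K, hK⟩ := hφ.2.1.exists_bound_of_continuous hφ.1.continuous
  have hcont : Continuous fun x => φ x t := hφ.1.continuous.comp (Continuous.prodMk continuous_id continuous_const)
  have hint : IntegrableOn (fun x => ‖v x t‖ ^ 2 * φ x t) Ω volume := by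
    have := hi.mul_bdd (c := K) (g := fun x => φ x t) hcont.aestronglyMeasurable (of_forall fun x => hK (x, t))
    exact this
  rw [ofReal_integral_eq_lintegral_ofReal hint (of_forall fun x => mul_nonneg (by positivity) (h0 x t))]
  unfold aN mB
  rw [n2_sq, ← lintegral_const_mul _ ((meas_slice h.mv t).enorm.pow_const 2)]
  refine le_trans ?_ (lintegral_mono_set hB)
  refine setLIntegral_mono' measurableSet_ball fun x hx => ?_
  rw [ofReal_mul (by positivity), mul_comm, ofReal_pow (norm_nonneg _), ofReal_norm]
  exact mul_le_mul_right (ofReal_le_ofReal (hc x hx)) _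

lemma lhs2 (h : MS Ω T v dv p f) {φ : VR} (hφ : IsTimeSpaceTest Ω (Ioo 0 T) φ) (h0 : ∀ x s, 0 ≤ φ x s) {a t r c : ℝ}
    (ha : 0 ≤ a) (htT : t ≤ T) (hB : ball x0 r ⊆ Ω) (_hc0 : 0 ≤ c) (hc : ∀ x ∈ ball x0 r, ∀ s ∈ Ioo a t, c ≤ φ x s) :
    ofReal c * ∫⁻ s in Ioo a t, aN dv x0 r s ^ 2 ≤ ofReal (∫ s in Ioo 0 t, ∫ x in Ω, fnormSq (dv x s) * φ x s) := by
  obtain ⟨K, hK⟩ := hφ.2.1.exists_bound_of_continuous hφ.1.continuous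
  have hint : IntegrableOn (fun z : V3 × ℝ => fnormSq (dv z.1 z.2) * φ z.1 z.2) (Ω ×ˢ Ioo 0 t) volume := by
    have h1 : IntegrableOn (fun z : V3 × ℝ => fnormSq (dv z.1 z.2)) (Ω ×ˢ Ioo 0 t) volume :=
      h.sol.dv_l2.mono_set (prod_mono le_rfl (Ioo_subset_Ioo_right htT))
    have := h1.mul_bdd (c := K) (g := fun z : V3 × ℝ => φ z.1 z.2) hφ.1.continuous.aestronglyMeasurable (of_forall fun z => hK z)
    exact this
  have hnn : ∀ x s, 0 ≤ fnormSq (dv x s) * φ x s := fun x s => mul_nonneg (fnormSq_nonneg _) (h0 x s)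
  have i1 := int_slice hint
  simp only at i1
  rw [ofReal_integral_eq_lintegral_ofReal i1 (of_forall fun s => integral_nonneg fun x => hnn x s)]
  rw [← lintegral_const_mul _ ((meas_aN h.mdv x0 r).pow_const 2)]
  refine le_trans ?_ (lintegral_mono_set (Ioo_subset_Ioo_left ha))
  refine lintegral_mono_ae ?_
  have i2 : ∀ᵐ s ∂(volume.restrict (Ioo a t)), IntegrableOn (fun x => fnormSq (dv x s) * φ x s) Ω :=
    ae_mono (restrict_mono (Ioo_subset_Ioo_left ha) le_rfl) (int_slice_ae hint)
  filter_upwards [i2, ae_restrict_mem measurableSet_Ioo] with s hs hsI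
  rw [ofReal_integral_eq_lintegral_ofReal hs (of_forall fun x => hnn x s)]
  unfold aN mB
  rw [n2_sq, ← lintegral_const_mul _ ((meas_slice h.mdv s).enorm.pow_const 2)]
  refine le_trans ?_ (lintegral_mono_set hB)
  refine setLIntegral_mono' measurableSet_ball fun x hx => ?_
  rw [ofReal_mul (fnormSq_nonneg _), mul_comm]
  exact mul_le_mul' (enorm_le_fnormSq _) (ofReal_le_ofReal (hc x hx s hsI))

/-- integral up to `t0` from integrals up to almost every earlier time -/
lemma lint_upto {a t0 : ℝ} (hat : a < t0) {g : ℝ → ℝ≥0∞} {B : ℝ≥0∞} (hg : ∀ᵐ t ∂(volume.restrict (Ioo a t0)), ∫⁻ s in Ioo a t, g s ≤ B) :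
    ∫⁻ s in Ioo a t0, g s ≤ B := by
  have hex : ∀ n : ℕ, ∃ t ∈ Ioo (t0 - (t0 - a) / (n + 1)) t0, ∫⁻ s in Ioo a t, g s ≤ B := by
    intro n
    have hpos : 0 < (t0 - a) / ((n:ℝ) + 1) := div_pos (by linarith) (by positivity)
    have hle : (t0 - a) / ((n:ℝ) + 1) ≤ t0 - a := div_le_self (by linarith) (by linarith [n.cast_nonneg (α := ℝ)])
    have h1 : ∀ᵐ t ∂(volume.restrict (Ioo (t0 - (t0 - a) / (n + 1)) t0)), t ∈ Ioo (t0 - (t0 - a) / (n + 1)) t0 ∧ ∫⁻ s in Ioo a t, g s ≤ B := by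
      filter_upwards [ae_mono (restrict_mono (Ioo_subset_Ioo_left (by linarith)) le_rfl) hg, ae_restrict_mem measurableSet_Ioo] with t h1 h2
      exact ⟨h2, h1⟩
    have : NeZero (volume.restrict (Ioo (t0 - (t0 - a) / ((n:ℝ) + 1)) t0)) := by
      constructor
      intro h0
      have := Measure.restrict_eq_zero.1 h0
      rw [Real.volume_Ioo, ENNReal.ofReal_eq_zero] at this
      linarith
    obtain ⟨t, ht1, ht2⟩ := h1.exists
    exact ⟨t, ht1, ht2⟩
  choose τ hτ hB using hex
  have hU : Ioo a t0 ⊆ ⋃ n, Ioo a (τ n) := by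
    intro s hs
    obtain ⟨n, hn⟩ := exists_nat_gt ((t0 - a) / (t0 - s))
    refine mem_iUnion.2 ⟨n, hs.1, lt_trans ?_ (hτ n).1⟩
    have h1 : 0 < t0 - s := by linarith [hs.2]
    rw [div_lt_iff₀ h1] at hn
    have : (t0 - a) / ((n:ℝ) + 1) < t0 - s := by
      rw [div_lt_iff₀ (by positivity)]; nlinarith
    linarith
  have hdir : Directed (· ⊆ ·) (fun n => Ioo a (τ n)) := by
    intro i j
    rcases le_total (τ i) (τ j) with hij | hij
    · exact ⟨j, Ioo_subset_Ioo_right hij, le_rfl⟩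
    · exact ⟨i, le_rfl, Ioo_subset_Ioo_right hij⟩
  refine (lintegral_mono_set hU).trans ?_
  rw [setLIntegral_iUnion_of_directed _ hdir]
  exact iSup_le hB

lemma tf_lower {e : ℝ} (hR : 0 < R) (he : 0 < e) (n : ℕ) {x : V3} {s : ℝ} (hx : x ∈ ball x0 (rr R (n+2))) (hs : s ∈ Ioo (t0 - rr R (n+2) ^ 2) t0) :
    1/8 * (rr R n)⁻¹ ^ 3 ≤ tf x0 t0 R (rr R n ^ 2) e x s := by
  have hrn := rr_pos hR n
  have hle : rr R n ≤ R := rr_le hR n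
  have e2 : rr R (n+2) = rr R n / 4 := by rw [rr_succ, rr_succ]; ring
  rw [e2] at hx hs
  have hx' : ‖x - x0‖ ^ 2 ≤ rr R n ^ 2 / 16 := by
    rw [mem_ball, dist_eq_norm] at hx
    calc ‖x - x0‖ ^ 2 ≤ (rr R n / 4) ^ 2 := pow_le_pow_left₀ (norm_nonneg _) hx.le 2
      _ = _ := by ring
  have hs' : t0 - s ≤ rr R n ^ 2 / 16 := by
    have : (rr R n / 4) ^ 2 = rr R n ^ 2 / 16 := by ring
    linarith [hs.1]
  have hq : rr R n ^ 2 ≤ R ^ 2 := pow_le_pow_left₀ hrn.le hle 2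
  have hp : 0 < rr R n ^ 2 := by positivity
  have hR2 : 0 < R ^ 2 := by positivity
  rw [tf_eq he x hs.2.le, hb_one, hb_one, one_mul, one_mul]
  · exact gam_lower hrn (by linarith [hs.2]) (by linarith) (by linarith)
  · rw [div_le_iff₀ hR2]; linarith
  · rw [div_le_iff₀ hR2]; linarith

def enB (v : VV) (p : VR) (f : VV) (x0 : V3) (t0 R : ℝ) (n : ℕ) : ℝ≥0∞ :=
  pw R (-5) * (∫⁻ s, aN v x0 R s ^ 2 ∂(mI t0 R)) + ∑ k ∈ range (n+1),
      (pw (rr R k) (-4) * ((∫⁻ s, kX v x0 (rr R k) s ∂(mI t0 (rr R k))) + ∫⁻ s, kY v p x0 (rr R k) s ∂(mI t0 (rr R k))) +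
        pw (rr R k) (-3) * ∫⁻ s, kZ v f x0 (rr R k) s ∂(mI t0 (rr R k)))

lemma en_bound : ∃ C : ℝ≥0, ∀ Ω T v dv p f, MS Ω T v dv p f → ∀ (x0 : V3) (t0 R : ℝ) (n : ℕ), 0 < R → ball x0 R ⊆ Ω → 0 ≤ t0 - R ^ 2 → t0 < T →
    ofReal (1/8 * (rr R n)⁻¹ ^ 3) * essSup (fun t => aN v x0 (rr R (n+2)) t ^ 2) (mI t0 (rr R (n+2))) ≤ C * enB v p f x0 t0 R n ∧
    ofReal (1/8 * (rr R n)⁻¹ ^ 3) * (∫⁻ t, aN dv x0 (rr R (n+2)) t ^ 2 ∂(mI t0 (rr R (n+2)))) ≤ C * enB v p f x0 t0 R n := by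
  obtain ⟨C, hC⟩ := rhs_bound
  refine ⟨C, fun Ω T v dv p f h x0 t0 R n hR hB ht0 htT => ?_⟩
  have hrn := rr_pos hR n
  have hr2 := rr_pos hR (n+2)
  set e := min (rr R n ^ 2 / 2) ((T - t0) / 2) with hedef
  have he : 0 < e := lt_min (by positivity) (by linarith)
  have heσ : e < rr R n ^ 2 := lt_of_le_of_lt (min_le_left _ _) (half_lt_self (by positivity))
  have heT : t0 + e < T := by
    have : e ≤ (T - t0) / 2 := min_le_right _ _
    linarith
  have htest := tf_test (T := T) (U := Ω) (x0 := x0) hR he heσ hB ht0 heT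
  have hnn := tf_nonneg (x0 := x0) (t0 := t0) (R := R) he heσ
  have hB2 : ball x0 (rr R (n+2)) ⊆ Ω := (ball_subset_ball (rr_le hR _)).trans hB
  have hsq : rr R (n+2) ^ 2 ≤ R ^ 2 := pow_le_pow_left₀ hr2.le (rr_le hR _) 2
  have ha0 : 0 ≤ t0 - rr R (n+2) ^ 2 := by linarith
  set c := 1/8 * (rr R n)⁻¹ ^ 3 with hcdef
  have hc0 : 0 < c := by positivity
  have hae : ∀ᵐ t ∂(mI t0 (rr R (n+2))), ofReal c * aN v x0 (rr R (n+2)) t ^ 2 ≤ C * enB v p f x0 t0 R n ∧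
      ofReal c * (∫⁻ s in Ioo (t0 - rr R (n+2) ^ 2) t, aN dv x0 (rr R (n+2)) s ^ 2) ≤ C * enB v p f x0 t0 R n := by
    have hsub : mI t0 (rr R (n+2)) ≤ volume.restrict (Ioo 0 T) := restrict_mono (Ioo_subset_Ioo ha0 htT.le) le_rfl
    obtain ⟨K, hK⟩ := h.sol.v_linf_l2
    filter_upwards [ae_mono hsub h.sol.energy, ae_mono hsub hK, ae_restrict_mem measurableSet_Ioo] with t hen hv htI
    have hE := hen _ htest hnn
    have hR' := hC Ω T v dv p f h x0 t0 R e n hR hB he heσ t htI.2 (htI.2.trans htT) _ rfl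
    have l1 := lhs1 h htest hnn (r := rr R (n+2)) hv.1 hB2 hc0.le (fun x hx => tf_lower hR he n hx htI)
    have l2 := lhs2 h htest hnn (r := rr R (n+2)) (t := t) ha0 (htI.2.trans htT).le hB2 hc0.le (fun x hx s hs => tf_lower hR he n hx ⟨hs.1, hs.2.trans htI.2⟩)
    have n1 : 0 ≤ ∫ x in Ω, ‖v x t‖ ^ 2 * tf x0 t0 R (rr R n ^ 2) e x t := integral_nonneg fun x => mul_nonneg (by positivity) (hnn x t)
    have n2' : 0 ≤ ∫ s in Ioo 0 t, ∫ x in Ω, fnormSq (dv x s) * tf x0 t0 R (rr R n ^ 2) e x s :=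
      integral_nonneg fun s => integral_nonneg fun x => mul_nonneg (fnormSq_nonneg _) (hnn x s)
    exact ⟨l1.trans ((ofReal_le_ofReal (by linarith)).trans hR'), l2.trans ((ofReal_le_ofReal (by linarith)).trans hR')⟩
  have hcne : ofReal c ≠ 0 := by simpa using hc0
  have key : ∀ x B : ℝ≥0∞, ofReal c * x ≤ B ↔ x ≤ B / ofReal c := by
    intro x B
    rw [ENNReal.le_div_iff_mul_le (Or.inl hcne) (Or.inl ofReal_ne_top), mul_comm]
  constructor
  · rw [key]
    refine essSup_le_of_ae_le _ ?_
    filter_upwards [hae] with t ht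
    exact (key _ _).1 ht.1
  · rw [key]
    refine lint_upto (by have : 0 < rr R (n+2) ^ 2 := by positivity
                         linarith) ?_
    filter_upwards [hae] with t ht
    exact (key _ _).1 ht.2
end
end

section

def fH (v : VV) (dv : DV) (p : VR) (f : VV) (x0 : V3) (t0 r : ℝ) : ℝ≥0∞ :=
  fA v x0 t0 r ^ ((1:ℝ)/2) * fE dv x0 t0 r ^ ((1:ℝ)/2) * fG v x0 t0 r ^ ((1:ℝ)/2) + fA v x0 t0 r ^ ((1:ℝ)/2) * fP p x0 t0 r +
    fG v x0 t0 r ^ ((1:ℝ)/2) * fF f x0 t0 r + fA v x0 t0 r ^ ((1:ℝ)/2) * fF f x0 t0 r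

lemma rr_ratio {R : ℝ} (hR : 0 < R) {k n : ℕ} (h : k ≤ n) : rr R n / rr R k = (1/2)^(n-k) := by
  unfold rr
  obtain ⟨j, rfl⟩ := Nat.exists_eq_add_of_le h
  rw [Nat.add_sub_cancel_left, pow_add]
  field_simp

lemma pw_scale {R : ℝ} (hR : 0 < R) {k n : ℕ} (h : k ≤ n) (e : ℝ) :
    pw (rr R n) 2 * pw (rr R k) e = ofReal ((1/4)^(n-k)) * pw (rr R k) (2 + e) := by
  have hk := rr_pos hR k
  have h1 := pw_ratio (rr_pos hR n) hk 2
  rw [rr_ratio hR h] at h1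
  have h2 : (((1:ℝ)/2)^(n-k)) ^ (2:ℝ) = (1/4)^(n-k) := by
    rw [rpow_two, ← pow_mul, mul_comm, pow_mul]; norm_num
  rw [← h2, ← h1, mul_assoc, pw_mul hk]
  congr 2
  ring

lemma K_ineq : ∃ C : ℝ≥0, ∀ Ω T v dv p f, MS Ω T v dv p f → ∀ (x0 : V3) (t0 R : ℝ) (n : ℕ), 0 < R → ball x0 R ⊆ Ω → 0 ≤ t0 - R ^ 2 → t0 < T →
    fA v x0 t0 (rr R (n+2)) ≤ C * (ofReal ((1/4)^n) * fG v x0 t0 R + ∑ k ∈ range (n+1), ofReal ((1/4)^(n-k)) * fH v dv p f x0 t0 (rr R k)) ∧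
    fE dv x0 t0 (rr R (n+2)) ≤ C * (ofReal ((1/4)^n) * fG v x0 t0 R + ∑ k ∈ range (n+1), ofReal ((1/4)^(n-k)) * fH v dv p f x0 t0 (rr R k)) := by
  obtain ⟨C, hC⟩ := en_bound
  obtain ⟨C0, h0⟩ := V2G
  obtain ⟨C1, h1⟩ := FL1
  obtain ⟨C2, h2⟩ := FL2
  refine ⟨32 * C * (C0 + (C1 + C2 + 1)), fun Ω T v dv p f h x0 t0 R n hR hB ht0 htT => ?_⟩
  have hrn := rr_pos hR n
  set W := ofReal ((1/4)^n) * fG v x0 t0 R + ∑ k ∈ range (n+1), ofReal ((1/4)^(n-k)) * fH v dv p f x0 t0 (rr R k) with hW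
  have hgi : GI x0 t0 R v dv p f := h.gi hB (Ioo_subset_Ioo ht0 htT.le)
  have hk : ∀ k, (pw (rr R k) (-2) * ((∫⁻ s, kX v x0 (rr R k) s ∂(mI t0 (rr R k))) + ∫⁻ s, kY v p x0 (rr R k) s ∂(mI t0 (rr R k))) +
        pw (rr R k) (-1) * ∫⁻ s, kZ v f x0 (rr R k) s ∂(mI t0 (rr R k))) ≤ CN(C1 + C2 + 1) * fH v dv p f x0 t0 (rr R k) := by
    intro k
    have hr := rr_pos hR k
    have g := hgi.mono hr.le (rr_le hR k)
    have a1 := h1 x0 t0 (rr R k) v dv p f hr g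
    have a2 := h2 x0 t0 (rr R k) v dv p f hr g
    have a3 := FL3 hr g
    unfold kX kY kZ
    rw [mul_add (pw (rr R k) (-2))]
    refine (add_le_add (add_le_add a1 a2) a3).trans ?_
    unfold fH
    generalize fA v x0 t0 (rr R k) ^ ((1:ℝ)/2) = a
    generalize fE dv x0 t0 (rr R k) ^ ((1:ℝ)/2) = b
    generalize fG v x0 t0 (rr R k) ^ ((1:ℝ)/2) = c
    generalize fP p x0 t0 (rr R k) = d
    generalize fF f x0 t0 (rr R k) = q
    push_cast
    have : ((C1:ℝ≥0∞) + C2 + 1) * (a * b * c + a * d + c * q + a * q) = (C1 * (a * b * c) + C2 * (a * d + (a * b * c + c * q)) + a * q) +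
      (C1 * (a * d + c * q + a * q) + C2 * (a * q) + (a * b * c + a * d + c * q)) := by ring
    rw [this]
    exact le_self_add
  have hen : pw (rr R n) 2 * enB v p f x0 t0 R n ≤ CN(C0 + (C1 + C2 + 1)) * W := by
    unfold enB
    rw [mul_add (pw (rr R n) 2), mul_sum, hW, mul_add CN(C0 + (C1 + C2 + 1)), mul_sum]
    refine add_le_add ?_ (sum_le_sum fun k hkm => ?_)
    · have e1 := pw_scale hR (Nat.zero_le n) (-5)
      rw [rr_zero, Nat.sub_zero] at e1
      rw [← mul_assoc, e1, show (2:ℝ) + -5 = -3 by norm_num, mul_assoc]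
      refine (mul_le_mul_right (h0 x0 t0 R v hR h.mv) _).trans ?_
      rw [mul_left_comm]
      refine mul_le_mul_left ?_ _
      exact_mod_cast le_self_add
    · have hkn : k ≤ n := Nat.lt_succ_iff.1 (mem_range.1 hkm)
      have e1 := pw_scale hR hkn (-4)
      have e2 := pw_scale hR hkn (-3)
      rw [mul_add (pw (rr R n) 2), ← mul_assoc, ← mul_assoc, e1, e2, show (2:ℝ) + -4 = -2 by norm_num, show (2:ℝ) + -3 = -1 by norm_num, mul_assoc, mul_assoc, ← mul_add]
      refine (mul_le_mul_right (hk k) _).trans ?_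
      rw [mul_left_comm]
      refine mul_le_mul_left ?_ _
      exact_mod_cast le_add_self
  have hred : ∀ x : ℝ≥0∞, ofReal (1/8 * (rr R n)⁻¹ ^ 3) * x ≤ C * enB v p f x0 t0 R n →
      pw (rr R (n+2)) (-1) * x ≤ CN(32 * C * (C0 + (C1 + C2 + 1))) * W := by
    intro x hx
    have e3 : pw (rr R (n+2)) (-1) = 32 * pw (rr R n) 2 * ofReal (1/8 * (rr R n)⁻¹ ^ 3) := by
      unfold pw
      rw [show (32:ℝ≥0∞) = ofReal 32 by norm_num, ← ofReal_mul (by norm_num), ← ofReal_mul (by positivity), rpow_two, rpow_neg_one,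
        rr_succ, rr_succ]
      congr 1
      field_simp
      norm_num
    rw [e3, mul_assoc]
    refine (mul_le_mul_right hx _).trans ?_
    calc 32 * pw (rr R n) 2 * (C * enB v p f x0 t0 R n) = (32 * C) * (pw (rr R n) 2 * enB v p f x0 t0 R n) := by ring
      _ ≤ (32 * C) * (CN(C0 + (C1 + C2 + 1)) * W) := mul_le_mul_right hen _
      _ = _ := by push_cast; ring
  obtain ⟨q1, q2⟩ := hC Ω T v dv p f h x0 t0 R n hR hB ht0 htT
  exact ⟨hred _ q1, hred _ q2⟩
end

section

def lam : ℝ := (√2 ^ 3)⁻¹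
lemma s2_pos : 0 < √(2:ℝ) := by positivity
lemma s2_sq : √(2:ℝ) * √2 = 2 := Real.mul_self_sqrt (by norm_num)
lemma lam_pos : 0 < lam := by unfold lam; positivity
lemma lam_sq : lam * lam = 1/8 := by
  unfold lam
  rw [← mul_inv, show √(2:ℝ)^3 * √2^3 = (√2*√2)^3 by ring, s2_sq]; norm_num
lemma lam_le : lam ≤ 1/2 := by
  have := lam_sq; have := lam_pos
  nlinarith
lemma lam_s2 : lam * √2 = 1/2 := by
  unfold lam
  rw [show √(2:ℝ)^3 = (√2*√2)*√2 by ring, s2_sq]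
  have := s2_pos
  field_simp
lemma lam_eq : ((1:ℝ)/2) ^ ((3:ℝ)/2) = lam := by
  unfold lam
  rw [one_div, Real.inv_rpow (by norm_num), sqrt_eq_rpow, ← Real.rpow_natCast, ← Real.rpow_mul (by norm_num)]
  norm_num
lemma lam_pow (n : ℕ) : (((1:ℝ)/2)^n) ^ ((3:ℝ)/2) = lam ^ n := by
  rw [← lam_eq, ← Real.rpow_natCast, ← Real.rpow_mul (by norm_num), mul_comm, Real.rpow_mul (by norm_num), Real.rpow_natCast]

/-- the flux term -/
def hH (A E G P F : ℝ) : ℝ := √A * √E * √G + √A * P + √G * F + √A * F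

structure SQ (C : ℝ) (A E G P Q F : ℕ → ℝ) : Prop where
  C1 : 1 ≤ C
  A0 : ∀ k, 0 ≤ A k
  E0 : ∀ k, 0 ≤ E k
  G0 : ∀ k, 0 ≤ G k
  P0 : ∀ k, 0 ≤ P k
  Q0 : ∀ k, 0 ≤ Q k
  F0 : ∀ k, 0 ≤ F k
  A1 : ∀ k, A (k+1) ≤ 2 * A k
  E1 : ∀ k, E (k+1) ≤ 2 * E k
  g : ∀ k n, G (k+n) ≤ C * (2^n * E k + (1/4)^n * A k)
  p : ∀ k n, P (k+n) ≤ C * ((1/2)^n * P k + ∑ j ∈ range n, (1/2)^(n-j) * (E (k+j) + F (k+j)))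
  q : ∀ k n, Q (k+n) ≤ C * (lam^n * Q k + ∑ j ∈ range n, lam^(n-j) * (A (k+j) ^ ((1:ℝ)/4) * E (k+j) ^ ((3:ℝ)/4) + F (k+j)))
  pq : ∀ k, P k ≤ C * Q k
  kA : ∀ k n, A (k+n+2) ≤ C * ((1/4)^n * G k + ∑ j ∈ range (n+1), (1/4)^(n-j) * hH (A (k+j)) (E (k+j)) (G (k+j)) (P (k+j)) (F (k+j)))
  kE : ∀ k n, E (k+n+2) ≤ C * ((1/4)^n * G k + ∑ j ∈ range (n+1), (1/4)^(n-j) * hH (A (k+j)) (E (k+j)) (G (k+j)) (P (k+j)) (F (k+j)))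

lemma hH_nonneg {A E G P F : ℝ} (hP : 0 ≤ P) (hF : 0 ≤ F) : 0 ≤ hH A E G P F := by unfold hH; positivity

lemma SQ.shift {C : ℝ} {A E G P Q F : ℕ → ℝ} (h : SQ C A E G P Q F) (m : ℕ) :
    SQ C (fun k => A (m+k)) (fun k => E (m+k)) (fun k => G (m+k)) (fun k => P (m+k)) (fun k => Q (m+k)) (fun k => F (m+k)) where
  C1 := h.C1
  A0 k := h.A0 _
  E0 k := h.E0 _
  G0 k := h.G0 _
  P0 k := h.P0 _
  Q0 k := h.Q0 _
  F0 k := h.F0 _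
  A1 k := h.A1 _
  E1 k := h.E1 _
  g k n := by simpa only [add_assoc] using h.g (m+k) n
  p k n := by simpa only [add_assoc] using h.p (m+k) n
  q k n := by simpa only [add_assoc] using h.q (m+k) n
  pq k := h.pq _
  kA k n := by simpa only [add_assoc] using h.kA (m+k) n
  kE k n := by simpa only [add_assoc] using h.kE (m+k) n

lemma sqrt_ofReal {a : ℝ} (h : 0 ≤ a) : ofReal a ^ ((1:ℝ)/2) = ofReal (√a) := by
  rw [ofReal_rpow_of_nonneg h (by norm_num), sqrt_eq_rpow]

lemma hH_ofReal {A E G P F : ℝ} (hA : 0 ≤ A) (hE : 0 ≤ E) (hG : 0 ≤ G) (hP : 0 ≤ P) (hF : 0 ≤ F) :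
    ofReal (hH A E G P F) = ofReal A ^ ((1:ℝ)/2) * ofReal E ^ ((1:ℝ)/2) * ofReal G ^ ((1:ℝ)/2) +
      ofReal A ^ ((1:ℝ)/2) * ofReal P + ofReal G ^ ((1:ℝ)/2) * ofReal F + ofReal A ^ ((1:ℝ)/2) * ofReal F := by
  rw [sqrt_ofReal hA, sqrt_ofReal hE, sqrt_ofReal hG]
  unfold hH
  rw [ofReal_add (by positivity) (by positivity), ofReal_add (by positivity) (by positivity), ofReal_add (by positivity) (by positivity),
    ofReal_mul (by positivity), ofReal_mul (by positivity), ofReal_mul (by positivity), ofReal_mul (by positivity), ofReal_mul (by positivity)]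

/-- transfer of a recursive inequality -/
lemma transfer {x : ℝ≥0∞} {C' : ℝ≥0} {C : ℝ} (hC : (C':ℝ) ≤ C) {a b : ℝ} {N : ℕ} {c d : ℕ → ℝ} (ha : 0 ≤ a) (hb : 0 ≤ b) (hc : ∀ j, 0 ≤ c j) (hd : ∀ j, 0 ≤ d j)
    (h : x ≤ C' * (ofReal a * ofReal b + ∑ j ∈ range N, ofReal (c j) * ofReal (d j))) :
    x.toReal ≤ C * (a * b + ∑ j ∈ range N, c j * d j) := by
  have hs : 0 ≤ ∑ j ∈ range N, c j * d j := Finset.sum_nonneg fun j _ => mul_nonneg (hc j) (hd j)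
  have hC0 : 0 ≤ C := C'.2.trans hC
  refine toReal_le_of_le_ofReal (by positivity) (h.trans ?_)
  rw [ofReal_mul hC0, ofReal_add (by positivity) hs, ofReal_mul ha, ENNReal.ofReal_sum_of_nonneg (fun j _ => mul_nonneg (hc j) (hd j))]
  simp only [ofReal_mul (hc _)]
  refine mul_le_mul_left ?_ _
  rw [← ofReal_coe_nnreal]
  exact ofReal_le_ofReal hC

def rA (v : VV) (x0 : V3) (t0 R : ℝ) (k : ℕ) : ℝ := (fA v x0 t0 (rr R k)).toReal
def rE (dv : DV) (x0 : V3) (t0 R : ℝ) (k : ℕ) : ℝ := (fE dv x0 t0 (rr R k)).toReal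
def rG (v : VV) (x0 : V3) (t0 R : ℝ) (k : ℕ) : ℝ := (fG v x0 t0 (rr R k)).toReal
def rP (p : VR) (x0 : V3) (t0 R : ℝ) (k : ℕ) : ℝ := (fP p x0 t0 (rr R k)).toReal
def rQ (p : VR) (x0 : V3) (t0 R : ℝ) (k : ℕ) : ℝ := (fQ p x0 t0 (rr R k)).toReal
def rF (f : VV) (x0 : V3) (t0 R : ℝ) (k : ℕ) : ℝ := (fF f x0 t0 (rr R k)).toReal

lemma half_quarter (n : ℕ) : (((1:ℝ)/2)^n)^2 = (1/4)^n := by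
  rw [← pow_mul, mul_comm, pow_mul]; norm_num

lemma SQ_of_MS : ∃ C : ℝ, 1 ≤ C ∧ ∀ Ω T v dv p f, MS Ω T v dv p f → ∀ (x0 : V3) (t0 R : ℝ), 0 < R → R ≤ 1 → ball x0 R ⊆ Ω → 0 ≤ t0 - R ^ 2 → t0 < T →
    SQ C (rA v x0 t0 R) (rE dv x0 t0 R) (rG v x0 t0 R) (rP p x0 t0 R) (rQ p x0 t0 R) (rF f x0 t0 R) ∧
    (∀ k, fA v x0 t0 (rr R k) < ∞ ∧ fE dv x0 t0 (rr R k) < ∞ ∧ fQ p x0 t0 (rr R k) < ∞ ∧ fF f x0 t0 (rr R k) < ∞) := by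
  obtain ⟨C1, h1⟩ := R1
  obtain ⟨C2, h2⟩ := R3
  obtain ⟨C3, h3⟩ := R3q
  obtain ⟨C4, h4⟩ := K_ineq
  refine ⟨1 + C1 + C2 + C3 + C4, by have := C1.2; have := C2.2; have := C3.2; have := C4.2; simp only [NNReal.val_eq_coe] at *; linarith, fun Ω T v dv p f h x0 t0 R hR hR1 hB ht0 htT => ?_⟩
  have hk0 := fun k => rr_pos hR k
  have hkB : ∀ k, ball x0 (rr R k) ⊆ Ω := fun k => (ball_subset_ball (rr_le hR k)).trans hB
  have hk2 : ∀ k, 0 ≤ t0 - rr R k ^ 2 := fun k => by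
    have := pow_le_pow_left₀ (hk0 k).le (rr_le hR k) 2
    linarith
  have hkI : ∀ k, Ioo (t0 - rr R k ^ 2) t0 ⊆ Ioo 0 T := fun k => Ioo_subset_Ioo (hk2 k) htT.le
  have hgi : ∀ k, GI x0 t0 (rr R k) v dv p f := fun k => h.gi (hkB k) (hkI k)
  have hfin : ∀ k, fA v x0 t0 (rr R k) < ∞ ∧ fE dv x0 t0 (rr R k) < ∞ ∧ fQ p x0 t0 (rr R k) < ∞ ∧ fF f x0 t0 (rr R k) < ∞ := by
    intro k
    obtain ⟨a, b, c⟩ := h.fin (hk0 k) (hkB k) (hkI k)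
    obtain ⟨γ, _, _, φ, hφ⟩ := h.F_decay
    exact ⟨a, b, c, lt_of_le_of_lt (hφ x0 t0 _ (hk0 k) ((rr_le hR k).trans hR1) (hkB k) (hkI k)) (mul_lt_top coe_lt_top (pw_ne_top _ _).lt_top)⟩
  have hG : ∀ k n, fG v x0 t0 (rr R (k+n)) ≤ C1 * (ofReal (2^n) * fE dv x0 t0 (rr R k) + ofReal ((1/4)^n) * fA v x0 t0 (rr R k)) := by
    intro k n
    have := h1 x0 t0 (rr R k) v dv p f (hk0 k) (hgi k) (rr R (k+n)) (hk0 _) (rr_anti hR (Nat.le_add_right k n))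
    have e1 : rr R (k+n) / rr R k = (1/2)^n := by rw [rr_ratio hR (Nat.le_add_right k n), Nat.add_sub_cancel_left]
    have e2 : rr R k / rr R (k+n) = 2^n := by rw [← inv_div, e1]; simp
    rwa [e1, e2, half_quarter] at this
  have hGf : ∀ k, fG v x0 t0 (rr R k) < ∞ := by
    intro k
    refine lt_of_le_of_lt (hG k 0) ?_
    have := (hfin k).1; have := (hfin k).2.1
    exact mul_lt_top coe_lt_top (add_lt_top.2 ⟨mul_lt_top ofReal_lt_top (by assumption), mul_lt_top ofReal_lt_top (by assumption)⟩)
  have hPQ : ∀ k, fP p x0 t0 (rr R k) ≤ fQ p x0 t0 (rr R k) := fun k => P_le_Q h.mp x0 t0 (hk0 k)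
  have hPf : ∀ k, fP p x0 t0 (rr R k) < ∞ := fun k => lt_of_le_of_lt (hPQ k) (hfin k).2.2.1
  have eA : ∀ k, fA v x0 t0 (rr R k) = ofReal (rA v x0 t0 R k) := fun k => (ofReal_toReal (hfin k).1.ne).symm
  have eE : ∀ k, fE dv x0 t0 (rr R k) = ofReal (rE dv x0 t0 R k) := fun k => (ofReal_toReal (hfin k).2.1.ne).symm
  have eQ : ∀ k, fQ p x0 t0 (rr R k) = ofReal (rQ p x0 t0 R k) := fun k => (ofReal_toReal (hfin k).2.2.1.ne).symm
  have eF : ∀ k, fF f x0 t0 (rr R k) = ofReal (rF f x0 t0 R k) := fun k => (ofReal_toReal (hfin k).2.2.2.ne).symm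
  have eG : ∀ k, fG v x0 t0 (rr R k) = ofReal (rG v x0 t0 R k) := fun k => (ofReal_toReal (hGf k).ne).symm
  have eP : ∀ k, fP p x0 t0 (rr R k) = ofReal (rP p x0 t0 R k) := fun k => (ofReal_toReal (hPf k).ne).symm
  have nA : ∀ k, 0 ≤ rA v x0 t0 R k := fun k => toReal_nonneg
  have nE : ∀ k, 0 ≤ rE dv x0 t0 R k := fun k => toReal_nonneg
  have nG : ∀ k, 0 ≤ rG v x0 t0 R k := fun k => toReal_nonneg
  have nP : ∀ k, 0 ≤ rP p x0 t0 R k := fun k => toReal_nonneg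
  have nQ : ∀ k, 0 ≤ rQ p x0 t0 R k := fun k => toReal_nonneg
  have nF : ∀ k, 0 ≤ rF f x0 t0 R k := fun k => toReal_nonneg
  have c1 := C1.2; have c2 := C2.2; have c3 := C3.2; have c4 := C4.2
  have hC1 : (1:ℝ) ≤ 1 + C1 + C2 + C3 + C4 := by
    change (0:ℝ) ≤ C1 at c1; change (0:ℝ) ≤ C2 at c2; change (0:ℝ) ≤ C3 at c3; change (0:ℝ) ≤ C4 at c4; linarith
  change (0:ℝ) ≤ C1 at c1; change (0:ℝ) ≤ C2 at c2; change (0:ℝ) ≤ C3 at c3; change (0:ℝ) ≤ C4 at c4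
  have hratio : ∀ k, rr R k / rr R (k+1) = 2 := fun k => by
    have := hk0 k
    rw [rr_succ]; field_simp
  have hsubI : ∀ k, Ioo (t0 - rr R (k+1) ^ 2) t0 ⊆ Ioo (t0 - rr R k ^ 2) t0 := fun k => by
    refine Ioo_subset_Ioo_left ?_
    have := pow_le_pow_left₀ (hk0 (k+1)).le (rr_anti hR (Nat.le_succ k)) 2
    linarith
  refine ⟨⟨hC1, nA, nE, nG, nP, nQ, nF, ?_, ?_, ?_, ?_, ?_, ?_, ?_, ?_⟩, hfin⟩
  · intro k
    have := A_sub (x0 := x0) (x1 := x0) (v := v) (hk0 (k+1)) (hk0 k) (ball_subset_ball (rr_anti hR (Nat.le_succ k))) (hsubI k)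
    rw [hratio, eA k, ← ofReal_mul (by norm_num)] at this
    exact toReal_le_of_le_ofReal (by have := nA k; positivity) this
  · intro k
    have := E_sub (x0 := x0) (x1 := x0) (dv := dv) (hk0 (k+1)) (hk0 k) (ball_subset_ball (rr_anti hR (Nat.le_succ k))) (hsubI k)
    rw [hratio, eE k, ← ofReal_mul (by norm_num)] at this
    exact toReal_le_of_le_ofReal (by have := nE k; positivity) this
  · intro k n
    have := hG k n
    rw [eE k, eA k] at this
    have e1 : C1 * (ofReal (2^n) * ofReal (rE dv x0 t0 R k) + ofReal ((1/4)^n) * ofReal (rA v x0 t0 R k)) =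
      C1 * (ofReal (2^n) * ofReal (rE dv x0 t0 R k) + ∑ j ∈ range 1, ofReal ((fun _ => (1/4)^n) j) * ofReal ((fun _ => rA v x0 t0 R k) j)) := by
      rw [sum_range_one]
    rw [e1] at this
    have t := transfer (C := 1 + C1 + C2 + C3 + C4) (by linarith) (by positivity) (nE k) (fun _ => by positivity) (fun _ => nA k) this
    rw [sum_range_one] at t
    exact t
  · intro k n
    rcases Nat.eq_zero_or_pos n with rfl | hn
    · simp only [Nat.add_zero, pow_zero, one_mul, Finset.range_zero, Finset.sum_empty, add_zero]
      exact le_mul_of_one_le_left (nP k) hC1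
    · have := h2 x0 t0 (rr R k) v dv p f (hk0 k) (hgi k) n hn
      refine transfer (C' := C2) (by linarith) (by positivity) (nP k) (fun _ => by positivity) (fun j => add_nonneg (nE _) (nF _)) ?_
      rw [rr_add] at this
      refine this.trans_eq ?_
      congr 2
      · rw [eP, rr_ratio hR (Nat.le_add_right k n), Nat.add_sub_cancel_left]
      · refine sum_congr rfl fun j hj => ?_
        have hjn := mem_range.1 hj
        rw [rr_add, eE, eF, rr_ratio hR (by omega), show k + n - (k + j) = n - j by omega, ofReal_add (nE _) (nF _)]
  · intro k n
    rcases Nat.eq_zero_or_pos n with rfl | hn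
    · simp only [Nat.add_zero, pow_zero, one_mul, Finset.range_zero, Finset.sum_empty, add_zero]
      exact le_mul_of_one_le_left (nQ k) hC1
    · have := h3 x0 t0 (rr R k) v dv p f (hk0 k) (hgi k) n hn
      have nn : ∀ j, 0 ≤ rA v x0 t0 R (k+j) ^ ((1:ℝ)/4) * rE dv x0 t0 R (k+j) ^ ((3:ℝ)/4) := fun j => mul_nonneg (rpow_nonneg (nA _) _) (rpow_nonneg (nE _) _)
      refine transfer (C' := C3) (by linarith) (pow_nonneg lam_pos.le _) (nQ k) (fun _ => pow_nonneg lam_pos.le _) (fun j => add_nonneg (nn j) (nF _)) ?_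
      rw [rr_add] at this
      refine this.trans_eq ?_
      congr 2
      · rw [eQ, rr_ratio hR (Nat.le_add_right k n), Nat.add_sub_cancel_left, lam_pow]
      · refine sum_congr rfl fun j hj => ?_
        have hjn := mem_range.1 hj
        rw [rr_add, eA, eE, eF, rr_ratio hR (by omega), show k + n - (k + j) = n - j by omega, lam_pow, ofReal_add (nn j) (nF _),
          ofReal_mul (rpow_nonneg (nA _) _), ofReal_rpow_of_nonneg (nA _) (by norm_num), ofReal_rpow_of_nonneg (nE _) (by norm_num)]
  · intro k
    have := hPQ k
    rw [eP, eQ, ENNReal.ofReal_le_ofReal_iff (nQ k)] at this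
    exact this.trans (le_mul_of_one_le_left (nQ k) hC1)
  all_goals
    intro k n
    have := h4 Ω T v dv p f h x0 t0 (rr R k) n (hk0 k) (hkB k) (hk2 k) htT
    simp only [rr_add, ← add_assoc] at this
    refine transfer (C' := C4) (by linarith) (by positivity) (nG k) (fun _ => by positivity) (fun j => hH_nonneg (nP _) (nF _)) ?_
    have e : ofReal ((1/4)^n) * fG v x0 t0 (rr R k) + ∑ j ∈ range (n+1), ofReal ((1/4)^(n-j)) * fH v dv p f x0 t0 (rr R (k+j)) =
      ofReal ((1/4)^n) * ofReal (rG v x0 t0 R k) + ∑ j ∈ range (n+1), ofReal ((1/4)^(n-j)) *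
        ofReal (hH (rA v x0 t0 R (k+j)) (rE dv x0 t0 R (k+j)) (rG v x0 t0 R (k+j)) (rP p x0 t0 R (k+j)) (rF f x0 t0 R (k+j))) := by
      rw [eG]
      congr 1
      refine sum_congr rfl fun j _ => ?_
      rw [hH_ofReal (nA _) (nE _) (nG _) (nP _) (nF _), ← eA, ← eE, ← eG, ← eP, ← eF]
      rfl
    rw [e] at this
    first | exact this.1 | exact this.2
end

section

lemma geo_le {ρ : ℝ} (h0 : 0 ≤ ρ) (h1 : ρ ≤ 1/2) (n : ℕ) : ∑ j ∈ range n, ρ^(n-j) ≤ 1 := by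
  induction n with
  | zero => simp
  | succ n ih =>
    rw [sum_range_succ]
    have : ∑ j ∈ range n, ρ^(n+1-j) = ρ * ∑ j ∈ range n, ρ^(n-j) := by
      rw [mul_sum]
      refine sum_congr rfl fun j hj => ?_
      have := mem_range.1 hj
      rw [show n + 1 - j = (n - j) + 1 by omega, pow_succ']
    rw [this, Nat.add_sub_cancel_left, pow_one]
    nlinarith

lemma geo_sum {ρ B : ℝ} (h0 : 0 ≤ ρ) (h1 : ρ ≤ 1/2) (hB : 0 ≤ B) {n : ℕ} {c : ℕ → ℝ} (hc : ∀ j < n, c j ≤ B) :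
    ∑ j ∈ range n, ρ^(n-j) * c j ≤ B := by
  calc ∑ j ∈ range n, ρ^(n-j) * c j ≤ ∑ j ∈ range n, ρ^(n-j) * B :=
        sum_le_sum fun j hj => mul_le_mul_of_nonneg_left (hc j (mem_range.1 hj)) (pow_nonneg h0 _)
    _ = (∑ j ∈ range n, ρ^(n-j)) * B := by rw [Finset.sum_mul]
    _ ≤ 1 * B := mul_le_mul_of_nonneg_right (geo_le h0 h1 n) hB
    _ = B := one_mul B

lemma q4 {A B : ℝ} (hA : 0 ≤ A) (hB : 0 ≤ B) (h : A ≤ B^4) : A ^ ((1:ℝ)/4) ≤ B := by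
  calc A ^ ((1:ℝ)/4) ≤ (B^4) ^ ((1:ℝ)/4) := Real.rpow_le_rpow hA h (by norm_num)
    _ = B := by rw [← Real.rpow_natCast, ← Real.rpow_mul hB]; norm_num

lemma q34 {A B : ℝ} (hA : 0 ≤ A) (hB : 0 ≤ B) (h : A ≤ B^4) : A ^ ((3:ℝ)/4) ≤ B^3 := by
  calc A ^ ((3:ℝ)/4) = (A ^ ((1:ℝ)/4))^3 := by rw [← Real.rpow_natCast, ← Real.rpow_mul hA]; norm_num
    _ ≤ B^3 := pow_le_pow_left₀ (rpow_nonneg hA _) (q4 hA hB h) 3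

variable {C : ℝ} {A E G P Q F : ℕ → ℝ}

lemma SQ.E_pow (h : SQ C A E G P Q F) (k n : ℕ) : E (k+n) ≤ 2^n * E k := by
  induction n with
  | zero => simp
  | succ n ih =>
    have := h.E1 (k+n)
    rw [pow_succ, ← add_assoc]; linarith

lemma SQ.Y (h : SQ C A E G P Q F) (k : ℕ) :
    A (k+2) ≤ A k / 256 + 300 * C^2 * (G k + E k * G k + P k ^2 + F k ^2) := by
  have h1 := h.kA k 0
  simp only [Nat.add_zero, pow_zero, one_mul, zero_add, sum_range_one, Nat.sub_zero] at h1
  unfold hH at h1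
  have hC := h.C1
  have a := sq_sqrt (h.A0 k); have e := sq_sqrt (h.E0 k); have g := sq_sqrt (h.G0 k)
  have hP := h.P0 k; have hF := h.F0 k; have hG := h.G0 k; have hE := h.E0 k
  set a' := √(A k); set e' := √(E k); set g' := √(G k)
  have i1 : C * (a' * e' * g') ≤ a'^2/1024 + 256*C^2*(e'^2*g'^2) := by nlinarith [sq_nonneg (a'/32 - 16*C*(e'*g'))]
  have i2 : C * (a' * P k) ≤ a'^2/1024 + 256*C^2*(P k ^2) := by nlinarith [sq_nonneg (a'/32 - 16*C*(P k))]
  have i3 : C * (a' * F k) ≤ a'^2/1024 + 256*C^2*(F k ^2) := by nlinarith [sq_nonneg (a'/32 - 16*C*(F k))]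
  have i4 : C * (g' * F k) ≤ C^2 * (g'^2 + F k ^2) := by
    have : C * (g' * F k) ≤ C * (g'^2 + F k ^2) := by
      refine mul_le_mul_of_nonneg_left ?_ (by linarith)
      nlinarith [sq_nonneg (g' - F k), sq_nonneg g', sq_nonneg (F k)]
    refine this.trans (mul_le_mul_of_nonneg_right ?_ (by positivity))
    nlinarith
  rw [a] at i1 i2 i3
  rw [g] at i4; rw [e, g] at i1
  have i5 : C * G k ≤ C^2 * G k := mul_le_mul_of_nonneg_right (by nlinarith) hG
  have hA := h.A0 k
  have j1 : 0 ≤ C^2 * G k := by positivity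
  have j2 : 0 ≤ C^2 * (E k * G k) := by positivity
  have j3 : 0 ≤ C^2 * P k^2 := by positivity
  have j4 : 0 ≤ C^2 * F k^2 := by positivity
  linarith

lemma ev_bound {a : ℕ → ℝ} {n : ℕ} {X : ℝ} (hX : 1 ≤ X) (h : ∀ k, a (k+n+2) ≤ a k / 4 + a (k+n) / 4 + X) :
    ∃ N, ∀ k ≥ N, a k ≤ 3 * X := by
  obtain ⟨B, hB0, hB⟩ : ∃ B, 2 * X ≤ B ∧ ∀ k, a k ≤ B := by
    refine ⟨2 * X + ∑ j ∈ range (n+2), |a j|, le_add_of_nonneg_right (by positivity), fun k => ?_⟩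
    have hs : 0 ≤ ∑ j ∈ range (n+2), |a j| := by positivity
    induction k using Nat.strong_induction_on with
    | _ k ih =>
      by_cases hk : k < n + 2
      · have := Finset.single_le_sum (f := fun j => |a j|) (fun j _ => abs_nonneg _) (mem_range.2 hk)
        have := le_abs_self (a k)
        linarith
      · obtain ⟨m, rfl⟩ : ∃ m, k = m + n + 2 := ⟨k - (n+2), by omega⟩
        have := h m; have := ih m (by omega); have := ih (m+n) (by omega)
        linarith
  have hm : ∀ m : ℕ, ∀ k ≥ m * (n+2), a k ≤ B * (1/2)^m + 2 * X := by
    intro m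
    induction m with
    | zero => intro k _; have := hB k; simp; linarith
    | succ m ih =>
      intro k hk
      have hk' : k ≥ m * (n+2) + (n + 2) := by rw [Nat.succ_mul] at hk; exact hk
      obtain ⟨j, rfl⟩ : ∃ j, k = j + n + 2 := ⟨k - (n+2), by omega⟩
      have := h j; have := ih j (by omega); have := ih (j+n) (by omega)
      rw [pow_succ]; linarith
  have ht : Tendsto (fun m : ℕ => B * (1/2:ℝ)^m) atTop (𝓝 (B * 0)) :=
    (tendsto_pow_atTop_nhds_zero_of_lt_one (by norm_num) (by norm_num)).const_mul B
  rw [mul_zero] at ht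
  obtain ⟨m, hm'⟩ := (ht.eventually (gt_mem_nhds (show (0:ℝ) < X by linarith))).exists
  exact ⟨m * (n+2), fun k hk => by have := hm m k hk; linarith⟩

lemma phase1P (h : SQ C A E G P Q F) {κ : ℝ} (hκ : 1 ≤ κ) (hE : ∀ k, E k ≤ κ^8) (hF : ∀ k, F k ≤ 1) :
    ∃ N, ∀ k ≥ N, P k ≤ 3 * C * κ^8 := by
  have ht : Tendsto (fun m : ℕ => (1/2:ℝ)^m * P 0) atTop (𝓝 (0 * P 0)) :=
    (tendsto_pow_atTop_nhds_zero_of_lt_one (by norm_num) (by norm_num)).mul_const _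
  rw [zero_mul] at ht
  obtain ⟨N, hN⟩ := eventually_atTop.1 (ht.eventually (gt_mem_nhds one_pos))
  refine ⟨N, fun k hk => ?_⟩
  have h1 := h.p 0 k
  have h8 : 1 ≤ κ^8 := one_le_pow₀ hκ
  have h2 : ∑ j ∈ range k, ((1:ℝ)/2)^(k-j) * (E (0+j) + F (0+j)) ≤ κ^8 + 1 :=
    geo_sum (by norm_num) (by norm_num) (by linarith) fun j _ => add_le_add (hE _) (hF _)
  have h3 := hN k hk
  rw [zero_add] at h1
  refine h1.trans ?_
  have hC := h.C1
  calc _ ≤ C * (3 * κ^8) := mul_le_mul_of_nonneg_left (by linarith) (by linarith)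
    _ = _ := by ring

lemma exists_n0 (D : ℝ) : ∃ n : ℕ, D * (1/4:ℝ)^n ≤ 1/4 := by
  have ht : Tendsto (fun m : ℕ => D * (1/4:ℝ)^m) atTop (𝓝 (D * 0)) :=
    (tendsto_pow_atTop_nhds_zero_of_lt_one (by norm_num) (by norm_num)).const_mul D
  rw [mul_zero] at ht
  obtain ⟨m, hm'⟩ := (ht.eventually (gt_mem_nhds (show (0:ℝ) < 1/4 by norm_num))).exists
  exact ⟨m, hm'.le⟩

lemma phase1A (C : ℝ) (hC : 1 ≤ C) : ∃ K ≥ (1:ℝ), ∀ A E G P Q F, SQ C A E G P Q F → ∀ h : ℕ, ∀ κ : ℝ, κ = 2^h → (∀ k, E k ≤ κ^8) → (∀ k, F k ≤ 1) → (∀ k, P k ≤ 3 * C * κ^8) →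
    ∃ N, ∀ k ≥ N, A k ≤ K * κ^20 := by
  obtain ⟨n0, hn0⟩ := exists_n0 (600 * C^3)
  refine ⟨3 * (600 * C^3 * 2^n0 + 300*C^2*(9*C^2+1)), ?_, ?_⟩
  · have : 1 ≤ C^2 := one_le_pow₀ hC
    have : 0 ≤ 600 * C^3 * 2^n0 := by positivity
    nlinarith
  intro A E G P Q F hs h κ hκ hE hF hP
  have hκ1 : 1 ≤ κ := by rw [hκ]; exact one_le_pow₀ (by norm_num)
  set X := (600 * C^3 * 2^n0 + 300*C^2*(9*C^2+1)) * κ^20 with hX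
  have h20 : 1 ≤ κ^20 := one_le_pow₀ hκ1
  have hX1 : 1 ≤ X := by
    refine one_le_mul_of_one_le_of_one_le ?_ h20
    have : 1 ≤ C^2 := one_le_pow₀ hC
    have : 0 ≤ 600 * C^3 * 2^n0 := by positivity
    nlinarith
  have := ev_bound (a := A) (n := 4*h+n0) hX1 (fun k => ?_)
  · obtain ⟨N, hN⟩ := this
    exact ⟨N, fun k hk => (hN k hk).trans_eq (by rw [hX]; ring)⟩
  have y := hs.Y (k+(4*h+n0))
  have g := hs.g k (4*h+n0)
  have e2 : (2:ℝ)^(4*h+n0) = κ^4 * 2^n0 := by rw [hκ, pow_add, ← pow_mul, mul_comm h 4]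
  have e4 : κ^8 * (1/4:ℝ)^(4*h+n0) = (1/4)^n0 := by
    rw [hκ, pow_add, ← mul_assoc, ← pow_mul, mul_comm h 8, pow_mul, pow_mul, ← mul_pow]; norm_num
  set j := k+(4*h+n0)
  have hG0 := hs.G0 j
  have hA0 := hs.A0 k; have hA0' := hs.A0 j; have hE0 := hs.E0 k; have hP0 := hs.P0 j; have hF0 := hs.F0 j
  have h8 : 1 ≤ κ^8 := one_le_pow₀ hκ1
  have i1 : G j + E j * G j ≤ 2 * κ^8 * G j := by nlinarith [hE j]
  have i2 : 2 * κ^8 * G j ≤ 2 * C * 2^n0 * κ^20 + 2 * C * (1/4)^n0 * A k := by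
    calc 2 * κ^8 * G j ≤ 2 * κ^8 * (C * (2^(4*h+n0) * κ^8 + (1/4)^(4*h+n0) * A k)) := by
          refine mul_le_mul_of_nonneg_left (g.trans ?_) (by positivity)
          have := hE k
          gcongr
      _ = 2 * C * ((κ^8*(2^(4*h+n0))) * κ^8 + (κ^8 * (1/4)^(4*h+n0)) * A k) := by ring
      _ = _ := by rw [e4, e2]; ring
  have i3 : P j ^ 2 ≤ 9 * C^2 * κ^20 := by
    calc P j ^2 ≤ (3 * C * κ^8)^2 := pow_le_pow_left₀ hP0 (hP j) 2
      _ = 9 * C^2 * κ^16 := by ring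
      _ ≤ _ := by gcongr <;> norm_num
  have i4 : F j ^2 ≤ κ^20 := (pow_le_one₀ hF0 (hF j)).trans h20
  have i5 : A j / 256 ≤ A j / 4 := by linarith
  have i6 : 600 * C^3 * (1/4)^n0 * A k ≤ 1/4 * A k := mul_le_mul_of_nonneg_right hn0 hA0
  have : k + (4*h+n0) + 2 = j + 2 := rfl
  rw [this]
  refine y.trans ?_
  have i7 : 300 * C^2 * (G j + E j * G j + P j ^2 + F j ^2) ≤ 300 * C^2 * (2 * C * 2^n0 * κ^20 + 2 * C * (1/4)^n0 * A k + 9 * C^2 * κ^20 + κ^20) := by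
    refine mul_le_mul_of_nonneg_left ?_ (by positivity)
    linarith
  have i8 : 300 * C^2 * (2 * C * 2^n0 * κ^20 + 2 * C * (1/4)^n0 * A k + 9 * C^2 * κ^20 + κ^20) = 600 * C^3 * (1/4)^n0 * A k + X := by rw [hX]; ring
  linarith

lemma phase1 (C : ℝ) (hC : 1 ≤ C) : ∃ K ≥ (1:ℝ), ∀ A E G P Q F, SQ C A E G P Q F → ∀ h : ℕ, ∀ κ : ℝ, κ = 2^h → (∀ k, E k ≤ κ^8) → (∀ k, F k ≤ 1) →
    ∃ N, ∀ k ≥ N, P k ≤ K * κ^8 ∧ A k ≤ K * κ^20 ∧ G k ≤ K * κ^12 ∧ Q k ≤ K * κ^12 := by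
  obtain ⟨K0, hK0, H⟩ := phase1A C hC
  refine ⟨3 * C * (1 + K0), by nlinarith, fun A E G P Q F hs h κ hκ hE hF => ?_⟩
  have hκ1 : 1 ≤ κ := by rw [hκ]; exact one_le_pow₀ (by norm_num)
  obtain ⟨N1, hN1⟩ := phase1P hs hκ1 hE hF
  obtain ⟨N2, hN2⟩ := H _ _ _ _ _ _ (hs.shift N1) h κ hκ (fun k => hE _) (fun k => hF _) (fun k => hN1 _ (Nat.le_add_right _ _))
  have hA : ∀ k ≥ N1 + N2, A k ≤ K0 * κ^20 := fun k hk => by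
    have := hN2 (k - N1) (by omega)
    rwa [show N1 + (k - N1) = k by omega] at this
  have ht : Tendsto (fun m : ℕ => lam^m * Q (N1+N2)) atTop (𝓝 (0 * Q (N1+N2))) :=
    (tendsto_pow_atTop_nhds_zero_of_lt_one lam_pos.le (by linarith [lam_le])).mul_const _
  rw [zero_mul] at ht
  obtain ⟨N3, hN3⟩ := eventually_atTop.1 (ht.eventually (gt_mem_nhds one_pos))
  have h8 : 1 ≤ κ^8 := one_le_pow₀ hκ1
  have h12 : 1 ≤ κ^12 := one_le_pow₀ hκ1
  refine ⟨N1 + N2 + N3 + 4 * h, fun k hk => ⟨?_, ?_, ?_, ?_⟩⟩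
  · refine (hN1 k (by omega)).trans ?_
    refine mul_le_mul_of_nonneg_right ?_ (by positivity)
    nlinarith
  · refine (hA k (by omega)).trans ?_
    refine mul_le_mul_of_nonneg_right ?_ (by positivity)
    nlinarith
  · obtain ⟨j, rfl⟩ : ∃ j, k = j + 4 * h := ⟨k - 4*h, by omega⟩
    refine (hs.g j (4*h)).trans ?_
    have e2 : (2:ℝ)^(4*h) = κ^4 := by rw [hκ, ← pow_mul, mul_comm h 4]
    have e4 : (1/4:ℝ)^(4*h) * κ^8 = 1 := by
      rw [hκ, ← pow_mul, mul_comm h 8, pow_mul, pow_mul, ← mul_pow]; norm_num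
    have := hE j
    calc _ ≤ C * (2^(4*h) * κ^8 + (1/4)^(4*h) * (K0 * κ^20)) := by have := hA j (by omega); gcongr
      _ = C * (2^(4*h) * κ^8 + ((1/4)^(4*h) * κ^8) * K0 * κ^12) := by ring
      _ = C * (1 + K0) * κ^12 := by rw [e2, e4]; ring
      _ ≤ _ := by
        refine mul_le_mul_of_nonneg_right ?_ (by positivity)
        nlinarith
  · obtain ⟨j, rfl⟩ : ∃ j, k = N1 + N2 + j := ⟨k - (N1+N2), by omega⟩
    refine (hs.q (N1+N2) j).trans ?_
    have i1 := hN3 j (by omega)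
    have i2 : ∑ i ∈ range j, lam^(j-i) * (A (N1+N2+i) ^ ((1:ℝ)/4) * E (N1+N2+i) ^ ((3:ℝ)/4) + F (N1+N2+i)) ≤ (K0+1) * κ^12 := by
      refine geo_sum lam_pos.le lam_le (by positivity) fun i _ => ?_
      have j1 : A (N1+N2+i) ^ ((1:ℝ)/4) ≤ K0 * κ^5 := q4 (hs.A0 _) (by positivity) ((hA _ (by omega)).trans (by
        rw [mul_pow, ← pow_mul]
        refine mul_le_mul_of_nonneg_right ?_ (by positivity)
        exact le_self_pow₀ hK0 (by norm_num)))
      have j2 : E (N1+N2+i) ^ ((3:ℝ)/4) ≤ (κ^2)^3 := q34 (hs.E0 _) (by positivity) ((hE _).trans_eq (by ring))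
      have j3 := hF (N1+N2+i)
      calc _ ≤ K0 * κ^5 * (κ^2)^3 + 1 := add_le_add (mul_le_mul j1 j2 (rpow_nonneg (hs.E0 _) _) (by positivity)) j3
        _ = K0 * κ^11 + 1 := by ring
        _ ≤ K0 * κ^12 + κ^12 := by gcongr <;> norm_num
        _ = _ := by ring
    calc _ ≤ C * (1 + (K0+1) * κ^12) := by gcongr
      _ ≤ C * (κ^12 + (K0+1) * κ^12) := by gcongr
      _ = C * (K0+2) * κ^12 := by ring
      _ ≤ _ := by
        refine mul_le_mul_of_nonneg_right ?_ (by positivity)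
        nlinarith
end

section

lemma stageA (C K : ℝ) (hC : 1 ≤ C) (hK : 1 ≤ K) : ∃ K' ≥ (1:ℝ), ∀ A E G P Q F, SQ C A E G P Q F → ∀ h : ℕ, ∀ κ ε : ℝ, κ = 2^h → 0 ≤ ε → ε ≤ 1 →
    (∀ i, A i ≤ K * κ^20) → (∀ i, G i ≤ K * κ^12) → P 0 ≤ K * κ^8 → Q 0 ≤ K * κ^12 → κ^8 * E 0 ≤ ε → (∀ i, F i ≤ 1) →
    A (2*h) ≤ K' * κ^12 ∧ P (2*h) ≤ K' * κ^6 ∧ Q (2*h) ≤ K' * κ^9 ∧ κ^6 * E (2*h) ≤ ε := by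
  set K1 := C * (K + 2) with hK1
  set K2 := 32 * (300 * C^2) * (2*K + K1^2 + 1) with hK2
  have hK10 : 0 ≤ K1 := by positivity
  have hK20 : 0 ≤ K2 := by positivity
  refine ⟨(K + K2) + K1 + C * (2 * K + 1), by nlinarith, fun A E G P Q F hs h κ ε hκ hε0 hε hA hG hP hQ hE hF => ?_⟩
  have hκ1 : 1 ≤ κ := by rw [hκ]; exact one_le_pow₀ (by norm_num)
  have e2 : (2:ℝ)^(2*h) = κ^2 := by rw [hκ, ← pow_mul, mul_comm h 2]
  have hEi : ∀ i ≤ 2*h, κ^6 * E i ≤ ε := by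
    intro i hi
    have h1 := hs.E_pow 0 i
    rw [zero_add] at h1
    have h2 : (2:ℝ)^i ≤ κ^2 := by rw [← e2]; exact pow_le_pow_right₀ (by norm_num) hi
    have h0 := hs.E0 0
    calc κ^6 * E i ≤ κ^6 * (κ^2 * E 0) := by
          refine mul_le_mul_of_nonneg_left (h1.trans ?_) (by positivity)
          exact mul_le_mul_of_nonneg_right h2 h0
      _ = κ^8 * E 0 := by ring
      _ ≤ ε := hE
  have hE1 : ∀ i ≤ 2*h, E i ≤ 1 := fun i hi => by
    have := hEi i hi
    have h6 : 1 ≤ κ^6 := one_le_pow₀ hκ1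
    have := hs.E0 i
    nlinarith
  have hPj : ∀ j ≤ h, P (2*j) ≤ K1 * ((1/4)^j * κ^8) := by
    intro j hj
    have h1 := hs.p 0 (2*j)
    rw [zero_add] at h1
    have hs2 : ∑ i ∈ range (2*j), ((1:ℝ)/2)^(2*j-i) * (E (0+i) + F (0+i)) ≤ 2 :=
      geo_sum (by norm_num) (by norm_num) (by norm_num) fun i hi => by
        have := hE1 (0+i) (by omega); have := hF (0+i); linarith
    have e3 : ((1:ℝ)/2)^(2*j) = (1/4)^j := by rw [pow_mul]; norm_num
    have e5 : 1 ≤ (1/4:ℝ)^j * κ^8 := by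
      have e6 : (1/4:ℝ)^h * κ^2 = 1 := by rw [hκ, ← pow_mul, mul_comm h 2, pow_mul, ← mul_pow]; norm_num
      have e7 : (1/4:ℝ)^h ≤ (1/4)^j := pow_le_pow_of_le_one (by norm_num) (by norm_num) hj
      have e8 : κ^2 ≤ κ^8 := pow_le_pow_right₀ hκ1 (by norm_num)
      calc (1:ℝ) = (1/4:ℝ)^h * κ^2 := e6.symm
        _ ≤ _ := mul_le_mul e7 e8 (by positivity) (by positivity)
    calc P (2*j) ≤ C * ((1/4)^j * (K * κ^8) + 2) := by
          refine h1.trans (mul_le_mul_of_nonneg_left ?_ (by linarith))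
          rw [e3]
          exact add_le_add (mul_le_mul_of_nonneg_left hP (by positivity)) hs2
      _ ≤ C * ((1/4)^j * (K * κ^8) + 2 * ((1/4)^j * κ^8)) := by gcongr; linarith
      _ = _ := by rw [hK1]; ring
  have hAj : ∀ j ≤ h, A (2*j) ≤ (1/256)^j * (K * κ^20) + K2 * ((1/16)^j * κ^16) := by
    intro j
    induction j with
    | zero => intro _; have := hA 0; simp only [mul_zero, pow_zero, one_mul]; have : 0 ≤ K2 * κ^16 := by positivity
              linarith
    | succ j ih =>
      intro hj
      have y := hs.Y (2*j)
      have i1 := ih (by omega)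
      have i2 := hPj j (by omega)
      have i3 := hE1 (2*j) (by omega)
      have i4 := hG (2*j); have i5 := hs.G0 (2*j)
      have i6 : P (2*j)^2 ≤ K1^2 * ((1/16)^j * κ^16) := by
        refine (pow_le_pow_left₀ (hs.P0 _) i2 2).trans_eq ?_
        have : ((1:ℝ)/16)^j = ((1/4)^j)^2 := by rw [← pow_mul, mul_comm, pow_mul]; norm_num
        rw [this]; ring
      have e5 : κ^12 ≤ (1/16:ℝ)^j * κ^16 := by
        have e6 : (1/16:ℝ)^h * κ^4 = 1 := by rw [hκ, ← pow_mul, mul_comm h 4, pow_mul, ← mul_pow]; norm_num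
        have e7 : (1/16:ℝ)^h ≤ (1/16)^j := pow_le_pow_of_le_one (by norm_num) (by norm_num) (by omega)
        calc κ^12 = ((1/16:ℝ)^h * κ^4) * κ^12 := by rw [e6, one_mul]
          _ = (1/16:ℝ)^h * κ^16 := by ring
          _ ≤ _ := mul_le_mul_of_nonneg_right e7 (by positivity)
      have h12 : 1 ≤ κ^12 := one_le_pow₀ hκ1
      set w := (1/16:ℝ)^j * κ^16
      have i7 : F (2*j)^2 ≤ w := (pow_le_one₀ (hs.F0 _) (hF _)).trans (h12.trans e5)
      have i8 : G (2*j) + E (2*j) * G (2*j) ≤ 2 * K * w := by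
        calc _ ≤ 2 * G (2*j) := by nlinarith
          _ ≤ 2 * (K * κ^12) := by linarith
          _ ≤ 2 * (K * w) := by gcongr
          _ = _ := by ring
      have i9 : 300 * C^2 * (G (2*j) + E (2*j) * G (2*j) + P (2*j)^2 + F (2*j)^2) ≤ 300 * C^2 * ((2*K+K1^2+1) * w) := by
        refine mul_le_mul_of_nonneg_left ?_ (by positivity)
        linarith
      have i10 : 300 * C^2 * ((2*K+K1^2+1) * w) = K2 * w / 32 := by rw [hK2]; ring
      have hw : 0 ≤ K2 * w := by positivity
      rw [show 2 * (j+1) = 2*j+2 by ring, pow_succ ((1:ℝ)/256), pow_succ ((1:ℝ)/16)]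
      have i11 : K2 * ((1/16)^j * (1/16) * κ^16) = K2 * w / 16 := by ring
      rw [i11]
      linarith
  have q8 : (1/256:ℝ)^h * κ^8 = 1 := by rw [hκ, ← pow_mul, mul_comm h 8, pow_mul, ← mul_pow]; norm_num
  have q4' : (1/16:ℝ)^h * κ^4 = 1 := by rw [hκ, ← pow_mul, mul_comm h 4, pow_mul, ← mul_pow]; norm_num
  have q2 : (1/4:ℝ)^h * κ^2 = 1 := by rw [hκ, ← pow_mul, mul_comm h 2, pow_mul, ← mul_pow]; norm_num
  have q3 : lam^(2*h) * κ^3 = 1 := by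
    rw [hκ, ← pow_mul, mul_comm h 3, pow_mul, pow_mul, ← mul_pow, pow_two, lam_sq]; norm_num
  refine ⟨?_, ?_, ?_, hEi _ le_rfl⟩
  · calc A (2*h) ≤ _ := hAj h le_rfl
      _ = ((1/256)^h * κ^8) * K * κ^12 + K2 * ((1/16)^h * κ^4) * κ^12 := by ring
      _ = (K + K2) * κ^12 := by rw [q8, q4']; ring
      _ ≤ _ := by
        refine mul_le_mul_of_nonneg_right ?_ (by positivity)
        have : 0 ≤ C * (2*K+1) := by positivity
        linarith
  · calc P (2*h) ≤ _ := hPj h le_rfl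
      _ = K1 * ((1/4)^h * κ^2) * κ^6 := by ring
      _ = K1 * κ^6 := by rw [q2]; ring
      _ ≤ _ := by
        refine mul_le_mul_of_nonneg_right ?_ (by positivity)
        have : 0 ≤ C * (2*K+1) := by positivity
        linarith
  · have h1 := hs.q 0 (2*h)
    rw [zero_add] at h1
    have h9 : 1 ≤ κ^9 := one_le_pow₀ hκ1
    have hs2 : ∑ i ∈ range (2*h), lam^(2*h-i) * (A (0+i) ^ ((1:ℝ)/4) * E (0+i) ^ ((3:ℝ)/4) + F (0+i)) ≤ (K+1) * κ^9 := by
      refine geo_sum lam_pos.le lam_le (by positivity) fun i hi => ?_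
      have j1 : A (0+i) ^ ((1:ℝ)/4) ≤ K * κ^5 := q4 (hs.A0 _) (by positivity) ((hA _).trans (by
        rw [mul_pow, ← pow_mul]
        refine mul_le_mul_of_nonneg_right ?_ (by positivity)
        exact le_self_pow₀ hK (by norm_num)))
      have j2 : E (0+i) ^ ((3:ℝ)/4) ≤ 1 := Real.rpow_le_one (hs.E0 _) (hE1 _ (by omega)) (by norm_num)
      have j3 := hF (0+i)
      calc _ ≤ K * κ^5 * 1 + 1 := add_le_add (mul_le_mul j1 j2 (rpow_nonneg (hs.E0 _) _) (by positivity)) j3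
        _ ≤ K * κ^9 * 1 + κ^9 := by gcongr <;> norm_num
        _ = _ := by ring
    calc Q (2*h) ≤ C * (lam^(2*h) * (K * κ^12) + (K+1) * κ^9) := by
          refine h1.trans (mul_le_mul_of_nonneg_left ?_ (by linarith))
          exact add_le_add (mul_le_mul_of_nonneg_left hQ (pow_nonneg lam_pos.le _)) hs2
      _ = C * ((lam^(2*h) * κ^3) * K * κ^9 + (K+1) * κ^9) := by ring
      _ = C * (2 * K + 1) * κ^9 := by rw [q3]; ring
      _ ≤ _ := by
        refine mul_le_mul_of_nonneg_right ?_ (by positivity)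
        linarith

set_option maxHeartbeats 1000000 in
lemma stageB (C K : ℝ) (hC : 1 ≤ C) (hK : 1 ≤ K) : ∃ K' ≥ (1:ℝ), ∀ A E G P Q F, SQ C A E G P Q F → ∀ N : ℕ, ∀ x φ s : ℝ, 0 ≤ x → x ≤ 1 → 0 ≤ φ → φ ≤ 1 →
    0 ≤ s → s ≤ 1 → x + φ ≤ s^4 →
    A 0 ≤ K * (4^N * x) → P 0 ≤ K * (2^N * x) → 2^N * E 0 ≤ x → lam^N * Q 0 ≤ K * x → (∀ i, F i ≤ φ) →
    A N ≤ K' * s ∧ E N ≤ K' * s ∧ Q N ≤ K' * s := by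
  set K1 := C * (K + 1) with hK1
  set K2 := 2 * K1 + 2 * K1^2 + 1 with hK2
  set K3 := 8 * K + 32 * (300 * C^2) * K2 with hK3
  have hK10 : 0 ≤ K1 := by positivity
  have hK20 : 0 ≤ K2 := by positivity
  have hK31 : 1 ≤ K3 := by
    have : 0 ≤ 32 * (300 * C^2) * K2 := by positivity
    linarith
  refine ⟨K3 + 1 + C * (K + K3 + 1), by nlinarith, fun A E G P Q F hs N x φ s hx0 hx1 hφ0 hφ1 hs0 hs1 hsx hA hP hE hQ hF => ?_⟩
  have hEi : ∀ i ≤ N, E i ≤ x := by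
    intro i hi
    have h1 := hs.E_pow 0 i
    rw [zero_add] at h1
    refine h1.trans (le_trans ?_ hE)
    exact mul_le_mul_of_nonneg_right (pow_le_pow_right₀ (by norm_num) hi) (hs.E0 0)
  have e4 : ∀ i ≤ N, (1/4:ℝ)^i * 4^N = 4^(N-i) := fun i hi => by
    obtain ⟨d, rfl⟩ := Nat.exists_eq_add_of_le hi
    rw [Nat.add_sub_cancel_left, pow_add, ← mul_assoc, ← mul_pow]; norm_num
  have e2 : ∀ i ≤ N, (1/2:ℝ)^i * 2^N = 2^(N-i) := fun i hi => by
    obtain ⟨d, rfl⟩ := Nat.exists_eq_add_of_le hi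
    rw [Nat.add_sub_cancel_left, pow_add, ← mul_assoc, ← mul_pow]; norm_num
  have hPi : ∀ i ≤ N, P i ≤ K1 * (2^(N-i) * x + φ) := by
    intro i hi
    have h1 := hs.p 0 i
    rw [zero_add] at h1
    have hs2 : ∑ j ∈ range i, ((1:ℝ)/2)^(i-j) * (E (0+j) + F (0+j)) ≤ x + φ :=
      geo_sum (by norm_num) (by norm_num) (by linarith) fun j hj => add_le_add (hEi _ (by omega)) (hF _)
    have h2 : (1:ℝ) ≤ 2^(N-i) := one_le_pow₀ (by norm_num)
    calc P i ≤ C * ((1/2)^i * (K * (2^N * x)) + (x + φ)) := by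
          refine h1.trans (mul_le_mul_of_nonneg_left ?_ (by linarith))
          exact add_le_add (mul_le_mul_of_nonneg_left hP (by positivity)) hs2
      _ = C * (K * (((1/2)^i * 2^N) * x) + (x + φ)) := by ring
      _ = C * (K * (2^(N-i) * x) + (x + φ)) := by rw [e2 i hi]
      _ ≤ C * (K * (2^(N-i) * x + φ) + (2^(N-i) * x + φ)) := by
        have : x ≤ 2^(N-i) * x := le_mul_of_one_le_left hx0 h2
        gcongr
        linarith
      _ = _ := by rw [hK1]; ring
  have hGi : ∀ i ≤ N, G i ≤ K1 * (4^(N-i) * x) := by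
    intro i hi
    have h1 := hs.g 0 i
    rw [zero_add] at h1
    have h2 : (1:ℝ) ≤ 4^(N-i) := one_le_pow₀ (by norm_num)
    have h3 : 2^i * E 0 ≤ x := le_trans (mul_le_mul_of_nonneg_right (pow_le_pow_right₀ (by norm_num) hi) (hs.E0 0)) hE
    calc G i ≤ C * (x + (1/4)^i * (K * (4^N * x))) := by
          refine h1.trans (mul_le_mul_of_nonneg_left ?_ (by linarith))
          exact add_le_add h3 (mul_le_mul_of_nonneg_left hA (by positivity))
      _ = C * (x + K * (((1/4)^i * 4^N) * x)) := by ring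
      _ = C * (x + K * (4^(N-i) * x)) := by rw [e4 i hi]
      _ ≤ C * (4^(N-i) * x + K * (4^(N-i) * x)) := by
        have : x ≤ 4^(N-i) * x := le_mul_of_one_le_left hx0 h2
        gcongr
      _ = _ := by rw [hK1]; ring
  have hAi : ∀ i ≤ N, A i ≤ K3 * (4^(N-i) * x + φ) := by
    intro i
    induction i using Nat.strong_induction_on with
    | _ i ih =>
      intro hi
      rcases i with _ | _ | i
      · refine hA.trans ?_
        have : 0 ≤ 4^N * x := by positivity
        rw [Nat.sub_zero]
        refine mul_le_mul ?_ (by linarith) this (by linarith)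
        have : 0 ≤ 32 * (300 * C^2) * K2 := by positivity
        linarith
      · have h1 := hs.A1 0
        have e : (4:ℝ)^N = 4 * 4^(N-(0+1)) := by rw [← pow_succ']; congr 1; omega
        have : 0 ≤ 4^(N-(0+1)) * x := by positivity
        calc A (0+1) ≤ 2 * (K * (4^N * x)) := by linarith
          _ = (8 * K) * (4^(N-(0+1)) * x) := by rw [e]; ring
          _ ≤ _ := by
            refine mul_le_mul ?_ (by linarith) this (by linarith)
            have : 0 ≤ 32 * (300 * C^2) * K2 := by positivity
            linarith
      · have y := hs.Y i
        have i1 := ih i (by omega) (by omega)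
        have i2 := hPi i (by omega)
        have i3 := hGi i (by omega)
        have i4 := (hEi i (by omega)).trans hx1
        have i5 := hs.G0 i; have i6 := hF i; have i7 := hs.F0 i
        have e : (4:ℝ)^(N-i) = 16 * 4^(N-(i+1+1)) := by
          rw [show N - i = 2 + (N-(i+1+1)) by omega, pow_add]; norm_num
        set u := (4:ℝ)^(N-(i+1+1)) * x with hu
        have hu0 : 0 ≤ u := by positivity
        have e' : (4:ℝ)^(N-i) * x = 16 * u := by rw [e, hu]; ring
        rw [e'] at i1 i3
        have i8 : P i ^2 ≤ K1^2 * (2 * (16 * u + φ)) := by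
          calc P i ^2 ≤ (K1 * (2^(N-i) * x + φ))^2 := pow_le_pow_left₀ (hs.P0 _) i2 2
            _ = K1^2 * (2^(N-i) * x + φ)^2 := by ring
            _ ≤ _ := by
              refine mul_le_mul_of_nonneg_left ?_ (by positivity)
              have : (2^(N-i) * x)^2 ≤ 16 * u := by
                rw [← e']
                calc (2^(N-i) * x)^2 = 4^(N-i) * (x * x) := by
                      rw [mul_pow, ← pow_mul, mul_comm (N-i) 2, pow_mul]; norm_num; ring
                  _ ≤ 4^(N-i) * (x * 1) := by gcongr
                  _ = _ := by ring
              have h2 : φ^2 ≤ φ := pow_le_of_le_one hφ0 hφ1 (by norm_num)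
              have h3 := add_sq_le (a := 2^(N-i) * x) (b := φ)
              linarith
        have i9 : F i^2 ≤ 16 * u + φ := by
          have : F i ^2 ≤ φ := (pow_le_of_le_one i7 (i6.trans hφ1) (by norm_num)).trans i6
          linarith
        have i10 : G i + E i * G i ≤ 2 * K1 * (16 * u + φ) := by
          calc _ ≤ 2 * G i := by
                have := mul_le_mul_of_nonneg_right i4 i5
                linarith
            _ ≤ 2 * (K1 * (16 * u)) := by linarith
            _ ≤ 2 * (K1 * (16 * u + φ)) := by gcongr; linarith
            _ = _ := by ring
        have i11 : 300 * C^2 * (G i + E i * G i + P i^2 + F i^2) ≤ 300 * C^2 * (K2 * (16 * u + φ)) := by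
          refine mul_le_mul_of_nonneg_left ?_ (by positivity)
          have : K2 * (16 * u + φ) = 2 * K1 * (16 * u + φ) + K1^2 * (2 * (16 * u + φ)) + (16 * u + φ) := by rw [hK2]; ring
          linarith
        have i12 : 300 * C^2 * (K2 * (16 * u + φ)) = (K3 - 8*K)/32 * (16 * u + φ) := by rw [hK3]; ring
        have i13 : (K3 - 8*K)/32 * (16 * u + φ) ≤ K3/32 * (16*u+φ) := by gcongr; linarith
        have i14 : 0 ≤ K3 * u := by positivity
        have i15 : 0 ≤ K3 * φ := by positivity
        change A (i+2) ≤ _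
        linarith
  have hs4 : s^4 ≤ s := pow_le_of_le_one hs0 hs1 (by norm_num)
  refine ⟨?_, ?_, ?_⟩
  · have := hAi N le_rfl
    rw [Nat.sub_self, pow_zero, one_mul] at this
    refine this.trans ?_
    refine mul_le_mul ?_ (by linarith) (by linarith) (by positivity)
    have : 0 ≤ C * (K + K3 + 1) := by positivity
    linarith
  · have := hEi N le_rfl
    refine this.trans ?_
    have : 0 ≤ C * (K + K3 + 1) := by positivity
    nlinarith
  · have h1 := hs.q 0 N
    rw [zero_add] at h1
    have hsum : ∑ j ∈ range N, lam^(N-j) * (A (0+j) ^ ((1:ℝ)/4) * E (0+j) ^ ((3:ℝ)/4) + F (0+j)) ≤ (K3 + 1) * s := by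
      calc _ ≤ ∑ j ∈ range N, (1/2:ℝ)^(N-j) * ((K3+1) * s) := by
            refine sum_le_sum fun j hj => ?_
            have hj' := mem_range.1 hj
            rw [zero_add]
            have h4 : (√2 ^ (N-j))^4 = (4:ℝ)^(N-j) := by
              rw [← pow_mul, mul_comm, pow_mul, show √(2:ℝ)^4 = (√2*√2)*(√2*√2) by ring, s2_sq]; norm_num
            have j1 : A j ^ ((1:ℝ)/4) ≤ K3 * √2^(N-j) * s := by
              refine q4 (hs.A0 _) (by positivity) ((hAi j hj'.le).trans ?_)
              have h3 : (1:ℝ) ≤ 4^(N-j) := one_le_pow₀ (by norm_num)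
              calc K3 * (4^(N-j) * x + φ) ≤ K3 * (4^(N-j) * x + 4^(N-j) * φ) := by
                    have := le_mul_of_one_le_left hφ0 h3
                    gcongr
                _ = K3 * (4^(N-j) * (x + φ)) := by ring
                _ ≤ K3^4 * (4^(N-j) * s^4) := by
                    have := le_self_pow₀ hK31 (show 4 ≠ 0 by norm_num)
                    gcongr
                _ = _ := by rw [← h4]; ring
            have j2 : E j ^ ((3:ℝ)/4) ≤ 1 := Real.rpow_le_one (hs.E0 _) ((hEi _ hj'.le).trans hx1) (by norm_num)
            have j3 := hF j
            have hl := pow_nonneg lam_pos.le (N-j)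
            have hl2 : lam^(N-j) ≤ (1/2)^(N-j) := pow_le_pow_left₀ lam_pos.le lam_le _
            calc _ ≤ lam^(N-j) * (K3 * √2^(N-j) * s * 1 + s) := by
                  refine mul_le_mul_of_nonneg_left ?_ hl
                  exact add_le_add (mul_le_mul j1 j2 (rpow_nonneg (hs.E0 _) _) (by positivity)) (by linarith)
              _ = (lam * √2)^(N-j) * (K3 * s) + lam^(N-j) * s := by rw [mul_pow]; ring
              _ ≤ (1/2)^(N-j) * (K3 * s) + (1/2)^(N-j) * s := by rw [lam_s2]; gcongr
              _ = _ := by ring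
        _ ≤ _ := geo_sum (by norm_num) (by norm_num) (by positivity) fun j _ => le_rfl
    calc Q N ≤ C * (K * x + (K3 + 1) * s) := by
          refine h1.trans (mul_le_mul_of_nonneg_left ?_ (by linarith))
          exact add_le_add hQ hsum
      _ ≤ C * (K * s + (K3+1) * s) := by gcongr; linarith
      _ = C * (K + K3 + 1) * s := by ring
      _ ≤ _ := by
        refine mul_le_mul_of_nonneg_right ?_ hs0
        linarith
end

section

lemma SQ_small (C : ℝ) (hC : 1 ≤ C) {δ : ℝ} (hδ : 0 < δ) : ∃ ε > (0:ℝ), ε ≤ 1 ∧ ∀ A E G P Q F, SQ C A E G P Q F → ∀ h : ℕ, ∀ κ : ℝ, κ = 2^h →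
    (∀ᶠ k in atTop, E k ≤ κ^8) → Tendsto F atTop (𝓝 0) → (∃ᶠ k in atTop, κ^8 * E k ≤ ε) → ∀ N0, ∃ k ≥ N0, A k ≤ δ ∧ E k ≤ δ ∧ Q k ≤ δ := by
  obtain ⟨K0, hK0, H0⟩ := phase1 C hC
  obtain ⟨K1, hK1, H1⟩ := stageA C K0 hC hK0
  obtain ⟨K2, hK2, H2⟩ := stageB C K1 hC hK1
  set s := min 1 (δ / K2) with hs
  have hs0 : 0 < s := lt_min one_pos (by positivity)
  have hs1 : s ≤ 1 := min_le_left _ _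
  have hsδ : K2 * s ≤ δ := by
    have : s ≤ δ / K2 := min_le_right _ _
    rw [le_div_iff₀ (by linarith)] at this
    linarith
  obtain ⟨q, hq⟩ := exists_pow_lt_of_lt_one (show 0 < s^4/2 by positivity) (show (1/2:ℝ) < 1 by norm_num)
  refine ⟨(1/4)^q, by positivity, pow_le_one₀ (by norm_num) (by norm_num), fun A E G P Q F hS h κ hκ hE hF hf N0 => ?_⟩
  have hs4 : s^4 ≤ 1 := pow_le_one₀ hs0.le hs1
  obtain ⟨N1, hN1⟩ := eventually_atTop.1 (hE.and (hF.eventually (gt_mem_nhds (show 0 < s^4/2 by positivity))))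
  obtain ⟨N2, hN2⟩ := H0 _ _ _ _ _ _ (hS.shift N1) h κ hκ (fun k => (hN1 _ (by omega)).1) (fun k => by have := (hN1 (N1+k) (by omega)).2; linarith)
  obtain ⟨k, hk, hk'⟩ := (frequently_atTop.1 hf) (N0+N1+N2)
  have hb : ∀ j ≥ N1 + N2, P j ≤ K0 * κ^8 ∧ A j ≤ K0 * κ^20 ∧ G j ≤ K0 * κ^12 ∧ Q j ≤ K0 * κ^12 := fun j hj => by
    have := hN2 (j - N1) (by omega)
    rwa [show N1 + (j - N1) = j by omega] at this
  obtain ⟨a1, a2, a3, a4⟩ := H1 _ _ _ _ _ _ (hS.shift k) h κ ((1/4)^q) hκ (by positivity) (pow_le_one₀ (by norm_num) (by norm_num))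
    (fun i => (hb _ (by omega)).2.1) (fun i => (hb _ (by omega)).2.2.1) (hb _ (by omega)).1 (hb _ (by omega)).2.2.2 hk'
    (fun i => by have := (hN1 (k+i) (by omega)).2; linarith)
  have hx1 : (1/2:ℝ)^q ≤ 1 := pow_le_one₀ (by norm_num) (by norm_num)
  have x2 : (1/2:ℝ)^q * 2^q = 1 := by rw [← mul_pow]; norm_num
  have p2 : (2:ℝ)^(q+6*h) * (1/2)^q = κ^6 := by
    rw [pow_add, hκ, ← pow_mul, mul_comm h 6, mul_right_comm, mul_comm ((2:ℝ)^q), x2, one_mul]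
  have p4 : (4:ℝ)^(q+6*h) * (1/2)^q = 2^q * κ^12 := by
    rw [pow_add, hκ, ← pow_mul, mul_comm h 12, pow_mul, pow_mul, mul_right_comm, ← mul_pow]; norm_num
  have pl : lam^(q+6*h) * κ^9 = lam^q := by
    rw [pow_add, hκ, ← pow_mul, mul_comm h 9, pow_mul lam, pow_mul, mul_assoc, ← mul_pow, show lam^6 = (lam*lam)*(lam*lam)*(lam*lam) by ring, lam_sq]; norm_num
  have hl2 : lam^q ≤ (1/2)^q := pow_le_pow_left₀ lam_pos.le lam_le _
  have := H2 _ _ _ _ _ _ (hS.shift (k+2*h)) (q+6*h) ((1/2)^q) (s^4/2) s (by positivity) hx1 (by positivity) (by linarith) hs0.le hs1 (by linarith) ?_ ?_ ?_ ?_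
    (fun i => (hN1 (k+2*h+i) (by omega)).2.le)
  · exact ⟨k+2*h+(q+6*h), by omega, this.1.trans hsδ, this.2.1.trans hsδ, this.2.2.trans hsδ⟩
  · rw [p4]
    refine a1.trans ?_
    have h2 : (1:ℝ) ≤ 2^q := one_le_pow₀ (by norm_num)
    have : κ^12 ≤ 2^q * κ^12 := le_mul_of_one_le_left (by positivity) h2
    exact mul_le_mul_of_nonneg_left this (by linarith)
  · rw [p2]; exact a2
  · have e : (2:ℝ)^(q+6*h) = 2^q * κ^6 := by rw [pow_add, hκ, ← pow_mul, mul_comm h 6]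
    have e4 : (2:ℝ)^q * (1/4)^q = (1/2)^q := by rw [← mul_pow]; norm_num
    rw [e, mul_assoc, ← e4]
    exact mul_le_mul_of_nonneg_left a4 (by positivity)
  · calc _ ≤ lam^(q+6*h) * (K1 * κ^9) := mul_le_mul_of_nonneg_left a3 (pow_nonneg lam_pos.le _)
      _ = K1 * (lam^(q+6*h) * κ^9) := by ring
      _ ≤ _ := by rw [pl]; gcongr

lemma geo67 (n : ℕ) : ∑ j ∈ range n, (6/7:ℝ)^(n-j) ≤ 6 := by
  induction n with
  | zero => simp
  | succ n ih =>
    rw [sum_range_succ]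
    have : ∑ j ∈ range n, (6/7:ℝ)^(n+1-j) = (6/7) * ∑ j ∈ range n, (6/7:ℝ)^(n-j) := by
      rw [mul_sum]
      refine sum_congr rfl fun j hj => ?_
      have := mem_range.1 hj
      rw [show n + 1 - j = (n - j) + 1 by omega, pow_succ']
    rw [this, Nat.add_sub_cancel_left, pow_one]
    linarith

lemma geo_up {ρ : ℝ} (h0 : 0 ≤ ρ) (h1 : ρ < 1) (n : ℕ) : ∑ j ∈ range n, ρ^j ≤ (1-ρ)⁻¹ := by
  rw [← one_div, le_div_iff₀ (by linarith), geom_sum_mul_neg]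
  have := pow_nonneg h0 n
  linarith

lemma geo_lam (n : ℕ) : ∑ j ∈ range n, (2*lam)^j ≤ 4 := by
  have h1 := lam_sq; have h2 := lam_pos
  have h3 : 2 * lam ≤ 3/4 := by nlinarith
  refine (geo_up (by positivity) (by linarith) n).trans ?_
  rw [inv_le_comm₀ (by linarith) (by norm_num)]
  linarith

lemma geo_half (n : ℕ) : ∑ j ∈ range n, (1/2:ℝ)^j ≤ 2 :=
  (geo_up (by norm_num) (by norm_num) n).trans (by norm_num)

lemma rp14 {a e X : ℝ} (ha : 0 ≤ a) (he : 0 ≤ e) (h1 : a ≤ X) (h2 : e ≤ X) : a ^ ((1:ℝ)/4) * e ^ ((3:ℝ)/4) ≤ X := by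
  have hX : 0 ≤ X := ha.trans h1
  calc _ ≤ X ^ ((1:ℝ)/4) * X ^ ((3:ℝ)/4) := mul_le_mul (Real.rpow_le_rpow ha h1 (by norm_num)) (Real.rpow_le_rpow he h2 (by norm_num)) (rpow_nonneg he _) (rpow_nonneg hX _)
    _ = X := by rw [← Real.rpow_add_of_nonneg hX (by norm_num) (by norm_num)]; norm_num

/-- one step of the final decay: bounds for the pressure -/
lemma SQ.Qj {C : ℝ} {A E G P Q F : ℕ → ℝ} (h : SQ C A E G P Q F) {δ t φ μ : ℝ} (hφ : 0 ≤ φ) (hμ0 : 0 < μ) (hμ : lam ≤ 6/7 * μ)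
    (hQ : Q 0 ≤ δ) (hF : ∀ j, F j ≤ φ * μ^j) {j : ℕ} (hA : ∀ i < j, A i ≤ t^2 * (1/4)^i) (hE : ∀ i < j, E i ≤ t^2 * (1/4)^i) :
    Q j ≤ C * (lam^j * (δ + 4 * t^2) + 6 * φ * μ^j) := by
  have h1 := h.q 0 j
  rw [zero_add] at h1
  have hC := h.C1
  have hl := lam_pos
  have s1 : ∑ i ∈ range j, lam^(j-i) * (A (0+i) ^ ((1:ℝ)/4) * E (0+i) ^ ((3:ℝ)/4) + F (0+i)) ≤ lam^j * (4 * t^2) + 6 * φ * μ^j := by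
    calc _ ≤ ∑ i ∈ range j, (lam^j * t^2 * (2*lam)^i + φ * μ^j * (6/7)^(j-i)) := by
          refine sum_le_sum fun i hi => ?_
          have hi := mem_range.1 hi
          rw [zero_add]
          obtain ⟨d, rfl⟩ := Nat.exists_eq_add_of_lt hi
          have e : i + d + 1 - i = d + 1 := by omega
          rw [e]
          have j1 := rp14 (h.A0 i) (h.E0 i) (hA i hi) (hE i hi)
          have j2 := hF i
          calc _ ≤ lam^(d+1) * (t^2 * (1/4)^i + φ * μ^i) := mul_le_mul_of_nonneg_left (add_le_add j1 j2) (by positivity)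
            _ = lam^(d+1) * (t^2 * (1/4)^i) + φ * (lam^(d+1) * μ^i) := by ring
            _ ≤ lam^(d+1) * (t^2 * (1/4)^i) + φ * ((6/7*μ)^(d+1) * μ^i) := by gcongr
            _ = _ := by
              have : (1/4:ℝ)^i = lam^i * (2*lam)^i := by
                rw [← mul_pow, show lam * (2*lam) = 2 * (lam*lam) by ring, lam_sq]; norm_num
              rw [this]; ring
      _ = lam^j * t^2 * ∑ i ∈ range j, (2*lam)^i + φ * μ^j * ∑ i ∈ range j, (6/7:ℝ)^(j-i) := by
          rw [sum_add_distrib, mul_sum, mul_sum]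
      _ ≤ lam^j * t^2 * 4 + φ * μ^j * 6 := by
          have := geo_lam j; have := geo67 j
          gcongr
      _ = _ := by ring
  calc Q j ≤ C * (lam^j * δ + (lam^j * (4*t^2) + 6 * φ * μ^j)) := by
        refine h1.trans (mul_le_mul_of_nonneg_left ?_ (by linarith))
        exact add_le_add (mul_le_mul_of_nonneg_left hQ (by positivity)) s1
    _ = _ := by ring

lemma hH_bound {C a e g p f t δ φ : ℝ} {j : ℕ} {μ : ℝ} (hC : 1 ≤ C) (ht : 0 ≤ t) (hδ : 0 ≤ δ) (hφ : 0 ≤ φ) (hμ0 : 0 < μ) (hp0 : 0 ≤ p) (hf0 : 0 ≤ f)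
    (ha : a ≤ t^2 * (1/4)^j) (he : e ≤ t^2 * (1/4)^j) (hg : g ≤ C * (e + a)) (hf : f ≤ φ * μ^j)
    (hp : p ≤ C^2 * (lam^j * (δ + 4 * t^2) + 6 * φ * μ^j)) :
    4^j * hH a e g p f ≤ 2 * C * t^3 * (1/2)^j + C^2 * t * (δ + 4 * t^2) * (2*lam)^j + 9 * C^2 * t * φ * (2*μ)^j := by
  have hl := lam_pos
  set b := t * (1/2:ℝ)^j with hb
  have hb0 : 0 ≤ b := by positivity
  have hbb : t^2 * (1/4:ℝ)^j = b^2 := by rw [hb, mul_pow, ← pow_mul, mul_comm j 2, pow_mul]; norm_num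
  rw [hbb] at ha he
  have ra : √a ≤ b := sqrt_le_iff.2 ⟨hb0, ha⟩
  have re : √e ≤ b := sqrt_le_iff.2 ⟨hb0, he⟩
  have rg : √g ≤ 2 * C * b := by
    refine sqrt_le_iff.2 ⟨by positivity, hg.trans ?_⟩
    have hbq : 0 ≤ b^2 := by positivity
    have h1 : C * (e + a) ≤ C * (2 * b^2) := mul_le_mul_of_nonneg_left (by linarith) (by linarith)
    have h2 : C * (2 * b^2) ≤ C^2 * (2 * b^2) := mul_le_mul_of_nonneg_right (by nlinarith) (by linarith)
    have h3 : 0 ≤ C^2 * b^2 := by positivity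
    nlinarith
  have hH' : hH a e g p f ≤ b * b * (2*C*b) + b * (C^2 * (lam^j * (δ + 4 * t^2) + 6 * φ * μ^j)) + (2*C*b) * (φ * μ^j) + b * (φ * μ^j) := by
    unfold hH
    gcongr
  have hCC : C ≤ C^2 := by nlinarith
  have h1C : 1 ≤ C^2 := by nlinarith
  have e1 : (4:ℝ)^j * (b*b*b) = t^3 * (1/2)^j := by
    rw [hb]
    have : (4:ℝ)^j * ((1/2)^j * (1/2)^j) = 1 := by rw [← mul_pow, ← mul_pow]; norm_num
    calc _ = t^3 * (1/2)^j * ((4:ℝ)^j * ((1/2)^j * (1/2)^j)) := by ring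
      _ = _ := by rw [this, mul_one]
  have e2 : (4:ℝ)^j * b = t * 2^j := by
    rw [hb]
    have : (4:ℝ)^j * (1/2)^j = 2^j := by rw [← mul_pow]; norm_num
    calc _ = t * ((4:ℝ)^j * (1/2)^j) := by ring
      _ = _ := by rw [this]
  have hw : 0 ≤ t * φ * (2*μ)^j := by positivity
  calc _ ≤ 4^j * (b * b * (2*C*b) + b * (C^2 * (lam^j * (δ + 4 * t^2) + 6 * φ * μ^j)) + (2*C*b) * (φ * μ^j) + b * (φ * μ^j)) :=
        mul_le_mul_of_nonneg_left hH' (by positivity)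
    _ = 2*C*(4^j * (b*b*b)) + (4^j * b) * (C^2 * (lam^j * (δ + 4 * t^2) + 6 * φ * μ^j) + 2*C*(φ*μ^j) + φ*μ^j) := by ring
    _ = 2 * C * t^3 * (1/2)^j + C^2 * t * (δ + 4 * t^2) * (2*lam)^j + (6 * C^2 + 2 * C + 1) * (t * φ * (2*μ)^j) := by
        rw [e1, e2, mul_pow, mul_pow]; ring
    _ ≤ 2 * C * t^3 * (1/2)^j + C^2 * t * (δ + 4 * t^2) * (2*lam)^j + (9 * C^2) * (t * φ * (2*μ)^j) := by
        have := mul_le_mul_of_nonneg_right (show 6 * C^2 + 2 * C + 1 ≤ 9 * C^2 by linarith) hw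
        linarith
    _ = _ := by ring

lemma SQ_decay (C : ℝ) (hC : 1 ≤ C) : ∃ t > (0:ℝ), ∃ δ > (0:ℝ), ∀ A E G P Q F, SQ C A E G P Q F → ∀ φ μ : ℝ, 0 ≤ φ → 0 < μ → lam ≤ 6/7 * μ → 2 * μ < 1 →
    A 0 ≤ δ → E 0 ≤ δ → Q 0 ≤ δ → (∀ j, F j ≤ φ * μ^j) → φ * (1-2*μ)⁻¹ ≤ t^2 → ∀ n, A n ≤ t^2 * (1/4)^n ∧ E n ≤ t^2 * (1/4)^n := by
  set t := (1000 * C^3)⁻¹ with ht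
  have ht0 : 0 < t := by positivity
  have htC : 1000 * C^3 * t = 1 := by rw [ht]; field_simp
  have hC3 : 1 ≤ C^3 := one_le_pow₀ hC
  have ht1 : t ≤ 1 := by nlinarith
  refine ⟨t, ht0, t^3, by positivity, fun A E G P Q F h φ μ hφ hμ0 hμ hμ1 hA hE hQ hF hΦ => ?_⟩
  have hC2 : 1 ≤ C^2 := one_le_pow₀ hC
  have t32 : 8 * t^3 ≤ t^2 := by
    have : 8 * t ≤ 1 := by nlinarith
    calc 8 * t^3 = (8*t) * t^2 := by ring
      _ ≤ 1 * t^2 := by gcongr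
      _ = _ := one_mul _
  have main : ∀ n, (∀ i ≤ n, A i ≤ t^2 * (1/4)^i ∧ E i ≤ t^2 * (1/4)^i) →
      C * ((1/4)^n * G 0 + ∑ j ∈ range (n+1), (1/4)^(n-j) * hH (A (0+j)) (E (0+j)) (G (0+j)) (P (0+j)) (F (0+j))) ≤ t^2 * (1/4)^(n+2) := by
    intro n ih
    have g0 : G 0 ≤ 2 * C * t^3 := by
      have := h.g 0 0
      simp only [Nat.add_zero, pow_zero, one_mul] at this
      have h2 : C * (E 0 + A 0) ≤ C * (t^3 + t^3) := by gcongr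
      linarith
    have hs : ∑ j ∈ range (n+1), (1/4:ℝ)^(n-j) * hH (A (0+j)) (E (0+j)) (G (0+j)) (P (0+j)) (F (0+j)) ≤
        (1/4)^n * (2 * C * t^3 * 2 + C^2 * t * (t^3 + 4 * t^2) * 4 + 9 * C^2 * t * t^2) := by
      calc _ ≤ ∑ j ∈ range (n+1), (1/4:ℝ)^n * (2 * C * t^3 * (1/2)^j + C^2 * t * (t^3 + 4 * t^2) * (2*lam)^j + 9 * C^2 * t * φ * (2*μ)^j) := by
            refine sum_le_sum fun j hj => ?_
            have hj := mem_range.1 hj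
            rw [zero_add]
            have e : (1/4:ℝ)^(n-j) = (1/4)^n * 4^j := by
              obtain ⟨d, rfl⟩ := Nat.exists_eq_add_of_le (show j ≤ n by omega)
              rw [Nat.add_sub_cancel_left, pow_add, mul_right_comm, ← mul_pow]; norm_num
            rw [e, mul_assoc]
            refine mul_le_mul_of_nonneg_left ?_ (by positivity)
            refine hH_bound hC ht0.le (by positivity) hφ hμ0 (h.P0 j) (h.F0 j) (ih j (by omega)).1 (ih j (by omega)).2 ?_ (hF j) ?_
            · have := h.g j 0
              simpa only [Nat.add_zero, pow_zero, one_mul] using this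
            · have q := h.Qj hφ hμ0 hμ hQ hF (j := j) (fun i hi => (ih i (by omega)).1) (fun i hi => (ih i (by omega)).2)
              calc P j ≤ C * Q j := h.pq j
                _ ≤ C * (C * (lam^j * (t^3 + 4 * t^2) + 6 * φ * μ^j)) := by gcongr
                _ = _ := by ring
        _ = (1/4)^n * (2 * C * t^3 * ∑ j ∈ range (n+1), (1/2:ℝ)^j + C^2 * t * (t^3 + 4 * t^2) * ∑ j ∈ range (n+1), (2*lam)^j + 9 * C^2 * t * (φ * ∑ j ∈ range (n+1), (2*μ)^j)) := by
            rw [← mul_sum, sum_add_distrib, sum_add_distrib, mul_sum, mul_sum, mul_sum, mul_sum]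
            congr 3
            funext j; ring
        _ ≤ _ := by
            have b1 := geo_half (n+1); have b2 := geo_lam (n+1)
            have b3 : φ * ∑ j ∈ range (n+1), (2*μ)^j ≤ t^2 :=
              (mul_le_mul_of_nonneg_left (geo_up (by positivity) hμ1 (n+1)) hφ).trans hΦ
            gcongr
    have t3 : t^4 ≤ t^3 := pow_le_pow_of_le_one ht0.le ht1 (by norm_num)
    have hCC : C ≤ C^2 := by nlinarith
    have hT : 0 ≤ t^3 := by positivity
    calc _ ≤ C * ((1/4)^n * (2 * C * t^3) + (1/4)^n * (2 * C * t^3 * 2 + C^2 * t * (t^3 + 4 * t^2) * 4 + 9 * C^2 * t * t^2)) := by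
          gcongr
      _ = (1/4)^n * (C * (6 * C * t^3 + 4 * C^2 * t^4 + 25 * C^2 * t^3)) := by ring
      _ ≤ (1/4)^n * (C * (6 * C^2 * t^3 + 4 * C^2 * t^3 + 25 * C^2 * t^3)) := by gcongr
      _ = (1/4)^n * ((1000 * C^3 * t) * t^2 * (35/1000)) := by ring
      _ = (1/4)^n * (t^2 * (35/1000)) := by rw [htC, one_mul]
      _ ≤ (1/4)^n * (t^2 * (1/16)) :=
          mul_le_mul_of_nonneg_left (mul_le_mul_of_nonneg_left (by norm_num) (by positivity)) (by positivity)
      _ = _ := by ring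
  intro n
  induction n using Nat.strong_induction_on with
  | _ n ih =>
    rcases n with _ | _ | n
    · rw [pow_zero, mul_one]
      have : 0 ≤ t^3 := by positivity
      exact ⟨by linarith, by linarith⟩
    · have a := h.A1 0; have e := h.E1 0
      rw [zero_add, pow_one]
      rw [zero_add] at a e
      exact ⟨by linarith, by linarith⟩
    · have m := main n fun i hi => ih i (by omega)
      have a := h.kA 0 n; have e := h.kE 0 n
      rw [zero_add] at a e
      exact ⟨a.trans m, e.trans m⟩
end

section

lemma rr_tendsto {R : ℝ} (hR : 0 < R) : Tendsto (rr R) atTop (𝓝[>] 0) := by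
  refine tendsto_nhdsWithin_iff.2 ⟨?_, of_forall fun n => rr_pos hR _⟩
  have h1 : Tendsto (fun n : ℕ => R * (1/2:ℝ) ^ n) atTop (𝓝 (R * 0)) :=
    (tendsto_pow_atTop_nhds_zero_of_lt_one (by norm_num) (by norm_num)).const_mul R
  rwa [mul_zero] at h1

lemma leb_bound {g : V3 → ℝ≥0∞} (hg : Measurable g) {x0 : V3} {R : ℝ} (hR : 0 < R) {K : ℝ} (hK : 0 ≤ K) {D : Set V3} (hD : Dense D)
    (h0 : ∫⁻ x in ball x0 R, g x ≠ ∞)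
    (h : ∀ x' ∈ D, x' ∈ ball x0 R → ∀ n, ∫⁻ x in ball x' (rr R n), g x ≤ ofReal (K * rr R n ^ 3)) :
    ∀ᵐ x ∂(volume.restrict (ball x0 R)), g x ≤ ofReal (64 * K) / volume (ball (0:V3) 1) := by
  rw [ae_restrict_iff' measurableSet_ball]
  have hm : Measurable ((ball x0 R).indicator g) := hg.indicator measurableSet_ball
  have hi : ∫⁻ x, (ball x0 R).indicator g x ≠ ∞ := by rwa [lintegral_indicator measurableSet_ball]
  filter_upwards [VitaliFamily.ae_tendsto_lintegral_div' (Besicovitch.vitaliFamily (volume : Measure V3)) hm hi] with x hx hxB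
  rw [indicator_of_mem hxB] at hx
  have ht := (rr_tendsto hR).comp (tendsto_add_atTop_nat 2)
  refine le_of_tendsto (hx.comp ((Besicovitch.tendsto_filterAt volume x).comp ht)) (of_forall fun n => ?_)
  have hrn := rr_pos hR n
  have h2 : rr R (n+2) = rr R n / 4 := by rw [rr_succ, rr_succ]; ring
  obtain ⟨x', hx'D, hx'⟩ := hD.exists_mem_open (isOpen_ball.inter (isOpen_ball (x := x) (ε := rr R n / 2)))
    ⟨x, hxB, mem_ball_self (by positivity)⟩
  have hd : dist x' x < rr R n / 2 := hx'.2
  have hsub : closedBall x (rr R (n+2)) ⊆ ball x' (rr R n) := by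
    intro y hy
    rw [mem_closedBall, h2] at hy
    have := dist_triangle_right y x' x
    rw [mem_ball]; linarith
  simp only [Function.comp]
  rw [Measure.addHaar_closedBall _ _ (rr_pos hR _).le, finrank_euclideanSpace_fin, h2]
  have hc0 : volume (ball (0:V3) 1) ≠ 0 := (measure_ball_pos _ _ one_pos).ne'
  have hct : volume (ball (0:V3) 1) ≠ ∞ := measure_ball_lt_top.ne
  have hr0 : ofReal ((rr R n / 4)^3) ≠ 0 := by rw [Ne, ENNReal.ofReal_eq_zero, not_le]; positivity
  have h3 : ∫⁻ y in closedBall x (rr R n / 4), (ball x0 R).indicator g y ≤ ofReal (K * rr R n ^ 3) := by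
    rw [← h2]
    refine (lintegral_mono fun y => indicator_le_self _ _ y).trans ((lintegral_mono_set hsub).trans (h x' hx'D hx'.1 n))
  rw [ENNReal.div_le_iff (mul_ne_zero hr0 hc0) (by finiteness)]
  refine h3.trans_eq ?_
  rw [mul_comm (ofReal _) (volume _), ← mul_assoc, ENNReal.div_mul_cancel hc0 hct, ← ofReal_mul (by positivity)]
  congr 1; ring

lemma half_rpow_quarter : (1/2:ℝ)^((1:ℝ)/4) ≤ 6/7 := by
  rw [show (1:ℝ)/4 = ((4:ℕ):ℝ)⁻¹ by norm_num]
  refine le_of_pow_le_pow_left₀ (n := 4) (by norm_num) (by norm_num) ?_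
  rw [Real.rpow_inv_natCast_pow (by norm_num) (by norm_num)]; norm_num

lemma pt_decay : ∃ δ0 > (0:ℝ), ∃ τ > (0:ℝ), ∀ Ω T v dv p f, MS Ω T v dv p f → ∃ R1 > (0:ℝ), ∀ x0 t0 R, 0 < R → R ≤ 1 → R ≤ R1 →
    ball x0 R ⊆ Ω → 0 ≤ t0 - R^2 → t0 < T → fA v x0 t0 R ≤ ofReal δ0 → fE dv x0 t0 R ≤ ofReal δ0 →
    fQ p x0 t0 R ≤ ofReal δ0 → ∀ x' ∈ ball x0 (R/2), ∀ t', t0 - (R/2)^2 < t' → t' ≤ t0 → ∀ n,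
    fA v x' t' (rr (R/2) n) ≤ ofReal (τ^2 * (1/4)^n) := by
  obtain ⟨C, hC, hSQ⟩ := SQ_of_MS
  obtain ⟨τ, hτ, δ, hδ, hdec⟩ := SQ_decay C hC
  obtain ⟨CQ, hCQ⟩ := Q_sub
  have h8 : (2:ℝ)^((5:ℝ)/2) ≤ 8 := by
    calc (2:ℝ)^((5:ℝ)/2) ≤ 2^(3:ℝ) := Real.rpow_le_rpow_of_exponent_le (by norm_num) (by norm_num)
      _ = 8 := by norm_num
  refine ⟨δ / (2 + 8 * CQ), by positivity, τ, hτ, fun Ω T v dv p f hMS => ?_⟩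
  obtain ⟨γ, hγ, hγ4, φ, hφ⟩ := hMS.F_decay
  set μ : ℝ := (1/2)^(1+γ) with hμ
  have hμ0 : 0 < μ := by positivity
  have hμ1 : 2 * μ < 1 := by
    have : μ < (1/2:ℝ)^(1:ℝ) := Real.rpow_lt_rpow_of_exponent_gt (by norm_num) (by norm_num) (by linarith)
    rw [Real.rpow_one] at this; linarith
  have hlam : lam ≤ 6/7 * μ := by
    rw [← lam_eq]
    calc (1/2:ℝ)^((3:ℝ)/2) = (1/2:ℝ)^((1:ℝ)/4) * (1/2:ℝ)^((5:ℝ)/4) := by rw [← rpow_add (by norm_num)]; norm_num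
      _ ≤ 6/7 * μ := mul_le_mul half_rpow_quarter (Real.rpow_le_rpow_of_exponent_ge (by norm_num) (by norm_num) (by linarith)) (by positivity) (by norm_num)
  have hi : 0 < 1 - 2*μ := by linarith
  refine ⟨τ^2 * (1-2*μ) / (φ + 1), by positivity, fun x0 t0 R hR hR1 hRR hB ht ht0 hA hE hQ x' hx' t' ht1 ht2 => ?_⟩
  have hB' : ball x' (R/2) ⊆ ball x0 R := ball_subset_ball' (by rw [mem_ball] at hx'; linarith)
  have hI' : Ioo (t' - (R/2)^2) t' ⊆ Ioo (t0 - R^2) t0 := Ioo_subset_Ioo (by nlinarith [sq_nonneg R]) ht2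
  have hI0 : Ioo (t0 - R^2) t0 ⊆ Ioo 0 T := Ioo_subset_Ioo ht ht0.le
  have hR2 : 0 < R/2 := by positivity
  obtain ⟨hS, hfin⟩ := hSQ Ω T v dv p f hMS x' t' (R/2) hR2 (by linarith) (hB'.trans hB) (by nlinarith [sq_nonneg R]) (by linarith)
  have hδ2 : 2 * (δ / (2 + 8 * CQ)) ≤ δ := by
    rw [← mul_div_assoc, div_le_iff₀ (by positivity)]
    nlinarith [mul_nonneg hδ.le CQ.2]
  have hδ8 : CQ * (8 * (δ / (2 + 8 * CQ))) ≤ δ := by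
    rw [← mul_div_assoc, ← mul_div_assoc, div_le_iff₀ (by positivity)]
    nlinarith
  have hdd : 0 ≤ δ / (2 + 8 * (CQ:ℝ)) := by positivity
  have hA0 : rA v x' t' (R/2) 0 ≤ δ := by
    refine toReal_le_of_le_ofReal hδ.le ?_
    rw [rr_zero]
    refine (A_sub (x0 := x0) (x1 := x') hR2 hR hB' hI').trans ((mul_le_mul_right hA _).trans ?_)
    rw [← ofReal_mul (by positivity), show R/(R/2) = 2 by field_simp]
    exact ofReal_le_ofReal hδ2
  have hE0 : rE dv x' t' (R/2) 0 ≤ δ := by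
    refine toReal_le_of_le_ofReal hδ.le ?_
    rw [rr_zero]
    refine (E_sub (x0 := x0) (x1 := x') hR2 hR hB' hI').trans ((mul_le_mul_right hE _).trans ?_)
    rw [← ofReal_mul (by positivity), show R/(R/2) = 2 by field_simp]
    exact ofReal_le_ofReal hδ2
  have hQ0 : rQ p x' t' (R/2) 0 ≤ δ := by
    refine toReal_le_of_le_ofReal hδ.le ?_
    rw [rr_zero]
    refine (hCQ x0 x' t0 t' (R/2) R v dv p f hR2 hR hB' hI' (hMS.gi hB hI0)).trans ((mul_le_mul_right (mul_le_mul_right hQ _) _).trans ?_)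
    rw [← ofReal_mul (by positivity), show R/(R/2) = 2 by field_simp, ← ofReal_coe_nnreal, ← ofReal_mul (by positivity)]
    refine ofReal_le_ofReal (le_trans ?_ hδ8)
    exact mul_le_mul_of_nonneg_left (mul_le_mul_of_nonneg_right h8 hdd) CQ.2
  have hF : ∀ j, rF f x' t' (R/2) j ≤ (φ * (R/2)) * μ^j := by
    intro j
    have hrj := rr_pos hR2 j
    have hrl := rr_le hR2 j
    have h1 := hφ x' t' (rr (R/2) j) hrj (by linarith) ((ball_subset_ball hrl).trans (hB'.trans hB))
      ((Ioo_subset_Ioo_left (by nlinarith)).trans (hI'.trans hI0))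
    refine toReal_le_of_le_ofReal (by positivity) (h1.trans ?_)
    rw [pw, ← ofReal_coe_nnreal, ← ofReal_mul (by positivity), mul_assoc]
    refine ofReal_le_ofReal (mul_le_mul_of_nonneg_left ?_ φ.2)
    rw [rr, Real.mul_rpow hR2.le (by positivity), hμ, ← Real.rpow_natCast ((1/2:ℝ)^(1+γ)), ← Real.rpow_natCast (1/2:ℝ), ← Real.rpow_mul (by norm_num), ← Real.rpow_mul (by norm_num), mul_comm (1+γ)]
    refine mul_le_mul_of_nonneg_right ?_ (by positivity)
    calc (R/2)^(1+γ) ≤ (R/2)^(1:ℝ) := Real.rpow_le_rpow_of_exponent_ge hR2 (by linarith) (by linarith)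
      _ = R/2 := Real.rpow_one _
  have hφ2 : φ * (R/2) * (1-2*μ)⁻¹ ≤ τ^2 := by
    rw [← div_eq_mul_inv, div_le_iff₀ hi]
    rw [le_div_iff₀ (by positivity)] at hRR
    nlinarith [mul_nonneg φ.2 hR.le]
  intro n
  have := (hdec _ _ _ _ _ _ hS (φ * (R/2)) μ (by positivity) hμ0 hlam hμ1 hA0 hE0 hQ0 hF hφ2 n).1
  rw [← ofReal_toReal (hfin n).1.ne]
  exact ofReal_le_ofReal this

lemma M7 : ∃ δ0 > (0:ℝ), ∀ Ω T v dv p f, MS Ω T v dv p f → ∃ R1 > (0:ℝ), ∀ x0 t0 R, 0 < R → R ≤ 1 → R ≤ R1 →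
    ball x0 R ⊆ Ω → 0 ≤ t0 - R^2 → t0 < T → fA v x0 t0 R ≤ ofReal δ0 → fE dv x0 t0 R ≤ ofReal δ0 →
    fQ p x0 t0 R ≤ ofReal δ0 →
    ∃ K : ℝ, ∀ᵐ w ∂(volume.restrict (ball x0 (R/2) ×ˢ Ioo (t0 - (R/2)^2) t0)), ‖v w.1 w.2‖ ≤ K := by
  obtain ⟨δ0, hδ0, τ, hτ, H⟩ := pt_decay
  refine ⟨δ0, hδ0, fun Ω T v dv p f hMS => ?_⟩
  obtain ⟨R1, hR1, H⟩ := H Ω T v dv p f hMS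
  refine ⟨R1, hR1, fun x0 t0 R hR h1 hRR hB ht ht0 hA hE hQ => ?_⟩
  have hR2 : 0 < R/2 := by positivity
  have H' := H x0 t0 R hR h1 hRR hB ht ht0 hA hE hQ
  obtain ⟨D, hDc, hDd⟩ := TopologicalSpace.exists_countable_dense V3
  set K0 : ℝ := τ^2 / (R/2)^2 with hK0
  have key : ∀ x' ∈ ball x0 (R/2), ∀ q : ℚ, t0 - (R/2)^2 < q → (q:ℝ) ≤ t0 → ∀ n, ∀ᵐ s, s ∈ Ioo ((q:ℝ) - rr (R/2) n ^2) q →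
      ∫⁻ x in ball x' (rr (R/2) n), ‖v x s‖ₑ^2 ≤ ofReal (K0 * rr (R/2) n ^ 3) := by
    intro x' hx' q hq1 hq2 n
    have hrn := rr_pos hR2 n
    rw [← ae_restrict_iff' measurableSet_Ioo]
    filter_upwards [ae_aN_le v x' q hrn] with s hs
    have h2 := pow_le_pow_left' hs 2
    rw [aN, n2_sq, mul_pow, rpow_half_sq, ← rpow_natCast (pw _ (1/2)), pw_rpow hrn _ _ (by norm_num)] at h2
    refine h2.trans ((mul_le_mul_right (H' x' hx' q hq1 hq2 n) _).trans_eq ?_)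
    rw [pw, ← ofReal_mul (by positivity)]
    congr 1
    have : rr (R/2) n ^ 2 = (R/2)^2 * (1/4)^n := by rw [rr, mul_pow, ← pow_mul, mul_comm n 2, pow_mul]; norm_num
    rw [show rr (R/2) n ^ 3 = rr (R/2) n ^ 2 * rr (R/2) n from pow_succ _ _, this, hK0]
    norm_num
    field_simp
  have key2 : ∀ᵐ s, ∀ x' ∈ insert x0 D, ∀ q : ℚ, ∀ n, x' ∈ ball x0 (R/2) → t0 - (R/2)^2 < q → (q:ℝ) ≤ t0 → s ∈ Ioo ((q:ℝ) - rr (R/2) n ^2) q →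
      ∫⁻ x in ball x' (rr (R/2) n), ‖v x s‖ₑ^2 ≤ ofReal (K0 * rr (R/2) n ^ 3) := by
    refine (ae_ball_iff (hDc.insert x0)).2 fun x' _ => ae_all_iff.2 fun q => ae_all_iff.2 fun n => ?_
    by_cases hx' : x' ∈ ball x0 (R/2)
    swap
    · exact of_forall fun s hh => absurd hh hx'
    by_cases hq1 : t0 - (R/2)^2 < q
    swap
    · exact of_forall fun s _ hh => absurd hh hq1
    by_cases hq2 : (q:ℝ) ≤ t0
    swap
    · exact of_forall fun s _ _ hh => absurd hh hq2
    filter_upwards [key x' hx' q hq1 hq2 n] with s hs _ _ _ using hs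
  set N : ℝ≥0∞ := ofReal (64 * K0) / volume (ball (0:V3) 1) with hN
  have hNt : N ≠ ∞ := ENNReal.div_ne_top ofReal_ne_top (measure_ball_pos _ _ one_pos).ne'
  have key3 : ∀ᵐ s ∂(volume.restrict (Ioo (t0 - (R/2)^2) t0)), ∀ᵐ x ∂(volume.restrict (ball x0 (R/2))), ‖v x s‖ₑ^2 ≤ N := by
    rw [ae_restrict_iff' measurableSet_Ioo]
    filter_upwards [key2] with s hs hsI
    have hall : ∀ x' ∈ insert x0 D, x' ∈ ball x0 (R/2) → ∀ n, ∫⁻ x in ball x' (rr (R/2) n), ‖v x s‖ₑ^2 ≤ ofReal (K0 * rr (R/2) n ^ 3) := by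
      intro x' hx' hxB n
      have hrn := rr_pos hR2 n
      obtain ⟨q, hq1, hq2⟩ := exists_rat_btwn (show s < min t0 (s + rr (R/2) n ^2) from lt_min hsI.2 (by nlinarith))
      rw [lt_min_iff] at hq2
      exact hs x' hx' q n hxB (by linarith [hsI.1]) hq2.1.le ⟨by linarith, hq1⟩
    have hmv : Measurable fun x => ‖v x s‖ₑ^2 := by
      have := hMS.mv.comp (measurable_id.prodMk measurable_const : Measurable fun x : V3 => (x, s))
      exact this.enorm.pow_const 2
    refine leb_bound hmv hR2 (by positivity) hDd ?_ (fun x' hx' => hall x' (mem_insert_of_mem _ hx'))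
    have := hall x0 (mem_insert _ _) (mem_ball_self hR2) 0
    rw [rr_zero] at this
    exact (this.trans_lt ofReal_lt_top).ne
  have hms : MeasurableSet {w : V3 × ℝ | ‖v w.1 w.2‖ₑ^2 ≤ N} := measurableSet_le (hMS.mv.enorm.pow_const 2) measurable_const
  have key4 : ∀ᵐ w ∂(volume.restrict (ball x0 (R/2) ×ˢ Ioo (t0 - (R/2)^2) t0)), ‖v w.1 w.2‖ₑ^2 ≤ N := by
    rw [volume_eq_prod, ← prod_restrict, Measure.ae_prod_iff_ae_ae hms, Measure.ae_ae_comm hms]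
    exact key3
  refine ⟨(N.toReal + 1), ?_⟩
  filter_upwards [key4] with w hw
  have h3 := ENNReal.toReal_mono hNt hw
  rw [ENNReal.toReal_pow, toReal_enorm] at h3
  nlinarith [sq_nonneg (‖v w.1 w.2‖ - 1), norm_nonneg (v w.1 w.2)]
end

section

lemma fE_le_funE2 {Ω : Set V3} {T : ℝ} {v' : VV} {dv dv' : DV} {p' : VR} {f' : VV}
    (h : MS Ω T v' dv' p' f') (hdv : (fun z : V3 × ℝ => dv z.1 z.2) =ᵐ[volume.restrict (Ω ×ˢ Ioo 0 T)] fun z => dv' z.1 z.2)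
    (hi : IntegrableOn (fun z : V3 × ℝ => fnormSq (dv z.1 z.2)) (Ω ×ˢ Ioo 0 T) volume) {z : V3 × ℝ} {r : ℝ} (hr : 0 < r)
    (hB : ball z.1 r ⊆ Ω) (hI : Ioo (z.2 - r^2) z.2 ⊆ Ioo 0 T) : fE dv' z.1 z.2 r ≤ ofReal (funE2 dv z r) := by
  have hsub : ball z.1 r ×ˢ Ioo (z.2 - r^2) z.2 ⊆ Ω ×ˢ Ioo 0 T := prod_mono hB hI
  have hi' := hi.mono_set hsub
  have h1 : ∫⁻ t, aN dv' z.1 r t ^ 2 ∂(mI z.2 r) = ∫⁻ w in ball z.1 r ×ˢ Ioo (z.2 - r^2) z.2, ‖dv' w.1 w.2‖ₑ^2 := by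
    rw [lint_slice (h.mdv.enorm.pow_const 2)]
    simp only [aN, n2_sq]
    rfl
  have h2 : ∫⁻ w in ball z.1 r ×ˢ Ioo (z.2 - r^2) z.2, ‖dv' w.1 w.2‖ₑ^2 ≤
      ofReal (∫ w in ball z.1 r ×ˢ Ioo (z.2 - r^2) z.2, fnormSq (dv w.1 w.2)) := by
    rw [ofReal_integral_eq_lintegral_ofReal hi' (of_forall fun _ => fnormSq_nonneg _)]
    refine lintegral_mono_ae ?_
    filter_upwards [ae_mono (restrict_mono hsub le_rfl) hdv] with w hw
    rw [← hw]
    exact enorm_le_fnormSq _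
  have h3 : ∫ w in ball z.1 r ×ˢ Ioo (z.2 - r^2) z.2, fnormSq (dv w.1 w.2) =
      ∫ t in Ioo (z.2 - r^2) z.2, ∫ x in ball z.1 r, fnormSq (dv x t) := by
    rw [IntegrableOn, volume_eq_prod, ← prod_restrict] at hi'
    rw [volume_eq_prod, ← prod_restrict, integral_prod_symm _ hi']
  rw [fE, h1, funE2, ofReal_mul (by positivity), pw, rpow_neg_one, ← h3]
  exact mul_le_mul_right h2 _

lemma exists_kappa {M : ℝ} (hM : 1 ≤ M) : ∃ h : ℕ, 2 * M ≤ ((2:ℝ)^h)^8 ∧ ((2:ℝ)^h)^8 ≤ 512 * M := by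
  obtain ⟨n, h1, h2⟩ := exists_nat_pow_near (show 1 ≤ 2 * M by linarith) (show (1:ℝ) < 256 by norm_num)
  have h3 : ((2:ℝ)^(n+1))^8 = 256^(n+1) := by rw [← pow_mul, mul_comm, pow_mul]; norm_num
  exact ⟨n+1, by rw [h3]; exact h2.le, by rw [h3, pow_succ]; linarith⟩
end
end

/-- quantitative Seregin criterion. -/
theorem statement2 :
    ∃ ε : ℝ, 0 < ε ∧
      ∀ (Ω : Set V3) (T : ℝ) (v : V3 → ℝ → V3) (dv : V3 → ℝ → V3 →L[ℝ] V3)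
        (p : V3 → ℝ → ℝ) (f : V3 → ℝ → V3),
        IsSuitableWeakSolution Ω 0 T v dv p f →
        (∃ m : ℝ, 5/2 < m ∧
          IntegrableOn (fun z : V3 × ℝ => ‖f z.1 z.2‖ ^ m) (Ω ×ˢ Ioo 0 T) volume) →
        ∀ M : ℝ, 0 < M →
        ∀ z : V3 × ℝ, z.1 ∈ Ω → z.2 ∈ Ioo 0 T →
          limsup (fun r => ENNReal.ofReal (funE2 dv z r)) (𝓝[>] (0:ℝ))
            ≤ ENNReal.ofReal M →
          liminf (fun r => ENNReal.ofReal (funE2 dv z r)) (𝓝[>] (0:ℝ))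
            < ENNReal.ofReal (ε / M) →
          RegularPoint v z := by
  obtain ⟨C, hC, hSQ⟩ := SQ_of_MS
  obtain ⟨δ, hδ, hM7⟩ := M7
  obtain ⟨ε0, hε0, hε1, hsm⟩ := SQ_small C hC hδ
  refine ⟨(ε0/1024)^2/2, by positivity, fun Ω T v dv p f hsol _ M hM z hzΩ hzT hsup hinf => ?_⟩
  obtain ⟨v', dv', p', f', hMS, hv, hdv⟩ := exists_MS hsol
  obtain ⟨R1, hR1, hM7⟩ := hM7 Ω T v' dv' p' f' hMS
  obtain ⟨x0, t0⟩ := z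
  simp only at hzΩ hzT
  obtain ⟨R0, hR0, hB0⟩ := Metric.isOpen_iff.1 hsol.open_dom x0 hzΩ
  obtain ⟨R, hR, hRle, hRR0, hRt⟩ : ∃ R > (0:ℝ), R ≤ 1 ∧ R ≤ R0 ∧ R ≤ t0 :=
    ⟨min 1 (min R0 t0), lt_min one_pos (lt_min hR0 hzT.1), min_le_left _ _, (min_le_right _ _).trans (min_le_left _ _),
      (min_le_right _ _).trans (min_le_right _ _)⟩
  have hB : ∀ r, r ≤ R → ball x0 r ⊆ Ω := fun r hr => (ball_subset_ball (hr.trans hRR0)).trans hB0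
  have hT : ∀ r, 0 < r → r ≤ R → 0 ≤ t0 - r^2 := fun r h0 hr => by nlinarith
  have hI : ∀ r, 0 < r → r ≤ R → Ioo (t0 - r^2) t0 ⊆ Ioo 0 T := fun r h0 hr => Ioo_subset_Ioo (hT r h0 hr) hzT.2.le
  obtain ⟨hS, hfin⟩ := hSQ Ω T v' dv' p' f' hMS x0 t0 R hR hRle (hB R le_rfl) (hT R hR le_rfl) hzT.2
  have hle : ∀ r, 0 < r → r ≤ R → fE dv' x0 t0 r ≤ ENNReal.ofReal (funE2 dv (x0, t0) r) := fun r h0 hr =>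
    fE_le_funE2 (z := (x0, t0)) hMS hdv hsol.dv_l2 h0 (hB r hr) (hI r h0 hr)
  have hev : ∀ᶠ r in 𝓝[>] (0:ℝ), ENNReal.ofReal (funE2 dv (x0, t0) r) < ENNReal.ofReal (2 * M) :=
    eventually_lt_of_limsup_lt (hsup.trans_lt ((ENNReal.ofReal_lt_ofReal_iff (by positivity)).2 (by linarith)))
  have hfr := frequently_lt_of_liminf_lt (by isBoundedDefault) hinf
  obtain ⟨h, hh1, hh2⟩ := exists_kappa (le_max_right M 1)
  have hE : ∀ᶠ k in atTop, rE dv' x0 t0 R k ≤ ((2:ℝ)^h)^8 := by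
    filter_upwards [(rr_tendsto hR).eventually hev] with k hk
    refine le_trans ?_ hh1
    refine ENNReal.toReal_le_of_le_ofReal (by positivity) ((hle _ (rr_pos hR k) (rr_le hR k)).trans (hk.le.trans ?_))
    exact ENNReal.ofReal_le_ofReal (by linarith [le_max_left M 1])
  have hfr2 : ∃ᶠ k in atTop, ((2:ℝ)^h)^8 * rE dv' x0 t0 R k ≤ ε0 := by
    rw [frequently_atTop]
    intro N
    have hlt : ∀ᶠ r in 𝓝[>] (0:ℝ), r ∈ Ioo 0 (rr R N) := Ioo_mem_nhdsGT (rr_pos hR N)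
    obtain ⟨r, hr1, hr2, hr0, hrN⟩ := (hfr.and_eventually (hev.and hlt)).exists
    have hrR : r ≤ R := hrN.le.trans (rr_le hR N)
    obtain ⟨k, hk1, hk2⟩ := exists_nat_pow_near_of_lt_one (div_pos hr0 hR) ((div_le_one hR).2 hrR) (show (0:ℝ) < 1/2 by norm_num) (by norm_num)
    rw [lt_div_iff₀ hR, mul_comm] at hk1
    rw [div_le_iff₀ hR, mul_comm] at hk2
    change rr R (k+1) < r at hk1
    change r ≤ rr R k at hk2
    refine ⟨k+1, ?_, ?_⟩
    · by_contra hc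
      push Not at hc
      linarith [rr_anti hR hc.le]
    set x := funE2 dv (x0, t0) r with hx
    have hx1 : x < (ε0/1024)^2/2/M := (ENNReal.ofReal_lt_ofReal_iff (by positivity)).1 hr1
    have hx2 : x < 2 * M := (ENNReal.ofReal_lt_ofReal_iff (by positivity)).1 hr2
    have hx0 : 0 ≤ x := mul_nonneg (by positivity) (integral_nonneg fun _ => integral_nonneg fun _ => fnormSq_nonneg _)
    have hrk := rr_pos hR (k+1)
    have hEk : rE dv' x0 t0 R (k+1) ≤ 2 * x := by
      refine ENNReal.toReal_le_of_le_ofReal (by positivity) ?_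
      refine (E_sub (x0 := x0) (x1 := x0) hrk hr0 (ball_subset_ball hk1.le) (Ioo_subset_Ioo_left (by nlinarith))).trans ?_
      rw [ENNReal.ofReal_mul (by norm_num)]
      refine mul_le_mul' (ENNReal.ofReal_le_ofReal ?_) (hle r hr0 hrR)
      rw [div_le_iff₀ hrk, rr_succ]
      linarith
    have hxx : 1024 * max M 1 * x ≤ ε0 := by
      rw [lt_div_iff₀ hM] at hx1
      rcases le_total M 1 with hM1 | hM1
      · rw [max_eq_right hM1]
        have : x^2 ≤ (ε0/1024)^2 := by nlinarith
        have := abs_le_of_sq_le_sq' this (by positivity)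
        linarith [this.2]
      · rw [max_eq_left hM1]
        nlinarith
    calc ((2:ℝ)^h)^8 * rE dv' x0 t0 R (k+1) ≤ (512 * max M 1) * (2 * x) := mul_le_mul hh2 hEk ENNReal.toReal_nonneg (by positivity)
      _ ≤ ε0 := by linarith
  have hF : Tendsto (rF f' x0 t0 R) atTop (𝓝 0) := by
    obtain ⟨γ, hγ, hγ4, φ, hφ⟩ := hMS.F_decay
    have h1 : Tendsto (fun k => (φ:ℝ) * rr R k) atTop (𝓝 (φ * 0)) := ((rr_tendsto hR).mono_right nhdsWithin_le_nhds).const_mul _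
    rw [mul_zero] at h1
    refine squeeze_zero (fun k => ENNReal.toReal_nonneg) (fun k => ?_) h1
    have hrk := rr_pos hR k
    have hrl := rr_le hR k
    refine ENNReal.toReal_le_of_le_ofReal (by positivity) ((hφ x0 t0 (rr R k) hrk (by linarith) (hB _ hrl) (hI _ hrk hrl)).trans ?_)
    rw [pw, ← ENNReal.ofReal_coe_nnreal, ← ENNReal.ofReal_mul (by positivity)]
    refine ENNReal.ofReal_le_ofReal (mul_le_mul_of_nonneg_left ?_ φ.2)
    calc (rr R k)^(1+γ) ≤ (rr R k)^(1:ℝ) := Real.rpow_le_rpow_of_exponent_ge hrk (by linarith) (by linarith)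
      _ = rr R k := Real.rpow_one _
  have hsmall : ∀ᶠ r in 𝓝[>] (0:ℝ), r ∈ Ioo 0 R1 := Ioo_mem_nhdsGT hR1
  obtain ⟨N0, hN0⟩ := eventually_atTop.1 ((rr_tendsto hR).eventually hsmall)
  obtain ⟨k, hk, hA, hEk, hQ⟩ := hsm _ _ _ _ _ _ hS h _ rfl hE hF hfr2 N0
  obtain ⟨f1, f2, f3, -⟩ := hfin k
  have hrk := rr_pos hR k
  have hrl := rr_le hR k
  obtain ⟨K, hK⟩ := hM7 x0 t0 (rr R k) hrk (hrl.trans hRle) (hN0 k hk).2.le (hB _ hrl) (hT _ hrk hrl) hzT.2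
    ((ENNReal.le_ofReal_iff_toReal_le f1.ne hδ.le).2 hA) ((ENNReal.le_ofReal_iff_toReal_le f2.ne hδ.le).2 hEk)
    ((ENNReal.le_ofReal_iff_toReal_le f3.ne hδ.le).2 hQ)
  refine ⟨rr R k / 2, by positivity, K, ?_⟩
  have hsub : ball x0 (rr R k / 2) ×ˢ Ioo (t0 - (rr R k / 2)^2) t0 ⊆ Ω ×ˢ Ioo 0 T :=
    prod_mono (hB _ (by linarith)) (hI _ (by positivity) (by linarith))
  filter_upwards [hK, ae_mono (Measure.restrict_mono hsub le_rfl) hv] with w hw1 hw2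
  rw [hw2]
  exact hw1

end
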